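/- Let n range over even positive integers, let d2 = d2(n) be an integer sequence with d2 → ∞ and d2 = O(n^{1/10}), and let d1 = d1(n), d1' = d1'(n) be integer sequences with min{d1, d1', d2−d1, d2−d1'} → ∞ as n → ∞. Then for each even n there exists a coupling of G_⊕ ~ μ_{d1,n} ⊕ μ_{d2−d1,n} and G'_⊕ ~ μ_{d1',n} ⊕ μ_{d2−d1',n} such that P(G_⊕ = G'_⊕) → 1 as n → ∞; equivalently, the total variation distance between μ_{d1,n} ⊕ μ_{d2−d1,n} and μ_{d1',n} ⊕ μ_{d2−d1',n} tends to 0. -/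

import Mathlib

open Filter Topology

/-- Degree of a vertex in a graph on `Fin n`. -/
noncomputable def gDeg {n : ℕ} (G : SimpleGraph (Fin n)) (v : Fin n) : ℕ :=
  Nat.card {w : Fin n // G.Adj v w}

/-- `G` is a `d`-regular graph. -/
def IsRegularGraph {n : ℕ} (G : SimpleGraph (Fin n)) (d : ℕ) : Prop :=
  ∀ v, gDeg G v = d

open scoped Classical in
/-- The uniform probability distribution `μ_{d,n}` on the `d`-regular graphs on `{1,…,n}`. -/
noncomputable def mu (n d : ℕ) : SimpleGraph (Fin n) → ℝ := fun G =>
  if IsRegularGraph G d then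
    (Nat.card {H : SimpleGraph (Fin n) // IsRegularGraph H d} : ℝ)⁻¹
  else 0

/-- `p` is a probability distribution on a finite or countable space. -/
def IsProbC {α : Type*} (p : α → ℝ) : Prop :=
  (∀ x, 0 ≤ p x) ∧ ∑' x, p x = 1

/-- Probability of an event `A` under the distribution `p`. -/
noncomputable def probOf {α : Type*} (p : α → ℝ) (A : Set α) : ℝ := ∑' x : A, p x

/-- Total variation distance. -/
noncomputable def tvDist {α : Type*} (p q : α → ℝ) : ℝ := (1/2) * ∑' x, |p x - q x|

/-- `π` is a coupling of `p` and `q`. -/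
def IsCoupling {α β : Type*} (π : α × β → ℝ) (p : α → ℝ) (q : β → ℝ) : Prop :=
  IsProbC π ∧ (∀ a, ∑' b, π (a, b) = p a) ∧ (∀ b, ∑' a, π (a, b) = q b)

/-- Expectation of `f` under the distribution `p`. -/
noncomputable def expec {α : Type*} (p f : α → ℝ) : ℝ := ∑' x, p x * f x

open scoped Classical in
/-- Unnormalised mass of `p ⊕ q` at `G`: sum over ordered pairs of edge-disjoint graphs
with union `G`. -/
noncomputable def oplusMass {n : ℕ} (p q : SimpleGraph (Fin n) → ℝ)
    (G : SimpleGraph (Fin n)) : ℝ :=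
  ∑' H : SimpleGraph (Fin n) × SimpleGraph (Fin n),
    if Disjoint H.1 H.2 ∧ H.1 ⊔ H.2 = G then p H.1 * q H.2 else 0

/-- The distribution `p ⊕ q`. -/
noncomputable def oplus {n : ℕ} (p q : SimpleGraph (Fin n) → ℝ) :
    SimpleGraph (Fin n) → ℝ :=
  fun G => oplusMass p q G / ∑' H, oplusMass p q H

namespace RegSum

/-- Fixed-point-free involutions that respect a colouring of the points. -/
def IsPairing {P ι : Type*} (c : P → ι) (π : Equiv.Perm P) : Prop :=
  (∀ p, π (π p) = p) ∧ (∀ p, π p ≠ p) ∧ ∀ p, c (π p) = c p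

/-- A pairing is simple when its projection to the vertices has no loops and no double edges. -/
def IsSimplePairing {P V : Type*} (vtx : P → V) (π : Equiv.Perm P) : Prop :=
  (∀ p, vtx (π p) ≠ vtx p) ∧ ∀ p q, p ≠ q → vtx p = vtx q → vtx (π p) ≠ vtx (π q)

open scoped Classical in
/-- Conjugation of a permutation by a transposition. -/
noncomputable def conjSwap {P : Type*} (π : Equiv.Perm P) (q x : P) : Equiv.Perm P :=
  Equiv.swap q x * π * Equiv.swap q x

section
open scoped Classical

variable {P V ι : Type*}

lemma conjSwap_apply (π : Equiv.Perm P) (q x r : P) :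
    conjSwap π q x r = Equiv.swap q x (π (Equiv.swap q x r)) := rfl

lemma conjSwap_conjSwap (π : Equiv.Perm P) (q x : P) :
    conjSwap (conjSwap π q x) q x = π := by
  ext r; simp [conjSwap_apply]

lemma IsPairing.conjSwap {c : P → ι} {π : Equiv.Perm P} (h : IsPairing c π) {q x : P}
    (hc : c q = c x) : IsPairing c (conjSwap π q x) := by
  have hs : ∀ r, c (Equiv.swap q x r) = c r := by
    intro r; rw [Equiv.swap_apply_def]; split_ifs <;> simp_all
  refine ⟨fun p => ?_, fun p hp => ?_, fun p => ?_⟩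
  · simp [conjSwap_apply, h.1]
  · rw [conjSwap_apply] at hp
    have := congrArg (Equiv.swap q x) hp
    simp only [Equiv.swap_apply_self] at this
    exact h.2.1 _ this
  · rw [conjSwap_apply, hs, h.2.2, hs]

/-- Values of a pairing after one switching. -/
lemma conjSwap_values {c : P → ι} {π : Equiv.Perm P} (h : IsPairing c π) {p q x : P}
    (hpq : π p = q) (hxp : x ≠ p) :
    conjSwap π q x p = x ∧ conjSwap π q x x = p ∧ conjSwap π q x q = π x ∧
      conjSwap π q x (π x) = q ∧
      ∀ r, r ≠ p → r ≠ x → r ≠ q → r ≠ π x → conjSwap π q x r = π r := by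
  obtain ⟨h1, h2, -⟩ := h
  have hqp : π q = p := by rw [← hpq, h1]
  have h3 : p ≠ q := fun e => h2 p (by rw [hpq, e])
  have h4 : π x ≠ q := fun e => hxp (by rw [← h1 x, e, hqp])
  have h5 := h2 x
  refine ⟨?_, ?_, ?_, ?_, ?_⟩
  · rw [conjSwap_apply, Equiv.swap_apply_of_ne_of_ne h3 hxp.symm, hpq, Equiv.swap_apply_left]
  · rw [conjSwap_apply, Equiv.swap_apply_right, hqp, Equiv.swap_apply_of_ne_of_ne h3 hxp.symm]
  · rw [conjSwap_apply, Equiv.swap_apply_left, Equiv.swap_apply_of_ne_of_ne h4 h5]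
  · rw [conjSwap_apply, Equiv.swap_apply_of_ne_of_ne h4 h5, h1, Equiv.swap_apply_right]
  · intro r a1 a2 a3 a4
    rw [conjSwap_apply, Equiv.swap_apply_of_ne_of_ne a3 a2, Equiv.swap_apply_of_ne_of_ne]
    · intro e; exact a1 (by rw [← h1 r, e, hqp])
    · intro e; exact a4 (by rw [← e, h1])

/-- Values of a pairing after the double switching that creates a prescribed edge. -/
lemma conjSwap_conjSwap_values {c : P → ι} {π : Equiv.Perm P} (h : IsPairing c π) {p q z : P}
    (hpq : p ≠ q) (hx : π p ≠ q) (hzp : z ≠ p) (hzq : z ≠ q) (hzx : z ≠ π p) (hzy : z ≠ π q) :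
    let τ := conjSwap (conjSwap π (π p) q) (π q) z
    τ p = q ∧ τ q = p ∧ τ (π p) = z ∧ τ z = π p ∧ τ (π q) = π z ∧ τ (π z) = π q ∧
      ∀ r, r ≠ p → r ≠ q → r ≠ π p → r ≠ z → r ≠ π q → r ≠ π z → τ r = π r := by
  obtain ⟨h1, h2, h3⟩ := h
  have e1 := h2 p
  have e2 := h2 q
  have e3 := h2 z
  have k1 : ∀ r s, π r = s ↔ r = π s := fun r s =>
    ⟨fun e => by rw [← e, h1], fun e => by rw [e, h1]⟩
  have inj : ∀ r s, π r = π s ↔ r = s := fun r s => π.injective.eq_iff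
  intro τ
  have hτ : ∀ r, τ r = Equiv.swap (π q) z (Equiv.swap (π p) q (π (Equiv.swap (π p) q
      (Equiv.swap (π q) z r)))) := fun r => rfl
  simp only [hτ, Equiv.swap_apply_def]
  refine ⟨?_, ?_, ?_, ?_, ?_, ?_, ?_⟩ <;> grind

lemma switch_upper {B : Finset (Equiv.Perm P)} {c : P → ι} (hB : ∀ π ∈ B, IsPairing c π)
    {p q : P} (C : Finset P) (bad : Equiv.Perm P → Finset P) (κ : ℕ)
    (hbad : ∀ π ∈ B, π p = q → ∀ x ∈ C, x ∉ bad π → x ≠ p ∧ x ≠ q ∧ conjSwap π q x ∈ B)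
    (hκ : ∀ π ∈ B, π p = q → (bad π).card ≤ κ) :
    (B.filter (fun π => π p = q)).card * C.card ≤
      B.card + κ * (B.filter (fun π => π p = q)).card := by
  set A := B.filter (fun π => π p = q) with hA
  have key : (A.sigma fun π => C \ bad π).card ≤ B.card := by
    apply Finset.card_le_card_of_injOn (fun s => conjSwap s.1 q s.2)
    · rintro ⟨π, x⟩ hs
      simp only [Finset.coe_sigma, Set.mem_sigma_iff, Finset.mem_coe, Finset.mem_sdiff, hA,
        Finset.mem_filter] at hs
      exact (hbad π hs.1.1 hs.1.2 x hs.2.1 hs.2.2).2.2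
    · rintro ⟨π, x⟩ hs ⟨π', x'⟩ hs' e
      simp only [Finset.coe_sigma, Set.mem_sigma_iff, Finset.mem_coe, Finset.mem_sdiff, hA,
        Finset.mem_filter] at hs hs'
      have b := hbad π hs.1.1 hs.1.2 x hs.2.1 hs.2.2
      have b' := hbad π' hs'.1.1 hs'.1.2 x' hs'.2.1 hs'.2.2
      have v := (conjSwap_values (hB π hs.1.1) hs.1.2 b.1).1
      have v' := (conjSwap_values (hB π' hs'.1.1) hs'.1.2 b'.1).1
      simp only at e
      have hx : x = x' := by rw [← v, ← v', e]
      subst hx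
      have : π = π' := by rw [← conjSwap_conjSwap π q x, e, conjSwap_conjSwap]
      subst this; rfl
  rw [Finset.card_sigma] at key
  have h2 : ∀ π ∈ A, C.card ≤ (C \ bad π).card + κ := by
    intro π hπ
    simp only [hA, Finset.mem_filter] at hπ
    have := hκ π hπ.1 hπ.2
    have := Finset.card_le_card_sdiff_add_card (s := C) (t := bad π)
    omega
  have h3 := Finset.sum_le_sum h2
  rw [Finset.sum_add_distrib] at h3
  simp only [Finset.sum_const, smul_eq_mul] at h3
  nlinarith

lemma switch_lower {B G : Finset (Equiv.Perm P)} {c : P → ι} (hB : ∀ π ∈ B, IsPairing c π)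
    (hG : G ⊆ B) {p q : P} (hpq : p ≠ q) (C : Finset P)
    (hC : ∀ π ∈ B, π p ∈ C ∧ π q ∈ C)
    (bad : Equiv.Perm P → Finset P) (κ : ℕ)
    (hbad : ∀ π ∈ G, π p ≠ q → ∀ z ∈ C, z ∉ bad π → z ≠ p ∧ z ≠ q ∧ z ≠ π p ∧ z ≠ π q ∧
      conjSwap (conjSwap π (π p) q) (π q) z ∈ B)
    (hκ : ∀ π ∈ G, π p ≠ q → (bad π).card ≤ κ) :
    G.card * C.card ≤
      (B.filter (fun π => π p = q)).card * (C.card * C.card + C.card) + κ * G.card := by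
  set A := B.filter (fun π => π p = q) with hA
  set G2 := G.filter (fun π => π p ≠ q) with hG2
  have hsplit : G.card ≤ A.card + G2.card := by
    rw [← Finset.card_filter_add_card_filter_not (s := G) (fun π => π p = q)]
    exact Nat.add_le_add_right (Finset.card_le_card (Finset.filter_subset_filter _ hG)) _
  have hG2G : G2.card ≤ G.card := Finset.card_filter_le _ _
  have key : (G2.sigma fun π => C \ bad π).card ≤ (A ×ˢ (C ×ˢ C)).card := by
    apply Finset.card_le_card_of_injOn
      (fun s => (conjSwap (conjSwap s.1 (s.1 p) q) (s.1 q) s.2, (s.1 p, s.1 q)))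
    · rintro ⟨π, z⟩ hs
      simp only [Finset.coe_sigma, Set.mem_sigma_iff, Finset.mem_coe, Finset.mem_sdiff, hG2,
        Finset.mem_filter] at hs
      have b := hbad π hs.1.1 hs.1.2 z hs.2.1 hs.2.2
      have v := conjSwap_conjSwap_values (hB π (hG hs.1.1)) hpq hs.1.2 b.1 b.2.1 b.2.2.1 b.2.2.2.1
      have := hC π (hG hs.1.1)
      simp only [Finset.coe_product, Set.mem_prod, Finset.mem_coe, hA, Finset.mem_filter]
      exact ⟨⟨b.2.2.2.2, v.1⟩, this.1, this.2⟩
    · rintro ⟨π, z⟩ hs ⟨π', z'⟩ hs' e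
      simp only [Finset.coe_sigma, Set.mem_sigma_iff, Finset.mem_coe, Finset.mem_sdiff, hG2,
        Finset.mem_filter] at hs hs'
      have b := hbad π hs.1.1 hs.1.2 z hs.2.1 hs.2.2
      have v := conjSwap_conjSwap_values (hB π (hG hs.1.1)) hpq hs.1.2 b.1 b.2.1 b.2.2.1 b.2.2.2.1
      have b' := hbad π' hs'.1.1 hs'.1.2 z' hs'.2.1 hs'.2.2
      have v' := conjSwap_conjSwap_values (hB π' (hG hs'.1.1)) hpq hs'.1.2 b'.1 b'.2.1
        b'.2.2.1 b'.2.2.2.1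
      simp only [Prod.mk.injEq] at e
      obtain ⟨e1, e2, e3⟩ := e
      have hz : z = z' := by
        rw [← v.2.2.1, ← v'.2.2.1, e1, e2]
      subst hz
      rw [← e2, ← e3] at e1
      have : π = π' := by
        have e4 := congrArg (fun τ => conjSwap τ (π q) z) e1
        simp only [conjSwap_conjSwap] at e4
        have e5 := congrArg (fun τ => conjSwap τ (π p) q) e4
        simpa only [conjSwap_conjSwap] using e5
      subst this; rfl
  rw [Finset.card_sigma, Finset.card_product, Finset.card_product] at key
  have h2 : ∀ π ∈ G2, C.card ≤ (C \ bad π).card + κ := by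
    intro π hπ
    simp only [hG2, Finset.mem_filter] at hπ
    have := hκ π hπ.1 hπ.2
    have := Finset.card_le_card_sdiff_add_card (s := C) (t := bad π)
    omega
  have h3 := Finset.sum_le_sum h2
  rw [Finset.sum_add_distrib] at h3
  simp only [Finset.sum_const, smul_eq_mul] at h3
  have h4 := Nat.mul_le_mul_right C.card hsplit
  have h5 := Nat.mul_le_mul_left κ hG2G
  nlinarith

end
end RegSum

namespace RegSum
section
open scoped Classical

variable {P V ι : Type*}

/-- The pairing edge at `r` is neither a loop nor parallel to another edge. -/
def CleanAt (vtx : P → V) (π : Equiv.Perm P) (r : P) : Prop :=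
  vtx (π r) ≠ vtx r ∧ ∀ r', r' ≠ r → vtx r' = vtx r → vtx (π r') ≠ vtx (π r)

lemma CleanAt.symm {vtx : P → V} {π : Equiv.Perm P} (h : ∀ p, π (π p) = p) {r : P}
    (hr : CleanAt vtx π r) : CleanAt vtx π (π r) := by
  refine ⟨by rw [h]; exact hr.1.symm, fun r' h1 h2 h3 => ?_⟩
  rw [h] at h3
  exact hr.2 (π r') (fun e => h1 (by rw [← e, h])) h3 (by rw [h, h2])

/-- Both prescribed edges of a quadruple are present. -/
def HasEdges (π : Equiv.Perm P) (g : P × P × P × P) : Prop :=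
  π g.1 = g.2.1 ∧ π g.2.2.1 = g.2.2.2

/-- A quadruple describing a double edge. -/
def IsDouble (vtx : P → V) (g : P × P × P × P) : Prop :=
  g.1 ≠ g.2.2.1 ∧ vtx g.1 = vtx g.2.2.1 ∧ vtx g.2.1 = vtx g.2.2.2

/-- Loopless pairings that contain the edges `E` and avoid the double edges in `S`. -/
def Avoids (c : P → ι) (vtx : P → V) (S : Set (P × P × P × P)) (E : Set (P × P))
    (π : Equiv.Perm P) : Prop :=
  IsPairing c π ∧ (∀ p, vtx (π p) ≠ vtx p) ∧ (∀ g ∈ S, ¬ HasEdges π g) ∧ ∀ e ∈ E, π e.1 = e.2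

lemma not_hasEdges_of_clean {vtx : P → V} {π τ : Equiv.Perm P} {g : P × P × P × P}
    (hg : IsDouble vtx g) (h : ¬ HasEdges π g) 
    (hτ : ∀ r, (r = g.1 ∨ r = g.2.2.1) → τ r ≠ π r → CleanAt vtx τ r) : ¬ HasEdges τ g := by
  rintro ⟨h1, h2⟩
  obtain ⟨g1, g2, g3⟩ := hg
  by_cases e : τ g.1 = π g.1
  · by_cases e' : τ g.2.2.1 = π g.2.2.1
    · exact h ⟨by rw [← e, h1], by rw [← e', h2]⟩
    · exact (hτ _ (Or.inr rfl) e').2 g.1 g1 g2 (by rw [h1, h2, g3])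
  · exact (hτ _ (Or.inl rfl) e).2 g.2.2.1 g1.symm g2.symm (by rw [h1, h2, g3])

set_option linter.unusedSectionVars false

variable [Fintype P]

/-- The points at a vertex. -/
noncomputable def fib (vtx : P → V) (u : V) : Finset P := Finset.univ.filter (fun p => vtx p = u)

lemma mem_fib {vtx : P → V} {u : V} {p : P} : p ∈ fib vtx u ↔ vtx p = u := by simp [fib]

/-- The points at neighbours of a vertex. -/
noncomputable def nbrPts (vtx : P → V) (π : Equiv.Perm P) (u : V) : Finset P :=
  (fib vtx u).biUnion fun r => fib vtx (vtx (π r))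

lemma mem_nbrPts {vtx : P → V} {π : Equiv.Perm P} {u : V} {p : P} :
    p ∈ nbrPts vtx π u ↔ ∃ r, vtx r = u ∧ vtx p = vtx (π r) := by
  simp [nbrPts, mem_fib]

lemma card_nbrPts_le {vtx : P → V} {d : ℕ} (hd : ∀ u, (fib vtx u).card ≤ d)
    (π : Equiv.Perm P) (u : V) : (nbrPts vtx π u).card ≤ d * d := by
  refine (Finset.card_biUnion_le_card_mul _ _ d fun r _ => hd _).trans ?_
  exact Nat.mul_le_mul_right _ (hd u)

lemma mem_image_inv {c : P → ι} {π : Equiv.Perm P} (h : IsPairing c π) {A : Finset P} {z : P} :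
    z ∈ A.image π ↔ π z ∈ A := by
  rw [Finset.mem_image]
  constructor
  · rintro ⟨a, ha, rfl⟩; rwa [h.1]
  · intro hz; exact ⟨π z, hz, h.1 z⟩

/-- Points excluded in a single switching. -/
noncomputable def badOne (vtx : P → V) (p q : P) (π : Equiv.Perm P) : Finset P :=
  fib vtx (vtx p) ∪ fib vtx (vtx q) ∪ (fib vtx (vtx p)).image π ∪ (fib vtx (vtx q)).image π ∪
    nbrPts vtx π (vtx p) ∪ (nbrPts vtx π (vtx q)).image π

/-- Points excluded in a double switching. -/
noncomputable def badTwo (vtx : P → V) (p q : P) (π : Equiv.Perm P) : Finset P :=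
  badOne vtx (π p) (π q) π ∪ (fib vtx (vtx p) ∪ fib vtx (vtx q) ∪
    (fib vtx (vtx p)).image π ∪ (fib vtx (vtx q)).image π)

lemma card_badOne_le {vtx : P → V} {d : ℕ} (hd : ∀ u, (fib vtx u).card ≤ d)
    (p q : P) (π : Equiv.Perm P) : (badOne vtx p q π).card ≤ 2 * d * d + 4 * d := by
  unfold badOne
  have h1 := hd (vtx p)
  have h2 := hd (vtx q)
  have h3 := (Finset.card_image_le (s := fib vtx (vtx p)) (f := π)).trans h1
  have h4 := (Finset.card_image_le (s := fib vtx (vtx q)) (f := π)).trans h2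
  have h5 := card_nbrPts_le hd π (vtx p)
  have h6 := (Finset.card_image_le (s := nbrPts vtx π (vtx q)) (f := π)).trans
    (card_nbrPts_le hd π (vtx q))
  grw [Finset.card_union_le, Finset.card_union_le, Finset.card_union_le, Finset.card_union_le,
    Finset.card_union_le, h1, h2, h3, h4, h5, h6]
  apply le_of_eq; ring

lemma card_badTwo_le {vtx : P → V} {d : ℕ} (hd : ∀ u, (fib vtx u).card ≤ d)
    (p q : P) (π : Equiv.Perm P) : (badTwo vtx p q π).card ≤ 2 * d * d + 8 * d := by
  unfold badTwo
  have h1 := hd (vtx p)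
  have h2 := hd (vtx q)
  have h3 := (Finset.card_image_le (s := fib vtx (vtx p)) (f := π)).trans h1
  have h4 := (Finset.card_image_le (s := fib vtx (vtx q)) (f := π)).trans h2
  have h5 := card_badOne_le hd (π p) (π q) π
  grw [Finset.card_union_le, Finset.card_union_le, Finset.card_union_le, Finset.card_union_le,
    h1, h2, h3, h4, h5]
  apply le_of_eq; ring

lemma conjSwap_avoids {c : P → ι} {vtx : P → V} {S : Set (P × P × P × P)} {E : Set (P × P)}
    {π : Equiv.Perm P} (h : Avoids c vtx S E π) (hS : ∀ g ∈ S, IsDouble vtx g) {p q x : P}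
    (hpq : π p = q) (hc : c x = c p) (hx : x ∉ badOne vtx p q π)
    (hE : ∀ e ∈ E, e.1 ≠ p ∧ e.1 ≠ q ∧ (vtx e.1 = vtx p ∨ vtx e.1 = vtx q) ∧
      (vtx e.2 = vtx p ∨ vtx e.2 = vtx q)) :
    x ≠ p ∧ x ≠ q ∧ Avoids c vtx S E (conjSwap π q x) := by
  obtain ⟨hp, hl, hs, he⟩ := h
  simp only [badOne, Finset.mem_union, mem_image_inv hp, mem_fib, mem_nbrPts, not_or, not_exists,
    not_and] at hx
  obtain ⟨⟨⟨⟨⟨b1, b2⟩, b3⟩, b4⟩, b5⟩, b6⟩ := hx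
  have hxp : x ≠ p := fun e => b1 (by rw [e])
  have hxq : x ≠ q := fun e => b2 (by rw [e])
  have hcq : c q = c x := by rw [← hpq, hp.2.2, hc]
  have hτ := hp.conjSwap hcq
  obtain ⟨v1, v2, v3, v4, v5⟩ := conjSwap_values hp hpq hxp
  set τ := conjSwap π q x
  have hlp := hl p
  rw [hpq] at hlp
  have hqp : π q = p := by rw [← hpq, hp.1]
  have c1 : CleanAt vtx τ p := by
    refine ⟨by rw [v1]; exact b1, fun r h1 h2 => ?_⟩
    rw [v1]
    by_cases r1 : r = x
    · subst r1; exact absurd h2 b1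
    by_cases r2 : r = q
    · subst r2; exact absurd h2 hlp
    by_cases r3 : r = π x
    · subst r3; exact absurd h2 b3
    rw [v5 r h1 r1 r2 r3]
    exact fun e => b5 r h2 e.symm
  have c2 : CleanAt vtx τ q := by
    refine ⟨by rw [v3]; exact b4, fun r h1 h2 => ?_⟩
    rw [v3]
    by_cases r1 : r = x
    · subst r1; exact absurd h2 b2
    by_cases r2 : r = p
    · subst r2; exact absurd h2.symm hlp
    by_cases r3 : r = π x
    · subst r3; exact absurd h2 b4
    rw [v5 r r2 r1 h1 r3]
    exact fun e => b6 r h2 e.symm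
  have c3 : CleanAt vtx τ x := by simpa [v1] using c1.symm hτ.1
  have c4 : CleanAt vtx τ (π x) := by simpa [v3] using c2.symm hτ.1
  have hclean : ∀ r, τ r ≠ π r → CleanAt vtx τ r := by
    intro r hr
    by_cases r0 : r = p
    · rwa [r0]
    by_cases r1 : r = x
    · rwa [r1]
    by_cases r2 : r = q
    · rwa [r2]
    by_cases r3 : r = π x
    · rwa [r3]
    exact absurd (v5 r r0 r1 r2 r3) hr
  refine ⟨hxp, hxq, hτ, fun r => ?_, fun g hg => ?_, fun e heE => ?_⟩
  · by_cases e : τ r = π r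
    · rw [e]; exact hl r
    · exact (hclean r e).1
  · exact not_hasEdges_of_clean (hS g hg) (hs g hg) fun r _ => hclean r
  · obtain ⟨e1, e2, e3, e4⟩ := hE e heE
    have h0 := he e heE
    rw [v5 e.1 e1 _ e2 _, h0]
    · intro e5; rw [e5] at e3; tauto
    · intro e5; rw [e5, hp.1] at h0; rw [← h0] at e4; tauto

lemma conjSwap_conjSwap_avoids {c : P → ι} {vtx : P → V} {S : Set (P × P × P × P)}
    {E : Set (P × P)} {π : Equiv.Perm P} (h : Avoids c vtx S E π)
    (hS : ∀ g ∈ S, IsDouble vtx g) {p q z : P}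
    (hpq : vtx p ≠ vtx q) (hx : π p ≠ q) (hc : c p = c q) (hcz : c z = c p)
    (hz : z ∉ badTwo vtx p q π)
    (hG : ∀ r, vtx r = vtx p → vtx (π r) = vtx q → ∃ e ∈ E, e.1 = r)
    (hE : ∀ e ∈ E, e.1 ≠ p ∧ e.2 ≠ q ∧ vtx e.1 = vtx p ∧ vtx e.2 = vtx q)
    (hSE : ∀ e ∈ E, (p, q, e) ∉ S ∧ (e.1, e.2, p, q) ∉ S ∧ (q, p, e.2, e.1) ∉ S ∧
      (e.2, e.1, q, p) ∉ S) :
    z ≠ p ∧ z ≠ q ∧ z ≠ π p ∧ z ≠ π q ∧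
      Avoids c vtx S E (conjSwap (conjSwap π (π p) q) (π q) z) := by
  obtain ⟨hp, hl, hs, he⟩ := h
  simp only [badTwo, badOne, Finset.mem_union, mem_image_inv hp, mem_fib, mem_nbrPts, not_or,
    not_exists, not_and] at hz
  obtain ⟨⟨⟨⟨⟨⟨b1, b2⟩, b3⟩, b4⟩, b5⟩, b6⟩, ⟨⟨b7, b8⟩, b9⟩, b10⟩ := hz
  have hzp : z ≠ p := fun e => b7 (by rw [e])
  have hzq : z ≠ q := fun e => b8 (by rw [e])
  have hzx : z ≠ π p := fun e => b1 (by rw [e])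
  have hzy : z ≠ π q := fun e => b2 (by rw [e])
  have hτ : IsPairing c (conjSwap (conjSwap π (π p) q) (π q) z) :=
    (hp.conjSwap (by rw [hp.2.2, hc])).conjSwap (by rw [hp.2.2, hcz, hc])
  obtain ⟨v1, v2, v3, v4, v5, v6, v7⟩ :=
    conjSwap_conjSwap_values hp (fun e => hpq (by rw [e])) hx hzp hzq hzx hzy
  set τ := conjSwap (conjSwap π (π p) q) (π q) z
  have hlp := hl p
  have hlq := hl q
  have hlz := hl z
  have hii := hp.1
  have c1 : CleanAt vtx τ (π p) := by
    refine ⟨by rw [v3]; exact b1, fun r h1 h2 => ?_⟩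
    rw [v3]
    by_cases r1 : r = p
    · subst r1; exact absurd h2.symm hlp
    by_cases r2 : r = q
    · rw [r2, v2]; exact fun e => b7 e.symm
    by_cases r3 : r = z
    · subst r3; exact absurd h2 b1
    by_cases r4 : r = π q
    · rw [r4, v5]; exact hlz
    by_cases r5 : r = π z
    · subst r5; exact absurd h2 b3
    rw [v7 r r1 r2 h1 r3 r4 r5]
    exact fun e => b5 r h2 e.symm
  have c2 : CleanAt vtx τ (π q) := by
    refine ⟨by rw [v5]; exact b4, fun r h1 h2 => ?_⟩
    rw [v5]
    by_cases r1 : r = p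
    · rw [r1, v1]; exact fun e => b10 e.symm
    by_cases r2 : r = q
    · subst r2; exact absurd h2.symm hlq
    by_cases r3 : r = z
    · subst r3; exact absurd h2 b2
    by_cases r4 : r = π p
    · rw [r4, v3]; exact hlz.symm
    by_cases r5 : r = π z
    · subst r5; exact absurd h2 b4
    rw [v7 r r1 r2 r4 r3 h1 r5]
    exact fun e => b6 r h2 e.symm
  have c3 : CleanAt vtx τ z := by simpa [v3] using c1.symm hτ.1
  have c4 : CleanAt vtx τ (π z) := by simpa [v5] using c2.symm hτ.1
  have hclean : ∀ r, r ≠ p → r ≠ q → τ r ≠ π r → CleanAt vtx τ r := by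
    intro r r0 r2 hr
    by_cases r1 : r = π p
    · rwa [r1]
    by_cases r3 : r = z
    · rwa [r3]
    by_cases r4 : r = π q
    · rwa [r4]
    by_cases r5 : r = π z
    · rwa [r5]
    exact absurd (v7 r r0 r2 r1 r3 r4 r5) hr
  have honly : ∀ r, r ≠ p → vtx r = vtx p → vtx (τ r) = vtx q → ∃ e ∈ E, e.1 = r := by
    intro r r0 h1 h2
    by_cases r2 : r = q
    · subst r2; exact absurd h1.symm hpq
    by_cases r1 : r = π p
    · subst r1; exact absurd h1 hlp
    by_cases r3 : r = z
    · subst r3; exact absurd h1 b7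
    by_cases r4 : r = π q
    · rw [r4, v5] at h2; exact absurd h2 b10
    by_cases r5 : r = π z
    · subst r5; exact absurd h1 b9
    rw [v7 r r0 r2 r1 r3 r4 r5] at h2
    exact hG r h1 h2
  have hkeep : ∀ e ∈ E, τ e.1 = e.2 := by
    intro e heE
    obtain ⟨e1, e2, e3, e4⟩ := hE e heE
    have h0 := he e heE
    have h0' : π e.2 = e.1 := by rw [← h0, hii]
    rw [v7 e.1 e1, h0]
    · intro e5; rw [e5] at e3; exact hpq e3.symm
    · intro e5; rw [e5, hii] at h0; rw [← h0] at e4; exact hpq e4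
    · intro e5; rw [e5] at e3; exact b7 e3
    · intro e5; rw [e5, hii] at h0; exact e2 h0.symm
    · intro e5; rw [e5, hii] at h0; rw [← h0] at e4; exact b8 e4
  refine ⟨hzp, hzq, hzx, hzy, hτ, fun r => ?_, fun g hg => ?_, hkeep⟩
  · by_cases e : τ r = π r
    · rw [e]; exact hl r
    by_cases r1 : r = p
    · rw [r1, v1]; exact hpq.symm
    by_cases r2 : r = q
    · rw [r2, v2]; exact hpq
    exact (hclean r r1 r2 e).1
  · obtain ⟨g1, g2, g3, g4⟩ := g
    intro hge
    have hd := hS _ hg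
    by_cases k : (g1 = p ∨ g1 = q) ∨ (g3 = p ∨ g3 = q)
    · obtain ⟨d1, d2, d3⟩ := hd
      obtain ⟨a1, a2⟩ := hge
      simp only at d1 d2 d3 a1 a2
      have a1' : τ g2 = g1 := by rw [← a1, hτ.1]
      have a2' : τ g4 = g3 := by rw [← a2, hτ.1]
      have d4 : g2 ≠ g4 := fun e => d1 (by rw [← a1', ← a2', e])
      rcases k with (k | k) | (k | k)
      · subst k
        have : g2 = q := by rw [← a1, v1]
        subst this
        obtain ⟨e, heE, e1⟩ := honly g3 d1.symm d2.symm (by rw [a2, d3])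
        have e2 : e.2 = g4 := by rw [← hkeep e heE, e1, a2]
        have := (hSE e heE).1
        rw [← e1, ← e2] at hg; exact this hg
      · subst k
        have : g2 = p := by rw [← a1, v2]
        subst this
        obtain ⟨e, heE, e1⟩ := honly g4 d4.symm d3.symm (by rw [a2', d2])
        have e2 : e.2 = g3 := by rw [← hkeep e heE, e1, a2']
        have := (hSE e heE).2.2.1
        rw [← e1, ← e2] at hg; exact this hg
      · subst k
        have : g4 = q := by rw [← a2, v1]
        subst this
        obtain ⟨e, heE, e1⟩ := honly g1 d1 d2 (by rw [a1, d3])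
        have e2 : e.2 = g2 := by rw [← hkeep e heE, e1, a1]
        have := (hSE e heE).2.1
        rw [← e1, ← e2] at hg; exact this hg
      · subst k
        have : g4 = p := by rw [← a2, v2]
        subst this
        obtain ⟨e, heE, e1⟩ := honly g2 d4 d3 (by rw [a1', d2])
        have e2 : e.2 = g1 := by rw [← hkeep e heE, e1, a1']
        have := (hSE e heE).2.2.2
        rw [← e1, ← e2] at hg; exact this hg
    · push Not at k
      refine not_hasEdges_of_clean hd (hs _ hg) (fun r hr => ?_) hge
      rcases hr with rfl | rfl
      · exact hclean _ k.1.1 k.1.2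
      · exact hclean _ k.2.1 k.2.2

end
end RegSum

namespace RegSum

lemma ratio_upper_of_switch {a b m κ δ M : ℝ} (hM : 0 < M) (hm : M ≤ m)
    (hκ : 0 ≤ κ) (hκδ : 2 * (κ + 1) ≤ δ * M) (hδ : δ ≤ 1)
    (h : a * m ≤ b + κ * a) (ha : 0 ≤ a) : a ≤ (1 + δ) / m * b := by
  have hm0 : 0 < m := lt_of_lt_of_le hM hm
  have hδ0 : 0 < δ := by
    by_contra hc
    nlinarith
  have h1 : 2 * (κ + 1) ≤ δ * m := by nlinarith
  rw [div_mul_eq_mul_div, le_div_iff₀ hm0]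
  have h2 : κ * 2 ≤ m := by nlinarith
  have h3 : a * (m - κ) ≤ b := by linarith
  have h4 : m ≤ (1 + δ) * (m - κ) := by nlinarith
  calc a * m ≤ a * ((1 + δ) * (m - κ)) := by gcongr
    _ = (1 + δ) * (a * (m - κ)) := by ring
    _ ≤ _ := by gcongr

lemma ratio_lower_of_switch {a b m κ δ M : ℝ} (hM : 0 < M) (hm : M ≤ m)
    (hκ : 0 ≤ κ) (hκδ : 2 * (κ + 1) ≤ δ * M)
    (h : b * m ≤ a * (m * m + m) + κ * b) (hb : 0 ≤ b) : (1 - δ) / m * b ≤ a := by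
  have hm0 : 0 < m := lt_of_lt_of_le hM hm
  have hδ0 : 0 < δ := by
    by_contra hc
    nlinarith
  have h1 : 2 * (κ + 1) ≤ δ * m := by nlinarith
  rw [div_mul_eq_mul_div, div_le_iff₀ hm0]
  have h4 : (1 - δ) * (m + 1) ≤ m - κ := by nlinarith
  have h5 : (1 - δ) * b * (m + 1) ≤ a * m * (m + 1) := by
    calc (1 - δ) * b * (m + 1) = b * ((1 - δ) * (m + 1)) := by ring
      _ ≤ b * (m - κ) := by gcongr
      _ ≤ _ := by nlinarith
  exact le_of_mul_le_mul_right h5 (by linarith)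

section
open scoped Classical

variable {P V ι : Type*} [Fintype P]

/-- The points of the same colour as `p`. -/
noncomputable def cls (c : P → ι) (p : P) : Finset P := Finset.univ.filter (fun x => c x = c p)

/-- Pairings that avoid the edges in `S`. -/
def AvoidsLoops (c : P → ι) (S : Set (P × P)) (π : Equiv.Perm P) : Prop :=
  IsPairing c π ∧ ∀ g ∈ S, π g.1 ≠ g.2

variable {c : P → ι} {vtx : P → V} {d : ℕ} {M δ : ℝ}

lemma conjSwap_avoidsLoops {S : Set (P × P)} (hS : ∀ g ∈ S, vtx g.1 = vtx g.2)
    {π : Equiv.Perm P} (h : AvoidsLoops c S π) {p q x : P} (hpq : π p = q) (hc : c x = c p)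
    (hx : x ∉ badOne vtx p q π) :
    x ≠ p ∧ x ≠ q ∧ AvoidsLoops c S (conjSwap π q x) := by
  obtain ⟨hp, hs⟩ := h
  simp only [badOne, Finset.mem_union, mem_image_inv hp, mem_fib, mem_nbrPts, not_or, not_exists,
    not_and] at hx
  obtain ⟨⟨⟨⟨⟨b1, b2⟩, b3⟩, b4⟩, -⟩, -⟩ := hx
  have hxp : x ≠ p := fun e => b1 (by rw [e])
  have hxq : x ≠ q := fun e => b2 (by rw [e])
  have hcq : c q = c x := by rw [← hpq, hp.2.2, hc]
  obtain ⟨v1, v2, v3, v4, v5⟩ := conjSwap_values hp hpq hxp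
  refine ⟨hxp, hxq, hp.conjSwap hcq, fun g hg e => ?_⟩
  have hv := hS g hg
  rw [← e] at hv
  by_cases r0 : g.1 = p
  · rw [r0, v1] at hv; exact b1 hv.symm
  by_cases r1 : g.1 = x
  · rw [r1, v2] at hv; exact b1 hv
  by_cases r2 : g.1 = q
  · rw [r2, v3] at hv; exact b4 hv.symm
  by_cases r3 : g.1 = π x
  · rw [r3, v4] at hv; exact b4 hv
  rw [v5 _ r0 r1 r2 r3] at e
  exact hs g hg e

lemma conjSwap_conjSwap_avoidsLoops {S : Set (P × P)} (hS : ∀ g ∈ S, vtx g.1 = vtx g.2)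
    {π : Equiv.Perm P} (h : AvoidsLoops c S π) {p q z : P} (hpq : p ≠ q) (hx : π p ≠ q)
    (hc : c p = c q) (hcz : c z = c p) (hz : z ∉ badTwo vtx p q π)
    (h1 : (p, q) ∉ S) (h2 : (q, p) ∉ S) :
    z ≠ p ∧ z ≠ q ∧ z ≠ π p ∧ z ≠ π q ∧
      AvoidsLoops c S (conjSwap (conjSwap π (π p) q) (π q) z) := by
  obtain ⟨hp, hs⟩ := h
  simp only [badTwo, badOne, Finset.mem_union, mem_image_inv hp, mem_fib, mem_nbrPts, not_or,
    not_exists, not_and] at hz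
  obtain ⟨⟨⟨⟨⟨⟨b1, b2⟩, b3⟩, b4⟩, b5⟩, b6⟩, ⟨⟨b7, b8⟩, b9⟩, b10⟩ := hz
  have hzp : z ≠ p := fun e => b7 (by rw [e])
  have hzq : z ≠ q := fun e => b8 (by rw [e])
  have hzx : z ≠ π p := fun e => b1 (by rw [e])
  have hzy : z ≠ π q := fun e => b2 (by rw [e])
  have hτ : IsPairing c (conjSwap (conjSwap π (π p) q) (π q) z) :=
    (hp.conjSwap (by rw [hp.2.2, hc])).conjSwap (by rw [hp.2.2, hcz, hc])
  obtain ⟨v1, v2, v3, v4, v5, v6, v7⟩ :=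
    conjSwap_conjSwap_values hp hpq hx hzp hzq hzx hzy
  refine ⟨hzp, hzq, hzx, hzy, hτ, fun g hg e => ?_⟩
  have hv := hS g hg
  rw [← e] at hv
  by_cases r0 : g.1 = p
  · rw [r0, v1] at e; rw [← Prod.mk.eta (p := g), r0, ← e] at hg; exact h1 hg
  by_cases r1 : g.1 = q
  · rw [r1, v2] at e; rw [← Prod.mk.eta (p := g), r1, ← e] at hg; exact h2 hg
  by_cases r2 : g.1 = π p
  · rw [r2, v3] at hv; exact b1 hv.symm
  by_cases r3 : g.1 = z
  · rw [r3, v4] at hv; exact b1 hv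
  by_cases r4 : g.1 = π q
  · rw [r4, v5] at hv; exact b4 hv.symm
  by_cases r5 : g.1 = π z
  · rw [r5, v6] at hv; exact b4 hv
  rw [v7 _ r0 r1 r2 r3 r4 r5] at e
  exact hs g hg e

/-- Numerical hypotheses shared by the switching estimates. -/
structure SwitchData (c : P → ι) (vtx : P → V) (d : ℕ) (M δ : ℝ) : Prop where
  hd : ∀ u, (fib vtx u).card ≤ d
  hM : 0 < M
  hcls : ∀ p, M ≤ (cls c p).card
  hδM : 2 * (2 * d * d + 8 * d + 1 : ℕ) ≤ δ * M
  hδ : δ ≤ 1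

lemma SwitchData.δ_pos (h : SwitchData c vtx d M δ) : 0 < δ := by
  have h1 := h.hδM
  have h2 := h.hM
  by_contra hc
  have : (1:ℝ) ≤ ((2 * d * d + 8 * d + 1 : ℕ) : ℝ) := by norm_cast; omega
  nlinarith

lemma SwitchData.cls_pos (h : SwitchData c vtx d M δ) (p : P) : (0:ℝ) < (cls c p).card :=
  lt_of_lt_of_le h.hM (h.hcls p)

/-- A generic form of the upper switching estimate. -/
lemma SwitchData.upper (h : SwitchData c vtx d M δ) {B : Finset (Equiv.Perm P)}
    (hB : ∀ π ∈ B, IsPairing c π) {p q : P}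
    (hbad : ∀ π ∈ B, π p = q → ∀ x ∈ cls c p, x ∉ badOne vtx p q π →
      x ≠ p ∧ x ≠ q ∧ conjSwap π q x ∈ B) :
    ((B.filter (fun π => π p = q)).card : ℝ) ≤ (1 + δ) / (cls c p).card * B.card := by
  have h1 := switch_upper hB (cls c p) (badOne vtx p q) (2 * d * d + 8 * d) hbad
    (fun π _ _ => (card_badOne_le h.hd p q π).trans (by omega))
  refine ratio_upper_of_switch h.hM (h.hcls p) (κ := ((2 * d * d + 8 * d : ℕ) : ℝ)) (by positivity)
    ?_ h.hδ (by exact_mod_cast h1) (by positivity)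
  have := h.hδM
  push_cast at this ⊢
  linarith

lemma SwitchData.lower (h : SwitchData c vtx d M δ) {B G : Finset (Equiv.Perm P)}
    (hB : ∀ π ∈ B, IsPairing c π) (hG : G ⊆ B) {p q : P} (hpq : p ≠ q) (hc : c p = c q)
    (hbad : ∀ π ∈ G, π p ≠ q → ∀ z ∈ cls c p, z ∉ badTwo vtx p q π →
      z ≠ p ∧ z ≠ q ∧ z ≠ π p ∧ z ≠ π q ∧ conjSwap (conjSwap π (π p) q) (π q) z ∈ B) :
    (1 - δ) / (cls c p).card * G.card ≤ ((B.filter (fun π => π p = q)).card : ℝ) := by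
  have h1 := switch_lower hB hG hpq (cls c p)
    (fun π hπ => by simp [cls, (hB π hπ).2.2, hc]) (badTwo vtx p q) (2 * d * d + 8 * d) hbad
    (fun π _ _ => (card_badTwo_le h.hd p q π))
  refine ratio_lower_of_switch h.hM (h.hcls p) (κ := ((2 * d * d + 8 * d : ℕ) : ℝ)) (by positivity)
    ?_ (by exact_mod_cast h1) (by positivity)
  have := h.hδM
  push_cast at this ⊢
  linarith

/-- Conditional probability of a loop given that some loops are absent. -/
lemma SwitchData.loop_bounds (h : SwitchData c vtx d M δ) {S : Set (P × P)}
    (hS : ∀ g ∈ S, vtx g.1 = vtx g.2) {p q : P} (hpq : p ≠ q) (hc : c p = c q)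
    (h1 : (p, q) ∉ S) (h2 : (q, p) ∉ S) :
    let B := Finset.univ.filter (AvoidsLoops c S)
    (1 - δ) / (cls c p).card * B.card ≤ ((B.filter (fun π => π p = q)).card : ℝ) ∧
    ((B.filter (fun π => π p = q)).card : ℝ) ≤ (1 + δ) / (cls c p).card * B.card := by
  intro B
  have hB : ∀ π ∈ B, IsPairing c π := fun π hπ => (Finset.mem_filter.1 hπ).2.1
  constructor
  · refine h.lower hB subset_rfl hpq hc fun π hπ hne z hz hzb => ?_
    have := conjSwap_conjSwap_avoidsLoops hS (Finset.mem_filter.1 hπ).2 hpq hne hc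
      (Finset.mem_filter.1 hz).2 hzb h1 h2
    simpa [B] using this
  · refine h.upper hB fun π hπ he x hx hxb => ?_
    have := conjSwap_avoidsLoops hS (Finset.mem_filter.1 hπ).2 he (Finset.mem_filter.1 hx).2 hxb
    simpa [B] using this

lemma SwitchData.avoids_upper (h : SwitchData c vtx d M δ) {S : Set (P × P × P × P)}
    {E : Set (P × P)} (hS : ∀ g ∈ S, IsDouble vtx g) {p q : P}
    (hE : ∀ e ∈ E, e.1 ≠ p ∧ e.1 ≠ q ∧ (vtx e.1 = vtx p ∨ vtx e.1 = vtx q) ∧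
      (vtx e.2 = vtx p ∨ vtx e.2 = vtx q)) :
    let B := Finset.univ.filter (Avoids c vtx S E)
    ((B.filter (fun π => π p = q)).card : ℝ) ≤ (1 + δ) / (cls c p).card * B.card := by
  intro B
  have hB : ∀ π ∈ B, IsPairing c π := fun π hπ => (Finset.mem_filter.1 hπ).2.1
  refine h.upper hB fun π hπ he x hx hxb => ?_
  have := conjSwap_avoids (Finset.mem_filter.1 hπ).2 hS he (Finset.mem_filter.1 hx).2 hxb hE
  simpa [B] using this

lemma SwitchData.avoids_lower (h : SwitchData c vtx d M δ) {S : Set (P × P × P × P)}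
    {E : Set (P × P)} (hS : ∀ g ∈ S, IsDouble vtx g) {p q : P} (hpq : vtx p ≠ vtx q)
    (hc : c p = c q)
    (hE : ∀ e ∈ E, e.1 ≠ p ∧ e.2 ≠ q ∧ vtx e.1 = vtx p ∧ vtx e.2 = vtx q)
    (hSE : ∀ e ∈ E, (p, q, e) ∉ S ∧ (e.1, e.2, p, q) ∉ S ∧ (q, p, e.2, e.1) ∉ S ∧
      (e.2, e.1, q, p) ∉ S) :
    let B := Finset.univ.filter (Avoids c vtx S E)
    (1 - δ) * (1 - δ) / (cls c p).card * B.card ≤ ((B.filter (fun π => π p = q)).card : ℝ) := by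
  intro B
  have hB : ∀ π ∈ B, IsPairing c π := fun π hπ => (Finset.mem_filter.1 hπ).2.1
  set G := B.filter (fun π => ∀ r, vtx r = vtx p → vtx (π r) = vtx q → ∃ e ∈ E, e.1 = r) with hGdef
  have h1 : (1 - δ) / (cls c p).card * G.card ≤ ((B.filter (fun π => π p = q)).card : ℝ) := by
    refine h.lower hB (Finset.filter_subset _ _) (fun e => hpq (by rw [e])) hc
      fun π hπ hne z hz hzb => ?_
    rw [Finset.mem_filter] at hπ
    have := conjSwap_conjSwap_avoids (Finset.mem_filter.1 hπ.1).2 hS hpq hne hc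
      (Finset.mem_filter.1 hz).2 hzb hπ.2 hE hSE
    simpa [B] using this
  have h2 : (1 - δ) * (B.card : ℝ) ≤ G.card := by
    have hsub : B \ G ⊆ ((fib vtx (vtx p)).filter (fun r => ∀ e ∈ E, e.1 ≠ r)).biUnion fun r =>
        (fib vtx (vtx q)).biUnion fun s => B.filter (fun π => π r = s) := by
      intro π hπ
      simp only [hGdef, Finset.mem_sdiff, Finset.mem_filter, not_and, not_forall] at hπ
      obtain ⟨hπB, h3⟩ := hπ
      obtain ⟨r, h4, h5, h6⟩ := h3 hπB
      simp only [Finset.mem_biUnion, Finset.mem_filter, mem_fib]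
      exact ⟨r, ⟨h4, fun e he e1 => h6 ⟨e, he, e1⟩⟩, π r, h5, hπB, rfl⟩
    have hM := h.hM
    have hδ0 := h.δ_pos
    have hone : ∀ r ∈ (fib vtx (vtx p)).filter (fun r => ∀ e ∈ E, e.1 ≠ r), ∀ s ∈ fib vtx (vtx q),
        ((B.filter (fun π => π r = s)).card : ℝ) ≤ 2 / M * B.card := by
      intro r hr s hs
      simp only [Finset.mem_filter, mem_fib] at hr hs
      have := h.avoids_upper (c := c) (E := E) hS (p := r) (q := s) (fun e he => by
        obtain ⟨e1, e2, e3, e4⟩ := hE e he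
        refine ⟨hr.2 e he, fun e5 => hpq ?_, Or.inl (by rw [e3, hr.1]), Or.inr (by rw [e4, hs])⟩
        rw [← e3, e5, hs])
      refine this.trans ?_
      have h7 := h.hcls r
      have h8 := h.hδ
      gcongr
      linarith
    have hcard : ((B \ G).card : ℝ) ≤ d * d * (2 / M * B.card) := by
      have h9 : ((B \ G).card : ℝ) ≤ ∑ r ∈ (fib vtx (vtx p)).filter (fun r => ∀ e ∈ E, e.1 ≠ r),
          ∑ s ∈ fib vtx (vtx q), ((B.filter (fun π => π r = s)).card : ℝ) := by
        have := (Finset.card_le_card hsub).trans (Finset.card_biUnion_le.trans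
          (Finset.sum_le_sum fun r _ => Finset.card_biUnion_le))
        exact_mod_cast this
      refine h9.trans ((Finset.sum_le_sum fun r hr => Finset.sum_le_sum fun s hs =>
        hone r hr s hs).trans ?_)
      simp only [Finset.sum_const, nsmul_eq_mul]
      have k1 : (((fib vtx (vtx p)).filter (fun r => ∀ e ∈ E, e.1 ≠ r)).card : ℝ) ≤ d := by
        exact_mod_cast (Finset.card_filter_le _ _).trans (h.hd _)
      have k2 : ((fib vtx (vtx q)).card : ℝ) ≤ d := by exact_mod_cast h.hd _
      rw [← mul_assoc]
      gcongr
    have hGB : G ⊆ B := Finset.filter_subset _ _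
    have h10 : ((B \ G).card : ℝ) = B.card - G.card := by
      rw [Finset.card_sdiff_of_subset hGB, Nat.cast_sub (Finset.card_le_card hGB)]
    have h11 : (d * d * (2 / M * B.card) : ℝ) ≤ δ * B.card := by
      have := h.hδM
      push_cast at this
      rw [show (d * d * (2 / M * B.card) : ℝ) = (2 * d * d / M) * B.card by ring]
      gcongr
      rw [div_le_iff₀ hM]
      nlinarith [Nat.cast_nonneg (α := ℝ) d]
    linarith
  have h3 : 0 ≤ (1 - δ) / ((cls c p).card : ℝ) := by
    have := h.hδ
    exact div_nonneg (by linarith) (by positivity)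
  calc (1 - δ) * (1 - δ) / (cls c p).card * B.card
      = (1 - δ) / (cls c p).card * ((1 - δ) * B.card) := by ring
    _ ≤ (1 - δ) / (cls c p).card * G.card := by gcongr
    _ ≤ _ := h1

/-- Conditional probability of a double edge given that loops and some double edges are absent. -/
lemma SwitchData.double_bounds (h : SwitchData c vtx d M δ) {S : Set (P × P × P × P)}
    (hS : ∀ g ∈ S, IsDouble vtx g) {p q p' q' : P} (hpq : vtx p ≠ vtx q) (hc : c p = c q)
    (hp : vtx p' = vtx p) (hq : vtx q' = vtx q) (hc' : c p' = c q') (hpp : p ≠ p') (hqq : q ≠ q')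
    (hSE : (p', q', p, q) ∉ S ∧ (p, q, p', q') ∉ S ∧ (q', p', q, p) ∉ S ∧
      (q, p, q', p') ∉ S) :
    let B := Finset.univ.filter (Avoids c vtx S ∅)
    let w : ℝ := 1 / ((cls c p).card * (cls c p').card)
    (1 - 4 * δ) * w * B.card ≤
      ((B.filter (fun π => π p = q ∧ π p' = q')).card : ℝ) ∧
    ((B.filter (fun π => π p = q ∧ π p' = q')).card : ℝ) ≤ (1 + 4 * δ) * w * B.card := by
  intro B w
  have hδ0 := h.δ_pos
  have hδ1 := h.hδ
  set m : ℝ := ((cls c p).card : ℝ)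
  set m' : ℝ := ((cls c p').card : ℝ)
  have hm : 0 < m := h.cls_pos p
  have hm' : 0 < m' := h.cls_pos p'
  have hBE : B.filter (fun π => π p = q) = Finset.univ.filter (Avoids c vtx S {(p, q)}) := by
    ext π; simp [B, Avoids]; tauto
  have hBE' : B.filter (fun π => π p = q ∧ π p' = q') =
      (Finset.univ.filter (Avoids c vtx S {(p, q)})).filter (fun π => π p' = q') := by
    rw [← hBE]; ext π; simp only [Finset.mem_filter, and_assoc]
  have hw : w = 1 / (m * m') := rfl
  have u1 := h.avoids_upper (c := c) (E := ∅) hS (p := p) (q := q) (by simp)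
  have l1 := h.avoids_lower (c := c) (E := ∅) hS (p := p) (q := q) hpq hc (by simp) (by simp)
  have u2 := h.avoids_upper (c := c) (E := {(p, q)}) hS (p := p') (q := q') (by
    simp only [Set.mem_singleton_iff, forall_eq]
    refine ⟨hpp, fun e => hpq ?_, Or.inl hp.symm, Or.inr hq.symm⟩
    rw [e, hq])
  have l2 := h.avoids_lower (c := c) (E := {(p, q)}) hS (p := p') (q := q') (by rwa [hp, hq]) hc'
    (by simp only [Set.mem_singleton_iff, forall_eq]; exact ⟨hpp, hqq, hp.symm, hq.symm⟩)
    (by simpa only [Set.mem_singleton_iff, forall_eq] using ⟨hSE.1, hSE.2.1, hSE.2.2.1, hSE.2.2.2⟩)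
  simp only at u1 l1 u2 l2
  rw [hBE', ← hBE]
  rw [← hBE] at u2 l2
  change _ ≤ (1 + δ) / m * (B.card : ℝ) at u1
  change (1 - δ) * (1 - δ) / m * (B.card : ℝ) ≤ _ at l1
  set b : ℝ := (B.card : ℝ)
  have hb : 0 ≤ b := Nat.cast_nonneg _
  set b' : ℝ := ((B.filter (fun π => π p = q)).card : ℝ)
  constructor
  · refine le_trans ?_ l2
    calc (1 - 4 * δ) * w * b ≤ ((1 - δ) * (1 - δ) * ((1 - δ) * (1 - δ))) * w * b := by
          gcongr
          nlinarith [mul_nonneg hδ0.le hδ0.le, mul_nonneg (mul_nonneg hδ0.le hδ0.le)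
            (sub_nonneg.2 hδ1), sq_nonneg (δ * δ)]
      _ = (1 - δ) * (1 - δ) / m' * ((1 - δ) * (1 - δ) / m * b) := by
          rw [hw]; field_simp
      _ ≤ _ := by
          refine mul_le_mul_of_nonneg_left l1 (div_nonneg (by nlinarith) hm'.le)
  · refine u2.trans ?_
    calc (1 + δ) / m' * b' ≤ (1 + δ) / m' * ((1 + δ) / m * b) := by gcongr
      _ = ((1 + δ) * (1 + δ)) * w * b := by
          rw [hw]; field_simp
      _ ≤ _ := by gcongr; nlinarith

end
end RegSum

namespace RegSum
section
open scoped Classical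

lemma exp_le_one_sub {x : ℝ} (h0 : 0 ≤ x) (h1 : x ≤ 1 / 2) :
    Real.exp (-x - 2 * x ^ 2) ≤ 1 - x := by
  have h2 : 0 < 1 - x := by linarith
  rw [← Real.le_log_iff_exp_le h2]
  refine le_trans ?_ (Real.one_sub_inv_le_log_of_pos h2)
  have : (1 - x)⁻¹ ≤ 1 + x + 2 * x ^ 2 := by
    rw [inv_le_iff_one_le_mul₀ h2]
    nlinarith [mul_nonneg (mul_nonneg h0 h0) (sub_nonneg.2 h1)]
  linarith

/-- Sequential sieve: removing events one at a time. -/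
lemma sieve_bounds {α κ : Type*} (Ω : Finset α) (ev : κ → α → Prop) (F : Finset κ) (w : κ → ℝ)
    {ε : ℝ} (hw1 : ∀ f ∈ F, (1 + ε) * w f ≤ 1)
    (hlow : ∀ S ⊆ F, ∀ f ∈ F, f ∉ S →
      (1 - ε) * w f * (Ω.filter (fun x => ∀ g ∈ S, ¬ ev g x)).card ≤
        (((Ω.filter (fun x => ∀ g ∈ S, ¬ ev g x)).filter (ev f)).card : ℝ))
    (hupp : ∀ S ⊆ F, ∀ f ∈ F, f ∉ S →
      (((Ω.filter (fun x => ∀ g ∈ S, ¬ ev g x)).filter (ev f)).card : ℝ) ≤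
      (1 + ε) * w f * (Ω.filter (fun x => ∀ g ∈ S, ¬ ev g x)).card) :
    ∀ S ⊆ F, Ω.card * ∏ f ∈ S, (1 - (1 + ε) * w f) ≤
        ((Ω.filter (fun x => ∀ g ∈ S, ¬ ev g x)).card : ℝ) ∧
      ((Ω.filter (fun x => ∀ g ∈ S, ¬ ev g x)).card : ℝ) ≤
        Ω.card * Real.exp (-(1 - ε) * ∑ f ∈ S, w f) := by
  intro S
  induction S using Finset.induction_on with
  | empty => intro _; simp
  | insert f S hf ih =>
    intro hS
    obtain ⟨i1, i2⟩ := ih ((Finset.subset_insert _ _).trans hS)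
    have hSF : S ⊆ F := (Finset.subset_insert _ _).trans hS
    have hfF : f ∈ F := hS (Finset.mem_insert_self _ _)
    have hl := hlow S hSF f hfF hf
    have hu := hupp S hSF f hfF hf
    set B := Ω.filter (fun x => ∀ g ∈ S, ¬ ev g x)
    have hB : Ω.filter (fun x => ∀ g ∈ insert f S, ¬ ev g x) = B.filter (fun x => ¬ ev f x) := by
      ext x; simp [B]; tauto
    have hc : ((B.filter (fun x => ¬ ev f x)).card : ℝ) = B.card - (B.filter (ev f)).card := by
      have := Finset.card_filter_add_card_filter_not (s := B) (ev f)
      rw [← this]; push_cast; ring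
    rw [hB, hc, Finset.prod_insert hf, Finset.sum_insert hf]
    constructor
    · have h1 := hw1 f hfF
      calc (Ω.card : ℝ) * ((1 - (1 + ε) * w f) * ∏ f ∈ S, (1 - (1 + ε) * w f))
          = (1 - (1 + ε) * w f) * (Ω.card * ∏ f ∈ S, (1 - (1 + ε) * w f)) := by ring
        _ ≤ (1 - (1 + ε) * w f) * B.card := by
            refine mul_le_mul_of_nonneg_left i1 (by linarith)
        _ ≤ _ := by linarith
    · have h3 : 1 - (1 - ε) * w f ≤ Real.exp (-(1 - ε) * w f) := by
        have := Real.add_one_le_exp (-(1 - ε) * w f); linarith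
      calc (B.card : ℝ) - (B.filter (ev f)).card ≤ (1 - (1 - ε) * w f) * B.card := by linarith
        _ ≤ Real.exp (-(1 - ε) * w f) * B.card := by gcongr
        _ ≤ Real.exp (-(1 - ε) * w f) * (Ω.card * Real.exp (-(1 - ε) * ∑ f ∈ S, w f)) := by gcongr
        _ = _ := by rw [mul_add, Real.exp_add]; ring

/-- Sequential sieve with exponential bounds. -/
lemma sieve_exp_bounds {α κ : Type*} (Ω : Finset α) (ev : κ → α → Prop) (F : Finset κ) (w : κ → ℝ)
    {ε : ℝ} (hε0 : 0 ≤ ε) (hε1 : ε ≤ 1) (hw0 : ∀ f ∈ F, 0 ≤ w f) (hwε : ∀ f ∈ F, 8 * w f ≤ ε)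
    (hlow : ∀ S ⊆ F, ∀ f ∈ F, f ∉ S →
      (1 - ε) * w f * (Ω.filter (fun x => ∀ g ∈ S, ¬ ev g x)).card ≤
        (((Ω.filter (fun x => ∀ g ∈ S, ¬ ev g x)).filter (ev f)).card : ℝ))
    (hupp : ∀ S ⊆ F, ∀ f ∈ F, f ∉ S →
      (((Ω.filter (fun x => ∀ g ∈ S, ¬ ev g x)).filter (ev f)).card : ℝ) ≤
      (1 + ε) * w f * (Ω.filter (fun x => ∀ g ∈ S, ¬ ev g x)).card) :
    Ω.card * Real.exp (-(1 + 2 * ε) * ∑ f ∈ F, w f) ≤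
        ((Ω.filter (fun x => ∀ g ∈ F, ¬ ev g x)).card : ℝ) ∧
      ((Ω.filter (fun x => ∀ g ∈ F, ¬ ev g x)).card : ℝ) ≤
        Ω.card * Real.exp (-(1 - 2 * ε) * ∑ f ∈ F, w f) := by
  have hsum : 0 ≤ ∑ f ∈ F, w f := Finset.sum_nonneg hw0
  have hhalf : ∀ f ∈ F, (1 + ε) * w f ≤ 1 / 2 := fun f hf => by nlinarith [hw0 f hf, hwε f hf]
  obtain ⟨h1, h2⟩ := sieve_bounds Ω ev F w (fun f hf => (hhalf f hf).trans (by norm_num))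
    hlow hupp F subset_rfl
  constructor
  · refine le_trans ?_ h1
    gcongr
    rw [Finset.mul_sum, Real.exp_sum]
    refine Finset.prod_le_prod (fun _ _ => (Real.exp_pos _).le) fun f hf => ?_
    have a := hw0 f hf
    refine le_trans ?_ (exp_le_one_sub (x := (1 + ε) * w f) (by positivity) (hhalf f hf))
    gcongr
    have b := hwε f hf
    have e1 : (1 + ε) * w f * ((1 + ε) * w f) ≤ 2 * w f * (2 * w f) := by gcongr <;> linarith
    nlinarith [mul_le_mul_of_nonneg_right b a]
  · refine h2.trans ?_
    gcongr
    nlinarith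

end
end RegSum

namespace RegSum
section
open scoped Classical

variable {P V ι : Type*} [Fintype P]

/-- Potential loops, one orientation each. -/
noncomputable def loopEv (c : P → ι) (vtx : P → V) (o : P → ℕ) : Finset (P × P) :=
  Finset.univ.filter fun g => vtx g.1 = vtx g.2 ∧ c g.1 = c g.2 ∧ o g.1 < o g.2

/-- Potential double edges, one representative each. -/
noncomputable def doubleEv (c : P → ι) (vtx : P → V) (o : P → ℕ) (ov : V → ℕ) :
    Finset (P × P × P × P) :=
  Finset.univ.filter fun g => c g.1 = c g.2.1 ∧ c g.2.2.1 = c g.2.2.2 ∧ vtx g.1 = vtx g.2.2.1 ∧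
    vtx g.2.1 = vtx g.2.2.2 ∧ ov (vtx g.1) < ov (vtx g.2.1) ∧ o g.1 < o g.2.2.1 ∧
    g.2.1 ≠ g.2.2.2

/-- The inverse colour class size. -/
noncomputable def wt (c : P → ι) (p : P) : ℝ := 1 / (cls c p).card

/-- The expected number of loops. -/
noncomputable def loopMean (c : P → ι) (vtx : P → V) (o : P → ℕ) : ℝ :=
  ∑ g ∈ loopEv c vtx o, wt c g.1

/-- The expected number of double edges. -/
noncomputable def doubleMean (c : P → ι) (vtx : P → V) (o : P → ℕ) (ov : V → ℕ) : ℝ :=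
  ∑ g ∈ doubleEv c vtx o ov, wt c g.1 * wt c g.2.2.1

variable {c : P → ι} {vtx : P → V} {d : ℕ} {M δ : ℝ}

lemma SwitchData.two_le (h : SwitchData c vtx d M δ) : 2 ≤ δ * M := by
  refine le_trans ?_ h.hδM
  have : (1:ℝ) ≤ ((2 * d * d + 8 * d + 1 : ℕ) : ℝ) := by norm_cast; omega
  linarith

lemma SwitchData.one_le (h : SwitchData c vtx d M δ) : 1 ≤ M := by
  have := h.two_le
  have := h.hδ
  nlinarith [h.hM]

lemma wt_nonneg (p : P) : 0 ≤ wt c p := by unfold wt; positivity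

lemma SwitchData.wt_le (h : SwitchData c vtx d M δ) (p : P) : wt c p ≤ 1 / M := by
  unfold wt
  exact one_div_le_one_div_of_le h.hM (h.hcls p)

lemma SwitchData.inv_le (h : SwitchData c vtx d M δ) : 8 * (1 / M) ≤ 4 * δ := by
  rw [mul_one_div, div_le_iff₀ h.hM]
  linarith [h.two_le]

lemma simple_pairings_bounds_mean (h : SwitchData c vtx d M δ) (hδ4 : 4 * δ ≤ 1) {o : P → ℕ}
    (ho : o.Injective) {ov : V → ℕ} (hov : ov.Injective) :
    let Λ := loopMean c vtx o + doubleMean c vtx o ov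
    let N : ℝ := (Finset.univ.filter (IsPairing c)).card
    let Ns : ℝ := (Finset.univ.filter fun π => IsPairing c π ∧ IsSimplePairing vtx π).card
    N * Real.exp (-(1 + 8 * δ) * Λ) ≤ Ns ∧ Ns ≤ N * Real.exp (-(1 - 8 * δ) * Λ) := by
  intro Λ N Ns
  have hδ0 := h.δ_pos
  have hmul : ∀ p p', wt c p * wt c p' ≤ 1 / M := fun p p' => by
    have h1 : (1:ℝ) / M ≤ 1 := by
      rw [div_le_one h.hM]; exact h.one_le
    calc wt c p * wt c p' ≤ 1 / M * 1 := by
          gcongr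
          · exact wt_nonneg _
          · exact div_nonneg zero_le_one h.hM.le
          · exact h.wt_le p
          · exact (h.wt_le p').trans h1
      _ = _ := mul_one _
  have sL := sieve_exp_bounds (Finset.univ.filter (IsPairing c)) (fun g π => π g.1 = g.2)
    (loopEv c vtx o) (fun g => wt c g.1) (ε := 4 * δ) (by positivity) hδ4
    (fun f _ => wt_nonneg _)
    (fun f _ => by have := h.wt_le f.1; have := h.inv_le; linarith)
  have hLset : ∀ (S : Finset (P × P)) (inst : DecidablePred fun π : Equiv.Perm P =>
      ∀ g ∈ S, ¬ π g.1 = g.2), @Finset.filter _ (fun π => ∀ g ∈ S, ¬ π g.1 = g.2) inst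
      (Finset.univ.filter (IsPairing c)) = Finset.univ.filter (AvoidsLoops c (S : Set (P × P))) := by
    intro S _; ext π; simp [AvoidsLoops]
  have hLb : ∀ S ⊆ loopEv c vtx o, ∀ f ∈ loopEv c vtx o, f ∉ S →
      (1 - δ) / (cls c f.1).card * (Finset.univ.filter (AvoidsLoops c (S : Set (P × P)))).card ≤
        (((Finset.univ.filter (AvoidsLoops c (S : Set (P × P)))).filter
          (fun π => π f.1 = f.2)).card : ℝ) ∧
      (((Finset.univ.filter (AvoidsLoops c (S : Set (P × P)))).filter
          (fun π => π f.1 = f.2)).card : ℝ) ≤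
      (1 + δ) / (cls c f.1).card * (Finset.univ.filter (AvoidsLoops c (S : Set (P × P)))).card := by
    intro S hS f hf hfS
    simp only [loopEv, Finset.mem_filter, Finset.mem_univ, true_and] at hf
    refine h.loop_bounds (S := (S : Set (P × P))) (fun g hg => ?_) (fun e => ?_) hf.2.1 hfS
      (fun hg => ?_)
    · have := hS hg
      simp only [loopEv, Finset.mem_filter, Finset.mem_univ, true_and] at this
      exact this.1
    · rw [e] at hf; exact lt_irrefl _ hf.2.2
    · have := hS hg
      simp only [loopEv, Finset.mem_filter, Finset.mem_univ, true_and] at this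
      exact lt_asymm hf.2.2 this.2.2
  simp only [hLset] at sL
  replace sL := sL (fun S hS f hf hfS => by
      refine le_trans ?_ (hLb S hS f hf hfS).1
      unfold wt
      rw [mul_one_div]
      gcongr
      linarith) (fun S hS f hf hfS => by
      refine (hLb S hS f hf hfS).2.trans ?_
      unfold wt
      rw [mul_one_div]
      gcongr
      linarith)
  have sD := sieve_exp_bounds (Finset.univ.filter (Avoids c vtx ∅ ∅)) (fun g π => HasEdges π g)
    (doubleEv c vtx o ov) (fun g => wt c g.1 * wt c g.2.2.1) (ε := 4 * δ) (by positivity) hδ4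
    (fun f _ => mul_nonneg (wt_nonneg _) (wt_nonneg _))
    (fun f _ => by have := hmul f.1 f.2.2.1; have := h.inv_le; linarith)
  have hDset : ∀ (S : Finset (P × P × P × P)) (inst : DecidablePred fun π : Equiv.Perm P =>
      ∀ g ∈ S, ¬ HasEdges π g), @Finset.filter _ (fun π => ∀ g ∈ S, ¬ HasEdges π g) inst
      (Finset.univ.filter (Avoids c vtx ∅ ∅)) =
      Finset.univ.filter (Avoids c vtx (S : Set (P × P × P × P)) ∅) := by
    intro S _; ext π; simp only [Avoids, Finset.mem_filter, Finset.mem_univ, true_and,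
      Set.mem_empty_iff_false, false_imp_iff, implies_true, and_true, Finset.mem_coe]
    tauto
  have hDb : ∀ S ⊆ doubleEv c vtx o ov, ∀ f ∈ doubleEv c vtx o ov, f ∉ S →
      (1 - 4 * δ) * (wt c f.1 * wt c f.2.2.1) *
          (Finset.univ.filter (Avoids c vtx (S : Set (P × P × P × P)) ∅)).card ≤
        (((Finset.univ.filter (Avoids c vtx (S : Set (P × P × P × P)) ∅)).filter
          (fun π => HasEdges π f)).card : ℝ) ∧
      (((Finset.univ.filter (Avoids c vtx (S : Set (P × P × P × P)) ∅)).filter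
          (fun π => HasEdges π f)).card : ℝ) ≤
      (1 + 4 * δ) * (wt c f.1 * wt c f.2.2.1) *
        (Finset.univ.filter (Avoids c vtx (S : Set (P × P × P × P)) ∅)).card := by
    rintro S hS ⟨p, q, p', q'⟩ hf hfS
    simp only [doubleEv, Finset.mem_filter, Finset.mem_univ, true_and] at hf
    obtain ⟨f1, f2, f3, f4, f5, f6, f7⟩ := hf
    have := h.double_bounds (S := (S : Set (P × P × P × P))) (fun g hg => ?_) (p := p) (q := q)
      (p' := p') (q' := q') (fun e => by rw [e] at f5; exact lt_irrefl _ f5) f1 f3.symm f4.symm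
      f2 (fun e => by rw [e] at f6; exact lt_irrefl _ f6) f7
      ⟨fun hg => ?_, hfS, fun hg => ?_, fun hg => ?_⟩
    · have e : ∀ A : Finset (Equiv.Perm P), (A.filter fun π => HasEdges π (p, q, p', q')) =
          A.filter fun π => π p = q ∧ π p' = q' := fun A => by
        ext; rw [Finset.mem_filter, Finset.mem_filter]; rfl
      rw [e]
      simpa only [wt, one_div_mul_one_div] using this
    all_goals
      have hg' := hS hg
      simp only [doubleEv, Finset.mem_filter, Finset.mem_univ, true_and] at hg'
      obtain ⟨g1, g2, g3, g4, g5, g6, g7⟩ := hg'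
    · exact ⟨fun e => by rw [e] at g6; exact lt_irrefl _ g6, g3, g4⟩
    · exact lt_asymm g6 f6
    · rw [← f3, ← f4] at g5; exact lt_asymm g5 f5
    · exact lt_asymm g5 f5
  simp only [hDset] at sD
  replace sD := sD (fun S hS f hf hfS => (hDb S hS f hf hfS).1)
    (fun S hS f hf hfS => (hDb S hS f hf hfS).2)
  have hmid : Finset.univ.filter (AvoidsLoops c ((loopEv c vtx o : Finset (P × P)) : Set (P × P))) =
      Finset.univ.filter (Avoids c vtx ∅ ∅) := by
    ext π
    simp only [AvoidsLoops, Avoids, Finset.mem_filter, Finset.mem_univ, true_and,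
      Set.mem_empty_iff_false, false_imp_iff, implies_true, and_true, Finset.mem_coe]
    refine and_congr_right fun hp => ⟨fun hl p e => ?_, fun hl g hg e => ?_⟩
    · rcases lt_trichotomy (o p) (o (π p)) with hlt | heq | hgt
      · exact hl (p, π p) (by simp [loopEv, e, hp.2.2, hlt]) rfl
      · exact hp.2.1 p (ho heq).symm
      · exact hl (π p, p) (by simp [loopEv, e, hp.2.2, hgt]) (hp.1 p)
    · simp only [loopEv, Finset.mem_filter, Finset.mem_univ, true_and] at hg
      exact hl g.1 (by rw [e, hg.1])
  have hend : Finset.univ.filter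
      (Avoids c vtx ((doubleEv c vtx o ov : Finset (P × P × P × P)) : Set (P × P × P × P)) ∅) =
      Finset.univ.filter fun π => IsPairing c π ∧ IsSimplePairing vtx π := by
    ext π
    simp only [Finset.mem_filter, Finset.mem_univ, true_and]
    simp only [IsSimplePairing, Avoids, Set.mem_empty_iff_false, false_imp_iff, implies_true, and_true, Finset.mem_coe]
    refine and_congr_right fun hp => and_congr_right fun hl => ?_
    refine ⟨fun hs => ?_, fun hs g hg hge => ?_⟩
    · have key : ∀ p q, vtx p = vtx q → vtx (π p) = vtx (π q) → o p < o q →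
          ov (vtx p) < ov (vtx (π p)) → False := by
        intro p q e1 e2 e3 e4
        refine hs (p, π p, q, π q) ?_ ⟨rfl, rfl⟩
        simp only [doubleEv, Finset.mem_filter, Finset.mem_univ, true_and, hp.2.2]
        exact ⟨e1, e2, e4, e3, fun e => by rw [π.injective e] at e3; exact lt_irrefl _ e3⟩
      have key2 : ∀ p q, p ≠ q → vtx p = vtx q → vtx (π p) = vtx (π q) →
          ov (vtx p) < ov (vtx (π p)) → False := by
        intro p q h0 e1 e2 e4
        rcases lt_trichotomy (o p) (o q) with hlt | heq | hgt
        · exact key p q e1 e2 hlt e4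
        · exact h0 (ho heq)
        · exact key q p e1.symm e2.symm hgt (by rwa [← e1, ← e2])
      intro p q h0 e1 e2
      rcases lt_trichotomy (ov (vtx p)) (ov (vtx (π p))) with hlt | heq | hgt
      · exact key2 p q h0 e1 e2 hlt
      · exact hl p (hov heq).symm
      · exact key2 (π p) (π q) (fun e => h0 (π.injective e)) e2 (by rwa [hp.1, hp.1])
          (by rwa [hp.1])
    · simp only [doubleEv, Finset.mem_filter, Finset.mem_univ, true_and] at hg
      obtain ⟨g1, g2, g3, g4, g5, g6, g7⟩ := hg
      obtain ⟨a1, a2⟩ := hge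
      exact hs g.1 g.2.2.1 (fun e => by rw [e] at g6; exact lt_irrefl _ g6) g3
        (by rw [a1, a2, g4])
  rw [hmid] at sL
  rw [hend] at sD
  rw [show 2 * (4 * δ) = 8 * δ by ring] at sL sD
  constructor
  · calc N * Real.exp (-(1 + 8 * δ) * Λ) = N * Real.exp (-(1 + 8 * δ) * loopMean c vtx o) *
          Real.exp (-(1 + 8 * δ) * doubleMean c vtx o ov) := by
          simp only [Λ]; rw [mul_add, Real.exp_add, mul_assoc]
      _ ≤ _ * Real.exp (-(1 + 8 * δ) * doubleMean c vtx o ov) := by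
          exact mul_le_mul_of_nonneg_right sL.1 (Real.exp_nonneg _)
      _ ≤ _ := sD.1
  · calc Ns ≤ _ := sD.2
      _ ≤ (N * Real.exp (-(1 - 8 * δ) * loopMean c vtx o)) *
          Real.exp (-(1 - 8 * δ) * doubleMean c vtx o ov) := by
          exact mul_le_mul_of_nonneg_right sL.2 (Real.exp_nonneg _)
      _ = _ := by simp only [Λ]; rw [mul_add, Real.exp_add, mul_assoc]

end
end RegSum

namespace RegSum
section
open scoped Classical

variable {P V ι : Type*} [Fintype P]

/-- The approximate probability that a random pairing matches `p` with `q`. -/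
noncomputable def edgeWt (c : P → ι) (p q : P) : ℝ := if c p = c q then wt c p else 0

/-- The approximate mean number of edges joining two fibres. -/
noncomputable def fibWt (c : P → ι) (vtx : P → V) (u v : V) : ℝ :=
  ∑ p ∈ fib vtx u, ∑ q ∈ fib vtx v, edgeWt c p q

variable {c : P → ι} {vtx : P → V} {d : ℕ} {M δ : ℝ}

lemma edgeWt_nonneg (p q : P) : 0 ≤ edgeWt c p q := by
  unfold edgeWt; split_ifs
  · exact wt_nonneg _
  · exact le_rfl

lemma wt_congr {p q : P} (h : c p = c q) : wt c p = wt c q := by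
  simp only [wt, cls, h]

lemma edgeWt_comm (p q : P) : edgeWt c p q = edgeWt c q p := by
  unfold edgeWt
  by_cases h : c p = c q
  · rw [if_pos h, if_pos h.symm, wt_congr h]
  · rw [if_neg h, if_neg (Ne.symm h)]

lemma cls_card_mul_wt (p : P) : ((cls c p).card : ℝ) * wt c p = 1 := by
  unfold wt
  rw [mul_one_div, div_self]
  have : p ∈ cls c p := by simp [cls]
  exact_mod_cast (Finset.card_pos.mpr ⟨p, this⟩).ne'

lemma sum_edgeWt (p : P) : ∑ q, edgeWt c p q = 1 := by
  have : ∀ q, edgeWt c p q = if c q = c p then wt c p else 0 := fun q => by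
    unfold edgeWt; simp only [eq_comm]
  simp only [this]
  rw [← Finset.sum_filter, Finset.sum_const, nsmul_eq_mul]
  exact cls_card_mul_wt p

lemma sum_edgeWt_mul (q q' : P) : ∑ p, edgeWt c p q * edgeWt c p q' = edgeWt c q q' := by
  by_cases h : c q = c q'
  · have : ∀ p, edgeWt c p q * edgeWt c p q' = wt c q * edgeWt c q p := fun p => by
      rw [edgeWt_comm q p]
      unfold edgeWt
      by_cases hp : c p = c q
      · rw [if_pos hp, if_pos (hp.trans h), wt_congr hp]
      · rw [if_neg hp]; simp
    simp only [this, ← Finset.mul_sum, sum_edgeWt, mul_one]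
    simp [edgeWt, h]
  · rw [show edgeWt c q q' = 0 by simp [edgeWt, h]]
    refine Finset.sum_eq_zero fun p _ => ?_
    unfold edgeWt
    by_cases hp : c p = c q
    · rw [if_neg (c := c p = c q') (fun e => h (hp.symm.trans e)), mul_zero]
    · rw [if_neg hp, zero_mul]

lemma edgeWt_sq (p q : P) : edgeWt c p q * edgeWt c p q = wt c p * edgeWt c p q := by
  unfold edgeWt; split_ifs <;> simp

/-- Weight of a pair of potential parallel edges. -/
noncomputable def quadWt (c : P → ι) (vtx : P → V) (p q p' q' : P) : ℝ :=
  if vtx p = vtx p' ∧ vtx q = vtx q' then edgeWt c p q * edgeWt c p' q' else 0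

lemma quadWt_nonneg (p q p' q' : P) : 0 ≤ quadWt c vtx p q p' q' := by
  unfold quadWt; split_ifs
  · exact mul_nonneg (edgeWt_nonneg _ _) (edgeWt_nonneg _ _)
  · exact le_rfl

lemma quadWt_swap (p q p' q' : P) : quadWt c vtx p' q' p q = quadWt c vtx p q p' q' := by
  unfold quadWt; simp only [eq_comm, mul_comm]

lemma quadWt_flip (p q p' q' : P) : quadWt c vtx q p q' p' = quadWt c vtx p q p' q' := by
  unfold quadWt; simp only [and_comm, edgeWt_comm q p, edgeWt_comm q' p']

/-- Expected number of ordered pairs inside a fibre that are matched. -/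
noncomputable def diagWt (c : P → ι) (vtx : P → V) : ℝ :=
  ∑ p, ∑ q, if vtx p = vtx q then edgeWt c p q else 0

lemma two_mul_loopMean {o : P → ℕ} (ho : o.Injective) :
    2 * loopMean c vtx o = diagWt c vtx - ∑ p, wt c p := by
  have h1 : loopMean c vtx o = ∑ p, ∑ q, if o p < o q then
      (if vtx p = vtx q then edgeWt c p q else 0) else 0 := by
    unfold loopMean loopEv
    rw [Finset.sum_filter, Fintype.sum_prod_type]
    refine Finset.sum_congr rfl fun p _ => Finset.sum_congr rfl fun q _ => ?_
    unfold edgeWt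
    by_cases a1 : vtx p = vtx q <;> by_cases a2 : c p = c q <;> by_cases a3 : o p < o q <;>
      simp [a1, a2, a3]
  have h2 : loopMean c vtx o = ∑ p, ∑ q, if o q < o p then
      (if vtx p = vtx q then edgeWt c p q else 0) else 0 := by
    rw [h1, Finset.sum_comm]
    refine Finset.sum_congr rfl fun p _ => Finset.sum_congr rfl fun q _ => ?_
    rw [edgeWt_comm q p]
    simp only [eq_comm]
  have h3 : diagWt c vtx = (∑ p, ∑ q, if o p < o q then
      (if vtx p = vtx q then edgeWt c p q else 0) else 0) + (∑ p, ∑ q, if o q < o p then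
      (if vtx p = vtx q then edgeWt c p q else 0) else 0) + ∑ p, wt c p := by
    have h4 : ∑ p, wt c p = ∑ p, ∑ q, if p = q then wt c p else 0 := by simp
    rw [h4]
    simp only [← Finset.sum_add_distrib]
    unfold diagWt
    refine Finset.sum_congr rfl fun p _ => Finset.sum_congr rfl fun q _ => ?_
    rcases lt_trichotomy (o p) (o q) with hlt | heq | hgt
    · have : p ≠ q := fun e => by rw [e] at hlt; exact lt_irrefl _ hlt
      simp [hlt, hlt.not_gt, this]
    · have := ho heq
      subst this
      simp [edgeWt]
    · have : p ≠ q := fun e => by rw [e] at hgt; exact lt_irrefl _ hgt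
      simp [hgt, hgt.not_gt, this]
  rw [h3, ← h1, ← h2]; ring

lemma sum_quadWt_left : ∑ p, ∑ q, ∑ p', ∑ q', (if p = p' then quadWt c vtx p q p' q' else 0) =
    diagWt c vtx := by
  have : ∀ p q : P, (∑ p', ∑ q', (if p = p' then quadWt c vtx p q p' q' else 0)) =
      ∑ q', quadWt c vtx p q p q' := fun p q => by
    rw [Finset.sum_comm]
    simp
  simp only [this]
  rw [Finset.sum_comm]
  unfold diagWt
  refine Finset.sum_congr rfl fun q _ => ?_
  rw [Finset.sum_comm]
  refine Finset.sum_congr rfl fun q' _ => ?_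
  unfold quadWt
  by_cases h : vtx q = vtx q'
  · simp only [h, and_self, if_true]
    exact sum_edgeWt_mul q q'
  · simp [h]

lemma sum_quadWt_right : ∑ p, ∑ q, ∑ p', ∑ q', (if q = q' then quadWt c vtx p q p' q' else 0) =
    diagWt c vtx := by
  rw [← sum_quadWt_left, Finset.sum_comm]
  refine Finset.sum_congr rfl fun p _ => Finset.sum_congr rfl fun q _ => ?_
  rw [Finset.sum_comm]
  refine Finset.sum_congr rfl fun p' _ => Finset.sum_congr rfl fun q' _ => ?_
  rw [quadWt_flip]

lemma sum_quadWt_both : ∑ p, ∑ q, ∑ p', ∑ q',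
    (if p = p' then if q = q' then quadWt c vtx p q p' q' else 0 else 0) = ∑ p, wt c p := by
  have : ∀ p q : P, (∑ p', ∑ q', (if p = p' then if q = q' then quadWt c vtx p q p' q' else 0
      else 0)) = wt c p * edgeWt c p q := fun p q => by
    rw [Finset.sum_eq_single p]
    · simp [quadWt, edgeWt_sq]
    · intro b _ hb
      simp [hb.symm]
    · simp
  simp only [this, ← Finset.mul_sum, sum_edgeWt, mul_one]

lemma sum_quadWt [Fintype V] : ∑ p, ∑ q, ∑ p', ∑ q', quadWt c vtx p q p' q' =
    ∑ u, ∑ v, fibWt c vtx u v ^ 2 := by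
  have h1 : ∀ u v, fibWt c vtx u v = ∑ p, ∑ q,
      if vtx p = u then if vtx q = v then edgeWt c p q else 0 else 0 := fun u v => by
    unfold fibWt fib
    rw [Finset.sum_filter]
    refine Finset.sum_congr rfl fun p _ => ?_
    by_cases h : vtx p = u
    · simp [h, Finset.sum_filter]
    · simp [h]
  have h2 : ∀ u v, fibWt c vtx u v ^ 2 = ∑ p, ∑ q, ∑ p', ∑ q',
      if vtx p = u then if vtx q = v then quadWt c vtx p q p' q' else 0 else 0 := fun u v => by
    rw [sq, h1, Finset.sum_mul]
    refine Finset.sum_congr rfl fun p _ => ?_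
    rw [Finset.sum_mul]
    refine Finset.sum_congr rfl fun q _ => ?_
    rw [Finset.mul_sum]
    refine Finset.sum_congr rfl fun p' _ => ?_
    rw [Finset.mul_sum]
    refine Finset.sum_congr rfl fun q' _ => ?_
    unfold quadWt
    by_cases a1 : vtx p = u
    · by_cases a2 : vtx q = v
      · subst a1 a2
        by_cases a3 : vtx p = vtx p' <;> by_cases a4 : vtx q = vtx q' <;>
          simp [a3, a4, eq_comm]
      · simp [a2]
    · simp [a1]
  simp only [h2]
  have h3 : ∀ (f : V → V → P → P → P → P → ℝ), ∑ u, ∑ v, ∑ p, ∑ q, ∑ p', ∑ q', f u v p q p' q' =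
      ∑ p, ∑ q, ∑ p', ∑ q', ∑ u, ∑ v, f u v p q p' q' := fun f => by
    have hc : ∀ g : V → V → P → ℝ, ∑ u, ∑ v, ∑ p, g u v p = ∑ p, ∑ u, ∑ v, g u v p := fun g => by
      rw [Finset.sum_comm]
      rw [Finset.sum_congr rfl fun u _ => Finset.sum_comm, Finset.sum_comm]
      exact Finset.sum_congr rfl fun p _ => Finset.sum_comm
    rw [hc]
    refine Finset.sum_congr rfl fun p _ => ?_
    rw [hc]
    refine Finset.sum_congr rfl fun q _ => ?_
    rw [hc]
    refine Finset.sum_congr rfl fun p' _ => ?_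
    rw [hc]
  rw [h3]
  refine Finset.sum_congr rfl fun p _ => Finset.sum_congr rfl fun q _ =>
    Finset.sum_congr rfl fun p' _ => Finset.sum_congr rfl fun q' _ => ?_
  simp

lemma four_mul_doubleMean {o : P → ℕ} (ho : o.Injective) {ov : V → ℕ} (hov : ov.Injective) :
    4 * doubleMean c vtx o ov = ∑ p, ∑ q, ∑ p', ∑ q', if p ≠ p' ∧ q ≠ q' ∧ vtx p ≠ vtx q then
      quadWt c vtx p q p' q' else 0 := by
  have h1 : doubleMean c vtx o ov = ∑ p, ∑ q, ∑ p', ∑ q',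
      if ov (vtx p) < ov (vtx q) ∧ o p < o p' ∧ q ≠ q' then quadWt c vtx p q p' q' else 0 := by
    unfold doubleMean doubleEv
    rw [Finset.sum_filter, Fintype.sum_prod_type]
    refine Finset.sum_congr rfl fun p _ => ?_
    rw [Fintype.sum_prod_type]
    refine Finset.sum_congr rfl fun q _ => ?_
    rw [Fintype.sum_prod_type]
    refine Finset.sum_congr rfl fun p' _ => Finset.sum_congr rfl fun q' _ => ?_
    unfold quadWt edgeWt
    by_cases a1 : c p = c q
    · by_cases a2 : c p' = c q'
      · simp only [a1, a2, if_true, true_and]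
        rw [← ite_and]
        exact if_congr (by tauto) rfl rfl
      · simp [a2]
    · simp [a1]
  have h2 : doubleMean c vtx o ov = ∑ p, ∑ q, ∑ p', ∑ q',
      if ov (vtx p) < ov (vtx q) ∧ o p' < o p ∧ q ≠ q' then quadWt c vtx p q p' q' else 0 := by
    have hs : ∀ f : P → P → P → P → ℝ, ∑ p, ∑ q, ∑ p', ∑ q', f p q p' q' =
        ∑ p, ∑ q, ∑ p', ∑ q', f p' q' p q := fun f => by
      have e : ∀ f : P → P → P → P → ℝ, ∑ p, ∑ q, ∑ p', ∑ q', f p q p' q' =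
          ∑ x : P × P, ∑ y : P × P, f x.1 x.2 y.1 y.2 := fun f => by
        simp only [Fintype.sum_prod_type]
      rw [e, e, Finset.sum_comm]
    rw [h1, hs]
    refine Finset.sum_congr rfl fun p _ => Finset.sum_congr rfl fun q _ =>
      Finset.sum_congr rfl fun p' _ => Finset.sum_congr rfl fun q' _ => ?_
    rw [quadWt_swap]
    by_cases a1 : vtx p = vtx p' ∧ vtx q = vtx q'
    · rw [a1.1, a1.2]; simp only [ne_comm]
    · simp [quadWt, a1]
  have h3 : 2 * doubleMean c vtx o ov = ∑ p, ∑ q, ∑ p', ∑ q',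
      if ov (vtx p) < ov (vtx q) ∧ p ≠ p' ∧ q ≠ q' then quadWt c vtx p q p' q' else 0 := by
    rw [two_mul]
    nth_rw 1 [h1]
    rw [h2]
    simp only [← Finset.sum_add_distrib]
    refine Finset.sum_congr rfl fun p _ => Finset.sum_congr rfl fun q _ =>
      Finset.sum_congr rfl fun p' _ => Finset.sum_congr rfl fun q' _ => ?_
    rcases lt_trichotomy (o p) (o p') with hlt | heq | hgt
    · have : p ≠ p' := fun e => by rw [e] at hlt; exact lt_irrefl _ hlt
      simp [hlt, hlt.not_gt, this]
    · have := ho heq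
      subst this
      simp
    · have : p ≠ p' := fun e => by rw [e] at hgt; exact lt_irrefl _ hgt
      simp [hgt, hgt.not_gt, this]
  have h4 : 2 * doubleMean c vtx o ov = ∑ p, ∑ q, ∑ p', ∑ q',
      if ov (vtx q) < ov (vtx p) ∧ p ≠ p' ∧ q ≠ q' then quadWt c vtx p q p' q' else 0 := by
    rw [h3, Finset.sum_comm]
    refine Finset.sum_congr rfl fun p _ => Finset.sum_congr rfl fun q _ => ?_
    rw [Finset.sum_comm]
    refine Finset.sum_congr rfl fun p' _ => Finset.sum_congr rfl fun q' _ => ?_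
    rw [quadWt_flip]
    simp only [and_comm (a := q ≠ q')]
  rw [show (4 : ℝ) * doubleMean c vtx o ov = 2 * doubleMean c vtx o ov + 2 * doubleMean c vtx o ov
    by ring]
  nth_rw 1 [h3]
  rw [h4]
  simp only [← Finset.sum_add_distrib]
  refine Finset.sum_congr rfl fun p _ => Finset.sum_congr rfl fun q _ =>
    Finset.sum_congr rfl fun p' _ => Finset.sum_congr rfl fun q' _ => ?_
  rcases lt_trichotomy (ov (vtx p)) (ov (vtx q)) with hlt | heq | hgt
  · have : vtx p ≠ vtx q := fun e => by rw [e] at hlt; exact lt_irrefl _ hlt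
    simp [hlt, hlt.not_gt, this]
  · have := hov heq
    simp [this]
  · have : vtx p ≠ vtx q := fun e => by rw [e] at hgt; exact lt_irrefl _ hgt
    simp [hgt, hgt.not_gt, this]

lemma SwitchData.edgeWt_le (h : SwitchData c vtx d M δ) (p q : P) : edgeWt c p q ≤ 1 / M := by
  unfold edgeWt; split_ifs
  · exact h.wt_le p
  · exact div_nonneg zero_le_one h.hM.le

lemma SwitchData.sum_fib_le (h : SwitchData c vtx d M δ) (f : P → ℝ) {C : ℝ} (hC : 0 ≤ C)
    (p : P) (hf : ∀ q, f q ≤ C) : (∑ q, if vtx p = vtx q then f q else 0) ≤ d * C := by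
  rw [← Finset.sum_filter]
  calc _ ≤ ∑ q ∈ Finset.univ.filter (fun q => vtx p = vtx q), C :=
        Finset.sum_le_sum fun q _ => hf q
    _ = (Finset.univ.filter (fun q => vtx p = vtx q)).card * C := by simp
    _ ≤ _ := by
      refine mul_le_mul_of_nonneg_right ?_ hC
      have := h.hd (vtx p)
      unfold fib at this
      simp only [eq_comm (a := vtx p)]
      exact_mod_cast this

lemma SwitchData.sum_quadWt_le (h : SwitchData c vtx d M δ) :
    ∑ p, ∑ q, ∑ p', ∑ q', quadWt c vtx p q p' q' ≤ Fintype.card P * d ^ 2 / M := by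
  have hM := h.hM
  have h1 : ∀ p q : P, ∑ p', ∑ q', quadWt c vtx p q p' q' ≤ edgeWt c p q * (d * (d * (1 / M))) := by
    intro p q
    have : ∀ p', (∑ q', quadWt c vtx p q p' q') ≤
        if vtx p = vtx p' then edgeWt c p q * (d * (1 / M)) else 0 := fun p' => by
      by_cases hp : vtx p = vtx p'
      · have := h.sum_fib_le (fun q' => edgeWt c p' q') (C := 1 / M) (by positivity) q
          (fun q' => h.edgeWt_le p' q')
        rw [if_pos hp]
        refine le_trans (le_of_eq ?_) (mul_le_mul_of_nonneg_left this (edgeWt_nonneg p q))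
        rw [Finset.mul_sum]
        simp [quadWt, hp]
      · simp [quadWt, hp]
    refine (Finset.sum_le_sum fun p' _ => this p').trans ?_
    have h2 := h.sum_fib_le (fun _ => edgeWt c p q * (d * (1 / M)))
      (C := edgeWt c p q * (d * (1 / M))) (mul_nonneg (edgeWt_nonneg p q) (by positivity)) p
      (fun _ => le_rfl)
    refine h2.trans (le_of_eq ?_); ring
  calc _ ≤ ∑ p : P, ∑ q, edgeWt c p q * (d * (d * (1 / M))) :=
        Finset.sum_le_sum fun p _ => Finset.sum_le_sum fun q _ => h1 p q
    _ = _ := by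
      simp only [← Finset.sum_mul, sum_edgeWt]
      simp; ring

lemma SwitchData.sum_quadWt_diag_le (h : SwitchData c vtx d M δ) :
    ∑ p, ∑ q, ∑ p', ∑ q', (if vtx p = vtx q then quadWt c vtx p q p' q' else 0) ≤
      Fintype.card P * d ^ 3 / M ^ 2 := by
  have hM := h.hM
  have h1 : ∀ p q : P, ∑ p', ∑ q', quadWt c vtx p q p' q' ≤ d * (d * (1 / M * (1 / M))) := by
    intro p q
    have : ∀ p', (∑ q', quadWt c vtx p q p' q') ≤
        if vtx p = vtx p' then (d * (1 / M * (1 / M))) else 0 := fun p' => by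
      by_cases hp : vtx p = vtx p'
      · have := h.sum_fib_le (fun q' => edgeWt c p q * edgeWt c p' q') (C := 1 / M * (1 / M))
          (by positivity) q (fun q' => mul_le_mul (h.edgeWt_le p q) (h.edgeWt_le p' q')
          (edgeWt_nonneg _ _) (by positivity))
        rw [if_pos hp]
        refine le_trans (le_of_eq ?_) this
        simp [quadWt, hp]
      · simp [quadWt, hp]
    refine (Finset.sum_le_sum fun p' _ => this p').trans ?_
    exact h.sum_fib_le (fun _ => (d * (1 / M * (1 / M)))) (by positivity) p (fun _ => le_rfl)
  have h2 : ∀ p : P, (∑ q, ∑ p', ∑ q', (if vtx p = vtx q then quadWt c vtx p q p' q' else 0)) ≤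
      d * (d * (d * (1 / M * (1 / M)))) := fun p => by
    refine le_trans (Finset.sum_le_sum fun q _ => ?_) (h.sum_fib_le
      (fun _ => d * (d * (1 / M * (1 / M)))) (by positivity) p (fun _ => le_rfl))
    by_cases hp : vtx p = vtx q
    · simpa [hp] using h1 p q
    · simp [hp]
  calc _ ≤ ∑ p : P, (d * (d * (d * (1 / M * (1 / M)))) : ℝ) := Finset.sum_le_sum fun p _ => h2 p
    _ = _ := by
      simp; field_simp

/-- Number of simple pairings, up to a factor close to one. -/
lemma simple_pairings_bounds [Fintype V] (h : SwitchData c vtx d M δ) (hδ4 : 4 * δ ≤ 1) :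
    let K := ∑ u, ∑ v, fibWt c vtx u v ^ 2
    let η := 2 * δ * (Fintype.card P * d ^ 2 / M) + Fintype.card P * d ^ 3 / M ^ 2
    let N : ℝ := (Finset.univ.filter (IsPairing c)).card
    let Ns : ℝ := (Finset.univ.filter fun π => IsPairing c π ∧ IsSimplePairing vtx π).card
    N * Real.exp (-((K - ∑ p, wt c p) / 4 + η)) ≤ Ns ∧
      Ns ≤ N * Real.exp (-((K - ∑ p, wt c p) / 4 - η)) := by
  intro K η N Ns
  set o : P → ℕ := fun p => (Fintype.equivFin P p : ℕ)
  have ho : o.Injective := fun p q e => (Fintype.equivFin P).injective (Fin.ext e)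
  set ov : V → ℕ := fun p => (Fintype.equivFin V p : ℕ)
  have hov : ov.Injective := fun p q e => (Fintype.equivFin V).injective (Fin.ext e)
  have hmain := simple_pairings_bounds_mean h hδ4 ho hov
  have hL := two_mul_loopMean (c := c) (vtx := vtx) ho
  have hD := four_mul_doubleMean (c := c) (vtx := vtx) ho hov
  have hδ0 := h.δ_pos
  have hK : K = ∑ p, ∑ q, ∑ p', ∑ q', quadWt c vtx p q p' q' := sum_quadWt.symm
  have hK0 : 0 ≤ K := Finset.sum_nonneg fun _ _ => Finset.sum_nonneg fun _ _ => sq_nonneg _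
  have hKle : K ≤ Fintype.card P * d ^ 2 / M := hK ▸ h.sum_quadWt_le
  have hwt : 0 ≤ ∑ p, wt c p := Finset.sum_nonneg fun p _ => wt_nonneg p
  have hE := h.sum_quadWt_diag_le
  have hup : 4 * doubleMean c vtx o ov ≤ K - 2 * diagWt c vtx + ∑ p, wt c p := by
    rw [hD, two_mul, ← sum_quadWt_both (c := c) (vtx := vtx)]
    nth_rw 1 [← sum_quadWt_left]
    rw [← sum_quadWt_right, hK]
    simp only [← Finset.sum_add_distrib, ← Finset.sum_sub_distrib]
    refine Finset.sum_le_sum fun p _ => Finset.sum_le_sum fun q _ =>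
      Finset.sum_le_sum fun p' _ => Finset.sum_le_sum fun q' _ => ?_
    have := quadWt_nonneg (c := c) (vtx := vtx) p q p' q'
    split_ifs <;> first | linarith | (exfalso; tauto)
  have hlow : K - 2 * diagWt c vtx + ∑ p, wt c p - Fintype.card P * d ^ 3 / M ^ 2 ≤
      4 * doubleMean c vtx o ov := by
    refine le_trans (sub_le_sub_left hE _) ?_
    rw [hD, two_mul, ← sum_quadWt_both (c := c) (vtx := vtx)]
    nth_rw 1 [← sum_quadWt_left]
    rw [← sum_quadWt_right, hK]
    simp only [← Finset.sum_add_distrib, ← Finset.sum_sub_distrib]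
    refine Finset.sum_le_sum fun p _ => Finset.sum_le_sum fun q _ =>
      Finset.sum_le_sum fun p' _ => Finset.sum_le_sum fun q' _ => ?_
    have := quadWt_nonneg (c := c) (vtx := vtx) p q p' q'
    split_ifs <;> first | linarith | (exfalso; tauto)
  set Λ := loopMean c vtx o + doubleMean c vtx o ov with hΛ
  have hΛ1 : Λ ≤ (K - ∑ p, wt c p) / 4 := by linarith
  have hΛ2 : (K - ∑ p, wt c p) / 4 - Fintype.card P * d ^ 3 / M ^ 2 ≤ Λ := by
    have : (0:ℝ) ≤ Fintype.card P * d ^ 3 / M ^ 2 := by positivity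
    linarith
  have hΛ3 : 8 * δ * Λ ≤ 2 * δ * (Fintype.card P * d ^ 2 / M) := by nlinarith
  constructor
  · refine le_trans ?_ hmain.1
    refine mul_le_mul_of_nonneg_left (Real.exp_le_exp.mpr ?_) (Nat.cast_nonneg _)
    have : (0:ℝ) ≤ Fintype.card P * d ^ 3 / M ^ 2 := by positivity
    simp only [η]
    linarith
  · refine hmain.2.trans ?_
    refine mul_le_mul_of_nonneg_left (Real.exp_le_exp.mpr ?_) (Nat.cast_nonneg _)
    simp only [η]
    linarith

end
end RegSum

namespace RegSum

/-- Number of perfect matchings of a set with `m` elements. -/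
def pf : ℕ → ℕ
  | 0 => 1
  | 1 => 0
  | (m + 2) => (m + 1) * pf m

lemma pf_two_mul (k : ℕ) : pf (2 * k) * (2 ^ k * k.factorial) = (2 * k).factorial := by
  induction k with
  | zero => simp [pf]
  | succ k ih =>
    have e : (2 * k + 2).factorial = (2 * k + 2) * ((2 * k + 1) * (2 * k).factorial) := by
      rw [Nat.factorial_succ, Nat.factorial_succ]
    rw [show 2 * (k + 1) = 2 * k + 2 by ring, e, pf, Nat.factorial_succ k, ← ih]
    ring

lemma pf_pos_of_even {m : ℕ} (h : Even m) : 0 < pf m := by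
  obtain ⟨k, rfl⟩ := h
  rw [← two_mul]
  have := pf_two_mul k
  have h2 := Nat.factorial_pos (2 * k)
  exact Nat.pos_of_ne_zero fun h0 => by rw [h0, zero_mul] at this; omega

lemma pf_of_odd {m : ℕ} (h : Odd m) : pf m = 0 := by
  obtain ⟨k, rfl⟩ := h
  induction k with
  | zero => rfl
  | succ k ih => rw [show 2 * (k + 1) + 1 = (2 * k + 1) + 2 by ring, pf, ih, mul_zero]

/-- Second moment ratio for pairings, as a function of the overlap. -/
noncomputable def ovr (N B T : ℕ) : ℝ :=
  pf T * pf (N - T) ^ 2 * pf (B + T - N) * pf (N + B) / (pf N * pf B) ^ 2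

lemma ovr_nonneg (N B T : ℕ) : 0 ≤ ovr N B T := by unfold ovr; positivity

lemma ovr_of_odd {N B T : ℕ} (h : Odd T) : ovr N B T = 0 := by
  unfold ovr; rw [pf_of_odd h]; simp

lemma ovr_step {N B T : ℕ} (hNB : N ≤ B) (hT : T + 2 ≤ N) :
    ovr N B (T + 2) * ((N : ℝ) - (T + 1)) ^ 2 = ovr N B T * ((T + 1) * ((B : ℝ) - N + (T + 1))) := by
  obtain ⟨m, rfl⟩ := Nat.exists_eq_add_of_le hT
  obtain ⟨l, rfl⟩ := Nat.exists_eq_add_of_le hNB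
  unfold ovr
  rw [show T + 2 + m - (T + 2) = m by omega, show T + 2 + m - T = m + 2 by omega,
    show T + 2 + m + l + (T + 2) - (T + 2 + m) = (l + T) + 2 by omega,
    show T + 2 + m + l + T - (T + 2 + m) = l + T by omega]
  have e1 : pf (T + 2) = (T + 1) * pf T := rfl
  have e2 : pf (m + 2) = (m + 1) * pf m := rfl
  have e3 : pf (l + T + 2) = (l + T + 1) * pf (l + T) := rfl
  rw [e1, e2, e3]
  push_cast
  ring

/-- Hypergeometric weights. -/
noncomputable def hyp (N B T : ℕ) : ℝ := (N.choose T : ℝ) * B.choose (N - T) / (N + B).choose N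

lemma hyp_nonneg (N B T : ℕ) : 0 ≤ hyp N B T := by unfold hyp; positivity

lemma sum_choose_mul (N B : ℕ) :
    ∑ T ∈ Finset.range (N + 1), N.choose T * B.choose (N - T) = (N + B).choose N := by
  rw [Nat.add_choose_eq, Finset.Nat.sum_antidiagonal_eq_sum_range_succ_mk]

lemma sum_hyp (N B : ℕ) : ∑ T ∈ Finset.range (N + 1), hyp N B T = 1 := by
  unfold hyp
  rw [← Finset.sum_div]
  have := sum_choose_mul N B
  rw [div_eq_one_iff_eq]
  · exact_mod_cast this
  · exact_mod_cast (Nat.choose_pos (Nat.le_add_right N B)).ne'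

lemma hyp_mul_ovr {p q k : ℕ} (hpq : p ≤ q) (hk : k ≤ p) :
    hyp (2 * p) (2 * q) (2 * k) * ovr (2 * p) (2 * q) (2 * k) = hyp p q k := by
  obtain ⟨i, rfl⟩ := Nat.exists_eq_add_of_le hk
  obtain ⟨l, rfl⟩ := Nat.exists_eq_add_of_le hpq
  unfold hyp ovr
  rw [show 2 * (k + i) - 2 * k = 2 * i by omega, show k + i - k = i by omega,
    show 2 * (k + i + l) + 2 * k - 2 * (k + i) = 2 * (l + k) by omega,
    show 2 * (k + i) + 2 * (k + i + l) = 2 * (k + i + (k + i + l)) by ring]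
  rw [Nat.cast_choose ℝ (show 2 * k ≤ 2 * (k + i) by omega),
    Nat.cast_choose ℝ (show 2 * i ≤ 2 * (k + i + l) by omega),
    Nat.cast_choose ℝ (show 2 * (k + i) ≤ 2 * (k + i + (k + i + l)) by omega),
    Nat.cast_choose ℝ (show k ≤ k + i by omega),
    Nat.cast_choose ℝ (show i ≤ k + i + l by omega),
    Nat.cast_choose ℝ (show k + i ≤ k + i + (k + i + l) by omega)]
  rw [show 2 * (k + i) - 2 * k = 2 * i by omega, show k + i - k = i by omega,
    show 2 * (k + i + l) - 2 * i = 2 * (l + k) by omega, show k + i + l - i = l + k by omega,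
    show 2 * (k + i + (k + i + l)) - 2 * (k + i) = 2 * (k + i + l) by omega,
    show k + i + (k + i + l) - (k + i) = k + i + l by omega]
  have key : ∀ m : ℕ, ((2 * m).factorial : ℝ) = pf (2 * m) * (2 ^ m * m.factorial) := fun m => by
    exact_mod_cast (pf_two_mul m).symm
  have hp : ∀ m : ℕ, (pf (2 * m) : ℝ) ≠ 0 := fun m => by
    exact_mod_cast (pf_pos_of_even (even_two_mul m)).ne'
  have hf : ∀ m : ℕ, (m.factorial : ℝ) ≠ 0 := fun m => by exact_mod_cast m.factorial_ne_zero
  simp only [key]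
  have := hp k; have := hp i; have := hp (k + i); have := hp (l + k); have := hp (k + i + l)
  have := hp (k + i + (k + i + l))
  have := hf k; have := hf i; have := hf (k + i); have := hf (l + k); have := hf (k + i + l)
  have := hf (k + i + (k + i + l))
  field_simp
  ring

lemma sum_even_eq {f : ℕ → ℝ} (hf : ∀ T, Odd T → f T = 0) (p : ℕ) :
    ∑ T ∈ Finset.range (2 * p + 1), f T = ∑ k ∈ Finset.range (p + 1), f (2 * k) := by
  induction p with
  | zero => simp
  | succ p ih =>
    rw [show 2 * (p + 1) + 1 = (2 * p + 1) + 1 + 1 by ring, Finset.sum_range_succ,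
      Finset.sum_range_succ, ih, Finset.sum_range_succ _ (p + 1), hf (2 * p + 1) ⟨p, rfl⟩]
    rw [show 2 * (p + 1) = 2 * p + 1 + 1 by ring]; ring

lemma sum_hyp_mul_ovr {N B : ℕ} (hN : Even N) (hB : Even B) (hNB : N ≤ B) :
    ∑ T ∈ Finset.range (N + 1), hyp N B T * ovr N B T = 1 := by
  obtain ⟨p, rfl⟩ := hN
  obtain ⟨q, rfl⟩ := hB
  rw [← two_mul, ← two_mul]
  rw [sum_even_eq (fun T hT => by rw [ovr_of_odd hT, mul_zero]), ← sum_hyp p q]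
  refine Finset.sum_congr rfl fun k hk => ?_
  rw [Finset.mem_range] at hk
  exact hyp_mul_ovr (by omega) (by omega)

lemma hyp_step {N B T : ℕ} (hNB : N ≤ B) (hT : T + 1 ≤ N) :
    hyp N B (T + 1) * ((T + 1) * ((B : ℝ) - N + (T + 1))) = hyp N B T * ((N : ℝ) - T) ^ 2 := by
  obtain ⟨m, rfl⟩ := Nat.exists_eq_add_of_le hT
  obtain ⟨l, rfl⟩ := Nat.exists_eq_add_of_le hNB
  unfold hyp
  rw [show T + 1 + m - (T + 1) = m by omega, show T + 1 + m - T = m + 1 by omega]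
  have e1 := Nat.choose_succ_right_eq (T + 1 + m) T
  have e2 := Nat.choose_succ_right_eq (T + 1 + m + l) m
  rw [show T + 1 + m - T = m + 1 by omega] at e1
  rw [show T + 1 + m + l - m = T + 1 + l by omega] at e2
  have e1' : ((T + 1 + m).choose (T + 1) : ℝ) * (T + 1) = (T + 1 + m).choose T * (m + 1) := by
    exact_mod_cast e1
  have e2' : ((T + 1 + m + l).choose (m + 1) : ℝ) * (m + 1) =
      (T + 1 + m + l).choose m * (T + 1 + l) := by
    exact_mod_cast e2
  push_cast
  rw [div_mul_eq_mul_div, div_mul_eq_mul_div]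
  congr 1
  linear_combination ((T + 1 + m + l).choose m * (T + 1 + l) : ℝ) * e1' -
    ((T + 1 + m).choose T * (m + 1) : ℝ) * e2'

end RegSum

namespace RegSum

/-- Likelihood parameter matching overlap `T`. -/
noncomputable def tilt (N B T : ℝ) : ℝ := T * B / (N * (N - T))

/-- Growth ratio of `ovr` over two steps centred at `τ`. -/
noncomputable def growth (N B τ : ℝ) : ℝ := τ * (B - N + τ) / (N - τ) ^ 2

lemma growth_eq {N B τ : ℝ} (hN : 0 < N) (hB : 0 < B) (hτ : τ < N) :
    growth N B τ = tilt N B τ * (1 + N / B * (tilt N B τ - 1)) := by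
  have : N - τ ≠ 0 := by linarith
  unfold growth tilt
  field_simp
  ring

lemma tilt_sub_one {N B τ : ℝ} (hN : 0 < N) (hB : 0 < B) (hτ : τ < N) :
    tilt N B τ - 1 = (N + B) * (τ - N ^ 2 / (N + B)) / (N * (N - τ)) := by
  have : N - τ ≠ 0 := by linarith
  have : N + B ≠ 0 := by linarith
  unfold tilt
  field_simp
  ring

lemma growth_le_tilt {N B T : ℝ} (hN : 100 ≤ N) (hB : 8 * N ≤ B)
    (hT : N ^ 2 / (N + B) + 14 ≤ T) (hTN : T + 2 ≤ N) :
    5 * growth N B (T + 1) ≤ 1 + 4 * tilt N B T ^ 2 := by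
  have hNB : 0 < N + B := by linarith
  have hT0 : 0 < N ^ 2 / (N + B) := by positivity
  have hT0' : N ^ 2 / (N + B) ≤ N / 9 := by
    rw [div_le_iff₀ hNB]; nlinarith
  have hm : 0 < N - T := by linarith
  have hm1 : 0 < N - (T + 1) := by linarith
  have hN0 : 0 < N := by linarith
  have hB0 : 0 < B := by linarith
  have e1 := tilt_sub_one (τ := T + 1) hN0 hB0 (by linarith)
  rw [growth_eq hN0 hB0 (by linarith)]
  have eX : tilt N B (T + 1) = (T + 1) * B / (N * (N - (T + 1))) := rfl
  set X := tilt N B (T + 1) with hX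
  have ex : tilt N B T = X * (T / (T + 1) * ((N - T - 1) / (N - T))) := by
    rw [hX]; unfold tilt
    have : T + 1 ≠ 0 := by linarith
    field_simp
    ring
  have hX1 : 1 ≤ X := by
    have : 0 ≤ X - 1 := by
      rw [e1]; refine div_nonneg (mul_nonneg hNB.le (by linarith)) (by positivity)
    linarith
  have hγ : N / B ≤ 1 / 8 := by rw [div_le_iff₀ hB0]; linarith
  have h1 : X * (1 + N / B * (X - 1)) ≤ X * (1 + 1 / 8 * (X - 1)) := by
    have := mul_le_mul_of_nonneg_right hγ (by linarith : (0:ℝ) ≤ X - 1)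
    exact mul_le_mul_of_nonneg_left (by linarith) (by linarith)
  refine (mul_le_mul_of_nonneg_left h1 (by norm_num)).trans ?_
  rw [ex]
  by_cases hsm : N - T ≤ 6
  · -- near the right end
    have hρ : 49 / 100 ≤ T / (T + 1) * ((N - T - 1) / (N - T)) := by
      have a1 : (98:ℝ) / 100 ≤ T / (T + 1) := by rw [le_div_iff₀ (by linarith)]; linarith
      have a2 : (1:ℝ) / 2 ≤ (N - T - 1) / (N - T) := by rw [le_div_iff₀ hm]; linarith
      calc (49:ℝ) / 100 = 98 / 100 * (1 / 2) := by norm_num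
        _ ≤ _ := mul_le_mul a1 a2 (by norm_num) (by positivity)
    have hXb : 100 ≤ X := by
      rw [eX, le_div_iff₀ (by positivity)]
      have : 100 * (N * (N - (T + 1))) ≤ 100 * (N * 5) := by
        have : N - (T + 1) ≤ 5 := by linarith
        have := mul_le_mul_of_nonneg_left this hN0.le
        linarith
      nlinarith
    have h2 : X * (49 / 100) ≤ X * (T / (T + 1) * ((N - T - 1) / (N - T))) :=
      mul_le_mul_of_nonneg_left hρ (by linarith)
    have h3 := pow_le_pow_left₀ (by positivity) h2 2
    nlinarith
  · push Not at hsm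
    set ε := 1 / (T + 1) + 1 / (N - T) with hε
    have hρ : 1 - ε ≤ T / (T + 1) * ((N - T - 1) / (N - T)) := by
      have a1 : T / (T + 1) = 1 - 1 / (T + 1) := by
        rw [eq_sub_iff_add_eq, ← add_div, div_self (by linarith)]
      have a2 : (N - T - 1) / (N - T) = 1 - 1 / (N - T) := by
        rw [eq_sub_iff_add_eq, ← add_div, div_eq_one_iff_eq hm.ne']; ring
      rw [a1, a2, hε]
      have : 0 ≤ 1 / (T + 1) * (1 / (N - T)) := by
        have : 0 < T + 1 := by linarith
        positivity
      nlinarith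
    have hε1 : ε ≤ 1 := by
      have a1 : 1 / (T + 1) ≤ 1 / 2 := by
        apply one_div_le_one_div_of_le <;> linarith
      have a2 : 1 / (N - T) ≤ 1 / 2 := by
        apply one_div_le_one_div_of_le <;> linarith
      linarith
    have hXε : X * ε = (B * (N + 1)) / (N * (N - (T + 1)) * (N - T)) := by
      rw [eX, hε]
      have : T + 1 ≠ 0 := by linarith
      field_simp
      ring
    have key : 8 * (X * ε) ≤ 2.375 * (X - 1) := by
      rw [hXε, e1]
      have : 8 * (N + 1) ≤ 2.375 * (T + 1 - N ^ 2 / (N + B)) * (N - T) := by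
        set t0 := N ^ 2 / (N + B)
        by_cases hc : N / 4 ≤ N - T
        · have : 2.375 * 15 * (N / 4) ≤ 2.375 * (T + 1 - t0) * (N - T) := by
            apply mul_le_mul _ hc (by positivity) (by linarith)
            linarith
          linarith
        · push Not at hc
          have : 2.375 * (0.6 * N) * 6 ≤ 2.375 * (T + 1 - t0) * (N - T) := by
            apply mul_le_mul _ hsm.le (by positivity) (by linarith)
            linarith
          linarith
      rw [← mul_div_assoc, ← mul_div_assoc, div_le_div_iff₀ (by positivity) (by positivity)]
      have h3 : 8 * (B * (N + 1)) ≤ 2.375 * ((N + B) * (T + 1 - N ^ 2 / (N + B))) * (N - T) := by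
        have h4 : 0 ≤ 2.375 * (T + 1 - N ^ 2 / (N + B)) * (N - T) := by linarith
        nlinarith
      have h5 : 0 ≤ N * (N - (T + 1)) := by positivity
      have := mul_le_mul_of_nonneg_right h3 h5
      linarith
    have h2 : X * (1 - ε) ≤ X * (T / (T + 1) * ((N - T - 1) / (N - T))) :=
      mul_le_mul_of_nonneg_left hρ (by linarith)
    have h3 := pow_le_pow_left₀ (mul_nonneg (by linarith) (by linarith)) h2 2
    have h4 : 0 ≤ X * ε := by
      have : 0 ≤ 2.375 * (X - 1) := by linarith
      rw [hXε]; positivity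
    nlinarith [mul_nonneg h4 h4]

set_option maxHeartbeats 1000000 in
lemma tilt_le_growth {N B T : ℝ} (hN : 100 ≤ N) (hB : 8 * N ≤ B)
    (hT : T + 14 ≤ N ^ 2 / (N + B)) (hT2 : 2 ≤ T) :
    5 * tilt N B T ^ 2 ≤ (tilt N B T ^ 2 + 4) * growth N B (T - 1) := by
  have hNB : 0 < N + B := by linarith
  have hT0' : N ^ 2 / (N + B) ≤ N / 9 := by
    rw [div_le_iff₀ hNB]; nlinarith
  have hm : 0 < N - T := by linarith
  have hm1 : 0 < N - (T - 1) := by linarith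
  have hN0 : 0 < N := by linarith
  have hB0 : 0 < B := by linarith
  have hT1 : 0 < T - 1 := by linarith
  have e1 := tilt_sub_one (τ := T - 1) hN0 hB0 (by linarith)
  rw [growth_eq hN0 hB0 (by linarith)]
  have eX : tilt N B (T - 1) = (T - 1) * B / (N * (N - (T - 1))) := rfl
  set X := tilt N B (T - 1) with hX
  have hX0 : 0 < X := by rw [eX]; positivity
  set ε := 1 / (T - 1) + 1 / (N - T) + 1 / (T - 1) * (1 / (N - T)) with hε
  have hε0 : 0 < ε := by positivity
  have ex : tilt N B T = X * (1 + ε) := by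
    rw [hX, hε]; unfold tilt
    field_simp
    ring
  have hX1 : X ≤ 1 := by
    have : X - 1 ≤ 0 := by
      rw [e1]
      refine div_nonpos_of_nonpos_of_nonneg (mul_nonpos_of_nonneg_of_nonpos hNB.le (by linarith))
        (by positivity)
    linarith
  have hγ : N / B ≤ 1 / 8 := by rw [div_le_iff₀ hB0]; linarith
  have h1 : X * (1 + 1 / 8 * (X - 1)) ≤ X * (1 + N / B * (X - 1)) := by
    have := mul_le_mul_of_nonpos_right hγ (by linarith : X - 1 ≤ (0:ℝ))
    exact mul_le_mul_of_nonneg_left (by linarith) (by linarith)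
  have hε2 : ε ≤ 2 := by
    have a1 : 1 / (T - 1) ≤ 1 := by rw [div_le_one hT1]; linarith
    have a2 : 1 / (N - T) ≤ 1 / 2 := by
      apply one_div_le_one_div_of_le <;> linarith
    have := mul_le_mul a1 a2 (by positivity) (by norm_num)
    linarith
  have hXε : X * ε = (B * N) / (N * (N - (T - 1)) * (N - T)) := by
    rw [eX, hε]
    field_simp
    ring
  have key : 20 * (X * ε) ≤ 2.375 * (1 - X) := by
    have e2 : 1 - X = (N + B) * (N ^ 2 / (N + B) - (T - 1)) / (N * (N - (T - 1))) := by
      rw [← neg_sub, e1, ← neg_div]; congr 1; ring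
    rw [hXε, e2]
    have : 20 * N ≤ 2.375 * (N ^ 2 / (N + B) - (T - 1)) * (N - T) := by
      have : 2.375 * 15 * (N * (8 / 9)) ≤ 2.375 * (N ^ 2 / (N + B) - (T - 1)) * (N - T) := by
        apply mul_le_mul _ _ (by positivity) (by linarith) <;> linarith
      linarith
    rw [← mul_div_assoc, ← mul_div_assoc, div_le_div_iff₀ (by positivity) (by positivity)]
    have h3 : 20 * (B * N) ≤ 2.375 * ((N + B) * (N ^ 2 / (N + B) - (T - 1))) * (N - T) := by
      have h4 : 0 ≤ 2.375 * (N ^ 2 / (N + B) - (T - 1)) * (N - T) := by linarith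
      nlinarith
    have h5 : 0 ≤ N * (N - (T - 1)) := by positivity
    have := mul_le_mul_of_nonneg_right h3 h5
    linarith
  rw [ex]
  have h6 : (X ^ 2 + 4) * (X * (1 + 1 / 8 * (X - 1))) ≤
      ((X * (1 + ε)) ^ 2 + 4) * (X * (1 + N / B * (X - 1))) := by
    apply mul_le_mul _ h1 _ (by positivity)
    · have : X ≤ X * (1 + ε) := by nlinarith
      have := pow_le_pow_left₀ hX0.le this 2
      linarith
    · exact mul_nonneg hX0.le (by linarith)
  refine le_trans ?_ h6
  have h7 : 5 * (X * (1 + ε)) ^ 2 - 5 * X ^ 2 ≤ X * (20 * (X * ε)) := by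
    have : X ^ 2 * ε * ε ≤ X ^ 2 * ε * 2 := mul_le_mul_of_nonneg_left hε2 (by positivity)
    nlinarith
  have h8 : X * (20 * (X * ε)) ≤ X * (2.375 * (1 - X)) := mul_le_mul_of_nonneg_left key hX0.le
  have h9 : X * (1 - X) * 2.375 ≤ X * (1 - X) * (3.5 - X - X ^ 2 / 8) := by
    apply mul_le_mul_of_nonneg_left _ (mul_nonneg hX0.le (by linarith))
    nlinarith
  nlinarith

end RegSum

namespace RegSum

lemma pow_mul_pow_le {i j : ℕ} {p q : ℝ} (hp : 0 ≤ p) (hq : 0 ≤ q) (h : p + q = i + j) :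
    p ^ i * q ^ j ≤ (i : ℝ) ^ i * (j : ℝ) ^ j := by
  have key : ∀ (k : ℕ) (x : ℝ), 0 ≤ x → x ^ k ≤ (k : ℝ) ^ k * Real.exp (x - k) := by
    intro k x hx
    rcases Nat.eq_zero_or_pos k with rfl | hk
    · simpa using hx
    · have hk' : (0:ℝ) < k := by exact_mod_cast hk
      have h1 : x / k ≤ Real.exp (x / k - 1) := by
        have := Real.add_one_le_exp (x / k - 1); linarith
      have h2 := pow_le_pow_left₀ (by positivity) h1 k
      rw [← Real.exp_nat_mul, div_pow, div_le_iff₀ (by positivity)] at h2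
      have e : (k : ℝ) * (x / k - 1) = x - k := by field_simp
      rw [e] at h2
      linarith
  calc p ^ i * q ^ j ≤ ((i : ℝ) ^ i * Real.exp (p - i)) * ((j : ℝ) ^ j * Real.exp (q - j)) :=
        mul_le_mul (key i p hp) (key j q hq) (by positivity) (by positivity)
    _ = (i : ℝ) ^ i * (j : ℝ) ^ j * (Real.exp (p - i) * Real.exp (q - j)) := by ring
    _ = (i : ℝ) ^ i * (j : ℝ) ^ j := by
        rw [← Real.exp_add, show p - i + (q - j) = 0 by linarith, Real.exp_zero, mul_one]

/-- Chernoff bound for the upper tail at `T` of a binomial variable with parameters `N`, `α`. -/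
noncomputable def chern (α β : ℝ) (N T : ℕ) : ℝ :=
  α ^ T * β ^ (N - T) * (N : ℝ) ^ N / ((T : ℝ) ^ T * ((N - T : ℕ) : ℝ) ^ (N - T))

lemma self_pow_pos (k : ℕ) : 0 < (k : ℝ) ^ k := by
  rcases Nat.eq_zero_or_pos k with rfl | hk
  · simp
  · positivity

lemma chern_nonneg {α β : ℝ} (hα : 0 ≤ α) (hβ : 0 ≤ β) (N T : ℕ) : 0 ≤ chern α β N T := by
  unfold chern; positivity

lemma chern_symm {α β : ℝ} {N T : ℕ} (hT : T ≤ N) : chern α β N (N - T) = chern β α N T := by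
  unfold chern
  rw [Nat.sub_sub_self hT]
  ring

lemma chern_le_one {α β : ℝ} (hα : 0 ≤ α) (hβ : 0 ≤ β) (h1 : α + β = 1) {N T : ℕ} (hT : T ≤ N) :
    chern α β N T ≤ 1 := by
  unfold chern
  rw [div_le_one (mul_pos (self_pow_pos _) (self_pow_pos _))]
  have := pow_mul_pow_le (i := T) (j := N - T) (p := α * N) (q := β * N) (by positivity)
    (by positivity) (by push_cast [hT]; linear_combination (N : ℝ) * h1)
  calc α ^ T * β ^ (N - T) * (N : ℝ) ^ N = (α * N) ^ T * (β * N) ^ (N - T) := by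
        have e : (N : ℝ) ^ N = (N : ℝ) ^ T * (N : ℝ) ^ (N - T) := by
          rw [← pow_add, Nat.add_sub_cancel' hT]
        rw [mul_pow, mul_pow, e]; ring
    _ ≤ _ := this

lemma chern_step {α β : ℝ} (hα : 0 ≤ α) (hβ : 0 ≤ β) {N T : ℕ} (hT : T + 2 ≤ N) :
    chern α β N (T + 2) * (T * β) ^ 2 ≤ chern α β N T * (α * ((N : ℝ) - T)) ^ 2 := by
  obtain ⟨m, rfl⟩ := Nat.exists_eq_add_of_le hT
  unfold chern
  rw [show T + 2 + m - (T + 2) = m by omega, show T + 2 + m - T = m + 2 by omega]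
  have key := pow_mul_pow_le (i := T + 2) (j := m) (p := T) (q := (m + 2 : ℕ)) (by positivity)
    (by positivity) (by push_cast; ring)
  have p1 := self_pow_pos T
  have p2 := self_pow_pos m
  have p3 := self_pow_pos (T + 2)
  have p4 := self_pow_pos (m + 2)
  rw [div_mul_eq_mul_div, div_mul_eq_mul_div, div_le_div_iff₀ (by positivity) (by positivity)]
  have e : ((T + 2 + m : ℕ) : ℝ) - T = (m + 2 : ℕ) := by push_cast; ring
  rw [e]
  calc _ = (α ^ (T + 2) * β ^ (m + 2) * ((T + 2 + m : ℕ) : ℝ) ^ (T + 2 + m) *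
        ((m + 2 : ℕ) : ℝ) ^ 2) * ((T : ℝ) ^ (T + 2) * ((m + 2 : ℕ) : ℝ) ^ m) := by ring
    _ ≤ (α ^ (T + 2) * β ^ (m + 2) * ((T + 2 + m : ℕ) : ℝ) ^ (T + 2 + m) *
        ((m + 2 : ℕ) : ℝ) ^ 2) * (((T + 2 : ℕ) : ℝ) ^ (T + 2) * (m : ℝ) ^ m) :=
        mul_le_mul_of_nonneg_left key (by positivity)
    _ = _ := by ring

/-- Moment generating function domination by a binomial variable. -/
def MgfLe (p : ℕ → ℝ) (N : ℕ) (α β : ℝ) : Prop :=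
  ∀ x : ℝ, 1 ≤ x → ∑ j ∈ Finset.range (N + 1), p j * x ^ j ≤ (β + α * x) ^ N

lemma tail_le_chern {p : ℕ → ℝ} {N : ℕ} {α β : ℝ} (hp : ∀ j, 0 ≤ p j) (hα : 0 < α) (hβ : 0 < β)
    (h1 : α + β = 1) (h : MgfLe p N α β) {T : ℕ} (hTN : T ≤ N) (hT : α * N ≤ T) :
    ∑ j ∈ Finset.Icc T N, p j ≤ chern α β N T := by
  have key : ∀ x : ℝ, 1 ≤ x → (∑ j ∈ Finset.Icc T N, p j) * x ^ T ≤ (β + α * x) ^ N := by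
    intro x hx
    refine le_trans ?_ (h x hx)
    rw [Finset.sum_mul]
    calc _ ≤ ∑ j ∈ Finset.Icc T N, p j * x ^ j := by
          refine Finset.sum_le_sum fun j hj => ?_
          rw [Finset.mem_Icc] at hj
          exact mul_le_mul_of_nonneg_left (pow_le_pow_right₀ hx hj.1) (hp j)
      _ ≤ _ := by
          refine Finset.sum_le_sum_of_subset_of_nonneg ?_ fun j _ _ => ?_
          · intro j hj
            rw [Finset.mem_Icc] at hj
            rw [Finset.mem_range]; omega
          · have := hp j; positivity
  rcases hTN.lt_or_eq with hlt | rfl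
  · have hT0 : (0:ℝ) < T := by
      have : (0:ℝ) < N := by exact_mod_cast (by omega : 0 < N)
      exact lt_of_lt_of_le (by positivity) hT
    obtain ⟨m, rfl⟩ := Nat.exists_eq_add_of_lt hlt
    have hx : 1 ≤ T * β / (α * (m + 1)) := by
      rw [le_div_iff₀ (by positivity)]
      push_cast at hT
      have : β = 1 - α := by linarith
      rw [this]; linarith
    have := key _ hx
    unfold chern
    rw [show T + m + 1 - T = m + 1 by omega]
    rw [← le_div_iff₀ (by positivity)] at this
    refine this.trans (le_of_eq ?_)
    have e : β + α * (T * β / (α * (m + 1))) = β * ((T + m + 1 : ℕ) : ℝ) / (m + 1) := by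
      field_simp; push_cast; ring
    rw [e, div_pow, div_pow, mul_pow, mul_pow, mul_pow]
    push_cast
    rw [show T + m + 1 = T + (m + 1) by ring, pow_add β, pow_add ((m:ℝ) + 1) T]
    field_simp
  · have h2 : ∀ x : ℝ, 1 ≤ x → ∑ j ∈ Finset.Icc T T, p j ≤ (β * x⁻¹ + α) ^ T := by
      intro x hx
      have := key x hx
      have hx0 : 0 < x := by linarith
      rw [← le_div_iff₀ (by positivity), ← div_pow] at this
      refine this.trans (le_of_eq ?_)
      congr 1
      field_simp
    have h3 : Tendsto (fun x : ℝ => (β * x⁻¹ + α) ^ T) atTop (𝓝 ((β * 0 + α) ^ T)) :=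
      ((tendsto_inv_atTop_zero.const_mul β).add_const α).pow T
    have h4 := ge_of_tendsto h3 ((eventually_ge_atTop 1).mono h2)
    refine h4.trans (le_of_eq ?_)
    unfold chern
    simp only [Nat.sub_self, pow_zero, mul_one, mul_zero, zero_add]
    rw [mul_div_assoc, div_self (self_pow_pos T).ne', mul_one]

end RegSum

namespace RegSum

/-- Typical overlap. -/
noncomputable def ovrCenter (N B : ℕ) : ℝ := (N : ℝ) ^ 2 / (N + B)

/-- Chernoff bound at `T` for the overlap. -/
noncomputable def chernOvr (N B T : ℕ) : ℝ :=
  chern ((N : ℝ) / (N + B)) ((B : ℝ) / (N + B)) N T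

lemma chernOvr_nonneg (N B T : ℕ) : 0 ≤ chernOvr N B T :=
  chern_nonneg (by positivity) (by positivity) N T

lemma chernOvr_le_one {N B T : ℕ} (hN : 0 < N) (hT : T ≤ N) : chernOvr N B T ≤ 1 := by
  refine chern_le_one (by positivity) (by positivity) ?_ hT
  have : (0:ℝ) < N := by exact_mod_cast hN
  rw [← add_div, div_self (by positivity)]

lemma ovr_growth {N B T : ℕ} (hNB : N ≤ B) (hT : T + 2 ≤ N) :
    ovr N B (T + 2) = ovr N B T * growth N B (T + 1) := by
  have h : (T : ℝ) + 2 ≤ N := by exact_mod_cast hT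
  have h2 : (0:ℝ) < N - (T + 1) := by linarith
  unfold growth
  rw [← mul_div_assoc, eq_div_iff (by positivity)]
  exact ovr_step hNB hT

lemma chernOvr_up {N B T : ℕ} (hB : 0 < B) (hT : T + 2 ≤ N) :
    chernOvr N B (T + 2) * tilt N B T ^ 2 ≤ chernOvr N B T := by
  have h : (T : ℝ) + 2 ≤ N := by exact_mod_cast hT
  have h2 : (0:ℝ) < N - T := by linarith
  have h3 : (0:ℝ) < N := by have : (0:ℝ) ≤ T := T.cast_nonneg
                            linarith
  have := chern_step (α := (N : ℝ) / (N + B)) (β := (B : ℝ) / (N + B)) (by positivity)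
    (by positivity) hT
  have e : tilt N B T = T * ((B : ℝ) / (N + B)) / ((N : ℝ) / (N + B) * (N - T)) := by
    unfold tilt; field_simp
  rw [e, div_pow, ← mul_div_assoc, div_le_iff₀ (by positivity)]
  exact this

lemma chernOvr_down {N B T : ℕ} (hT : T + 2 < N) :
    chernOvr N B T ≤ chernOvr N B (T + 2) * tilt N B ((T + 2 : ℕ) : ℝ) ^ 2 := by
  have h : (T : ℝ) + 2 < N := by exact_mod_cast hT
  have h2 : (0:ℝ) < N - ((T + 2 : ℕ) : ℝ) := by push_cast; linarith
  have h3 : (0:ℝ) < N := by have : (0:ℝ) ≤ T := T.cast_nonneg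
                            linarith
  have := chern_step (α := (B : ℝ) / (N + B)) (β := (N : ℝ) / (N + B)) (by positivity)
    (by positivity) (show N - (T + 2) + 2 ≤ N by omega)
  rw [show N - (T + 2) + 2 = N - T by omega, chern_symm (by omega), chern_symm (by omega),
    Nat.cast_sub (by omega)] at this
  have e : tilt N B ((T + 2 : ℕ) : ℝ) = ((B : ℝ) / (N + B) * ((T + 2 : ℕ) : ℝ)) /
      (((N : ℝ) - ((T + 2 : ℕ) : ℝ)) * ((N : ℝ) / (N + B))) := by
    unfold tilt; field_simp
  rw [e, div_pow, ← mul_div_assoc, le_div_iff₀ (by positivity)]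
  refine this.trans (le_of_eq ?_)
  rw [sub_sub_cancel]; rfl

lemma ovrCenter_nonneg (N B : ℕ) : 0 ≤ ovrCenter N B := by unfold ovrCenter; positivity

lemma ovrCenter_le {N B : ℕ} (hNB : 8 * N ≤ B) : ovrCenter N B ≤ N / 9 := by
  have h : (8:ℝ) * N ≤ B := by exact_mod_cast hNB
  rcases Nat.eq_zero_or_pos N with rfl | hN
  · simp [ovrCenter]
  · have : (0:ℝ) < N := by exact_mod_cast hN
    unfold ovrCenter
    rw [div_le_iff₀ (by positivity)]; nlinarith

lemma div_center_le_tilt {N B : ℕ} {T : ℝ} (hN : 0 < N) (hT : ovrCenter N B ≤ T) (hTN : T < N) :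
    T / ovrCenter N B ≤ tilt N B T := by
  have : (0:ℝ) < N := by exact_mod_cast hN
  have h0 : 0 < ovrCenter N B := by unfold ovrCenter; positivity
  have hm : 0 < (N : ℝ) - T := by linarith
  unfold ovrCenter at hT
  rw [div_le_iff₀ (by positivity)] at hT
  have : T / ovrCenter N B = T * (N + B) / N ^ 2 := by unfold ovrCenter; field_simp
  rw [this]; unfold tilt
  rw [div_le_div_iff₀ (by positivity) (by positivity)]
  have hT0 : 0 ≤ T * N := by
    have : 0 ≤ T := by by_contra hc; push Not at hc; nlinarith
    positivity
  nlinarith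

lemma tilt_le_div_center {N B : ℕ} {T : ℝ} (hN : 0 < N) (hT : T ≤ ovrCenter N B) (hT0 : 0 ≤ T)
    (hTN : T < N) : tilt N B T ≤ T / ovrCenter N B := by
  have : (0:ℝ) < N := by exact_mod_cast hN
  have h0 : 0 < ovrCenter N B := by unfold ovrCenter; positivity
  have hm : 0 < (N : ℝ) - T := by linarith
  unfold ovrCenter at hT
  rw [le_div_iff₀ (by positivity)] at hT
  have : T / ovrCenter N B = T * (N + B) / N ^ 2 := by unfold ovrCenter; field_simp
  rw [this]; unfold tilt
  rw [div_le_div_iff₀ (by positivity) (by positivity)]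
  have hT0 : 0 ≤ T * N := by positivity
  nlinarith

section
variable {N B : ℕ} (hN : 100 ≤ N) (hB : 8 * N ≤ B)
include hN hB

lemma ovr_chern_up {T : ℕ} (hT : ovrCenter N B + 14 ≤ T) (hTN : T + 2 ≤ N) :
    (ovr N B (T + 2) - ovr N B T) * chernOvr N B (T + 2) ≤
      4 * (ovr N B T * chernOvr N B T - ovr N B (T + 2) * chernOvr N B (T + 2)) := by
  have h1 := growth_le_tilt (N := N) (B := B) (T := T) (by exact_mod_cast hN)
    (by exact_mod_cast hB) hT (by exact_mod_cast hTN)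
  have h2 := chernOvr_up (B := B) (by omega) hTN
  rw [ovr_growth (by omega) hTN]
  have h3 := ovr_nonneg N B T
  have h4 := chernOvr_nonneg N B (T + 2)
  have h5 := mul_le_mul_of_nonneg_right h1 h4
  have : 5 * growth N B (T + 1) * chernOvr N B (T + 2) ≤
    chernOvr N B (T + 2) + 4 * chernOvr N B T := by linarith
  have := mul_le_mul_of_nonneg_left this h3
  linarith

lemma ovr_chern_decay_up {T : ℕ} (hT : ovrCenter N B + 14 ≤ T) (hTN : T + 2 ≤ N) :
    ovr N B (T + 2) * chernOvr N B (T + 2) ≤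
      ovr N B T * chernOvr N B T * (1 - (1 - ovrCenter N B / T) / 5) := by
  have h1 := growth_le_tilt (N := N) (B := B) (T := T) (by exact_mod_cast hN)
    (by exact_mod_cast hB) hT (by exact_mod_cast hTN)
  have h2 := chernOvr_up (B := B) (by omega) hTN
  rw [ovr_growth (by omega) hTN]
  have h3 := ovr_nonneg N B T
  have h4 := chernOvr_nonneg N B (T + 2)
  have h5 := mul_le_mul_of_nonneg_right h1 h4
  have hc : 0 < ovrCenter N B := by
    have : (0:ℝ) < N := by exact_mod_cast (by omega : 0 < N)
    unfold ovrCenter; positivity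
  have hT0 : (0:ℝ) < T := by linarith
  have hx := div_center_le_tilt (N := N) (B := B) (T := T) (by omega) (by linarith)
    (by exact_mod_cast (by omega : T < N))
  have hr : 1 ≤ T / ovrCenter N B := by rw [le_div_iff₀ hc]; linarith
  have h6 : chernOvr N B (T + 2) * (T / ovrCenter N B) ≤ chernOvr N B T := by
    refine le_trans (mul_le_mul_of_nonneg_left ?_ h4) h2
    nlinarith
  have h7 : chernOvr N B (T + 2) ≤ chernOvr N B T * (ovrCenter N B / T) := by
    rw [← mul_div_assoc, le_div_iff₀ hT0]
    rw [← mul_div_assoc, div_le_iff₀ hc] at h6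
    exact h6
  have : growth N B (T + 1) * chernOvr N B (T + 2) ≤
    chernOvr N B T * (1 - (1 - ovrCenter N B / T) / 5) := by linarith
  have := mul_le_mul_of_nonneg_left this h3
  linarith

lemma ovr_chern_down {T : ℕ} (hT : ((T + 2 : ℕ) : ℝ) + 14 ≤ ovrCenter N B) :
    (ovr N B T - ovr N B (T + 2)) * chernOvr N B T ≤
      4 * (ovr N B (T + 2) * chernOvr N B (T + 2) - ovr N B T * chernOvr N B T) ∧
    ovr N B T * chernOvr N B T ≤ ovr N B (T + 2) * chernOvr N B (T + 2) *
      (1 - (1 - ((T + 2 : ℕ) : ℝ) / ovrCenter N B) / 5) := by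
  have hc := ovrCenter_le hB
  have hTN' : ((T + 2 : ℕ) : ℝ) < N := by
    have : (0:ℝ) ≤ N := N.cast_nonneg
    linarith
  have hTN : T + 2 < N := by exact_mod_cast hTN'
  have h1 := tilt_le_growth (N := N) (B := B) (T := ((T + 2 : ℕ) : ℝ)) (by exact_mod_cast hN)
    (by exact_mod_cast hB) hT (by push_cast; linarith [(T.cast_nonneg : (0:ℝ) ≤ T)])
  have h2 := chernOvr_down (B := B) hTN
  have h0 : (0:ℝ) < (T + 2 : ℕ) := by positivity
  have hc0 : 0 < ovrCenter N B := by linarith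
  have hx := tilt_le_div_center (N := N) (B := B) (T := ((T + 2 : ℕ) : ℝ)) (by omega)
    (by linarith) h0.le hTN'
  rw [ovr_growth (by omega) hTN.le]
  have e : ((T + 2 : ℕ) : ℝ) - 1 = T + 1 := by push_cast; ring
  rw [e] at h1
  set x := tilt N B ((T + 2 : ℕ) : ℝ)
  have hx0 : 0 ≤ x := by
    have : (0:ℝ) ≤ N - ((T + 2 : ℕ) : ℝ) := by linarith
    change 0 ≤ tilt _ _ _
    unfold tilt; positivity
  set g := growth N B (T + 1)
  have h3 := ovr_nonneg N B T
  have h4 := chernOvr_nonneg N B T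
  have h5 := chernOvr_nonneg N B (T + 2)
  have hg : 0 ≤ g := by
    by_contra hg
    push Not at hg
    nlinarith [sq_nonneg x]
  have h6 : (5 - g) * chernOvr N B T ≤ 4 * g * chernOvr N B (T + 2) := by
    by_cases h : 5 ≤ g
    · have : (5 - g) * chernOvr N B T ≤ 0 := mul_nonpos_of_nonpos_of_nonneg (by linarith) h4
      exact this.trans (by positivity)
    · push Not at h
      have a1 := mul_le_mul_of_nonneg_left h2 (by linarith : 0 ≤ 5 - g)
      have a2 := mul_le_mul_of_nonneg_right (by linarith : (5 - g) * x ^ 2 ≤ 4 * g) h5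
      linarith
  refine ⟨by have := mul_le_mul_of_nonneg_left h6 h3; linarith, ?_⟩
  set y := ((T + 2 : ℕ) : ℝ) / ovrCenter N B
  have hy : y ≤ 1 := by
    change _ / _ ≤ _
    rw [div_le_one hc0]; linarith
  have h7 : 5 * chernOvr N B T ≤ g * chernOvr N B (T + 2) * (4 + y) := by
    have a1 := mul_le_mul_of_nonneg_right h1 h5
    have a2 : x ^ 2 ≤ y := by nlinarith
    have a3 := mul_le_mul_of_nonneg_left a2 (mul_nonneg hg h5)
    linarith
  have := mul_le_mul_of_nonneg_left h7 h3
  linarith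

end

end RegSum

namespace RegSum

lemma hyp_odd_le {N B T : ℕ} (hN : 100 ≤ N) (hB : 8 * N ≤ B) (hT : T + 2 ≤ N) :
    hyp N B (T + 1) ≤ 2 * hyp N B T + 2 * hyp N B (T + 2) := by
  have h0 : (T : ℝ) + 2 ≤ N := by exact_mod_cast hT
  have hB' : (8:ℝ) * N ≤ B := by exact_mod_cast hB
  have hN' : (100:ℝ) ≤ N := by exact_mod_cast hN
  have hT0 : (0:ℝ) ≤ T := T.cast_nonneg
  have e1 := hyp_step (N := N) (B := B) (T := T) (by omega) (by omega)
  have e2 := hyp_step (N := N) (B := B) (T := T + 1) (by omega) (by omega)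
  push_cast at e1 e2
  rw [show T + 1 + 1 = T + 2 by ring, show (T : ℝ) + 1 + 1 = T + 2 by ring] at e2
  have p0 := hyp_nonneg N B T
  have p1 := hyp_nonneg N B (T + 1)
  have p2 := hyp_nonneg N B (T + 2)
  set D1 := ((T : ℝ) + 1) * (B - N + (T + 1)) with hD1
  have hD1p : 700 ≤ D1 := by
    rw [hD1]; nlinarith
  set D2 := ((T : ℝ) + 2) * (B - N + (T + 2)) with hD2
  have hD2p : 0 < D2 := by
    rw [hD2]; nlinarith
  by_cases hc : D2 ≤ 2 * ((N : ℝ) - (T + 1)) ^ 2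
  · have : hyp N B (T + 1) * D2 ≤ 2 * hyp N B (T + 2) * D2 := by
      have := mul_le_mul_of_nonneg_left hc p1
      linarith
    have := le_of_mul_le_mul_right this hD2p
    linarith
  · push Not at hc
    have h3 : ((N : ℝ) - T) ^ 2 ≤ 2 * D1 := by
      set m := (N : ℝ) - (T + 1) with hm
      have e : (N : ℝ) - T = m + 1 := by rw [hm]; ring
      rw [e]
      have h5 : D2 ≤ 2.1 * D1 := by
        rw [hD1, hD2]; nlinarith
      nlinarith [sq_nonneg (m - 2)]
    have : hyp N B (T + 1) * D1 ≤ 2 * hyp N B T * D1 := by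
      have := mul_le_mul_of_nonneg_left h3 p0
      linarith
    have := le_of_mul_le_mul_right this (by linarith)
    linarith

lemma sum_hyp_even_ge {p B : ℕ} (hN : 100 ≤ 2 * p) (hB : 8 * (2 * p) ≤ B) :
    1 / 5 ≤ ∑ k ∈ Finset.range (p + 1), hyp (2 * p) B (2 * k) := by
  have h1 := sum_hyp (2 * p) B
  have h2 : ∀ f : ℕ → ℝ, ∑ T ∈ Finset.range (2 * p + 1), f T =
      ∑ k ∈ Finset.range (p + 1), f (2 * k) + ∑ k ∈ Finset.range p, f (2 * k + 1) := by
    intro f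
    clear hN hB h1
    induction p with
    | zero => simp
    | succ p ih =>
      rw [show 2 * (p + 1) + 1 = (2 * p + 1) + 1 + 1 by ring, Finset.sum_range_succ,
        Finset.sum_range_succ, ih,
        Finset.sum_range_succ (fun k => f (2 * k)) (p + 1),
        Finset.sum_range_succ (fun k => f (2 * k + 1)) p]
      rw [show 2 * (p + 1) = 2 * p + 1 + 1 by ring]; ring
  rw [h2] at h1
  have h3 : ∑ k ∈ Finset.range p, hyp (2 * p) B (2 * k + 1) ≤
      2 * ∑ k ∈ Finset.range p, hyp (2 * p) B (2 * k) +
        2 * ∑ k ∈ Finset.range p, hyp (2 * p) B (2 * (k + 1)) := by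
    rw [Finset.mul_sum, Finset.mul_sum, ← Finset.sum_add_distrib]
    refine Finset.sum_le_sum fun k hk => ?_
    rw [Finset.mem_range] at hk
    exact hyp_odd_le hN hB (by omega)
  have h4 : ∑ k ∈ Finset.range p, hyp (2 * p) B (2 * k) ≤
      ∑ k ∈ Finset.range (p + 1), hyp (2 * p) B (2 * k) := by
    rw [Finset.sum_range_succ]; linarith [hyp_nonneg (2 * p) B (2 * p)]
  have h5 : ∑ k ∈ Finset.range p, hyp (2 * p) B (2 * (k + 1)) ≤
      ∑ k ∈ Finset.range (p + 1), hyp (2 * p) B (2 * k) := by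
    rw [Finset.sum_range_succ']; linarith [hyp_nonneg (2 * p) B (2 * 0)]
  linarith

lemma exists_ovr_le {N B : ℕ} (hN : 100 ≤ N) (hB : 8 * N ≤ B) (hNe : Even N) (hBe : Even B) :
    ∃ T, T ≤ N ∧ Even T ∧ ovr N B T ≤ 5 := by
  by_contra hc
  push Not at hc
  have h1 := sum_hyp_mul_ovr hNe hBe (by omega)
  obtain ⟨p, rfl⟩ := hNe
  rw [← two_mul] at *
  rw [sum_even_eq (fun T hT => by rw [ovr_of_odd hT, mul_zero])] at h1
  have h2 := sum_hyp_even_ge hN hB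
  have h3 : ∀ k ∈ Finset.range (p + 1), 5 * hyp (2 * p) B (2 * k) ≤
      hyp (2 * p) B (2 * k) * ovr (2 * p) B (2 * k) := fun k hk => by
    rw [Finset.mem_range] at hk
    have := hc (2 * k) (by omega) (even_two_mul k)
    have := mul_le_mul_of_nonneg_left this.le (hyp_nonneg (2 * p) B (2 * k))
    linarith
  have hpos : 0 < hyp (2 * p) B (2 * 0) := by
    unfold hyp
    have := Nat.choose_pos (show 2 * p - 2 * 0 ≤ B by omega)
    have := Nat.choose_pos (show 2 * p ≤ 2 * p + B by omega)
    have := Nat.choose_pos (show 2 * 0 ≤ 2 * p by omega)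
    positivity
  have h4 : ∑ k ∈ Finset.range (p + 1), 5 * hyp (2 * p) B (2 * k) <
      ∑ k ∈ Finset.range (p + 1), hyp (2 * p) B (2 * k) * ovr (2 * p) B (2 * k) := by
    refine Finset.sum_lt_sum h3 ⟨0, by simp, ?_⟩
    have := hc (2 * 0) (by omega) (even_two_mul 0)
    nlinarith
  rw [← Finset.mul_sum] at h4
  linarith

lemma growth_le_exp {N B : ℕ} (hN : 100 ≤ N) (hB : 8 * N ≤ B) {τ : ℝ}
    (h1 : ovrCenter N B ≤ τ) (h2 : τ ≤ N / 2) :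
    growth N B τ ≤ Real.exp (6 * ((τ - ovrCenter N B) / ovrCenter N B)) := by
  have hN' : (100:ℝ) ≤ N := by exact_mod_cast hN
  have hB' : (8:ℝ) * N ≤ B := by exact_mod_cast hB
  have hc : 0 < ovrCenter N B := by unfold ovrCenter; positivity
  rw [growth_eq (by linarith) (by linarith) (by linarith)]
  have e := tilt_sub_one (N := N) (B := B) (τ := τ) (by linarith) (by linarith) (by linarith)
  rw [show (N : ℝ) ^ 2 / (N + B) = ovrCenter N B from rfl] at e
  set s := (τ - ovrCenter N B) / ovrCenter N B with hs
  have hs0 : 0 ≤ s := div_nonneg (by linarith) hc.le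
  set X := tilt N B τ
  have es : τ - ovrCenter N B = s * ovrCenter N B := by rw [hs]; field_simp
  have eN : ((N : ℝ) + B) * ovrCenter N B = N ^ 2 := by unfold ovrCenter; field_simp
  have hX : X - 1 ≤ 2 * s := by
    rw [e, es, div_le_iff₀ (mul_pos (by linarith) (by linarith))]
    have : (N + B : ℝ) * (s * ovrCenter N B) = s * (N : ℝ) ^ 2 := by rw [← eN]; ring
    rw [this]
    have : s * (N : ℝ) * (N / 2) ≤ s * N * (N - τ) := by
      apply mul_le_mul_of_nonneg_left _ (by positivity); linarith
    nlinarith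
  have hX1 : 0 ≤ X - 1 := by
    rw [e, es]
    apply div_nonneg (by positivity) (mul_nonneg (by linarith) (by linarith))
  have hγ : (N : ℝ) / B ≤ 1 / 8 := by rw [div_le_iff₀ (by linarith)]; linarith
  have h3 : X ≤ Real.exp (2 * s) := by
    have := Real.add_one_le_exp (2 * s); linarith
  have h4 : 1 + N / B * (X - 1) ≤ Real.exp (2 * s) := by
    have := mul_le_mul_of_nonneg_right hγ hX1; linarith
  have h5 : 0 ≤ (N : ℝ) / B * (X - 1) := by positivity
  calc X * (1 + N / B * (X - 1)) ≤ Real.exp (2 * s) * Real.exp (2 * s) :=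
        mul_le_mul h3 h4 (by linarith) (Real.exp_pos _).le
    _ = Real.exp (4 * s) := by rw [← Real.exp_add]; congr 1; ring
    _ ≤ _ := Real.exp_le_exp.mpr (by linarith)

lemma exp_le_growth {N B : ℕ} (hN : 100 ≤ N) (hB : 8 * N ≤ B) {τ : ℝ}
    (h1 : τ ≤ ovrCenter N B) (h2 : ovrCenter N B / 2 ≤ τ) :
    Real.exp (-(6 * ((ovrCenter N B - τ) / ovrCenter N B))) ≤ growth N B τ := by
  have hN' : (100:ℝ) ≤ N := by exact_mod_cast hN
  have hB' : (8:ℝ) * N ≤ B := by exact_mod_cast hB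
  have hc : 0 < ovrCenter N B := by unfold ovrCenter; positivity
  have hcN := ovrCenter_le hB
  rw [growth_eq (by linarith) (by linarith) (by linarith)]
  have e := tilt_sub_one (N := N) (B := B) (τ := τ) (by linarith) (by linarith) (by linarith)
  rw [show (N : ℝ) ^ 2 / (N + B) = ovrCenter N B from rfl] at e
  set s := (ovrCenter N B - τ) / ovrCenter N B with hs
  have hs0 : 0 ≤ s := div_nonneg (by linarith) hc.le
  have hs1 : s ≤ 1 / 2 := by rw [hs, div_le_iff₀ hc]; linarith
  set X := tilt N B τ
  have es : τ - ovrCenter N B = -(s * ovrCenter N B) := by rw [hs]; field_simp; ring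
  have eN : ((N : ℝ) + B) * ovrCenter N B = N ^ 2 := by unfold ovrCenter; field_simp
  have hX : -(9 / 8 * s) ≤ X - 1 := by
    rw [e, es, le_div_iff₀ (mul_pos (by linarith) (by linarith))]
    have : (N + B : ℝ) * (-(s * ovrCenter N B)) = -(s * (N : ℝ) ^ 2) := by rw [← eN]; ring
    rw [this]
    have : s * (N : ℝ) * (N * (8 / 9)) ≤ s * N * (N - τ) := by
      apply mul_le_mul_of_nonneg_left _ (by positivity); linarith
    nlinarith
  have hX1 : X - 1 ≤ 0 := by
    rw [e, es]
    apply div_nonpos_of_nonpos_of_nonneg _ (mul_nonneg (by linarith) (by linarith))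
    exact mul_nonpos_of_nonneg_of_nonpos (by linarith) (by
      have := mul_nonneg hs0 hc.le; linarith)
  have hγ : (N : ℝ) / B ≤ 1 / 8 := by rw [div_le_iff₀ (by linarith)]; linarith
  have hE : Real.exp (-(3 * s)) ≤ X := by
    have h3 : 1 ≤ X * Real.exp (3 * s) := by
      have a1 : 3 * s + 1 ≤ Real.exp (3 * s) := Real.add_one_le_exp _
      have a2 := mul_le_mul (by linarith : 1 - 9 / 8 * s ≤ X) a1 (by linarith) (by linarith)
      nlinarith
    rw [Real.exp_neg, inv_eq_one_div, div_le_iff₀ (Real.exp_pos _)]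
    exact h3
  have h4 : X ≤ 1 + N / B * (X - 1) := by
    have := mul_le_mul_of_nonpos_right hγ hX1; linarith
  calc _ = Real.exp (-(3 * s)) * Real.exp (-(3 * s)) := by rw [← Real.exp_add]; congr 1; ring
    _ ≤ X * (1 + N / B * (X - 1)) :=
        mul_le_mul hE (hE.trans h4) (Real.exp_pos _).le ((Real.exp_pos _).le.trans hE)

end RegSum

namespace RegSum

lemma growth_le_one {N B : ℕ} {τ : ℝ} (hN : 0 < N) (h : τ ≤ ovrCenter N B) (h2 : τ < N) :
    growth N B τ ≤ 1 := by
  have : (0:ℝ) < N := by exact_mod_cast hN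
  have h3 : 0 < (N : ℝ) - τ := by linarith
  unfold ovrCenter at h
  rw [le_div_iff₀ (by positivity)] at h
  unfold growth
  rw [div_le_one (by positivity)]; nlinarith

lemma one_le_growth {N B : ℕ} {τ : ℝ} (hN : 0 < N) (h : ovrCenter N B ≤ τ) (h2 : τ < N) :
    1 ≤ growth N B τ := by
  have : (0:ℝ) < N := by exact_mod_cast hN
  have h3 : 0 < (N : ℝ) - τ := by linarith
  unfold ovrCenter at h
  rw [div_le_iff₀ (by positivity)] at h
  unfold growth
  rw [one_le_div (by positivity)]; nlinarith

section
variable {N B : ℕ} (hN : 100 ≤ N) (hB : 8 * N ≤ B)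
include hN hB

lemma ovr_bulk_up {c δ : ℝ} (hc0 : 0 ≤ c) (hδ : δ ≤ ovrCenter N B / 2)
    (hcδ : 3 * δ / ovrCenter N B ≤ c) {S : ℕ} (hS : ovr N B S ≤ 5) (k : ℕ) :
    ((S + 2 * k : ℕ) : ℝ) ≤ ovrCenter N B + δ →
    ovr N B (S + 2 * k) ≤ 5 * Real.exp (c * max 0 (((S + 2 * k : ℕ) : ℝ) - ovrCenter N B + 1)) := by
  have hcN := ovrCenter_le hB
  have hc := ovrCenter_nonneg N B
  have hN' : (100:ℝ) ≤ N := by exact_mod_cast hN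
  have hcp : 0 < ovrCenter N B := by unfold ovrCenter; positivity
  induction k with
  | zero =>
    intro _
    refine hS.trans ?_
    have : 1 ≤ Real.exp (c * max 0 (((S + 2 * 0 : ℕ) : ℝ) - ovrCenter N B + 1)) :=
      Real.one_le_exp (mul_nonneg hc0 (le_max_left _ _))
    simpa using this
  | succ k ih =>
    intro h
    have e : S + 2 * (k + 1) = (S + 2 * k) + 2 := by ring
    rw [e] at h ⊢
    set T := S + 2 * k with hT
    push_cast at h
    have ih := ih (by linarith)
    have hTN : T + 2 ≤ N := by
      have : (T : ℝ) + 2 ≤ N := by linarith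
      exact_mod_cast this
    rw [ovr_growth (by omega) hTN]
    have h3 := ovr_nonneg N B T
    rcases le_total ((T : ℝ) + 1) (ovrCenter N B) with hle | hle
    · have hg := growth_le_one (N := N) (B := B) (τ := T + 1) (by omega) hle (by linarith)
      have : Real.exp (c * max 0 ((T : ℝ) - ovrCenter N B + 1)) ≤
          Real.exp (c * max 0 (((T + 2 : ℕ) : ℝ) - ovrCenter N B + 1)) := by
        apply Real.exp_le_exp.mpr
        apply mul_le_mul_of_nonneg_left _ hc0
        apply max_le_max le_rfl
        push_cast; linarith
      nlinarith
    · have hg := growth_le_exp hN hB (τ := T + 1) hle (by linarith)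
      have h4 : 6 * (((T : ℝ) + 1 - ovrCenter N B) / ovrCenter N B) ≤ 2 * c := by
        have : ((T : ℝ) + 1 - ovrCenter N B) / ovrCenter N B ≤ δ / ovrCenter N B :=
          div_le_div_of_nonneg_right (by linarith) hc
        rw [mul_div_assoc] at hcδ
        linarith
      have hg2 := hg.trans (Real.exp_le_exp.mpr h4)
      rw [max_eq_right (by linarith)] at ih
      rw [max_eq_right (by push_cast; linarith)]
      have hg1 := one_le_growth (N := N) (B := B) (τ := T + 1) (by omega) hle (by linarith)
      calc ovr N B T * growth N B (T + 1) ≤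
          (5 * Real.exp (c * (T - ovrCenter N B + 1))) * Real.exp (2 * c) :=
            mul_le_mul ih hg2 (by linarith) (by positivity)
        _ = 5 * Real.exp (c * (((T + 2 : ℕ) : ℝ) - ovrCenter N B + 1)) := by
            rw [mul_assoc, ← Real.exp_add]; congr 2; push_cast; ring

lemma ovr_bulk_down {c δ : ℝ} (hc0 : 0 ≤ c) (hδ : δ ≤ ovrCenter N B / 2)
    (hcδ : 3 * δ / ovrCenter N B ≤ c) (k : ℕ) : ∀ T : ℕ, ovr N B (T + 2 * k) ≤ 5 →
    T + 2 * k ≤ N →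
    ovrCenter N B - δ ≤ T →
    ovr N B T ≤ 5 * Real.exp (c * max 0 (ovrCenter N B - T + 1)) := by
  have hcN := ovrCenter_le hB
  have hc := ovrCenter_nonneg N B
  have hN' : (100:ℝ) ≤ N := by exact_mod_cast hN
  have hcp : 0 < ovrCenter N B := by unfold ovrCenter; positivity
  induction k with
  | zero =>
    intro T h1 _ _
    refine h1.trans ?_
    have : 1 ≤ Real.exp (c * max 0 (ovrCenter N B - T + 1)) :=
      Real.one_le_exp (mul_nonneg hc0 (le_max_left _ _))
    linarith
  | succ k ih =>
    intro T h1 h2 h3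
    have ih := ih (T + 2) (by rw [show T + 2 + 2 * k = T + 2 * (k + 1) by ring]; exact h1)
      (by omega) (by push_cast; linarith)
    have hTN : T + 2 ≤ N := by omega
    have hTN' : (T : ℝ) + 2 ≤ N := by exact_mod_cast hTN
    rw [ovr_growth (by omega) hTN] at ih
    have h4 := ovr_nonneg N B T
    rcases le_total (ovrCenter N B) ((T : ℝ) + 1) with hle | hle
    · have hg := one_le_growth (N := N) (B := B) (τ := T + 1) (by omega) hle (by linarith)
      have : Real.exp (c * max 0 (ovrCenter N B - ((T + 2 : ℕ) : ℝ) + 1)) ≤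
          Real.exp (c * max 0 (ovrCenter N B - T + 1)) := by
        apply Real.exp_le_exp.mpr
        apply mul_le_mul_of_nonneg_left _ hc0
        apply max_le_max le_rfl
        push_cast; linarith
      nlinarith
    · have hg := exp_le_growth hN hB (τ := T + 1) hle (by linarith)
      have h5 : 6 * ((ovrCenter N B - ((T : ℝ) + 1)) / ovrCenter N B) ≤ 2 * c := by
        have : (ovrCenter N B - ((T : ℝ) + 1)) / ovrCenter N B ≤ δ / ovrCenter N B :=
          div_le_div_of_nonneg_right (by linarith) hc
        rw [mul_div_assoc] at hcδ
        linarith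
      have hg2 := (Real.exp_le_exp.mpr (neg_le_neg h5)).trans hg
      rw [max_eq_right (by linarith)]
      have e : max 0 (ovrCenter N B - ((T + 2 : ℕ) : ℝ) + 1) = ovrCenter N B - T - 1 := by
        rw [max_eq_right (by push_cast; linarith)]; push_cast; ring
      rw [e] at ih
      have h6 := (mul_le_mul_of_nonneg_left hg2 h4).trans ih
      have e2 : Real.exp (c * (ovrCenter N B - T + 1)) =
          Real.exp (c * (ovrCenter N B - T - 1)) * Real.exp (2 * c) := by
        rw [← Real.exp_add]; congr 1; ring
      rw [Real.exp_neg, ← div_eq_mul_inv, div_le_iff₀ (Real.exp_pos _)] at h6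
      rw [e2]; linarith

lemma ovr_bulk (hNe : Even N) (hBe : Even B) {K : ℝ} (hK : 0 ≤ K)
    (hK2 : 2 * K ≤ √(ovrCenter N B)) (h1 : 1 ≤ ovrCenter N B) {T : ℕ}
    (hT : |(T : ℝ) - ovrCenter N B| ≤ K * √(ovrCenter N B)) :
    ovr N B T ≤ 5 * Real.exp (3 * K * (K + 1)) := by
  rcases Nat.even_or_odd T with hTe | hTo
  swap
  · rw [ovr_of_odd hTo]; positivity
  obtain ⟨S, hSN, hSe, hS⟩ := exists_ovr_le hN hB hNe hBe
  set s := √(ovrCenter N B) with hs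
  have hs2 : s * s = ovrCenter N B := Real.mul_self_sqrt (by linarith)
  have hs1 : 1 ≤ s := by rw [hs]; exact Real.one_le_sqrt.mpr h1
  have hδ : K * s ≤ ovrCenter N B / 2 := by rw [← hs2]; nlinarith
  have hcδ : 3 * (K * s) / ovrCenter N B ≤ 3 * K / s := by
    rw [← hs2, ← mul_assoc, mul_div_mul_right _ _ (by linarith)]
  have hc0 : 0 ≤ 3 * K / s := by positivity
  have fin : ∀ y : ℝ, y ≤ K * s + 1 → 3 * K / s * max 0 y ≤ 3 * K * (K + 1) := by
    intro y hy
    rw [div_mul_eq_mul_div, div_le_iff₀ (by linarith), mul_assoc (3 * K)]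
    apply mul_le_mul_of_nonneg_left _ (by positivity)
    apply max_le (by positivity)
    nlinarith
  rw [abs_le] at hT
  rcases le_total S T with h | h
  · obtain ⟨k, hk⟩ : ∃ k, T = S + 2 * k := by
      obtain ⟨a, rfl⟩ := hTe; obtain ⟨b, rfl⟩ := hSe
      exact ⟨a - b, by omega⟩
    have := ovr_bulk_up hN hB hc0 hδ hcδ hS k (by rw [← hk]; linarith)
    rw [← hk] at this
    refine this.trans ?_
    apply mul_le_mul_of_nonneg_left _ (by norm_num)
    exact Real.exp_le_exp.mpr (fin _ (by linarith))
  · obtain ⟨k, hk⟩ : ∃ k, S = T + 2 * k := by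
      obtain ⟨a, rfl⟩ := hTe; obtain ⟨b, rfl⟩ := hSe
      exact ⟨b - a, by omega⟩
    rw [hk] at hS hSN
    have := ovr_bulk_down hN hB hc0 hδ hcδ k T hS hSN (by linarith)
    refine this.trans ?_
    apply mul_le_mul_of_nonneg_left _ (by norm_num)
    exact Real.exp_le_exp.mpr (fin _ (by linarith))

lemma upper_tail {p : ℕ → ℝ} (hp : ∀ j, 0 ≤ p j)
    (h : MgfLe p N ((N : ℝ) / (N + B)) ((B : ℝ) / (N + B))) (k : ℕ) :
    ∀ T : ℕ, T + 2 * k = N → ovrCenter N B + 14 ≤ T → Even T →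
    ∑ j ∈ Finset.Icc T N, p j * ovr N B j ≤
      (∑ j ∈ Finset.Icc T N, p j) * ovr N B T + 4 * (ovr N B T * chernOvr N B T) := by
  have hN' : (100:ℝ) ≤ N := by exact_mod_cast hN
  have hB' : (8:ℝ) * N ≤ B := by exact_mod_cast hB
  induction k with
  | zero =>
    intro T hT _ _
    simp only [mul_zero, add_zero] at hT
    subst hT
    simp only [Finset.Icc_self, Finset.sum_singleton]
    have := mul_nonneg (ovr_nonneg T B T) (chernOvr_nonneg T B T)
    linarith
  | succ k ih =>
    intro T hT h1 hTe
    have ih := ih (T + 2) (by omega) (by push_cast; linarith) (hTe.add (by decide))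
    have hs : ∀ f : ℕ → ℝ, ∑ j ∈ Finset.Icc T N, f j =
        f T + f (T + 1) + ∑ j ∈ Finset.Icc (T + 2) N, f j := by
      intro f
      rw [← Finset.add_sum_Ioc_eq_sum_Icc (by omega), ← Finset.Icc_add_one_left_eq_Ioc,
        ← Finset.add_sum_Ioc_eq_sum_Icc (by omega), ← Finset.Icc_add_one_left_eq_Ioc,
        show T + 1 + 1 = T + 2 from rfl]
      ring
    rw [hs, hs p, ovr_of_odd (T := T + 1) hTe.add_one]
    have hB0 : (0:ℝ) < B := by linarith
    have ht := tail_le_chern hp (by positivity) (by positivity)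
      (by rw [← add_div, div_self (by positivity)]) h (T := T + 2) (by omega) (by
        have e : (N : ℝ) / (N + B) * N = ovrCenter N B := by unfold ovrCenter; ring
        rw [e]; push_cast; linarith)
    have hstep := ovr_chern_up hN hB h1 (by omega)
    set t := ∑ j ∈ Finset.Icc (T + 2) N, p j
    change t ≤ chernOvr N B (T + 2) at ht
    have hg := one_le_growth (N := N) (B := B) (τ := T + 1) (by omega) (by linarith)
      (by have : T + 2 ≤ N := by omega
          have : (T : ℝ) + 2 ≤ N := by exact_mod_cast this
          linarith)
    have hR : 0 ≤ ovr N B (T + 2) - ovr N B T := by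
      rw [ovr_growth (by omega) (by omega)]; nlinarith [ovr_nonneg N B T]
    have := mul_le_mul_of_nonneg_left ht hR
    have := mul_nonneg (hp (T + 1)) (ovr_nonneg N B T)
    linarith

lemma lower_tail {p : ℕ → ℝ} (hp : ∀ j, 0 ≤ p j)
    (h : ∀ T : ℕ, (T : ℝ) ≤ ovrCenter N B → ∑ j ∈ Finset.range (T + 1), p j ≤ chernOvr N B T)
    (k : ℕ) : ((2 * k : ℕ) : ℝ) + 14 ≤ ovrCenter N B →
    ∑ j ∈ Finset.range (2 * k + 1), p j * ovr N B j ≤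
      (∑ j ∈ Finset.range (2 * k + 1), p j) * ovr N B (2 * k) +
        4 * (ovr N B (2 * k) * chernOvr N B (2 * k)) := by
  induction k with
  | zero =>
    intro _
    simp only [mul_zero, zero_add, Finset.sum_range_one]
    have := mul_nonneg (ovr_nonneg N B 0) (chernOvr_nonneg N B 0)
    linarith
  | succ k ih =>
    intro h1
    have e : 2 * (k + 1) = 2 * k + 2 := by ring
    rw [e] at h1 ⊢
    have h1' := h1
    push_cast at h1'
    have ih := ih (by push_cast; linarith)
    have hs : ∀ f : ℕ → ℝ, ∑ j ∈ Finset.range (2 * k + 2 + 1), f j =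
        ∑ j ∈ Finset.range (2 * k + 1), f j + f (2 * k + 1) + f (2 * k + 2) := by
      intro f
      rw [Finset.sum_range_succ, Finset.sum_range_succ]
    rw [hs, hs p, ovr_of_odd (T := 2 * k + 1) ⟨k, rfl⟩]
    have ht := h (2 * k) (by push_cast; linarith)
    have hstep := (ovr_chern_down hN hB h1).1
    have hcN := ovrCenter_le hB
    have hN0 : (100:ℝ) ≤ N := by exact_mod_cast hN
    have hTN' : ((2 * k : ℕ) : ℝ) + 2 < N := by
      push_cast; linarith
    have hTN : 2 * k + 2 < N := by exact_mod_cast hTN'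
    have hg := growth_le_one (N := N) (B := B) (τ := (2 * k : ℕ) + 1) (by omega)
      (by push_cast; linarith) (by linarith)
    have hR : 0 ≤ ovr N B (2 * k) - ovr N B (2 * k + 2) := by
      rw [ovr_growth (by omega) hTN.le]; nlinarith [ovr_nonneg N B (2 * k)]
    have := mul_le_mul_of_nonneg_left ht hR
    have := mul_nonneg (hp (2 * k + 1)) (ovr_nonneg N B (2 * k + 2))
    linarith

end

end RegSum

namespace RegSum

/-- A law on `{0,…,N}` dominated on both sides by the binomial law with mean `ovrCenter N B`. -/
structure OvrLaw (p : ℕ → ℝ) (N B : ℕ) : Prop where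
  nonneg : ∀ j, 0 ≤ p j
  sum_eq : ∑ j ∈ Finset.range (N + 1), p j = 1
  upper : MgfLe p N ((N : ℝ) / (N + B)) ((B : ℝ) / (N + B))
  lower : MgfLe (fun j => p (N - j)) N ((B : ℝ) / (N + B)) ((N : ℝ) / (N + B))

lemma OvrLaw.lower_le {p : ℕ → ℝ} {N B : ℕ} (h : OvrLaw p N B) (hN : 0 < N) (hB : 0 < B) {T : ℕ}
    (hTN : T ≤ N) (hT : (T : ℝ) ≤ ovrCenter N B) :
    ∑ j ∈ Finset.range (T + 1), p j ≤ chernOvr N B T := by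
  have hN' : (0:ℝ) < N := by exact_mod_cast hN
  have hB' : (0:ℝ) < B := by exact_mod_cast hB
  have h1 := tail_le_chern (fun j => h.nonneg (N - j)) (by positivity) (by positivity)
    (by rw [← add_div, add_comm, div_self (by positivity)]) h.lower (T := N - T) (by omega) (by
      rw [Nat.cast_sub hTN]
      have e : (B : ℝ) / (N + B) * N = N - ovrCenter N B := by
        unfold ovrCenter; field_simp; ring
      rw [e]; linarith)
  rw [chern_symm hTN] at h1
  refine le_trans (le_of_eq ?_) h1
  rw [Finset.range_eq_Ico]
  refine Finset.sum_nbij' (fun j => N - j) (fun j => N - j) ?_ ?_ ?_ ?_ ?_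
  · intro j hj; simp only [Finset.mem_Ico, Finset.mem_Icc] at *; omega
  · intro j hj; simp only [Finset.mem_Ico, Finset.mem_Icc] at *; omega
  · intro j hj; simp only [Finset.mem_Ico] at *; omega
  · intro j hj; simp only [Finset.mem_Icc] at *; omega
  · intro j hj
    simp only [Finset.mem_Ico] at hj
    rw [show N - (N - j) = j by omega]

lemma sum_le_sum_of_support {ι : Type*} {s t : Finset ι} {f : ι → ℝ} (h0 : ∀ j, 0 ≤ f j)
    (h : ∀ j ∈ s, f j ≠ 0 → j ∈ t) : ∑ j ∈ s, f j ≤ ∑ j ∈ t, f j := by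
  classical
  rw [← Finset.sum_filter_ne_zero]
  refine Finset.sum_le_sum_of_subset_of_nonneg ?_ fun j _ _ => h0 j
  intro j hj
  rw [Finset.mem_filter] at hj
  exact h j hj.1 hj.2

lemma exists_even_ge {x : ℝ} (hx : 0 ≤ x) : ∃ k : ℕ, x ≤ ((2 * k : ℕ) : ℝ) ∧
    ((2 * k : ℕ) : ℝ) < x + 2 ∧ ∀ j : ℕ, x ≤ ((2 * j : ℕ) : ℝ) → k ≤ j := by
  refine ⟨⌈x / 2⌉₊, ?_, ?_, ?_⟩
  · have := Nat.le_ceil (x / 2); push_cast; linarith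
  · have := Nat.ceil_lt_add_one (by positivity : 0 ≤ x / 2); push_cast; linarith
  · intro j hj
    apply Nat.ceil_le.mpr; push_cast at hj; linarith

lemma exists_even_le {x : ℝ} (hx : 0 ≤ x) : ∃ k : ℕ, ((2 * k : ℕ) : ℝ) ≤ x ∧
    x < ((2 * k : ℕ) : ℝ) + 2 ∧ ∀ j : ℕ, ((2 * j : ℕ) : ℝ) ≤ x → j ≤ k := by
  refine ⟨⌊x / 2⌋₊, ?_, ?_, ?_⟩
  · have := Nat.floor_le (by positivity : 0 ≤ x / 2); push_cast; linarith
  · have := Nat.lt_floor_add_one (x / 2); push_cast; linarith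
  · intro j hj
    apply Nat.le_floor; push_cast at hj; linarith

section
variable {N B : ℕ} (hN : 100 ≤ N) (hB : 8 * N ≤ B)
include hN hB

lemma decay_up {T : ℕ} (hT : ovrCenter N B + 14 ≤ T) (k : ℕ) (hk : T + 2 * k ≤ N) :
    ovr N B (T + 2 * k) * chernOvr N B (T + 2 * k) ≤
      ovr N B T * chernOvr N B T * Real.exp (-(k * ((1 - ovrCenter N B / T) / 5))) := by
  have hc := ovrCenter_nonneg N B
  induction k with
  | zero => simp
  | succ k ih =>
    have ih := ih (by omega)
    have h1 : (T : ℝ) ≤ ((T + 2 * k : ℕ) : ℝ) := by push_cast; linarith [(k.cast_nonneg : (0:ℝ) ≤ k)]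
    have h2 := ovr_chern_decay_up hN hB (T := T + 2 * k) (by linarith) (by omega)
    rw [show T + 2 * (k + 1) = T + 2 * k + 2 by ring]
    refine h2.trans ?_
    have hA := mul_nonneg (ovr_nonneg N B (T + 2 * k)) (chernOvr_nonneg N B (T + 2 * k))
    have h3 : 1 - (1 - ovrCenter N B / ((T + 2 * k : ℕ) : ℝ)) / 5 ≤
        Real.exp (-((1 - ovrCenter N B / T) / 5)) := by
      have := Real.add_one_le_exp (-((1 - ovrCenter N B / T) / 5))
      have h4 : ovrCenter N B / ((T + 2 * k : ℕ) : ℝ) ≤ ovrCenter N B / T :=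
        div_le_div_of_nonneg_left hc (by linarith) h1
      linarith
    calc _ ≤ ovr N B (T + 2 * k) * chernOvr N B (T + 2 * k) *
          Real.exp (-((1 - ovrCenter N B / T) / 5)) := mul_le_mul_of_nonneg_left h3 hA
      _ ≤ ovr N B T * chernOvr N B T * Real.exp (-(k * ((1 - ovrCenter N B / T) / 5))) *
          Real.exp (-((1 - ovrCenter N B / T) / 5)) :=
          mul_le_mul_of_nonneg_right ih (Real.exp_pos _).le
      _ = _ := by rw [mul_assoc, ← Real.exp_add]; congr 2; push_cast; ring

lemma decay_down (k : ℕ) : ∀ T : ℕ, ((T + 2 * k : ℕ) : ℝ) + 14 ≤ ovrCenter N B →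
    ovr N B T * chernOvr N B T ≤ ovr N B (T + 2 * k) * chernOvr N B (T + 2 * k) *
      Real.exp (-(k * ((1 - ((T + 2 * k : ℕ) : ℝ) / ovrCenter N B) / 5))) := by
  have hc := ovrCenter_nonneg N B
  induction k with
  | zero => intro T _; simp
  | succ k ih =>
    intro T hT
    have e : T + 2 * (k + 1) = (T + 2) + 2 * k := by ring
    rw [e] at hT ⊢
    have ih := ih (T + 2) hT
    have h1 : ((T + 2 : ℕ) : ℝ) ≤ ((T + 2 + 2 * k : ℕ) : ℝ) := by
      push_cast; linarith [(k.cast_nonneg : (0:ℝ) ≤ k)]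
    have h2 := (ovr_chern_down hN hB (T := T) (by linarith)).2
    refine h2.trans ?_
    have hA := mul_nonneg (ovr_nonneg N B (T + 2)) (chernOvr_nonneg N B (T + 2))
    set c := (1 - ((T + 2 + 2 * k : ℕ) : ℝ) / ovrCenter N B) / 5 with hcdef
    have h3 : 1 - (1 - ((T + 2 : ℕ) : ℝ) / ovrCenter N B) / 5 ≤ Real.exp (-c) := by
      have := Real.add_one_le_exp (-c)
      have h4 : ((T + 2 : ℕ) : ℝ) / ovrCenter N B ≤ ((T + 2 + 2 * k : ℕ) : ℝ) / ovrCenter N B :=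
        div_le_div_of_nonneg_right h1 hc
      linarith
    calc _ ≤ ovr N B (T + 2) * chernOvr N B (T + 2) * Real.exp (-c) :=
          mul_le_mul_of_nonneg_left h3 hA
      _ ≤ _ := mul_le_mul_of_nonneg_right ih (Real.exp_pos _).le
      _ = _ := by rw [mul_assoc, ← Real.exp_add]; congr 2; push_cast; ring

variable (hNe : Even N) (hBe : Even B) (h400 : 400 ≤ ovrCenter N B)
include hNe hBe h400

lemma ovr_near {T : ℕ} (hT : |(T : ℝ) - ovrCenter N B| ≤ 16) : ovr N B T ≤ 5 * Real.exp 6 := by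
  have hs : 20 ≤ √(ovrCenter N B) := by
    rw [show (20:ℝ) = √400 by rw [show (400:ℝ) = 20 ^ 2 by norm_num]; simp]
    exact Real.sqrt_le_sqrt h400
  have := ovr_bulk hN hB hNe hBe (K := 1) (by norm_num) (by linarith) (by linarith) (T := T)
    (by linarith)
  norm_num at this
  exact this

lemma sum_upper_le {p : ℕ → ℝ} (h : OvrLaw p N B) {δ : ℝ} (h1 : 60 ≤ δ)
    (h2 : δ ≤ ovrCenter N B / 2) :
    ∑ j ∈ (Finset.range (N + 1)).filter (fun j : ℕ => ovrCenter N B + δ ≤ (j : ℝ)), p j * ovr N B j ≤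
      25 * Real.exp 6 * Real.exp (-(δ ^ 2 / (100 * ovrCenter N B))) := by
  have hcN := ovrCenter_le hB
  set c := ovrCenter N B with hc
  obtain ⟨ks, s1, s2, s3⟩ := exists_even_ge (x := c + 14) (by linarith)
  obtain ⟨kh, b1, b2, b3⟩ := exists_even_ge (x := c + δ / 2) (by linarith)
  obtain ⟨kt, t1, t2, t3⟩ := exists_even_ge (x := c + δ) (by linarith)
  have hsh : ks ≤ kh := s3 _ (by linarith)
  have hht : kh ≤ kt := b3 _ (by linarith)
  by_cases hle : 2 * kt ≤ N
  swap
  · rw [Finset.sum_eq_zero]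
    · positivity
    intro j hj
    rw [Finset.mem_filter, Finset.mem_range] at hj
    rcases Nat.even_or_odd j with ⟨i, hi⟩ | ho
    · have := t3 i (by rw [show 2 * i = j by omega]; exact hj.2)
      omega
    · rw [ovr_of_odd ho, mul_zero]
  have hp := h.nonneg
  have hsub : ∑ j ∈ (Finset.range (N + 1)).filter (fun j : ℕ => c + δ ≤ (j : ℝ)), p j * ovr N B j ≤
      ∑ j ∈ Finset.Icc (2 * kt) N, p j * ovr N B j := by
    refine sum_le_sum_of_support (fun j => mul_nonneg (hp j) (ovr_nonneg N B j)) fun j hj hne => ?_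
    rw [Finset.mem_filter, Finset.mem_range] at hj
    rcases Nat.even_or_odd j with ⟨i, hi⟩ | ho
    · have := t3 i (by rw [show 2 * i = j by omega]; exact hj.2)
      rw [Finset.mem_Icc]; omega
    · rw [ovr_of_odd ho, mul_zero] at hne
      exact absurd rfl hne
  obtain ⟨q, hq⟩ := hNe
  have hS := upper_tail hN hB hp h.upper (q - kt) (2 * kt) (by omega) (by linarith)
    (even_two_mul kt)
  have htail := tail_le_chern hp (α := (N : ℝ) / (N + B)) (β := (B : ℝ) / (N + B))
    (by have : 0 < N := by omega
        positivity) (by have : 0 < B := by omega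
                        positivity)
    (by have : 0 < N := by omega
        rw [← add_div, div_self (by positivity)]) h.upper (T := 2 * kt) hle (by
      have e : (N : ℝ) / (N + B) * N = c := by rw [hc]; unfold ovrCenter; ring
      rw [e]; linarith)
  have htail2 := mul_le_mul_of_nonneg_right htail (ovr_nonneg N B (2 * kt))
  change _ ≤ chernOvr N B (2 * kt) * _ at htail2
  have hRs := ovr_near hN hB ⟨q, hq⟩ hBe h400 (T := 2 * ks) (by rw [abs_le]; constructor <;> linarith)
  have d1 := decay_up hN hB (T := 2 * ks) s1 (kh - ks) (by omega)
  rw [show 2 * ks + 2 * (kh - ks) = 2 * kh by omega] at d1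
  have d2 := decay_up hN hB (T := 2 * kh) (by linarith) (kt - kh) (by omega)
  rw [show 2 * kh + 2 * (kt - kh) = 2 * kt by omega, ← hc] at d2
  have hAs : ovr N B (2 * ks) * chernOvr N B (2 * ks) ≤ 5 * Real.exp 6 := by
    have := mul_le_mul hRs (chernOvr_le_one (N := N) (B := B) (T := 2 * ks) (by omega) (by omega))
      (chernOvr_nonneg N B (2 * ks)) (by positivity)
    linarith
  have hE1 : Real.exp (-(((kh - ks : ℕ) : ℝ) * ((1 - ovrCenter N B / ((2 * ks : ℕ) : ℝ)) / 5))) ≤ 1 := by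
    apply Real.exp_le_one_iff.mpr
    have : ovrCenter N B / ((2 * ks : ℕ) : ℝ) ≤ 1 := by
      rw [div_le_one (by linarith)]; linarith
    have : 0 ≤ ((kh - ks : ℕ) : ℝ) * ((1 - ovrCenter N B / ((2 * ks : ℕ) : ℝ)) / 5) :=
      mul_nonneg (Nat.cast_nonneg _) (by linarith)
    linarith
  have hAh : ovr N B (2 * kh) * chernOvr N B (2 * kh) ≤ 5 * Real.exp 6 := by
    have := mul_le_mul hAs hE1 (Real.exp_pos _).le (by positivity)
    linarith
  have hE2 : Real.exp (-(((kt - kh : ℕ) : ℝ) * ((1 - c / ((2 * kh : ℕ) : ℝ)) / 5))) ≤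
      Real.exp (-(δ ^ 2 / (100 * c))) := by
    apply Real.exp_le_exp.mpr
    apply neg_le_neg
    have a1 : δ / 5 ≤ ((kt - kh : ℕ) : ℝ) := by
      rw [Nat.cast_sub hht]; push_cast at *; linarith
    have a2 : δ / (4 * c) ≤ 1 - c / ((2 * kh : ℕ) : ℝ) := by
      have : c / ((2 * kh : ℕ) : ℝ) ≤ c / (c + δ / 2) :=
        div_le_div_of_nonneg_left (by linarith) (by linarith) b1
      have : δ / (4 * c) ≤ 1 - c / (c + δ / 2) := by
        have e : 1 - c / (c + δ / 2) = (δ / 2) / (c + δ / 2) := by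
          field_simp; ring
        rw [e, div_le_div_iff₀ (by linarith) (by linarith)]; nlinarith
      linarith
    have := mul_le_mul a1 (div_le_div_of_nonneg_right a2 (by norm_num : (0:ℝ) ≤ 5))
      (by positivity) (Nat.cast_nonneg _)
    refine le_trans (le_of_eq ?_) this
    field_simp; norm_num
  have hAt := mul_le_mul hAh hE2 (Real.exp_pos _).le (by positivity)
  linarith

lemma sum_lower_le {p : ℕ → ℝ} (h : OvrLaw p N B) {δ : ℝ} (h1 : 60 ≤ δ)
    (h2 : δ ≤ ovrCenter N B / 2) :
    ∑ j ∈ (Finset.range (N + 1)).filter (fun j : ℕ => (j : ℝ) ≤ ovrCenter N B - δ), p j * ovr N B j ≤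
      25 * Real.exp 6 * Real.exp (-(δ ^ 2 / (100 * ovrCenter N B))) := by
  have hcN := ovrCenter_le hB
  have hN0 : (100:ℝ) ≤ N := by exact_mod_cast hN
  set c := ovrCenter N B with hc
  obtain ⟨ks, s1, s2, s3⟩ := exists_even_le (x := c - 14) (by linarith)
  obtain ⟨kh, b1, b2, b3⟩ := exists_even_le (x := c - δ / 2) (by linarith)
  obtain ⟨kt, t1, t2, t3⟩ := exists_even_le (x := c - δ) (by linarith)
  have hsh : kh ≤ ks := s3 _ (by linarith)
  have hht : kt ≤ kh := b3 _ (by linarith)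
  have hksN : 2 * ks ≤ N := by
    have : ((2 * ks : ℕ) : ℝ) ≤ N := by linarith
    exact_mod_cast this
  have hp := h.nonneg
  have hlow : ∀ T : ℕ, (T : ℝ) ≤ c → ∑ j ∈ Finset.range (T + 1), p j ≤ chernOvr N B T := by
    intro T hT
    refine h.lower_le (by omega) (by omega) ?_ hT
    have : (T : ℝ) ≤ N := by linarith
    exact_mod_cast this
  have hsub : ∑ j ∈ (Finset.range (N + 1)).filter (fun j : ℕ => (j : ℝ) ≤ c - δ), p j * ovr N B j ≤
      ∑ j ∈ Finset.range (2 * kt + 1), p j * ovr N B j := by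
    refine sum_le_sum_of_support (fun j => mul_nonneg (hp j) (ovr_nonneg N B j)) fun j hj hne => ?_
    rw [Finset.mem_filter, Finset.mem_range] at hj
    rcases Nat.even_or_odd j with ⟨i, hi⟩ | ho
    · have := t3 i (by rw [show 2 * i = j by omega]; exact hj.2)
      rw [Finset.mem_range]; omega
    · rw [ovr_of_odd ho, mul_zero] at hne
      exact absurd rfl hne
  have hS := lower_tail hN hB hp hlow kt (by linarith)
  have htail := hlow (2 * kt) (by linarith)
  have htail2 := mul_le_mul_of_nonneg_right htail (ovr_nonneg N B (2 * kt))
  have hRs := ovr_near hN hB hNe hBe h400 (T := 2 * ks) (by rw [abs_le]; constructor <;> linarith)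
  have d1 := decay_down hN hB (ks - kh) (2 * kh) (by
    rw [show 2 * kh + 2 * (ks - kh) = 2 * ks by omega]; linarith)
  rw [show 2 * kh + 2 * (ks - kh) = 2 * ks by omega] at d1
  have d2 := decay_down hN hB (kh - kt) (2 * kt) (by
    rw [show 2 * kt + 2 * (kh - kt) = 2 * kh by omega]; linarith)
  rw [show 2 * kt + 2 * (kh - kt) = 2 * kh by omega, ← hc] at d2
  have hAs : ovr N B (2 * ks) * chernOvr N B (2 * ks) ≤ 5 * Real.exp 6 := by
    have := mul_le_mul hRs (chernOvr_le_one (N := N) (B := B) (T := 2 * ks) (by omega) (by omega))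
      (chernOvr_nonneg N B (2 * ks)) (by positivity)
    linarith
  have hE1 : Real.exp (-(((ks - kh : ℕ) : ℝ) * ((1 - ((2 * ks : ℕ) : ℝ) / ovrCenter N B) / 5))) ≤ 1 := by
    apply Real.exp_le_one_iff.mpr
    have : ((2 * ks : ℕ) : ℝ) / ovrCenter N B ≤ 1 := by
      rw [div_le_one (by linarith)]; linarith
    have : 0 ≤ ((ks - kh : ℕ) : ℝ) * ((1 - ((2 * ks : ℕ) : ℝ) / ovrCenter N B) / 5) :=
      mul_nonneg (Nat.cast_nonneg _) (by linarith)
    linarith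
  have hAh : ovr N B (2 * kh) * chernOvr N B (2 * kh) ≤ 5 * Real.exp 6 := by
    have := mul_le_mul hAs hE1 (Real.exp_pos _).le (by positivity)
    linarith
  have hE2 : Real.exp (-(((kh - kt : ℕ) : ℝ) * ((1 - ((2 * kh : ℕ) : ℝ) / c) / 5))) ≤
      Real.exp (-(δ ^ 2 / (100 * c))) := by
    apply Real.exp_le_exp.mpr
    apply neg_le_neg
    have a1 : δ / 5 ≤ ((kh - kt : ℕ) : ℝ) := by
      rw [Nat.cast_sub hht]; push_cast at *; linarith
    have a2 : δ / (4 * c) ≤ 1 - ((2 * kh : ℕ) : ℝ) / c := by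
      rw [le_sub_iff_add_le, div_add_div _ _ (by linarith) (by linarith),
        div_le_one (by nlinarith)]
      nlinarith
    have := mul_le_mul a1 (div_le_div_of_nonneg_right a2 (by norm_num : (0:ℝ) ≤ 5))
      (by positivity) (Nat.cast_nonneg _)
    refine le_trans (le_of_eq ?_) this
    field_simp; norm_num
  have hAt := mul_le_mul hAh hE2 (Real.exp_pos _).le (by positivity)
  linarith

lemma sum_far_le {p : ℕ → ℝ} (h : OvrLaw p N B) {δ : ℝ} (h1 : 60 ≤ δ)
    (h2 : δ ≤ ovrCenter N B / 2) :
    ∑ j ∈ (Finset.range (N + 1)).filter (fun j : ℕ => ¬ |(j : ℝ) - ovrCenter N B| < δ),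
      p j * ovr N B j ≤ 50 * Real.exp 6 * Real.exp (-(δ ^ 2 / (100 * ovrCenter N B))) := by
  have a1 := sum_upper_le hN hB hNe hBe h400 h h1 h2
  have a2 := sum_lower_le hN hB hNe hBe h400 h h1 h2
  rw [Finset.sum_filter] at *
  have : ∑ j ∈ Finset.range (N + 1),
      (if ¬ |(j : ℝ) - ovrCenter N B| < δ then p j * ovr N B j else 0) ≤
      ∑ j ∈ Finset.range (N + 1), ((if ovrCenter N B + δ ≤ (j : ℝ) then p j * ovr N B j else 0) +
        (if (j : ℝ) ≤ ovrCenter N B - δ then p j * ovr N B j else 0)) := by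
    refine Finset.sum_le_sum fun j _ => ?_
    have hj := mul_nonneg (h.nonneg j) (ovr_nonneg N B j)
    by_cases hc : |(j : ℝ) - ovrCenter N B| < δ
    · rw [if_neg (not_not.mpr hc)]; positivity
    · rw [if_pos hc]
      push Not at hc
      rcases le_abs.mp hc with hh | hh
      · rw [if_pos (by linarith : ovrCenter N B + δ ≤ (j : ℝ))]
        split_ifs <;> linarith
      · rw [if_pos (by linarith : (j : ℝ) ≤ ovrCenter N B - δ)]
        split_ifs <;> linarith
  rw [Finset.sum_add_distrib] at this
  linarith

end

end RegSum

namespace RegSum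

section
variable {ι S : Type*} [Fintype ι] [Fintype S] [DecidableEq ι]

/-- Expectation of `F` under the product over `ι` of the (possibly unnormalised) weight `w`. -/
noncomputable def pexp (ι : Type*) [Fintype ι] [DecidableEq ι] (w : S → ℝ) (F : (ι → S) → ℝ) : ℝ :=
  ∑ τ : ι → S, (∏ v, w (τ v)) * F τ

lemma pexp_prod (w f : S → ℝ) :
    pexp ι w (fun τ => ∏ v, f (τ v)) = (∑ s, w s * f s) ^ Fintype.card ι := by
  unfold pexp
  have := Finset.prod_univ_sum (fun _ : ι => (Finset.univ : Finset S)) (fun _ s => w s * f s)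
  rw [Finset.prod_const, Finset.card_univ] at this
  rw [this, Fintype.piFinset_univ]
  exact Finset.sum_congr rfl fun τ _ => Finset.prod_mul_distrib.symm

lemma pexp_const {w : S → ℝ} (hw : ∑ s, w s = 1) (c : ℝ) : pexp ι w (fun _ => c) = c := by
  have := pexp_prod (ι := ι) w (fun _ => 1)
  simp only [Finset.prod_const_one, mul_one, hw, one_pow] at this
  unfold pexp at *
  rw [← Finset.sum_mul]
  simp only [mul_one] at this
  rw [this, one_mul]

lemma pexp_add (w : S → ℝ) (F G : (ι → S) → ℝ) :
    pexp ι w (fun τ => F τ + G τ) = pexp ι w F + pexp ι w G := by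
  unfold pexp; rw [← Finset.sum_add_distrib]; simp only [mul_add]

lemma pexp_sub (w : S → ℝ) (F G : (ι → S) → ℝ) :
    pexp ι w (fun τ => F τ - G τ) = pexp ι w F - pexp ι w G := by
  unfold pexp; rw [← Finset.sum_sub_distrib]; simp only [mul_sub]

lemma pexp_mul_left (w : S → ℝ) (c : ℝ) (F : (ι → S) → ℝ) :
    pexp ι w (fun τ => c * F τ) = c * pexp ι w F := by
  unfold pexp; rw [Finset.mul_sum]; exact Finset.sum_congr rfl fun τ _ => by ring

lemma pexp_sum {κ : Type*} (s : Finset κ) (w : S → ℝ) (F : κ → (ι → S) → ℝ) :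
    pexp ι w (fun τ => ∑ k ∈ s, F k τ) = ∑ k ∈ s, pexp ι w (F k) := by
  unfold pexp; simp only [Finset.mul_sum]; rw [Finset.sum_comm]

lemma pexp_mono {w : S → ℝ} (hw : ∀ s, 0 ≤ w s) {F G : (ι → S) → ℝ} (h : ∀ τ, F τ ≤ G τ) :
    pexp ι w F ≤ pexp ι w G :=
  Finset.sum_le_sum fun τ _ => mul_le_mul_of_nonneg_left (h τ)
    (Finset.prod_nonneg fun _ _ => hw _)

lemma pexp_nonneg {w : S → ℝ} (hw : ∀ s, 0 ≤ w s) {F : (ι → S) → ℝ} (h : ∀ τ, 0 ≤ F τ) :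
    0 ≤ pexp ι w F :=
  Finset.sum_nonneg fun τ _ => mul_nonneg (Finset.prod_nonneg fun _ _ => hw _) (h τ)

lemma pexp_resample {w : S → ℝ} (hw : ∑ s, w s = 1) (v : ι) (F : (ι → S) → ℝ) :
    pexp ι w (fun τ => ∑ s, w s * F (Function.update τ v s)) = pexp ι w F := by
  have key : ∀ (τ : ι → S) (s : S),
      w (τ v) * ∏ u, w (Function.update τ v s u) = w s * ∏ u, w (τ u) := by
    intro τ s
    rw [← Finset.mul_prod_erase _ _ (Finset.mem_univ v),
      ← Finset.mul_prod_erase _ (fun u => w (τ u)) (Finset.mem_univ v), Function.update_self]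
    rw [Finset.prod_congr rfl (g := fun u => w (τ u)) (fun u hu => by
      rw [Function.update_of_ne (Finset.ne_of_mem_erase hu)])]
    ring
  unfold pexp
  calc _ = ∑ x : (ι → S) × S, (w x.2 * ∏ u, w (x.1 u)) * F (Function.update x.1 v x.2) := by
        rw [Fintype.sum_prod_type]
        refine Finset.sum_congr rfl fun τ _ => ?_
        rw [Finset.mul_sum]
        exact Finset.sum_congr rfl fun s _ => by ring
    _ = ∑ x : (ι → S) × S, (w x.2 * ∏ u, w (x.1 u)) * F x.1 := by
        refine Finset.sum_nbij' (fun x => (Function.update x.1 v x.2, x.1 v))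
          (fun x => (Function.update x.1 v x.2, x.1 v)) ?_ ?_ ?_ ?_ ?_
        · simp
        · simp
        · intro x _; simp
        · intro x _; simp
        · intro x _
          simp only
          rw [key]
    _ = _ := by
        rw [Fintype.sum_prod_type]
        refine Finset.sum_congr rfl fun τ _ => ?_
        simp only [← Finset.sum_mul, hw, one_mul]

lemma pexp_congr_coord {w : S → ℝ} (hw : ∑ s, w s = 1) (v : ι) {F G : (ι → S) → ℝ}
    (h : ∀ τ, ∑ s, w s * F (Function.update τ v s) = ∑ s, w s * G (Function.update τ v s)) :
    pexp ι w F = pexp ι w G := by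
  rw [← pexp_resample hw v F, ← pexp_resample hw v G]
  simp only [h]

lemma pexp_coord {w : S → ℝ} (hw : ∑ s, w s = 1) (v : ι) (f : S → ℝ) :
    pexp ι w (fun τ => f (τ v)) = ∑ s, w s * f s := by
  rw [← pexp_resample hw v]
  simp only [Function.update_self]
  exact pexp_const hw _

lemma pexp_mul_coord_eq_zero {w : S → ℝ} (hw : ∑ s, w s = 1) {u v : ι} (huv : u ≠ v) {f : S → ℝ}
    (hf : ∑ s, w s * f s = 0) (g : S → ℝ) : pexp ι w (fun τ => f (τ u) * g (τ v)) = 0 := by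
  rw [← pexp_resample hw u]
  simp only [Function.update_self, Function.update_of_ne huv.symm, ← mul_assoc, ← Finset.sum_mul,
    hf, zero_mul]
  exact pexp_const hw 0

lemma pexp_sum_coord {w : S → ℝ} (hw : ∑ s, w s = 1) (f : S → ℝ) :
    pexp ι w (fun τ => ∑ v, f (τ v)) = Fintype.card ι * ∑ s, w s * f s := by
  rw [pexp_sum, Finset.sum_congr rfl (fun v _ => pexp_coord hw v f), Finset.sum_const,
    Finset.card_univ, nsmul_eq_mul]

lemma pexp_sq_sum_coord {w : S → ℝ} (hw : ∑ s, w s = 1) {f : S → ℝ} (hf : ∑ s, w s * f s = 0) :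
    pexp ι w (fun τ => (∑ v, f (τ v)) ^ 2) = Fintype.card ι * ∑ s, w s * f s ^ 2 := by
  have : (fun τ : ι → S => (∑ v, f (τ v)) ^ 2) =
      fun τ => ∑ u, ∑ v, f (τ u) * f (τ v) := by
    funext τ; rw [sq, Finset.sum_mul_sum]
  rw [this, pexp_sum]
  simp_rw [pexp_sum]
  rw [Finset.sum_congr rfl (g := fun _ => ∑ s, w s * f s ^ 2), Finset.sum_const, Finset.card_univ,
    nsmul_eq_mul]
  intro u _
  rw [Finset.sum_eq_single u]
  · rw [← pexp_coord hw u (fun s => f s ^ 2)]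
    simp only [sq]
  · intro v _ hv
    exact pexp_mul_coord_eq_zero hw hv.symm hf f
  · simp

end

end RegSum

namespace RegSum

lemma descFactorial_mul_pow_le {K D : ℕ} (h : K ≤ D) (j : ℕ) :
    K.descFactorial j * D ^ j ≤ D.descFactorial j * K ^ j := by
  induction j with
  | zero => simp
  | succ j ih =>
    rw [Nat.descFactorial_succ, Nat.descFactorial_succ]
    have h1 : (K - j) * D ≤ (D - j) * K := by
      rw [Nat.sub_mul, Nat.sub_mul, mul_comm D K]
      exact Nat.sub_le_sub_left (Nat.mul_le_mul_left j h) _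
    calc _ = ((K - j) * D) * (K.descFactorial j * D ^ j) := by ring
      _ ≤ ((D - j) * K) * (D.descFactorial j * K ^ j) := Nat.mul_le_mul h1 ih
      _ = _ := by ring

lemma choose_mul_pow_le {K D : ℕ} (h : K ≤ D) (j : ℕ) :
    K.choose j * D ^ j ≤ D.choose j * K ^ j := by
  have := descFactorial_mul_pow_le h j
  rw [Nat.descFactorial_eq_factorial_mul_choose, Nat.descFactorial_eq_factorial_mul_choose,
    mul_assoc, mul_assoc] at this
  exact Nat.le_of_mul_le_mul_left this j.factorial_pos

lemma sum_choose_choose (K K' a j : ℕ) (hj : j ≤ a) :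
    ∑ k ∈ Finset.range (a + 1), K.choose k * k.choose j * K'.choose (a - k) =
      K.choose j * (K + K' - j).choose (a - j) := by
  rcases lt_or_ge K j with h | h
  · rw [Nat.choose_eq_zero_of_lt h, zero_mul]
    refine Finset.sum_eq_zero fun k _ => ?_
    rcases lt_or_ge k j with h2 | h2
    · rw [Nat.choose_eq_zero_of_lt h2]; simp
    · rw [Nat.choose_eq_zero_of_lt (lt_of_lt_of_le h h2)]; simp
  · rw [show K + K' - j = (K - j) + K' by omega, Nat.add_choose_eq,
      Finset.Nat.sum_antidiagonal_eq_sum_range_succ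
        (fun x y => (K - j).choose x * K'.choose y), Finset.mul_sum]
    rw [show a + 1 = j + (a - j).succ by omega, Finset.sum_range_add]
    rw [Finset.sum_eq_zero, zero_add]
    · refine Finset.sum_congr rfl fun i _ => ?_
      rw [Nat.choose_mul (by omega), show j + i - j = i by omega,
        show a - (j + i) = a - j - i by omega, mul_assoc]
    · intro k hk
      rw [Nat.choose_eq_zero_of_lt (Finset.mem_range.mp hk)]; simp

lemma sum_choose_mul_pow_le (K K' a : ℕ) (hD : 0 < K + K') {x : ℝ} (hx : 1 ≤ x) :
    ∑ k ∈ Finset.range (a + 1), (K.choose k : ℝ) * K'.choose (a - k) * x ^ k ≤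
      (K + K').choose a * ((K' + K * x) / (K + K')) ^ a := by
  obtain ⟨y, hy, rfl⟩ : ∃ y : ℝ, 0 ≤ y ∧ x = y + 1 := ⟨x - 1, by linarith, by ring⟩
  have hD' : (0 : ℝ) < K + K' := by exact_mod_cast hD
  have e1 : ∀ k ∈ Finset.range (a + 1), (K.choose k : ℝ) * K'.choose (a - k) * (y + 1) ^ k =
      ∑ j ∈ Finset.range (a + 1),
        ((K.choose k * k.choose j * K'.choose (a - k) : ℕ) : ℝ) * y ^ j := by
    intro k hk
    have : (y + 1) ^ k = ∑ j ∈ Finset.range (a + 1), y ^ j * (k.choose j : ℝ) := by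
      rw [add_pow]
      simp only [one_pow, mul_one]
      refine Finset.sum_subset ?_ ?_
      · intro j hj; simp only [Finset.mem_range] at *; omega
      · intro j _ hj
        rw [Nat.choose_eq_zero_of_lt]; · simp
        simp only [Finset.mem_range] at *; omega
    rw [this, Finset.mul_sum]
    refine Finset.sum_congr rfl fun j _ => ?_
    push_cast; ring
  rw [Finset.sum_congr rfl e1, Finset.sum_comm]
  have e2 : ((K' + K * (y + 1)) / (K + K') : ℝ) = (K / (K + K')) * y + 1 := by
    field_simp; ring
  rw [e2, add_pow, Finset.mul_sum]
  refine Finset.sum_le_sum fun j hj => ?_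
  have hj : j ≤ a := by simp only [Finset.mem_range] at hj; omega
  rw [← Finset.sum_mul, ← Nat.cast_sum, sum_choose_choose _ _ _ _ hj]
  have h1 : ((K + K').choose a * a.choose j : ℕ) = ((K + K').choose j * (K + K' - j).choose (a - j)) :=
    Nat.choose_mul hj
  have h2 : (K.choose j : ℝ) ≤ (K + K').choose j * (K / (K + K')) ^ j := by
    rw [div_pow, mul_div_assoc', le_div_iff₀ (by positivity)]
    exact_mod_cast choose_mul_pow_le (Nat.le_add_right K K') j
  have h1' : ((K + K').choose a : ℝ) * a.choose j =
      (K + K').choose j * (K + K' - j).choose (a - j) := by exact_mod_cast h1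
  calc _ ≤ ((K + K').choose j * (K / (K + K')) ^ j) * (K + K' - j).choose (a - j) * y ^ j := by
        push_cast
        gcongr
    _ = ((K + K').choose j * (K + K' - j).choose (a - j)) * (K / (K + K')) ^ j * y ^ j := by ring
    _ = _ := by rw [← h1', mul_pow, one_pow]; ring

section
variable {ι : Type*} [Fintype ι] [DecidableEq ι]

/-- The hypergeometric weight on `Fin (a+1)`. -/
noncomputable def hypW (a b : ℕ) (s : Fin (a + 1)) : ℝ := hyp a b s

lemma hypW_nonneg (a b : ℕ) (s : Fin (a + 1)) : 0 ≤ hypW a b s := hyp_nonneg _ _ _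

lemma sum_hypW_mul (a b : ℕ) (f : ℕ → ℝ) :
    ∑ s : Fin (a + 1), hypW a b s * f s = ∑ k ∈ Finset.range (a + 1), hyp a b k * f k :=
  (Finset.sum_range (fun k => hyp a b k * f k)).symm

lemma sum_hypW (a b : ℕ) : ∑ s, hypW a b s = 1 := by
  have := sum_hypW_mul a b (fun _ => 1)
  simp only [mul_one] at this
  rw [this, sum_hyp]

/-- The sum of the coordinates. -/
def coordSum {a : ℕ} (τ : ι → Fin (a + 1)) : ℕ := ∑ v, (τ v : ℕ)

omit [DecidableEq ι] in
lemma coordSum_le {a : ℕ} (τ : ι → Fin (a + 1)) : coordSum τ ≤ a * Fintype.card ι := by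
  unfold coordSum
  calc _ ≤ ∑ _v : ι, a := Finset.sum_le_sum fun v _ => by omega
    _ = _ := by rw [Finset.sum_const, Finset.card_univ, smul_eq_mul, mul_comm]

/-- The law of `coordSum`. -/
noncomputable def sumLaw (ι : Type*) [Fintype ι] [DecidableEq ι] (a b j : ℕ) : ℝ :=
  pexp ι (hypW a b) (fun τ => if coordSum τ = j then 1 else 0)

lemma sum_sumLaw (a b : ℕ) (f : ℕ → ℝ) :
    ∑ j ∈ Finset.range (a * Fintype.card ι + 1), sumLaw ι a b j * f j =
      pexp ι (hypW a b) (fun τ => f (coordSum τ)) := by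
  unfold sumLaw
  simp_rw [mul_comm _ (f _), ← pexp_mul_left]
  rw [← pexp_sum]
  congr 1
  funext τ
  rw [Finset.sum_eq_single (coordSum τ)]
  · simp
  · intro j _ hj; rw [if_neg hj.symm, mul_zero]
  · intro h; exact absurd (Finset.mem_range.mpr (Nat.lt_succ_of_le (coordSum_le τ))) h

lemma sum_hyp_mul_pow_le {a b : ℕ} (hab : 0 < a + b) {x : ℝ} (hx : 1 ≤ x) :
    ∑ k ∈ Finset.range (a + 1), hyp a b k * x ^ k ≤ ((b + a * x) / (a + b)) ^ a := by
  have h := sum_choose_mul_pow_le a b a hab hx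
  have hpos : (0:ℝ) < (a + b).choose a := by exact_mod_cast Nat.choose_pos (by omega)
  unfold hyp
  calc _ = (∑ k ∈ Finset.range (a + 1), (a.choose k : ℝ) * b.choose (a - k) * x ^ k) /
        (a + b).choose a := by
        rw [Finset.sum_div]; exact Finset.sum_congr rfl fun k _ => by ring
    _ ≤ _ := by rw [div_le_iff₀ hpos, mul_comm]; exact h

lemma sum_hyp_mul_pow_sub_le {a b : ℕ} (hab : 0 < a + b) {x : ℝ} (hx : 1 ≤ x) :
    ∑ k ∈ Finset.range (a + 1), hyp a b k * x ^ (a - k) ≤ ((a + b * x) / (a + b)) ^ a := by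
  have h := sum_choose_mul_pow_le b a a (by omega) hx
  have hpos : (0:ℝ) < (a + b).choose a := by exact_mod_cast Nat.choose_pos (by omega)
  unfold hyp
  calc _ = (∑ k ∈ Finset.range (a + 1), (a.choose k : ℝ) * b.choose (a - k) * x ^ (a - k)) /
        (a + b).choose a := by
        rw [Finset.sum_div]; exact Finset.sum_congr rfl fun k _ => by ring
    _ = (∑ k ∈ Finset.range (a + 1), (b.choose k : ℝ) * a.choose (a - k) * x ^ k) /
        (a + b).choose a := by
        congr 1
        rw [← Finset.sum_range_reflect]
        refine Finset.sum_congr rfl fun k hk => ?_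
        have hk : k ≤ a := by simp only [Finset.mem_range] at hk; omega
        rw [show a + 1 - 1 - k = a - k by omega, show a - (a - k) = k by omega]
        ring
    _ ≤ _ := by
        rw [div_le_iff₀ hpos, mul_comm]
        rw [add_comm b a, add_comm (b:ℝ) a] at h
        exact h

lemma ovrLaw_sumLaw {a b : ℕ} (ha : 0 < a) (hι : 0 < Fintype.card ι) :
    OvrLaw (sumLaw ι a b) (a * Fintype.card ι) (b * Fintype.card ι) := by
  have ha' : (0:ℝ) < a := by exact_mod_cast ha
  have hι' : (0:ℝ) < Fintype.card ι := by exact_mod_cast hι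
  refine ⟨fun j => pexp_nonneg (hypW_nonneg a b) fun τ => by split_ifs <;> simp, ?_, ?_, ?_⟩
  · have := sum_sumLaw (ι := ι) a b (fun _ => 1)
    simp only [mul_one] at this
    rw [this, pexp_const (sum_hypW a b)]
  · intro x hx
    rw [sum_sumLaw]
    unfold coordSum
    simp_rw [← Finset.prod_pow_eq_pow_sum]
    rw [pexp_prod _ (fun s : Fin (a + 1) => x ^ (s : ℕ)), sum_hypW_mul a b (fun k => x ^ k), pow_mul]
    refine pow_le_pow_left₀ (Finset.sum_nonneg fun k _ => mul_nonneg (hyp_nonneg _ _ _)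
      (by positivity)) ?_ _
    refine (sum_hyp_mul_pow_le (by omega) hx).trans (le_of_eq ?_)
    congr 1
    push_cast; field_simp
  · intro x hx
    have e : ∑ j ∈ Finset.range (a * Fintype.card ι + 1),
        sumLaw ι a b (a * Fintype.card ι - j) * x ^ j =
        ∑ j ∈ Finset.range (a * Fintype.card ι + 1),
        sumLaw ι a b j * x ^ (a * Fintype.card ι - j) := by
      rw [← Finset.sum_range_reflect]
      refine Finset.sum_congr rfl fun k hk => ?_
      have hk : k ≤ a * Fintype.card ι := by simp only [Finset.mem_range] at hk; omega
      rw [show a * Fintype.card ι + 1 - 1 - k = a * Fintype.card ι - k by omega,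
        show a * Fintype.card ι - (a * Fintype.card ι - k) = k by omega]
    rw [e, sum_sumLaw a b (fun j => x ^ (a * Fintype.card ι - j))]
    have e2 : ∀ τ : ι → Fin (a + 1), a * Fintype.card ι - coordSum τ = ∑ v, (a - (τ v : ℕ)) := by
      intro τ
      have : ∑ v, (a - (τ v : ℕ)) + coordSum τ = a * Fintype.card ι := by
        unfold coordSum
        rw [← Finset.sum_add_distrib, Finset.sum_congr rfl (g := fun _ => a)
          (fun v _ => by have := (τ v).2; omega), Finset.sum_const, Finset.card_univ, smul_eq_mul,
          mul_comm]
      omega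
    simp_rw [e2, ← Finset.prod_pow_eq_pow_sum]
    rw [pexp_prod _ (fun s : Fin (a + 1) => x ^ (a - (s : ℕ))),
      sum_hypW_mul a b (fun k => x ^ (a - k)), pow_mul]
    refine pow_le_pow_left₀ (Finset.sum_nonneg fun k _ => mul_nonneg (hyp_nonneg _ _ _)
      (by positivity)) ?_ _
    refine (sum_hyp_mul_pow_sub_le (by omega) hx).trans (le_of_eq ?_)
    congr 1
    push_cast; field_simp

end

end RegSum

namespace RegSum

lemma hyp_pos {N B T : ℕ} (hNB : N ≤ B) (hT : T ≤ N) : 0 < hyp N B T := by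
  unfold hyp
  have h1 := Nat.choose_pos hT
  have h2 := Nat.choose_pos (show N - T ≤ B by omega)
  have h3 := Nat.choose_pos (Nat.le_add_right N B)
  positivity

lemma hyp_swap {a b : ℕ} (hab : a ≤ b) (F : ℕ → ℝ) :
    ∑ k ∈ Finset.range (a + 1), hyp a b k * (((a : ℝ) - k) ^ 2 * F (k + 1)) =
      ∑ k ∈ Finset.range (a + 1), hyp a b k * (k * ((b : ℝ) - a + k) * F k) := by
  rw [Finset.sum_range_succ (fun k => hyp a b k * (((a : ℝ) - k) ^ 2 * F (k + 1))),
    Finset.sum_range_succ' (fun k => hyp a b k * (k * ((b : ℝ) - a + k) * F k))]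
  simp only [sub_self, Nat.cast_zero]
  have : ∀ k ∈ Finset.range a, hyp a b k * (((a : ℝ) - k) ^ 2 * F (k + 1)) =
      hyp a b (k + 1) * ((k + 1 : ℕ) * ((b : ℝ) - a + (k + 1 : ℕ)) * F (k + 1)) := by
    intro k hk
    have := hyp_step hab (show k + 1 ≤ a by simp only [Finset.mem_range] at hk; omega)
    push_cast
    linear_combination -F (k + 1) * this
  rw [Finset.sum_congr rfl this]
  ring

lemma hyp_mean {a b : ℕ} (hab : a ≤ b) (ha : 0 < a) :
    ∑ k ∈ Finset.range (a + 1), hyp a b k * (k : ℝ) = (a : ℝ) ^ 2 / (a + b) := by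
  have h := hyp_swap hab (fun _ => 1)
  have h0 := sum_hyp a b
  have ha' : (0:ℝ) < a := by exact_mod_cast ha
  rw [← sub_eq_zero, ← Finset.sum_sub_distrib] at h
  have e : ∀ k ∈ Finset.range (a + 1), hyp a b k * (((a : ℝ) - k) ^ 2 * 1) -
      hyp a b k * (k * ((b : ℝ) - a + k) * 1) =
      (a : ℝ) ^ 2 * hyp a b k - (a + b) * (hyp a b k * k) := fun k _ => by ring
  rw [Finset.sum_congr rfl e, Finset.sum_sub_distrib, ← Finset.mul_sum, ← Finset.mul_sum, h0] at h
  field_simp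
  linarith

lemma hyp_variance {a b : ℕ} (hab : a ≤ b) (ha : 0 < a) (hb : 1 < a + b) :
    ∑ k ∈ Finset.range (a + 1), hyp a b k * ((k : ℝ) - (a : ℝ) ^ 2 / (a + b)) ^ 2 =
      (a : ℝ) ^ 2 * b ^ 2 / ((a + b) ^ 2 * (a + b - 1)) := by
  have h := hyp_swap hab (fun k => k)
  have h0 := sum_hyp a b
  have h1 := hyp_mean hab ha
  have ha' : (0:ℝ) < a := by exact_mod_cast ha
  have hb' : (0:ℝ) < a + b - 1 := by
    have : (1:ℝ) < a + b := by exact_mod_cast hb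
    linarith
  rw [← sub_eq_zero, ← Finset.sum_sub_distrib] at h
  have e : ∀ k ∈ Finset.range (a + 1), hyp a b k * (((a : ℝ) - k) ^ 2 * ((k + 1 : ℕ) : ℝ)) -
      hyp a b k * (k * ((b : ℝ) - a + k) * (k : ℝ)) =
      (a : ℝ) ^ 2 * hyp a b k + ((a : ℝ) ^ 2 - 2 * a) * (hyp a b k * k) -
        (a + b - 1) * (hyp a b k * (k : ℝ) ^ 2) := fun k _ => by push_cast; ring
  rw [Finset.sum_congr rfl e, Finset.sum_sub_distrib, Finset.sum_add_distrib, ← Finset.mul_sum,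
    ← Finset.mul_sum, ← Finset.mul_sum, h0, h1] at h
  have e2 : ∀ k ∈ Finset.range (a + 1), hyp a b k * ((k : ℝ) - (a : ℝ) ^ 2 / (a + b)) ^ 2 =
      hyp a b k * (k : ℝ) ^ 2 - (2 * ((a : ℝ) ^ 2 / (a + b))) * (hyp a b k * k) +
        ((a : ℝ) ^ 2 / (a + b)) ^ 2 * hyp a b k := fun k _ => by ring
  rw [Finset.sum_congr rfl e2, Finset.sum_add_distrib, Finset.sum_sub_distrib, ← Finset.mul_sum,
    ← Finset.mul_sum, h0, h1]
  have e3 : ∑ k ∈ Finset.range (a + 1), hyp a b k * (k : ℝ) ^ 2 =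
      ((a : ℝ) ^ 2 * 1 + ((a : ℝ) ^ 2 - 2 * a) * ((a : ℝ) ^ 2 / (a + b))) / (a + b - 1) := by
    rw [eq_div_iff hb'.ne']; linarith
  rw [e3]
  field_simp
  ring

section stein
variable {N B : ℕ} {φ : ℕ → ℝ} {K : ℝ}

lemma sum_hyp_flux_lower (hNB : N ≤ B) {T : ℕ} (hT : T ≤ N) :
    ∑ j ∈ Finset.range T, hyp N B j * (((N : ℝ) - j) ^ 2 - j * ((B : ℝ) - N + j)) =
      hyp N B T * (T * ((B : ℝ) - N + T)) := by
  induction T with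
  | zero => simp
  | succ T ih =>
    rw [Finset.sum_range_succ, ih (by omega)]
    have := hyp_step hNB hT
    push_cast
    linear_combination -this

lemma sum_hyp_flux_upper (hNB : N ≤ B) {T : ℕ} (hT : T ≤ N) :
    ∑ j ∈ Finset.Ico (T + 1) (N + 1), hyp N B j * (j * ((B : ℝ) - N + j) - ((N : ℝ) - j) ^ 2) =
      hyp N B T * ((N : ℝ) - T) ^ 2 := by
  have h1 := sum_hyp_flux_lower hNB hT
  have h2 := sum_hyp_flux_lower hNB (le_refl N)
  have h3 := Finset.sum_range_add_sum_Ico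
    (fun j : ℕ => hyp N B j * (((N : ℝ) - j) ^ 2 - j * ((B : ℝ) - N + j)))
    (show T + 1 ≤ N + 1 by omega)
  rw [Finset.sum_range_succ, Finset.sum_range_succ, h1, h2] at h3
  have h4 : ∑ j ∈ Finset.Ico (T + 1) (N + 1),
      hyp N B j * (j * ((B : ℝ) - N + j) - ((N : ℝ) - j) ^ 2) =
      -∑ j ∈ Finset.Ico (T + 1) (N + 1),
      hyp N B j * (((N : ℝ) - j) ^ 2 - j * ((B : ℝ) - N + j)) := by
    rw [← Finset.sum_neg_distrib]; exact Finset.sum_congr rfl fun j _ => by ring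
  rw [h4]
  simp only [sub_self] at h3
  linarith

lemma hyp_tail_upper (hNB : N ≤ B) {T : ℕ} (hT : T ≤ N) :
    (T * ((B : ℝ) - N + T) - ((N : ℝ) - T) ^ 2) * ∑ j ∈ Finset.Ico (T + 1) (N + 1), hyp N B j ≤
      hyp N B T * ((N : ℝ) - T) ^ 2 := by
  rw [← sum_hyp_flux_upper hNB hT, Finset.mul_sum]
  refine Finset.sum_le_sum fun j hj => ?_
  rw [mul_comm]
  refine mul_le_mul_of_nonneg_left ?_ (hyp_nonneg _ _ _)
  have h1 : (T : ℝ) ≤ j := by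
    have := (Finset.mem_Ico.mp hj).1; exact_mod_cast (by omega : T ≤ j)
  have h2 : (N : ℝ) ≤ B := by exact_mod_cast hNB
  have h3 : (0 : ℝ) ≤ N := by positivity
  have : (j * ((B : ℝ) - N + j) - ((N : ℝ) - j) ^ 2) - (T * ((B : ℝ) - N + T) - ((N : ℝ) - T) ^ 2)
      = (j - T) * (B + N) := by ring
  nlinarith

lemma hyp_tail_lower (hNB : N ≤ B) {T : ℕ} (hT : T ≤ N) :
    (((N : ℝ) - T) ^ 2 - T * ((B : ℝ) - N + T)) * ∑ j ∈ Finset.range T, hyp N B j ≤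
      hyp N B T * (T * ((B : ℝ) - N + T)) := by
  rw [← sum_hyp_flux_lower hNB hT, Finset.mul_sum]
  refine Finset.sum_le_sum fun j hj => ?_
  rw [mul_comm]
  refine mul_le_mul_of_nonneg_left ?_ (hyp_nonneg _ _ _)
  have h1 : (j : ℝ) ≤ T := by
    have := Finset.mem_range.mp hj; exact_mod_cast (by omega : j ≤ T)
  have h2 : (N : ℝ) ≤ B := by exact_mod_cast hNB
  have h3 : (0 : ℝ) ≤ N := by positivity
  have : (j * ((B : ℝ) - N + j) - ((N : ℝ) - j) ^ 2) - (T * ((B : ℝ) - N + T) - ((N : ℝ) - T) ^ 2)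
      = (j - T) * (B + N) := by ring
  nlinarith

/-- The solution of the Stein equation for the hypergeometric law. -/
noncomputable def steinSol (N B : ℕ) (ψ : ℕ → ℝ) : ℕ → ℝ
  | 0 => 0
  | T + 1 => (∑ j ∈ Finset.range (T + 1), hyp N B j * ψ j) / (hyp N B T * ((N : ℝ) - T) ^ 2)

variable {ψ : ℕ → ℝ}

lemma steinSol_mul (hNB : N ≤ B) {T : ℕ} (hT : T ≤ N) :
    hyp N B T * (T * ((B : ℝ) - N + T)) * steinSol N B ψ T = ∑ j ∈ Finset.range T, hyp N B j * ψ j := by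
  cases T with
  | zero => simp
  | succ T =>
    have h := hyp_step hNB hT
    have hp := hyp_pos hNB (show T ≤ N by omega)
    have h1 : (0:ℝ) < (N : ℝ) - T := by
      rw [sub_pos]; exact_mod_cast (by omega : T < N)
    push_cast
    rw [h, steinSol]
    field_simp

lemma steinSol_succ_mul (hNB : N ≤ B) (hψ : ∑ j ∈ Finset.range (N + 1), hyp N B j * ψ j = 0)
    {T : ℕ} (hT : T ≤ N) :
    hyp N B T * ((N : ℝ) - T) ^ 2 * steinSol N B ψ (T + 1) =
      ∑ j ∈ Finset.range (T + 1), hyp N B j * ψ j := by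
  rcases Nat.lt_or_ge T N with h | h
  · have hp := hyp_pos hNB hT
    have h1 : (0:ℝ) < (N : ℝ) - T := by rw [sub_pos]; exact_mod_cast h
    rw [steinSol]; field_simp
  · obtain rfl : T = N := le_antisymm hT h
    rw [hψ]; simp

lemma steinSol_eq (hNB : N ≤ B) (hψ : ∑ j ∈ Finset.range (N + 1), hyp N B j * ψ j = 0)
    {T : ℕ} (hT : T ≤ N) :
    ((N : ℝ) - T) ^ 2 * steinSol N B ψ (T + 1) - T * ((B : ℝ) - N + T) * steinSol N B ψ T = ψ T := by
  have h1 := steinSol_mul (ψ := ψ) hNB hT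
  have h2 := steinSol_succ_mul hNB hψ hT
  rw [Finset.sum_range_succ] at h2
  have hp := hyp_pos hNB hT
  apply mul_left_cancel₀ hp.ne'
  linarith

lemma abs_sum_hyp_mul_le {s : Finset ℕ} (hK : ∀ j, |ψ j| ≤ K) :
    |∑ j ∈ s, hyp N B j * ψ j| ≤ K * ∑ j ∈ s, hyp N B j := by
  refine (Finset.abs_sum_le_sum_abs _ _).trans ?_
  rw [Finset.mul_sum]
  refine Finset.sum_le_sum fun j _ => ?_
  rw [abs_mul, abs_of_nonneg (hyp_nonneg _ _ _), mul_comm]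
  exact mul_le_mul_of_nonneg_right (hK j) (hyp_nonneg _ _ _)

lemma abs_steinSol_diff_le (hNB : N ≤ B) (hψ : ∑ j ∈ Finset.range (N + 1), hyp N B j * ψ j = 0)
    (hK : ∀ j, |ψ j| ≤ K) {T : ℕ} (hT0 : 0 < T) (hT : T < N) :
    |steinSol N B ψ (T + 1) - steinSol N B ψ T| ≤ 8 * K / (N : ℝ) ^ 2 := by
  have hK0 : 0 ≤ K := (abs_nonneg _).trans (hK 0)
  have hp := hyp_pos hNB hT.le
  have hT0' : (0:ℝ) < T := by exact_mod_cast hT0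
  have hT' : (T:ℝ) < N := by exact_mod_cast hT
  have hNB' : (N:ℝ) ≤ B := by exact_mod_cast hNB
  have h1 := steinSol_mul (ψ := ψ) hNB hT.le
  have h2 := steinSol_succ_mul hNB hψ hT.le
  have h3 := steinSol_eq hNB hψ hT.le
  have hup := hyp_tail_upper hNB hT.le
  have hlo := hyp_tail_lower hNB hT.le
  set g1 := steinSol N B ψ (T + 1)
  set g0 := steinSol N B ψ T
  have hu : 0 < ((N : ℝ) - T) ^ 2 := by
    have : (0:ℝ) < N - T := by linarith
    positivity
  have hd : 0 < (T : ℝ) * ((B : ℝ) - N + T) := mul_pos hT0' (by linarith)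
  have hmax : (N:ℝ) ^ 2 / 4 ≤ ((N : ℝ) - T) ^ 2 ∨ (N:ℝ) ^ 2 / 4 ≤ (T : ℝ) * ((B : ℝ) - N + T) := by
    rcases le_total ((T:ℝ)) (N / 2) with h | h
    · left; nlinarith
    · right; nlinarith
  set u := ((N : ℝ) - T) ^ 2
  set e := (T : ℝ) * ((B : ℝ) - N + T)
  set p := hyp N B T
  have hψT := hK T
  have hN2 : (0:ℝ) < (N:ℝ) ^ 2 := by have : (0:ℝ) < N := by linarith
                                     positivity
  have fin : ∀ m : ℝ, 0 < m → (N:ℝ) ^ 2 / 4 ≤ m → m * |g1 - g0| ≤ 2 * K →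
      |g1 - g0| ≤ 8 * K / (N : ℝ) ^ 2 := by
    intro m hm h5 h6
    rw [le_div_iff₀ hN2]
    have := mul_le_mul_of_nonneg_right h5 (abs_nonneg (g1 - g0))
    linarith
  rcases le_total u e with h | h
  · refine fin e hd (by rcases hmax with h5 | h5 <;> linarith) ?_
    have h4 : |p * u * g1| ≤ K * ∑ j ∈ Finset.Ico (T + 1) (N + 1), hyp N B j := by
      rw [h2, ← abs_neg]
      have := Finset.sum_range_add_sum_Ico (fun j => hyp N B j * ψ j) (show T + 1 ≤ N + 1 by omega)
      rw [hψ] at this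
      rw [show -(∑ j ∈ Finset.range (T + 1), hyp N B j * ψ j) =
        ∑ j ∈ Finset.Ico (T + 1) (N + 1), hyp N B j * ψ j by linarith]
      exact abs_sum_hyp_mul_le hK
    rw [abs_mul, abs_of_pos (mul_pos hp hu)] at h4
    have h5 : (e - u) * |g1| ≤ K := by
      have h6 := mul_le_mul_of_nonneg_left h4 (sub_nonneg.mpr h)
      have h7 := mul_le_mul_of_nonneg_left hup hK0
      have : (p * u) * ((e - u) * |g1|) ≤ (p * u) * K := by linarith
      exact le_of_mul_le_mul_left this (mul_pos hp hu)
    calc e * |g1 - g0| = |(e - u) * g1 + ψ T| := by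
          rw [← abs_of_pos hd, ← abs_mul, abs_of_pos hd, ← h3]; ring_nf
      _ ≤ |(e - u) * g1| + |ψ T| := abs_add_le _ _
      _ ≤ K + K := by rw [abs_mul, abs_of_nonneg (sub_nonneg.mpr h)]; linarith
      _ = _ := by ring
  · refine fin u hu (by rcases hmax with h5 | h5 <;> linarith) ?_
    have h4 : |p * e * g0| ≤ K * ∑ j ∈ Finset.range T, hyp N B j := by
      rw [h1]; exact abs_sum_hyp_mul_le hK
    rw [abs_mul, abs_of_pos (mul_pos hp hd)] at h4
    have h5 : (u - e) * |g0| ≤ K := by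
      have h6 := mul_le_mul_of_nonneg_left h4 (sub_nonneg.mpr h)
      have h7 := mul_le_mul_of_nonneg_left hlo hK0
      have : (p * e) * ((u - e) * |g0|) ≤ (p * e) * K := by linarith
      exact le_of_mul_le_mul_left this (mul_pos hp hd)
    calc u * |g1 - g0| = |-((u - e) * g0) + ψ T| := by
          rw [← abs_of_pos hu, ← abs_mul, abs_of_pos hu, ← h3]; ring_nf
      _ ≤ |-((u - e) * g0)| + |ψ T| := abs_add_le _ _
      _ ≤ K + K := by rw [abs_neg, abs_mul, abs_of_nonneg (sub_nonneg.mpr h)]; linarith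
      _ = _ := by ring

end stein

end RegSum

namespace RegSum

section
variable {ι : Type*} [Fintype ι]

/-- Sum of the squared deviations of the coordinates from their mean. -/
noncomputable def dispersion {a : ℕ} (τ : ι → Fin (a + 1)) : ℝ :=
  ∑ v, (((τ v : ℕ) : ℝ) - (coordSum τ : ℝ) / Fintype.card ι) ^ 2

lemma dispersion_nonneg {a : ℕ} (τ : ι → Fin (a + 1)) : 0 ≤ dispersion τ :=
  Finset.sum_nonneg fun _ _ => sq_nonneg _

lemma cast_coordSum {a : ℕ} (τ : ι → Fin (a + 1)) : (coordSum τ : ℝ) = ∑ v, ((τ v : ℕ) : ℝ) := by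
  unfold coordSum; push_cast; rfl

lemma sum_quadratic {a : ℕ} (hι : 0 < Fintype.card ι) (τ : ι → Fin (a + 1)) (c₀ c₁ : ℝ) :
    Fintype.card ι * ∑ v, (((τ v : ℕ) : ℝ) + c₀) * (((τ v : ℕ) : ℝ) + c₁) =
      (coordSum τ + Fintype.card ι * c₀) * (coordSum τ + Fintype.card ι * c₁) +
        Fintype.card ι * dispersion τ := by
  have hι' : (0:ℝ) < Fintype.card ι := by exact_mod_cast hι
  have e1 : ∑ v, (((τ v : ℕ) : ℝ) + c₀) * (((τ v : ℕ) : ℝ) + c₁) =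
      ∑ v, ((τ v : ℕ) : ℝ) ^ 2 + (c₀ + c₁) * coordSum τ + Fintype.card ι * (c₀ * c₁) := by
    rw [cast_coordSum, Finset.mul_sum, ← Finset.sum_add_distrib, ← nsmul_eq_mul, ← Finset.card_univ,
      ← Finset.sum_const, ← Finset.sum_add_distrib]
    exact Finset.sum_congr rfl fun v _ => by ring
  have e2 : dispersion τ = ∑ v, ((τ v : ℕ) : ℝ) ^ 2 -
      2 * ((coordSum τ : ℝ) / Fintype.card ι) * coordSum τ +
      Fintype.card ι * ((coordSum τ : ℝ) / Fintype.card ι) ^ 2 := by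
    unfold dispersion
    generalize (coordSum τ : ℝ) / Fintype.card ι = m
    rw [cast_coordSum, Finset.mul_sum, ← Finset.sum_sub_distrib, ← nsmul_eq_mul, ← Finset.card_univ,
      ← Finset.sum_const, ← Finset.sum_add_distrib]
    exact Finset.sum_congr rfl fun v _ => by ring
  rw [e1, e2]
  field_simp
  ring

lemma dispersion_le {a : ℕ} (hι : 0 < Fintype.card ι) (τ : ι → Fin (a + 1)) (m : ℝ) :
    dispersion τ = ∑ v, (((τ v : ℕ) : ℝ) - m) ^ 2 -
      (coordSum τ - Fintype.card ι * m) ^ 2 / Fintype.card ι := by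
  have hι' : (0:ℝ) < Fintype.card ι := by exact_mod_cast hι
  have := sum_quadratic hι τ (-m) (-m)
  have e : ∑ v, (((τ v : ℕ) : ℝ) + -m) * (((τ v : ℕ) : ℝ) + -m) =
    ∑ v, (((τ v : ℕ) : ℝ) - m) ^ 2 := Finset.sum_congr rfl fun v _ => by ring
  rw [e] at this
  field_simp
  linarith

lemma dispersion_eq_zero {a : ℕ} (hι : 0 < Fintype.card ι) (τ : ι → Fin (a + 1)) (c : ℕ)
    (h : ∀ v, (τ v : ℕ) = c) : dispersion τ = 0 := by
  have hι' : (0:ℝ) < Fintype.card ι := by exact_mod_cast hι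
  have : (coordSum τ : ℝ) = Fintype.card ι * c := by
    rw [cast_coordSum]; simp [h]
  rw [dispersion_le hι τ c, this]; simp [h]

lemma dispersion_eq_zero_of_coordSum_eq_zero {a : ℕ} (hι : 0 < Fintype.card ι)
    (τ : ι → Fin (a + 1)) (h : coordSum τ = 0) : dispersion τ = 0 := by
  refine dispersion_eq_zero hι τ 0 fun v => ?_
  exact (Finset.sum_eq_zero_iff.mp h) v (Finset.mem_univ v)

lemma dispersion_eq_zero_of_coordSum_eq {a : ℕ} (hι : 0 < Fintype.card ι)
    (τ : ι → Fin (a + 1)) (h : coordSum τ = a * Fintype.card ι) : dispersion τ = 0 := by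
  refine dispersion_eq_zero hι τ a fun v => ?_
  by_contra hv
  have : coordSum τ < ∑ _v : ι, a :=
    Finset.sum_lt_sum (fun u _ => by omega) ⟨v, Finset.mem_univ v, by omega⟩
  rw [Finset.sum_const, Finset.card_univ, smul_eq_mul, mul_comm] at this
  omega

variable [DecidableEq ι]

lemma coordSum_update {a : ℕ} (τ : ι → Fin (a + 1)) (v : ι) (s : Fin (a + 1)) :
    coordSum (Function.update τ v s) = s + ∑ u ∈ Finset.univ.erase v, (τ u : ℕ) := by
  unfold coordSum
  rw [← Finset.add_sum_erase _ _ (Finset.mem_univ v), Function.update_self]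
  congr 1
  exact Finset.sum_congr rfl fun u hu => by
    rw [Function.update_of_ne (Finset.ne_of_mem_erase hu)]

lemma pexp_swap {a b : ℕ} (hab : a ≤ b) (g : ℕ → ℝ) (v : ι) :
    pexp ι (hypW a b) (fun τ => ((a : ℝ) - (τ v : ℕ)) ^ 2 * g (coordSum τ + 1)) =
      pexp ι (hypW a b) (fun τ => (τ v : ℕ) * ((b : ℝ) - a + (τ v : ℕ)) * g (coordSum τ)) := by
  refine pexp_congr_coord (sum_hypW a b) v fun τ => ?_
  simp only [Function.update_self, coordSum_update]
  set R := ∑ u ∈ Finset.univ.erase v, (τ u : ℕ)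
  have h := hyp_swap hab (fun k => g (k + R))
  rw [sum_hypW_mul a b (fun k => ((a : ℝ) - k) ^ 2 * g (k + R + 1)),
    sum_hypW_mul a b (fun k => k * ((b : ℝ) - a + k) * g (k + R)), ← h]
  simp only [add_right_comm]

lemma pexp_stein {a b : ℕ} (hab : a ≤ b) (hι : 0 < Fintype.card ι) (g : ℕ → ℝ) :
    pexp ι (hypW a b) (fun τ =>
      (((a * Fintype.card ι : ℕ) : ℝ) - coordSum τ) ^ 2 * g (coordSum τ + 1) -
      coordSum τ * (((b * Fintype.card ι : ℕ) : ℝ) - (a * Fintype.card ι : ℕ) + coordSum τ) *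
        g (coordSum τ)) =
    -pexp ι (hypW a b) (fun τ => Fintype.card ι * dispersion τ *
      (g (coordSum τ + 1) - g (coordSum τ))) := by
  have h : pexp ι (hypW a b) (fun τ =>
        ∑ v, ((a : ℝ) - (τ v : ℕ)) ^ 2 * g (coordSum τ + 1)) =
      pexp ι (hypW a b) (fun τ =>
        ∑ v, (τ v : ℕ) * ((b : ℝ) - a + (τ v : ℕ)) * g (coordSum τ)) := by
    rw [pexp_sum, pexp_sum]; exact Finset.sum_congr rfl fun v _ => pexp_swap hab g v
  have h2 : (Fintype.card ι : ℝ) * (pexp ι (hypW a b) (fun τ =>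
        ∑ v, ((a : ℝ) - (τ v : ℕ)) ^ 2 * g (coordSum τ + 1)) -
      pexp ι (hypW a b) (fun τ =>
        ∑ v, (τ v : ℕ) * ((b : ℝ) - a + (τ v : ℕ)) * g (coordSum τ))) = 0 := by
    rw [h]; ring
  rw [← pexp_sub, ← pexp_mul_left] at h2
  rw [eq_neg_iff_add_eq_zero, ← pexp_add, ← h2]
  congr 1
  funext τ
  have q1 := sum_quadratic hι τ (-a) (-a)
  have q2 := sum_quadratic hι τ 0 (b - a)
  rw [← Finset.sum_mul, ← Finset.sum_mul]
  have e1 : ∑ v, ((a : ℝ) - (τ v : ℕ)) ^ 2 =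
      ∑ v, (((τ v : ℕ) : ℝ) + -a) * (((τ v : ℕ) : ℝ) + -a) :=
    Finset.sum_congr rfl fun v _ => by ring
  have e2 : ∑ v, ((τ v : ℕ) : ℝ) * ((b : ℝ) - a + (τ v : ℕ)) =
      ∑ v, (((τ v : ℕ) : ℝ) + 0) * (((τ v : ℕ) : ℝ) + (b - a)) :=
    Finset.sum_congr rfl fun v _ => by ring
  rw [e1, e2]
  push_cast
  linear_combination -g (coordSum τ + 1) * q1 + g (coordSum τ) * q2

/-- The sum of `card ι` hypergeometric variables is close in law to one hypergeometric variable. -/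
lemma abs_pexp_sub_hyp_le {a b : ℕ} (hab : a ≤ b) (ha : 0 < a) (hb : 1 < a + b)
    (hι : 0 < Fintype.card ι) {φ : ℕ → ℝ} {K : ℝ} (h0 : ∀ j, 0 ≤ φ j) (hK : ∀ j, φ j ≤ K) :
    |pexp ι (hypW a b) (fun τ => φ (coordSum τ)) -
      ∑ j ∈ Finset.range (a * Fintype.card ι + 1),
        hyp (a * Fintype.card ι) (b * Fintype.card ι) j * φ j| ≤ 8 * K / (a + b - 1) := by
  have hι' : (0:ℝ) < Fintype.card ι := by exact_mod_cast hι
  have ha' : (0:ℝ) < a := by exact_mod_cast ha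
  have hb' : (0:ℝ) < a + b - 1 := by
    have : (1:ℝ) < a + b := by exact_mod_cast hb
    linarith
  have hK0 : 0 ≤ K := (h0 0).trans (hK 0)
  set N := a * Fintype.card ι with hN
  set B := b * Fintype.card ι with hB
  have hNB : N ≤ B := Nat.mul_le_mul_right _ hab
  set μ := ∑ j ∈ Finset.range (N + 1), hyp N B j * φ j with hμ
  have hμ0 : 0 ≤ μ := Finset.sum_nonneg fun j _ => mul_nonneg (hyp_nonneg _ _ _) (h0 j)
  have hμK : μ ≤ K := by
    calc μ ≤ ∑ j ∈ Finset.range (N + 1), hyp N B j * K :=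
          Finset.sum_le_sum fun j _ => mul_le_mul_of_nonneg_left (hK j) (hyp_nonneg _ _ _)
      _ = K := by rw [← Finset.sum_mul, sum_hyp, one_mul]
  set ψ : ℕ → ℝ := fun j => φ j - μ with hψd
  have hψ : ∑ j ∈ Finset.range (N + 1), hyp N B j * ψ j = 0 := by
    simp only [hψd, mul_sub, Finset.sum_sub_distrib, ← Finset.sum_mul, sum_hyp]
    rw [← hμ]; ring
  have hψK : ∀ j, |ψ j| ≤ K := fun j => by
    rw [abs_le]; constructor <;> simp only [hψd] <;> linarith [h0 j, hK j]
  have key := pexp_stein (ι := ι) hab hι (steinSol N B ψ)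
  rw [← hN, ← hB] at key
  have e1 : (fun τ : ι → Fin (a + 1) => ((N : ℝ) - coordSum τ) ^ 2 * steinSol N B ψ (coordSum τ + 1)
      - coordSum τ * ((B : ℝ) - N + coordSum τ) * steinSol N B ψ (coordSum τ)) =
      fun τ => φ (coordSum τ) - μ := by
    funext τ
    rw [steinSol_eq hNB hψ (coordSum_le τ)]
  rw [e1, pexp_sub, pexp_const (sum_hypW a b)] at key
  rw [key, abs_neg]
  set m : ℝ := (a : ℝ) ^ 2 / (a + b)
  have hdisp : ∀ τ : ι → Fin (a + 1), |Fintype.card ι * dispersion τ *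
      (steinSol N B ψ (coordSum τ + 1) - steinSol N B ψ (coordSum τ))| ≤
      (8 * K / (N:ℝ) ^ 2 * Fintype.card ι) * ∑ v, (((τ v : ℕ) : ℝ) - m) ^ 2 := by
    intro τ
    have hd : dispersion τ ≤ ∑ v, (((τ v : ℕ) : ℝ) - m) ^ 2 := by
      rw [dispersion_le hι τ m]
      have : 0 ≤ (coordSum τ - Fintype.card ι * m) ^ 2 / Fintype.card ι := by positivity
      linarith
    have hs : 0 ≤ ∑ v, (((τ v : ℕ) : ℝ) - m) ^ 2 := (dispersion_nonneg τ).trans hd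
    rcases eq_or_ne (coordSum τ) 0 with h | h
    · rw [dispersion_eq_zero_of_coordSum_eq_zero hι τ h]
      simp only [mul_zero, zero_mul, abs_zero]; positivity
    rcases eq_or_lt_of_le (coordSum_le τ) with h2 | h2
    · rw [dispersion_eq_zero_of_coordSum_eq hι τ h2]
      simp only [mul_zero, zero_mul, abs_zero]; positivity
    have := abs_steinSol_diff_le hNB hψ hψK (Nat.pos_of_ne_zero h) h2
    rw [abs_mul, abs_of_nonneg (mul_nonneg hι'.le (dispersion_nonneg τ))]
    calc _ ≤ (Fintype.card ι * ∑ v, (((τ v : ℕ) : ℝ) - m) ^ 2) * (8 * K / (N:ℝ) ^ 2) := by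
          gcongr
      _ = _ := by ring
  calc _ ≤ pexp ι (hypW a b) (fun τ => (8 * K / (N:ℝ) ^ 2 * Fintype.card ι) *
        ∑ v, (((τ v : ℕ) : ℝ) - m) ^ 2) := by
        rw [abs_le]
        constructor
        · rw [neg_le_iff_add_nonneg, ← pexp_add]
          refine pexp_nonneg (hypW_nonneg a b) fun τ => ?_
          linarith [(abs_le.mp (hdisp τ)).1]
        · exact pexp_mono (hypW_nonneg a b) fun τ => (abs_le.mp (hdisp τ)).2
    _ = (8 * K / (N:ℝ) ^ 2 * Fintype.card ι) * (Fintype.card ι *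
          ((a : ℝ) ^ 2 * b ^ 2 / ((a + b) ^ 2 * (a + b - 1)))) := by
        rw [pexp_mul_left, pexp_sum_coord (sum_hypW a b) (fun s => (((s : ℕ) : ℝ) - m) ^ 2),
          sum_hypW_mul a b (fun k => ((k : ℝ) - m) ^ 2), hyp_variance hab ha hb]
    _ = 8 * K * ((b:ℝ) ^ 2 / (a + b) ^ 2) / (a + b - 1) := by
        rw [hN]; push_cast; field_simp
    _ ≤ 8 * K * 1 / (a + b - 1) := by
        gcongr
        rw [div_le_one (by positivity)]
        gcongr; linarith
    _ = _ := by ring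

end

end RegSum

namespace RegSum

/-- The sum of inverse sizes of the four classes determined by two overlapping families. -/
noncomputable def invSum (N B : ℕ) (T : ℝ) : ℝ := 1 / T + 2 / (N - T) + 1 / (B - N + T)

lemma invSum_le_mul {N B : ℕ} {T T₀ η : ℝ} (hNB : (N : ℝ) ≤ B) (hT : 0 < T) (hTN : T < N)
    (hT0 : 0 < T₀) (hT0N : 2 * T₀ ≤ N) (hη : |T - T₀| ≤ η * T₀) :
    invSum N B T₀ ≤ (1 + η) * invSum N B T := by
  obtain ⟨h1, h2⟩ := abs_le.mp hη
  have hη0 : 0 ≤ η := by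
    by_contra h
    have : η * T₀ < 0 := mul_neg_of_neg_of_pos (by linarith) hT0
    linarith [abs_nonneg (T - T₀)]
  have key : ∀ x y c : ℝ, 0 < x → 0 < y → 0 ≤ c → x ≤ (1 + η) * y → c / y ≤ (1 + η) * (c / x) := by
    intro x y c hx hy hc h
    rw [div_le_iff₀ hy, mul_assoc, div_mul_eq_mul_div, mul_div_assoc', le_div_iff₀ hx]
    nlinarith
  have hl : (N:ℝ) - T₀ ≥ T₀ := by linarith
  unfold invSum
  rw [mul_add, mul_add]
  refine add_le_add (add_le_add ?_ ?_) ?_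
  · exact key _ _ _ hT hT0 zero_le_one (by linarith)
  · exact key _ _ _ (by linarith) (by linarith) zero_le_two (by nlinarith)
  · exact key _ _ _ (by linarith) (by linarith) zero_le_one (by nlinarith)

lemma invSum_center {a b n : ℕ} (ha : 0 < a) (hab : 8 * a ≤ b) (hn : 0 < n) :
    invSum (a * n) (b * n) (ovrCenter (a * n) (b * n)) =
      ((a : ℝ) + b) ^ 3 / (n * (a ^ 2 * b ^ 2)) := by
  have ha' : (0:ℝ) < a := by exact_mod_cast ha
  have hn' : (0:ℝ) < n := by exact_mod_cast hn
  have hb' : (0:ℝ) < b := by exact_mod_cast (by omega : 0 < b)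
  have e0 : ovrCenter (a * n) (b * n) = n * (a ^ 2 / (a + b)) := by
    unfold ovrCenter; push_cast; field_simp
  have e1 : ((a * n : ℕ) : ℝ) - n * (a ^ 2 / (a + b)) = n * (a * b / (a + b)) := by
    push_cast; field_simp; ring
  have e2 : ((b * n : ℕ) : ℝ) - (a * n : ℕ) + n * (a ^ 2 / (a + b)) = n * (b ^ 2 / (a + b)) := by
    push_cast; field_simp; ring
  unfold invSum
  rw [e0, e1, e2]
  field_simp
  ring

lemma hyp_fourth_le {a b : ℕ} (hab : 8 * a ≤ b) (ha : 0 < a) {v m : ℝ}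
    (hm : m = (a : ℝ) ^ 2 / (a + b)) (hv : v = (a : ℝ) ^ 2 * b ^ 2 / ((a + b) ^ 2 * (a + b - 1))) :
    ∑ k ∈ Finset.range (a + 1), hyp a b k * (((k : ℝ) - m) ^ 2 - v) ^ 2 ≤ a ^ 2 * v := by
  have ha' : (0:ℝ) < a := by exact_mod_cast ha
  have hb' : (0:ℝ) < b := by exact_mod_cast (by omega : 0 < b)
  have h0 := sum_hyp a b
  have h2 := hyp_variance (show a ≤ b by omega) ha (by omega)
  rw [← hm, ← hv] at h2
  have hm0 : 0 ≤ m := by rw [hm]; positivity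
  have hma : m ≤ a := by rw [hm, div_le_iff₀ (by positivity)]; nlinarith
  have : ∀ k ∈ Finset.range (a + 1), hyp a b k * (((k : ℝ) - m) ^ 2 - v) ^ 2 ≤
      (a ^ 2 - 2 * v) * (hyp a b k * ((k : ℝ) - m) ^ 2) + v ^ 2 * hyp a b k := by
    intro k hk
    have hk' : (k : ℝ) ≤ a := by
      have := Finset.mem_range.mp hk; exact_mod_cast (by omega : k ≤ a)
    have hk0 : (0:ℝ) ≤ k := by positivity
    have h3 : ((k : ℝ) - m) ^ 2 ≤ a ^ 2 := 
      sq_le_sq' (by linarith) (by linarith)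
    have := mul_le_mul_of_nonneg_left (mul_le_mul_of_nonneg_right h3 (sq_nonneg ((k:ℝ) - m)))
      (hyp_nonneg a b k)
    linear_combination this
  refine (Finset.sum_le_sum this).trans ?_
  rw [Finset.sum_add_distrib, ← Finset.mul_sum, ← Finset.mul_sum, h2, h0]
  nlinarith [sq_nonneg v]

lemma mean_le_two_mul_var {a b : ℕ} (hab : 8 * a ≤ b) (ha : 0 < a) {v m : ℝ}
    (hm : m = (a : ℝ) ^ 2 / (a + b)) (hv : v = (a : ℝ) ^ 2 * b ^ 2 / ((a + b) ^ 2 * (a + b - 1))) :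
    m ≤ 2 * v := by
  have hb' : (8:ℝ) * a ≤ b := by exact_mod_cast hab
  have ha1 : (1:ℝ) ≤ a := by exact_mod_cast ha
  have hD1 : (0:ℝ) < a + b - 1 := by linarith
  have h7 : ((a:ℝ) + b - 1) * (a + b) ≤ 2 * b ^ 2 := by nlinarith
  have h8 : (0:ℝ) < (a + b) ^ 2 * (a + b - 1) := by positivity
  rw [hm, hv, mul_div_assoc', div_le_div_iff₀ (by positivity) h8]
  have h6 : 0 ≤ (a:ℝ) ^ 2 * (a + b) := by positivity
  linear_combination mul_le_mul_of_nonneg_left h7 h6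

section
variable {ι : Type*} [Fintype ι] [DecidableEq ι]

lemma pexp_dev_sq_le {a b : ℕ} (hab : 8 * a ≤ b) (ha : 0 < a) {v m : ℝ}
    (hm : m = (a : ℝ) ^ 2 / (a + b)) (hv : v = (a : ℝ) ^ 2 * b ^ 2 / ((a + b) ^ 2 * (a + b - 1))) :
    pexp ι (hypW a b) (fun τ => (∑ u, (((τ u : ℕ) : ℝ) - m) ^ 2 - Fintype.card ι * v) ^ 2) ≤
      Fintype.card ι * (a ^ 2 * v) := by
  have e : ∀ τ : ι → Fin (a + 1), ∑ u, (((τ u : ℕ) : ℝ) - m) ^ 2 - Fintype.card ι * v =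
      ∑ u, ((((τ u : ℕ) : ℝ) - m) ^ 2 - v) := by
    intro τ; rw [Finset.sum_sub_distrib, Finset.sum_const, Finset.card_univ, nsmul_eq_mul]
  simp_rw [e]
  have h2 := hyp_variance (show a ≤ b by omega) ha (by omega)
  rw [← hm, ← hv] at h2
  rw [pexp_sq_sum_coord (sum_hypW a b) (f := fun s => (((s : ℕ) : ℝ) - m) ^ 2 - v)]
  · rw [sum_hypW_mul a b (fun k => ((((k : ℝ) - m) ^ 2 - v)) ^ 2)]
    exact mul_le_mul_of_nonneg_left (hyp_fourth_le hab ha hm hv) (by positivity)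
  · rw [sum_hypW_mul a b (fun k => (((k : ℝ) - m) ^ 2 - v))]
    simp only [mul_sub, Finset.sum_sub_distrib, ← Finset.sum_mul, sum_hyp]
    rw [h2]; ring

lemma pexp_far_le {a b : ℕ} (hab : 8 * a ≤ b) (ha : 0 < a) (hι : Even (Fintype.card ι))
    (h100 : 100 ≤ Fintype.card ι) {δ : ℝ}
    (h400 : 400 ≤ ovrCenter (a * Fintype.card ι) (b * Fintype.card ι)) (h1 : 60 ≤ δ)
    (h2 : δ ≤ ovrCenter (a * Fintype.card ι) (b * Fintype.card ι) / 2) :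
    pexp ι (hypW a b) (fun τ =>
      if |(coordSum τ : ℝ) - ovrCenter (a * Fintype.card ι) (b * Fintype.card ι)| < δ then 0
      else ovr (a * Fintype.card ι) (b * Fintype.card ι) (coordSum τ)) ≤
    50 * Real.exp 6 *
      Real.exp (-(δ ^ 2 / (100 * ovrCenter (a * Fintype.card ι) (b * Fintype.card ι)))) := by
  set N := a * Fintype.card ι with hN
  set B := b * Fintype.card ι with hB
  have hN100 : 100 ≤ N := le_trans h100 (Nat.le_mul_of_pos_left _ ha)
  have hNB : 8 * N ≤ B := by
    rw [hN, hB, ← mul_assoc]; exact Nat.mul_le_mul_right _ hab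
  have := sum_far_le hN100 hNB (hι.mul_left a) (hι.mul_left b) h400
    (ovrLaw_sumLaw (ι := ι) (b := b) ha (by omega)) h1 h2
  refine le_trans (le_of_eq ?_) this
  rw [← sum_sumLaw a b (fun j => if |(j : ℝ) - ovrCenter N B| < δ then 0 else ovr N B j),
    Finset.sum_filter]
  refine Finset.sum_congr rfl fun j _ => ?_
  by_cases h : |(j : ℝ) - ovrCenter N B| < δ <;> simp [h]

omit [DecidableEq ι] in
set_option maxHeartbeats 1000000 in
/-- Lower bound for the normalised dispersion near the centre. -/
lemma one_sub_le_disp {a b : ℕ} (hab : 8 * a ≤ b) (ha : 0 < a) (hι : 0 < Fintype.card ι)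
    {κ ε : ℝ} (hε : 0 < ε) (hε1 : 6 * ε ≤ 1)
    (hT0 : κ ^ 2 ≤ ε ^ 2 * ovrCenter (a * Fintype.card ι) (b * Fintype.card ι))
    (hpos : 0 < ovrCenter (a * Fintype.card ι) (b * Fintype.card ι))
    (hn : 2 * κ ^ 2 ≤ ε * Fintype.card ι) {v m : ℝ}
    (hm : m = (a : ℝ) ^ 2 / (a + b)) (hv : v = (a : ℝ) ^ 2 * b ^ 2 / ((a + b) ^ 2 * (a + b - 1)))
    (τ : ι → Fin (a + 1))
    (hτ : |(coordSum τ : ℝ) - ovrCenter (a * Fintype.card ι) (b * Fintype.card ι)| <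
      κ * √(ovrCenter (a * Fintype.card ι) (b * Fintype.card ι)))
    (hY : (1 - ε) * (Fintype.card ι * v) ≤ ∑ u, (((τ u : ℕ) : ℝ) - m) ^ 2) :
    1 - 3 * ε ≤ invSum (a * Fintype.card ι) (b * Fintype.card ι) (coordSum τ) * dispersion τ := by
  have ha' : (0:ℝ) < a := by exact_mod_cast ha
  have hb' : (8:ℝ) * a ≤ b := by exact_mod_cast hab
  have ha1 : (1:ℝ) ≤ a := by exact_mod_cast ha
  have hι' : (0:ℝ) < Fintype.card ι := by exact_mod_cast hι
  have hQ0 := invSum_center ha hab hι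
  have hNB : 8 * (a * Fintype.card ι) ≤ b * Fintype.card ι := by
    rw [← mul_assoc]; exact Nat.mul_le_mul_right _ hab
  have hcl := ovrCenter_le hNB
  have hN0 : (0:ℝ) < (a * Fintype.card ι : ℕ) := by push_cast; positivity
  have hNB' : ((a * Fintype.card ι : ℕ) : ℝ) ≤ (b * Fintype.card ι : ℕ) := by
    exact_mod_cast (by omega : a * Fintype.card ι ≤ b * Fintype.card ι)
  have e0 : ovrCenter (a * Fintype.card ι) (b * Fintype.card ι) = Fintype.card ι * m := by
    rw [hm]; unfold ovrCenter; push_cast; field_simp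
  have hm0 : 0 < m := by rw [hm]; positivity
  set T₀ := ovrCenter (a * Fintype.card ι) (b * Fintype.card ι) with hT₀
  have hs : κ ≤ ε * √T₀ := by
    apply le_of_sq_le_sq _ (by positivity)
    rw [mul_pow, Real.sq_sqrt hpos.le]; exact hT0
  have hss : √T₀ * √T₀ = T₀ := Real.mul_self_sqrt hpos.le
  have hdev : |(coordSum τ : ℝ) - T₀| ≤ ε * T₀ := by
    refine hτ.le.trans ?_
    calc κ * √T₀ ≤ (ε * √T₀) * √T₀ := mul_le_mul_of_nonneg_right hs (Real.sqrt_nonneg _)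
      _ = ε * T₀ := by rw [mul_assoc, hss]
  obtain ⟨h1, h2⟩ := abs_le.mp hdev
  have hQ := invSum_le_mul hNB' (show 0 < (coordSum τ : ℝ) by nlinarith)
    (show (coordSum τ : ℝ) < _ by nlinarith) hpos (by linarith) hdev
  have hdisp : (1 - 2 * ε) * (Fintype.card ι * v) ≤ dispersion τ := by
    rw [dispersion_le hι τ m, ← e0]
    have h3 : ((coordSum τ : ℝ) - T₀) ^ 2 ≤ κ ^ 2 * T₀ := by
      rw [← sq_abs, ← Real.sq_sqrt hpos.le, ← mul_pow, Real.sq_sqrt hpos.le]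
      exact pow_le_pow_left₀ (abs_nonneg _) hτ.le 2
    have h4 : ((coordSum τ : ℝ) - T₀) ^ 2 / Fintype.card ι ≤ κ ^ 2 * m := by
      rw [div_le_iff₀ hι']
      calc _ ≤ κ ^ 2 * T₀ := h3
        _ = _ := by rw [e0]; ring
    have h5 := mean_le_two_mul_var hab ha hm hv
    have hv0 : 0 < v := by linarith
    have h6 : κ ^ 2 * m ≤ ε * (Fintype.card ι * v) := by
      calc κ ^ 2 * m ≤ κ ^ 2 * (2 * v) := mul_le_mul_of_nonneg_left h5 (sq_nonneg _)
        _ = (2 * κ ^ 2) * v := by ring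
        _ ≤ (ε * Fintype.card ι) * v := mul_le_mul_of_nonneg_right hn hv0.le
        _ = _ := by ring
    linarith
  have hQv : 1 ≤ invSum (a * Fintype.card ι) (b * Fintype.card ι) T₀ * (Fintype.card ι * v) := by
    have hD1 : (0:ℝ) < a + b - 1 := by linarith
    rw [hQ0, hv]
    have hb0 : (0:ℝ) < b := by linarith
    have : ((a : ℝ) + b) ^ 3 / (Fintype.card ι * (a ^ 2 * b ^ 2)) *
        (Fintype.card ι * (a ^ 2 * b ^ 2 / ((a + b) ^ 2 * (a + b - 1)))) =
        (a + b) / (a + b - 1) := by field_simp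
    rw [this, le_div_iff₀ hD1]; linarith
  have hv0 : 0 < v := by
    have hD1 : (0:ℝ) < a + b - 1 := by linarith
    have hb0 : (0:ℝ) < b := by linarith
    rw [hv]; positivity
  set q := invSum (a * Fintype.card ι) (b * Fintype.card ι) (coordSum τ)
  set q0 := invSum (a * Fintype.card ι) (b * Fintype.card ι) T₀
  have hnv : 0 < Fintype.card ι * v := by positivity
  have hq : 1 ≤ (1 + ε) * (q * (Fintype.card ι * v)) := by
    calc 1 ≤ q0 * (Fintype.card ι * v) := hQv
      _ ≤ ((1 + ε) * q) * (Fintype.card ι * v) := mul_le_mul_of_nonneg_right hQ hnv.le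
      _ = _ := by ring
  have hq0 : 0 ≤ q := by
    by_contra h
    push Not at h
    have : q * (Fintype.card ι * v) < 0 := mul_neg_of_neg_of_pos h hnv
    nlinarith
  have h7 : 1 - ε ≤ q * (Fintype.card ι * v) := by
    by_contra h
    push Not at h
    nlinarith
  calc 1 - 3 * ε ≤ (1 - 2 * ε) * (1 - ε) := by nlinarith
    _ ≤ (1 - 2 * ε) * (q * (Fintype.card ι * v)) := mul_le_mul_of_nonneg_left h7 (by linarith)
    _ = q * ((1 - 2 * ε) * (Fintype.card ι * v)) := by ring
    _ ≤ _ := mul_le_mul_of_nonneg_left hdisp hq0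

end

end RegSum

namespace RegSum

section
variable {ι : Type*} [Fintype ι] [DecidableEq ι]

/-- The second moment weight of the overlap, in the central range. -/
noncomputable def bulkWt (N B : ℕ) (T : ℕ) (s : ℝ) : ℝ :=
  ovr N B T * Real.exp ((1 - (invSum N B T * s) ^ 2) / 4)

lemma bulkWt_le (N B T : ℕ) (s : ℝ) : bulkWt N B T s ≤ 2 * ovr N B T := by
  unfold bulkWt
  rw [mul_comm]
  refine mul_le_mul_of_nonneg_right ?_ (ovr_nonneg _ _ _)
  calc _ ≤ Real.exp (1 / 4) := Real.exp_le_exp.mpr (by nlinarith [sq_nonneg (invSum N B T * s)])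
    _ ≤ 2 := by
      have := Real.exp_one_lt_d9
      have h2 : Real.exp (1/4) ^ 4 = Real.exp 1 := by rw [← Real.exp_nat_mul]; norm_num
      by_contra h
      push Not at h
      have : (2:ℝ) ^ 4 < Real.exp (1/4) ^ 4 := pow_lt_pow_left₀ h (by norm_num) (by norm_num)
      linarith

set_option maxHeartbeats 2000000 in
lemma pexp_bulk_le {a b : ℕ} (hab : 8 * a ≤ b) (ha : 0 < a) (hι : Even (Fintype.card ι))
    (h100 : 100 ≤ Fintype.card ι) {κ ε : ℝ} (hκ : 3 ≤ κ) (hε : 0 < ε) (hε1 : 6 * ε ≤ 1)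
    (hT0 : κ ^ 2 ≤ ε ^ 2 * ovrCenter (a * Fintype.card ι) (b * Fintype.card ι))
    (h400 : 400 ≤ ovrCenter (a * Fintype.card ι) (b * Fintype.card ι))
    (hn : 2 * κ ^ 2 ≤ ε * Fintype.card ι) :
    pexp ι (hypW a b) (fun τ =>
      if |(coordSum τ : ℝ) - ovrCenter (a * Fintype.card ι) (b * Fintype.card ι)| <
        ovrCenter (a * Fintype.card ι) (b * Fintype.card ι) / 2
      then bulkWt (a * Fintype.card ι) (b * Fintype.card ι) (coordSum τ) (dispersion τ) else 0) ≤
    Real.exp (2 * ε) * (1 + 8 * (5 * Real.exp (3 * κ * (κ + 1))) / (a + b - 1)) +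
      10 * Real.exp (3 * κ * (κ + 1)) * (2 * (a + b) / (ε ^ 2 * Fintype.card ι)) +
      2 * (50 * Real.exp 6 * Real.exp (-(κ ^ 2 / 100))) := by
  have ha' : (0:ℝ) < a := by exact_mod_cast ha
  have hb' : (8:ℝ) * a ≤ b := by exact_mod_cast hab
  have ha1 : (1:ℝ) ≤ a := by exact_mod_cast ha
  have hι' : (0:ℝ) < Fintype.card ι := by exact_mod_cast (by omega : 0 < Fintype.card ι)
  have hNB : 8 * (a * Fintype.card ι) ≤ b * Fintype.card ι := by
    rw [← mul_assoc]; exact Nat.mul_le_mul_right _ hab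
  set m : ℝ := (a : ℝ) ^ 2 / (a + b) with hm
  set v : ℝ := (a : ℝ) ^ 2 * b ^ 2 / ((a + b) ^ 2 * (a + b - 1)) with hv
  have hD1 : (0:ℝ) < a + b - 1 := by linarith
  have hb0 : (0:ℝ) < b := by linarith
  have hv0 : 0 < v := by rw [hv]; positivity
  set n : ℝ := (Fintype.card ι : ℝ) with hn_def
  set N := a * Fintype.card ι with hN
  set B := b * Fintype.card ι with hB
  have hN100 : 100 ≤ N := le_trans h100 (Nat.le_mul_of_pos_left _ ha)
  set T₀ := ovrCenter N B with hT₀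
  have hpos : 0 < T₀ := by linarith
  have hss : √T₀ * √T₀ = T₀ := Real.mul_self_sqrt hpos.le
  have hs0 : 0 ≤ √T₀ := Real.sqrt_nonneg _
  have h20 : 20 ≤ √T₀ := by
    apply Real.le_sqrt_of_sq_le; linarith
  have hs : κ ≤ ε * √T₀ := by
    apply le_of_sq_le_sq _ (by positivity)
    rw [mul_pow, Real.sq_sqrt hpos.le]; exact hT0
  have hs6 : 6 * κ ≤ √T₀ := by nlinarith
  set Kφ := 5 * Real.exp (3 * κ * (κ + 1)) with hKφ
  have hKφ0 : 0 < Kφ := by positivity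
  set φ : ℕ → ℝ := fun j => if |(j : ℝ) - T₀| < κ * √T₀ then ovr N B j else 0 with hφ
  have hφ0 : ∀ j, 0 ≤ φ j := fun j => by
    simp only [hφ]; split_ifs; exacts [ovr_nonneg _ _ _, le_rfl]
  have hφK : ∀ j, φ j ≤ Kφ := fun j => by
    simp only [hφ]; split_ifs with h
    · exact ovr_bulk hN100 hNB (hι.mul_left a) (hι.mul_left b) (by linarith) (by linarith)
        (by linarith) h.le
    · exact hKφ0.le
  have hEφ : pexp ι (hypW a b) (fun τ => φ (coordSum τ)) ≤ 1 + 8 * Kφ / (a + b - 1) := by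
    have h1 := abs_pexp_sub_hyp_le (ι := ι) (show a ≤ b by omega) ha (by omega) (by omega) hφ0 hφK
    have h2 : ∑ j ∈ Finset.range (N + 1), hyp N B j * φ j ≤ 1 := by
      rw [← sum_hyp_mul_ovr (hι.mul_left a) (hι.mul_left b) (show N ≤ B by omega)]
      refine Finset.sum_le_sum fun j _ => mul_le_mul_of_nonneg_left ?_ (hyp_nonneg _ _ _)
      simp only [hφ]; split_ifs; exacts [le_rfl, ovr_nonneg _ _ _]
    linarith [(abs_le.mp h1).2]
  have hdev := pexp_dev_sq_le (ι := ι) hab ha hm hv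
  have hfar := pexp_far_le hab ha hι h100 (δ := κ * √T₀) h400 (by nlinarith) (by nlinarith)
  have hptw : ∀ τ : ι → Fin (a + 1),
      (if |(coordSum τ : ℝ) - T₀| < T₀ / 2 then bulkWt N B (coordSum τ) (dispersion τ) else 0) ≤
      (Real.exp (2 * ε) * φ (coordSum τ) +
        (2 * Kφ / (ε * (n * v)) ^ 2) * (∑ u, (((τ u : ℕ) : ℝ) - m) ^ 2 - n * v) ^ 2) +
      2 * (if |(coordSum τ : ℝ) - T₀| < κ * √T₀ then 0 else ovr N B (coordSum τ)) := by
    intro τ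
    have hb1 := bulkWt_le N B (coordSum τ) (dispersion τ)
    have hR := ovr_nonneg N B (coordSum τ)
    have hφτ := hφ0 (coordSum τ)
    have hφKτ := hφK (coordSum τ)
    have t1 : 0 ≤ Real.exp (2 * ε) * φ (coordSum τ) := mul_nonneg (Real.exp_pos _).le hφτ
    have t2 : 0 ≤ (2 * Kφ / (ε * (n * v)) ^ 2) *
        (∑ u, (((τ u : ℕ) : ℝ) - m) ^ 2 - n * v) ^ 2 := by positivity
    by_cases hI : |(coordSum τ : ℝ) - T₀| < κ * √T₀
    · rw [if_pos hI, mul_zero, add_zero]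
      have hφe : φ (coordSum τ) = ovr N B (coordSum τ) := if_pos hI
      split_ifs with h
      swap
      · linarith
      by_cases hY : (1 - ε) * (n * v) ≤ ∑ u, (((τ u : ℕ) : ℝ) - m) ^ 2
      · have hd := one_sub_le_disp hab ha (by omega) hε hε1 hT0 hpos hn hm hv τ hI hY
        have : bulkWt N B (coordSum τ) (dispersion τ) ≤ Real.exp (2 * ε) * φ (coordSum τ) := by
          rw [hφe, bulkWt, mul_comm]
          refine mul_le_mul_of_nonneg_right (Real.exp_le_exp.mpr ?_) hR
          set χ := invSum N B (coordSum τ) * dispersion τ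
          have h9 : (1 - 3 * ε) ^ 2 ≤ χ ^ 2 := pow_le_pow_left₀ (by linarith) hd 2
          nlinarith
        linarith
      · push Not at hY
        have hlt : ε * (n * v) ≤ n * v - ∑ u, (((τ u : ℕ) : ℝ) - m) ^ 2 := by linarith
        have hp : 0 < ε * (n * v) := by positivity
        have h1 : 1 ≤ (∑ u, (((τ u : ℕ) : ℝ) - m) ^ 2 - n * v) ^ 2 / (ε * (n * v)) ^ 2 := by
          rw [one_le_div (by positivity), ← neg_sq (∑ u, (((τ u : ℕ) : ℝ) - m) ^ 2 - n * v), neg_sub]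
          exact pow_le_pow_left₀ hp.le hlt 2
        have h2 := mul_le_mul_of_nonneg_left h1 (show 0 ≤ 2 * Kφ by positivity)
        have h3 : (2 * Kφ / (ε * (n * v)) ^ 2) * (∑ u, (((τ u : ℕ) : ℝ) - m) ^ 2 - n * v) ^ 2 =
          2 * Kφ * ((∑ u, (((τ u : ℕ) : ℝ) - m) ^ 2 - n * v) ^ 2 / (ε * (n * v)) ^ 2) := by ring
        rw [h3]
        linarith
    · rw [if_neg hI]
      split_ifs
      · linarith
      · linarith
  have hsum := pexp_mono (hypW_nonneg a b) hptw
  rw [pexp_add, pexp_add, pexp_mul_left, pexp_mul_left, pexp_mul_left] at hsum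
  refine hsum.trans ?_
  refine add_le_add (add_le_add (mul_le_mul_of_nonneg_left hEφ (Real.exp_pos _).le) ?_)
    (mul_le_mul_of_nonneg_left ?_ zero_le_two)
  · calc _ ≤ (2 * Kφ / (ε * (n * v)) ^ 2) * (n * (a ^ 2 * v)) :=
        mul_le_mul_of_nonneg_left hdev (by positivity)
      _ = 2 * Kφ * (a ^ 2 / (ε ^ 2 * (n * v))) := by field_simp
      _ ≤ 2 * Kφ * (2 * (a + b) / (ε ^ 2 * n)) := by
        refine mul_le_mul_of_nonneg_left ?_ (by positivity)
        have h5 := mean_le_two_mul_var hab ha hm hv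
        rw [hm, div_le_iff₀ (by positivity)] at h5
        rw [div_le_div_iff₀ (by positivity) (by positivity)]
        have := mul_le_mul_of_nonneg_left h5 (show 0 ≤ ε ^ 2 * n by positivity)
        linarith
      _ = _ := by rw [hKφ]; ring
  · refine hfar.trans (le_of_eq ?_)
    have e : (κ * √T₀) ^ 2 / (100 * T₀) = κ ^ 2 / 100 := by
      rw [mul_pow, Real.sq_sqrt hpos.le]; field_simp
    rw [← hN, ← hB, ← hT₀, e]

end

end RegSum

namespace RegSum

lemma exists_gauss_small {c ε : ℝ} (hε : 0 < ε) :
    ∃ κ : ℝ, 3 ≤ κ ∧ c * Real.exp (-(κ ^ 2 / 100)) ≤ ε := by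
  have h : Tendsto (fun κ : ℝ => c * Real.exp (-(κ ^ 2 / 100))) atTop (𝓝 (c * 0)) := by
    refine Tendsto.const_mul _ (Real.tendsto_exp_atBot.comp (tendsto_neg_atTop_atBot.comp ?_))
    exact (tendsto_pow_atTop two_ne_zero).atTop_div_const (by norm_num)
  rw [mul_zero] at h
  obtain ⟨κ, h1, h2⟩ := ((eventually_ge_atTop 3).and (h.eventually (gt_mem_nhds hε))).exists
  exact ⟨κ, h1, h2.le⟩

lemma div_le_ovrCenter {n a b d : ℕ} (ha : 0 < a) (habd : a + b ≤ d) :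
    (n : ℝ) / d ≤ ovrCenter (a * n) (b * n) := by
  rcases Nat.eq_zero_or_pos n with rfl | hn
  · simp [ovrCenter]
  have ha' : (1:ℝ) ≤ a := by exact_mod_cast ha
  have hn' : (0:ℝ) < n := by exact_mod_cast hn
  have hd' : (a:ℝ) + b ≤ d := by exact_mod_cast habd
  have hb : (0:ℝ) ≤ b := by positivity
  have : ovrCenter (a * n) (b * n) = n * (a ^ 2 / (a + b)) := by
    unfold ovrCenter; push_cast; field_simp
  rw [this, div_eq_mul_one_div]
  refine mul_le_mul_of_nonneg_left ?_ hn'.le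
  rw [div_le_div_iff₀ (by linarith) (by linarith)]
  have h1 : (1:ℝ) ≤ (a:ℝ) ^ 2 := one_le_pow₀ ha'
  nlinarith

set_option maxHeartbeats 1600000 in
lemma overlap_bound {C ε : ℝ} (hC : 1 ≤ C) (hε : 0 < ε) (hε1 : ε ≤ 1) :
    ∃ K : ℕ, ∀ n a b d : ℕ, Even n → K ≤ a → 8 * a ≤ b → a + b ≤ d → (d : ℝ) ^ 10 ≤ C * n →
      pexp (Fin n) (hypW a b) (fun τ =>
        if |(coordSum τ : ℝ) - ovrCenter (a * n) (b * n)| < ovrCenter (a * n) (b * n) / 2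
        then bulkWt (a * n) (b * n) (coordSum τ) (dispersion τ)
        else Real.exp ((d : ℝ) ^ 2) * ovr (a * n) (b * n) (coordSum τ)) ≤ 1 + ε := by
  obtain ⟨κ, hκ, hκs⟩ := exists_gauss_small (c := 2 * (50 * Real.exp 6)) (show 0 < ε / 8 by linarith)
  set ε₂ := ε / 32 with hε₂
  have hε₂0 : 0 < ε₂ := by positivity
  set M := Real.exp (3 * κ * (κ + 1)) with hM
  have hM0 : 0 < M := Real.exp_pos _
  set X : ℝ := 800 * C + κ ^ 2 / ε₂ ^ 2 + 2 * κ ^ 2 / ε₂ + 400 * M / ε + 160 * M * C / (ε₂ ^ 2 * ε) +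
    400 * Real.exp 6 / ε with hX
  have p1 : 0 ≤ κ ^ 2 / ε₂ ^ 2 := by positivity
  have p2 : 0 ≤ 2 * κ ^ 2 / ε₂ := by positivity
  have p3 : 0 ≤ 400 * M / ε := by positivity
  have p4 : 0 ≤ 160 * M * C / (ε₂ ^ 2 * ε) := by positivity
  have p5 : 0 ≤ 400 * Real.exp 6 / ε := by positivity
  refine ⟨⌈X⌉₊, fun n a b d hn hK hab habd hd => ?_⟩
  have hXa : X ≤ a := (Nat.le_ceil X).trans (by exact_mod_cast hK)
  have hb' : (8:ℝ) * a ≤ b := by exact_mod_cast hab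
  have hd' : (a:ℝ) + b ≤ d := by exact_mod_cast habd
  have ha1 : (800:ℝ) ≤ a := by linarith
  have ha0 : 0 < a := by
    have : (0:ℝ) < a := by linarith
    exact_mod_cast this
  have hXd : X ≤ d := by linarith
  have hd1 : (1:ℝ) ≤ d := by linarith
  have hdC : C ≤ d := by linarith
  have hd0 : (0:ℝ) < d := by linarith
  have hC0 : 0 < C := by linarith
  have hd9 : (d:ℝ) ^ 9 / C ≤ n / d := by
    rw [div_le_div_iff₀ hC0 hd0]
    linarith [show (d:ℝ) ^ 9 * d = d ^ 10 by ring]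
  have hT9 : (d:ℝ) ^ 9 / C ≤ ovrCenter (a * n) (b * n) := hd9.trans (div_le_ovrCenter ha0 habd)
  have h89 : 800 * (d:ℝ) ^ 2 ≤ d ^ 9 / C := by
    rw [le_div_iff₀ hC0]
    have h7 : (d:ℝ) ≤ d ^ 7 := le_self_pow₀ hd1 (by norm_num)
    calc 800 * (d:ℝ) ^ 2 * C = (800 * C) * (d:ℝ) ^ 2 := by ring
      _ ≤ (d:ℝ) * (d:ℝ) ^ 2 := mul_le_mul_of_nonneg_right (by linarith) (by positivity)
      _ ≤ (d:ℝ) ^ 7 * (d:ℝ) ^ 2 := mul_le_mul_of_nonneg_right h7 (by positivity)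
      _ = _ := by ring
  have hdd : (d:ℝ) ≤ 800 * (d:ℝ) ^ 2 := by nlinarith
  set T₀ := ovrCenter (a * n) (b * n) with hT₀
  have hTd : 800 * (d:ℝ) ^ 2 ≤ T₀ := h89.trans hT9
  have hnd : 800 * (d:ℝ) ^ 2 ≤ n := by
    refine (h89.trans hd9).trans (div_le_self (by positivity) hd1)
  have hn100 : 100 ≤ n := by
    have : (100:ℝ) ≤ n := by linarith
    exact_mod_cast this
  have hbulk := pexp_bulk_le (ι := Fin n) (a := a) (b := b) hab ha0
    (by rwa [Fintype.card_fin]) (by rwa [Fintype.card_fin]) hκ hε₂0 (by linarith)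
    (by
      rw [Fintype.card_fin, ← hT₀]
      rw [← div_le_iff₀' (by positivity)]; linarith)
    (by rw [Fintype.card_fin, ← hT₀]; linarith)
    (by
      rw [Fintype.card_fin, ← div_le_iff₀' hε₂0]; linarith)
  have hfar := pexp_far_le (ι := Fin n) (a := a) (b := b) hab ha0
    (by rwa [Fintype.card_fin]) (by rwa [Fintype.card_fin]) (δ := T₀ / 2)
    (by rw [Fintype.card_fin, ← hT₀]; linarith) (by linarith) (by rw [Fintype.card_fin])
  rw [Fintype.card_fin, ← hT₀] at hbulk hfar
  have hsplit : ∀ τ : Fin n → Fin (a + 1),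
      (if |(coordSum τ : ℝ) - T₀| < T₀ / 2
        then bulkWt (a * n) (b * n) (coordSum τ) (dispersion τ)
        else Real.exp ((d : ℝ) ^ 2) * ovr (a * n) (b * n) (coordSum τ)) =
      (if |(coordSum τ : ℝ) - T₀| < T₀ / 2
        then bulkWt (a * n) (b * n) (coordSum τ) (dispersion τ) else 0) +
      Real.exp ((d : ℝ) ^ 2) * (if |(coordSum τ : ℝ) - T₀| < T₀ / 2 then 0
        else ovr (a * n) (b * n) (coordSum τ)) := by
    intro τ; split_ifs <;> simp
  simp_rw [hsplit]
  rw [pexp_add, pexp_mul_left]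
  have hq1 : Real.exp (2 * ε₂) ≤ 1 + ε / 8 := by
    have h1 : 1 - 2 * ε₂ ≤ Real.exp (-(2 * ε₂)) := by
      have := Real.add_one_le_exp (-(2 * ε₂)); linarith
    have h2 : Real.exp (-(2 * ε₂)) * Real.exp (2 * ε₂) = 1 := by rw [← Real.exp_add]; simp
    have h3 := Real.exp_pos (2 * ε₂)
    by_contra h
    push Not at h
    have h4 := mul_le_mul_of_nonneg_right h1 h3.le
    rw [h2] at h4
    have h5 : 1 - 2 * ε₂ = 1 - ε / 16 := by rw [hε₂]; ring
    rw [h5] at h4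
    nlinarith
  have hq2 : 8 * (5 * M) / ((a:ℝ) + b - 1) ≤ ε / 8 := by
    rw [div_le_iff₀ (by linarith)]
    have : 400 * M / ε ≤ (a:ℝ) + b - 1 := by linarith
    rw [div_le_iff₀ hε] at this
    linarith
  have hq3 : 10 * M * (2 * ((a:ℝ) + b) / (ε₂ ^ 2 * n)) ≤ ε / 8 := by
    have h1 : 160 * M * C / (ε₂ ^ 2 * ε) ≤ d := by linarith
    rw [div_le_iff₀ (by positivity)] at h1
    rw [mul_div_assoc', div_le_iff₀ (by positivity)]
    have h2 : (d:ℝ) * d ≤ n := by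
      rw [← sq]; have := sq_nonneg (d:ℝ); linarith
    calc 10 * M * (2 * ((a:ℝ) + b)) ≤ 10 * M * (2 * (d:ℝ)) := by gcongr
      _ = (160 * M * 1) * (d:ℝ) / 8 := by ring
      _ ≤ (160 * M * C) * (d:ℝ) / 8 := by gcongr
      _ ≤ ((d:ℝ) * (ε₂ ^ 2 * ε)) * (d:ℝ) / 8 := by gcongr
      _ = ε / 8 * (ε₂ ^ 2 * ((d:ℝ) * d)) := by ring
      _ ≤ ε / 8 * (ε₂ ^ 2 * n) := by gcongr
  have hq4 : Real.exp ((d:ℝ) ^ 2) * (50 * Real.exp 6 * Real.exp (-((T₀ / 2) ^ 2 / (100 * T₀)))) ≤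
      ε / 8 := by
    have hT0 : 0 < T₀ := by nlinarith
    have e : (T₀ / 2) ^ 2 / (100 * T₀) = T₀ / 400 := by field_simp; norm_num
    rw [e]
    have h1 : Real.exp ((d:ℝ) ^ 2) * Real.exp (-(T₀ / 400)) ≤ Real.exp (-(d:ℝ)) := by
      rw [← Real.exp_add, Real.exp_le_exp]; nlinarith
    have h2 : Real.exp (-(d:ℝ)) * d ≤ 1 := by
      have h3 := Real.add_one_le_exp (d:ℝ)
      have h4 : Real.exp (-(d:ℝ)) * Real.exp d = 1 := by rw [← Real.exp_add]; simp
      rw [← h4]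
      exact mul_le_mul_of_nonneg_left (by linarith) (Real.exp_pos _).le
    have h5 : 400 * Real.exp 6 / ε ≤ d := by linarith
    rw [div_le_iff₀ hε] at h5
    calc _ = 50 * Real.exp 6 * (Real.exp ((d:ℝ) ^ 2) * Real.exp (-(T₀ / 400))) := by ring
      _ ≤ 50 * Real.exp 6 * Real.exp (-(d:ℝ)) := by gcongr
      _ = (400 * Real.exp 6) * Real.exp (-(d:ℝ)) / 8 := by ring
      _ ≤ ((d:ℝ) * ε) * Real.exp (-(d:ℝ)) / 8 := by gcongr
      _ = ε / 8 * (Real.exp (-(d:ℝ)) * d) := by ring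
      _ ≤ ε / 8 * 1 := by gcongr
      _ = _ := mul_one _
  have hq5 := mul_le_mul_of_nonneg_left hfar (Real.exp_pos ((d:ℝ) ^ 2)).le
  have hq6 : Real.exp (2 * ε₂) * (1 + 8 * (5 * M) / ((a:ℝ) + b - 1)) ≤ (1 + ε / 8) * (1 + ε / 8) := by
    gcongr
    have : 0 ≤ 8 * (5 * M) / ((a:ℝ) + b - 1) := by
      have : (0:ℝ) < a + b - 1 := by linarith
      positivity
    linarith
  have hq7 : 2 * (50 * Real.exp 6 * Real.exp (-(κ ^ 2 / 100))) ≤ ε / 8 := by linarith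
  nlinarith

end RegSum

namespace RegSum
section
open scoped Classical

lemma pairing_iff_cycleType {P : Type*} [Fintype P] {k : ℕ} (hk : Fintype.card P = 2 * k)
    (π : Equiv.Perm P) :
    ((∀ p, π (π p) = p) ∧ ∀ p, π p ≠ p) ↔ π.cycleType = Multiset.replicate k 2 := by
  have hpow : (∀ p, π (π p) = p) ↔ π ^ 2 = 1 := by
    rw [Equiv.ext_iff]; simp [sq]
  rw [hpow, Equiv.Perm.pow_prime_eq_one_iff]
  have hsum := π.sum_cycleType
  constructor
  · rintro ⟨h1, h2⟩
    have h3 := Multiset.eq_replicate_card.mpr h1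
    have h4 : π.support = Finset.univ := by ext p; simpa using h2 p
    rw [h3, h4, Multiset.sum_replicate, Finset.card_univ, hk, smul_eq_mul] at hsum
    rw [h3]; congr 1; omega
  · intro h
    refine ⟨fun c hc => ?_, fun p => ?_⟩
    · rw [h] at hc; exact Multiset.eq_of_mem_replicate hc
    · rw [h, Multiset.sum_replicate, smul_eq_mul, mul_comm, ← hk] at hsum
      have := Finset.eq_univ_of_card _ hsum.symm
      rw [← Equiv.Perm.mem_support, this]; exact Finset.mem_univ p

lemma card_involutions (P : Type*) [Fintype P] :
    (Finset.univ.filter fun π : Equiv.Perm P => (∀ p, π (π p) = p) ∧ ∀ p, π p ≠ p).card =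
      pf (Fintype.card P) := by
  rcases Nat.even_or_odd (Fintype.card P) with h | h
  · obtain ⟨k, hk⟩ := h
    rw [← two_mul] at hk
    simp only [pairing_iff_cycleType hk]
    have h1 := Equiv.Perm.card_of_cycleType (α := P) (Multiset.replicate k 2)
    have h2 : (Multiset.replicate k 2).toFinset.prod
        (fun n => ((Multiset.replicate k 2).count n).factorial) = k.factorial := by
      rcases Nat.eq_zero_or_pos k with rfl | hk0
      · simp
      · rw [Multiset.toFinset_replicate, if_neg hk0.ne']; simp
    rw [if_pos ⟨by simp [hk, mul_comm], fun a ha => (Multiset.eq_of_mem_replicate ha).ge⟩, h2,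
      hk, Multiset.sum_replicate, Multiset.prod_replicate, smul_eq_mul, mul_comm k 2,
      Nat.sub_self, Nat.factorial_zero, one_mul, ← pf_two_mul] at h1
    rw [hk]
    rw [Nat.mul_div_cancel _ (by positivity)] at h1
    convert h1 using 1
  · rw [pf_of_odd h, Finset.card_eq_zero, Finset.filter_eq_empty_iff]
    rintro π - ⟨h1, h2⟩
    have h3 : π ^ 2 = 1 := by rw [Equiv.ext_iff]; simpa [sq] using h1
    rw [Equiv.Perm.pow_prime_eq_one_iff] at h3
    have h4 := Multiset.eq_replicate_card.mpr h3
    have h5 := π.sum_cycleType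
    have h6 : π.support = Finset.univ := by ext p; simpa using h2 p
    rw [h4, h6, Multiset.sum_replicate, Finset.card_univ, smul_eq_mul] at h5
    rw [← h5, Nat.odd_mul] at h
    exact absurd h.2 (by decide)

lemma natCard_involutions (P : Type*) [Fintype P] :
    Nat.card {π : Equiv.Perm P // (∀ p, π (π p) = p) ∧ ∀ p, π p ≠ p} = pf (Fintype.card P) := by
  rw [← card_involutions P]
  exact Nat.subtype_card _ fun π => by simp

lemma card_pairings {P ι : Type*} [Fintype P] [Fintype ι] (c : P → ι) :
    (Finset.univ.filter (IsPairing c)).card =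
      ∏ k, pf (Finset.univ.filter fun p => c p = k).card := by
  have hcast : ∀ (ρ : ∀ k, Equiv.Perm {p // c p = k}) (q : P) (k : ι) (h : c q = k),
      ((ρ k ⟨q, h⟩ : {p // c p = k}) : P) = (ρ (c q) ⟨q, rfl⟩ : {p // c p = c q}) := by
    rintro ρ q k rfl; rfl
  let I (k : ι) := {ρ : Equiv.Perm {p // c p = k} // (∀ p, ρ (ρ p) = p) ∧ ∀ p, ρ p ≠ p}
  have hinv : ∀ (ρ : ∀ k, I k), Function.Involutive
      (fun p : P => ((ρ (c p)).1 ⟨p, rfl⟩ : P)) := by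
    intro ρ p
    have h1 : c ((ρ (c p)).1 ⟨p, rfl⟩ : P) = c p := ((ρ (c p)).1 ⟨p, rfl⟩).2
    have h2 := hcast (fun k => (ρ k).1) _ _ h1
    show ((ρ (c ((ρ (c p)).1 ⟨p, rfl⟩ : P))).1 ⟨_, rfl⟩ : P) = p
    rw [← h2]
    exact congrArg Subtype.val ((ρ (c p)).2.1 ⟨p, rfl⟩)
  let e : {π // IsPairing c π} ≃ ∀ k, I k :=
    { toFun := fun π k => ⟨π.1.subtypePerm (fun p => by rw [π.2.2.2 p]), by
        refine ⟨fun p => ?_, fun p hp => ?_⟩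
        · ext; simp [π.2.1]
        · exact π.2.2.1 p (congrArg Subtype.val hp)⟩
      invFun := fun ρ => ⟨(hinv ρ).toPerm, hinv ρ, fun p hp =>
        (ρ (c p)).2.2 ⟨p, rfl⟩ (Subtype.ext hp), fun p => ((ρ (c p)).1 ⟨p, rfl⟩).2⟩
      left_inv := fun π => by ext p; rfl
      right_inv := fun ρ => by
        funext k
        refine Subtype.ext (Equiv.ext fun p => Subtype.ext ?_)
        obtain ⟨p, rfl⟩ := p
        rfl }
  rw [← Nat.subtype_card (p := IsPairing c) _ (fun x => by simp), Nat.card_congr e, Nat.card_pi]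
  refine Finset.prod_congr rfl fun k _ => ?_
  rw [natCard_involutions, Fintype.card_subtype]

end
end RegSum

namespace RegSum
section
open scoped Classical

section
variable {P V ι : Type*} [Fintype P] [Fintype ι] {c : P → ι} {vtx : P → V}

lemma sum_wt_eq : ∑ p, wt c p = ∑ k, ((Finset.univ.filter fun p => c p = k).card : ℝ) /
    (Finset.univ.filter fun p => c p = k).card := by
  rw [← Finset.sum_fiberwise Finset.univ c]
  refine Finset.sum_congr rfl fun k _ => ?_
  have : ∀ p ∈ Finset.univ.filter (fun p => c p = k),
      wt c p = 1 / (Finset.univ.filter fun p => c p = k).card := by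
    intro p hp
    rw [Finset.mem_filter] at hp
    rw [wt, cls, hp.2]
  rw [Finset.sum_congr rfl this, Finset.sum_const, nsmul_eq_mul, mul_one_div]

lemma fibWt_eq (u v : V) : fibWt c vtx u v =
    ∑ k, (((fib vtx u).filter fun p => c p = k).card : ℝ) * ((fib vtx v).filter fun p => c p = k).card /
      (Finset.univ.filter fun p => c p = k).card := by
  unfold fibWt
  rw [← Finset.sum_fiberwise (fib vtx u) c]
  refine Finset.sum_congr rfl fun k _ => ?_
  have : ∀ p ∈ (fib vtx u).filter (fun p => c p = k), ∑ q ∈ fib vtx v, edgeWt c p q =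
      ((fib vtx v).filter fun p => c p = k).card / (Finset.univ.filter fun p => c p = k).card := by
    intro p hp
    rw [Finset.mem_filter] at hp
    have h1 : ∀ q, edgeWt c p q =
        if c q = k then 1 / ((Finset.univ.filter fun p => c p = k).card : ℝ) else 0 := by
      intro q
      rw [edgeWt, wt, cls, hp.2]
      simp only [eq_comm]
    simp only [h1]
    rw [← Finset.sum_filter, Finset.sum_const, nsmul_eq_mul, mul_one_div]
  rw [Finset.sum_congr rfl this, Finset.sum_const, nsmul_eq_mul, mul_div_assoc]

end

/-- The points: at each of `n` vertices, `e` spectators and `D` labelled points. -/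
inductive Pt (n e D : ℕ) : Type
  | spec (v : Fin n) (i : Fin e)
  | lab (v : Fin n) (i : Fin D)

/-- Points as pairs of a vertex and a position. -/
def ptEquiv (n e D : ℕ) : Fin n × (Fin e ⊕ Fin D) ≃ Pt n e D where
  toFun p := Sum.elim (Pt.spec p.1) (Pt.lab p.1) p.2
  invFun
    | Pt.spec v i => (v, Sum.inl i)
    | Pt.lab v i => (v, Sum.inr i)
  left_inv := by rintro ⟨v, i | i⟩ <;> rfl
  right_inv := by rintro (⟨v, i⟩ | ⟨v, i⟩) <;> rfl

noncomputable instance (n e D : ℕ) : Fintype (Pt n e D) := Fintype.ofEquiv _ (ptEquiv n e D)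

/-- The vertex of a point. -/
def Pt.vtx {n e D : ℕ} : Pt n e D → Fin n
  | Pt.spec v _ => v
  | Pt.lab v _ => v

/-- The colours: a label, or the colour of the spectators. -/
inductive Col (L : Type*)
  | none : Col L
  | some (x : L) : Col L

/-- Colours as optional labels. -/
def colEquiv (L : Type*) : Option L ≃ Col L where
  toFun o := o.elim Col.none Col.some
  invFun
    | Col.none => Option.none
    | Col.some x => Option.some x
  left_inv := by rintro (_ | x) <;> rfl
  right_inv := by rintro (_ | x) <;> rfl

noncomputable instance (L : Type*) [Fintype L] : Fintype (Col L) := Fintype.ofEquiv _ (colEquiv L)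

lemma Col.sum_eq {L M : Type*} [Fintype L] [AddCommMonoid M] (f : Col L → M) :
    ∑ k, f k = f Col.none + ∑ x, f (Col.some x) := by
  rw [← (colEquiv L).sum_comp, Fintype.sum_option]; rfl

lemma Col.prod_eq {L M : Type*} [Fintype L] [CommMonoid M] (f : Col L → M) :
    ∏ k, f k = f Col.none * ∏ x, f (Col.some x) := by
  rw [← (colEquiv L).prod_comp, Fintype.prod_option]; rfl

/-- The colouring of the points with `e` spectators and `D` labelled points at each vertex. -/
def labelCol {n e D : ℕ} {L : Type*} (l : Fin n → Fin D → L) : Pt n e D → Col L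
  | Pt.spec _ _ => Col.none
  | Pt.lab v i => Col.some (l v i)

/-- The number of points at a vertex with a given label. -/
noncomputable def labCount {n D : ℕ} {L : Type*} (l : Fin n → Fin D → L) (v : Fin n) (x : L) : ℕ :=
  (Finset.univ.filter fun i => l v i = x).card

section
variable {n e D : ℕ} {L : Type*} (l : Fin n → Fin D → L)

lemma card_fib_labelCol_none (v : Fin n) :
    ((fib (Pt.vtx : Pt n e D → Fin n) v).filter fun p => labelCol l p = Col.none).card = e := by
  have : ((fib (Pt.vtx : Pt n e D → Fin n) v).filter fun p => labelCol l p = Col.none) =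
      Finset.univ.image fun i : Fin e => Pt.spec v i := by
    ext p
    rcases p with ⟨w, x⟩ | ⟨w, x⟩ <;> simp [mem_fib, labelCol, Pt.vtx, eq_comm]
  rw [this, Finset.card_image_of_injective _ (fun i j h => by simpa using h)]
  simp

lemma card_fib_labelCol_some (v : Fin n) (x : L) :
    ((fib (Pt.vtx : Pt n e D → Fin n) v).filter fun p => labelCol l p = Col.some x).card =
      labCount l v x := by
  have : ((fib (Pt.vtx : Pt n e D → Fin n) v).filter fun p => labelCol l p = Col.some x) =
      (Finset.univ.filter fun i => l v i = x).image fun i : Fin D => Pt.lab v i := by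
    ext p
    rw [Finset.mem_filter, mem_fib, Finset.mem_image]
    rcases p with ⟨w, y⟩ | ⟨w, y⟩
    · simp [labelCol]
    · simp only [labelCol, Pt.vtx, Finset.mem_filter, Finset.mem_univ,
        true_and, Col.some.injEq, Pt.lab.injEq]
      constructor
      · rintro ⟨rfl, h⟩; exact ⟨y, h, rfl, rfl⟩
      · rintro ⟨z, h, rfl, rfl⟩; exact ⟨rfl, h⟩
  rw [this, Finset.card_image_of_injective _ (fun i j h => by simpa using h), labCount]

lemma card_eq_sum_fib {P V : Type*} [Fintype P] [Fintype V] (vtx : P → V) (q : P → Prop) :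
    (Finset.univ.filter q).card = ∑ v, ((fib vtx v).filter q).card := by
  rw [Finset.card_eq_sum_card_fiberwise (f := vtx) (t := Finset.univ) (by simp)]
  refine Finset.sum_congr rfl fun v _ => ?_
  congr 1; ext p; simp [fib, and_comm]

lemma card_labelCol_none :
    (Finset.univ.filter fun p : Pt n e D => labelCol l p = Col.none).card = n * e := by
  rw [card_eq_sum_fib (Pt.vtx : Pt n e D → Fin n)]
  simp only [card_fib_labelCol_none]
  simp

lemma card_labelCol_some (x : L) :
    (Finset.univ.filter fun p : Pt n e D => labelCol l p = Col.some x).card =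
      ∑ v, labCount l v x := by
  rw [card_eq_sum_fib (Pt.vtx : Pt n e D → Fin n)]
  simp only [card_fib_labelCol_some]

lemma card_pairings_labelCol [Fintype L] :
    (Finset.univ.filter (IsPairing (labelCol (e := e) l))).card =
      pf (n * e) * ∏ x, pf (∑ v, labCount l v x) := by
  rw [card_pairings, Col.prod_eq, card_labelCol_none]
  simp only [card_labelCol_some]

lemma sum_wt_labelCol [Fintype L] : ∑ p, wt (labelCol (e := e) l) p =
    ((n * e : ℕ) : ℝ) / (n * e : ℕ) +
      ∑ x, ((∑ v, labCount l v x : ℕ) : ℝ) / (∑ v, labCount l v x : ℕ) := by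
  rw [sum_wt_eq, Col.sum_eq, card_labelCol_none]
  simp only [card_labelCol_some]

lemma fibWt_labelCol [Fintype L] (u v : Fin n) :
    fibWt (labelCol (e := e) l) Pt.vtx u v = (e : ℝ) / n +
      ∑ x, (labCount l u x : ℝ) * labCount l v x / (∑ v, labCount l v x : ℕ) := by
  rw [fibWt_eq, Col.sum_eq, card_labelCol_none]
  simp only [card_labelCol_some, card_fib_labelCol_some, card_fib_labelCol_none]
  congr 1
  rcases Nat.eq_zero_or_pos e with rfl | he
  · simp
  · have : (0:ℝ) < e := by exact_mod_cast he
    push_cast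
    rw [mul_comm (n:ℝ), mul_div_mul_left _ _ this.ne']

/-- The sum of the squared mean multiplicities. -/
noncomputable def labK (e : ℕ) {n D : ℕ} {L : Type*} [Fintype L] (l : Fin n → Fin D → L) : ℝ :=
  ∑ u, ∑ v, fibWt (labelCol (e := e) l) Pt.vtx u v ^ 2

/-- The number of pairings that respect the labelling. -/
noncomputable def labN (e : ℕ) {n D : ℕ} {L : Type*} (l : Fin n → Fin D → L) : ℝ :=
  (Finset.univ.filter (IsPairing (labelCol (e := e) l))).card

/-- The number of simple pairings that respect the labelling. -/
noncomputable def labS (e : ℕ) {n D : ℕ} {L : Type*} (l : Fin n → Fin D → L) : ℝ :=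
  (Finset.univ.filter fun π => IsPairing (labelCol (e := e) l) π ∧
    IsSimplePairing Pt.vtx π).card

lemma labS_le_labN : labS e l ≤ labN e l := by
  unfold labS labN
  exact_mod_cast Finset.card_le_card fun π h => by
    rw [Finset.mem_filter] at h ⊢; exact ⟨h.1, h.2.1⟩

lemma card_Pt : Fintype.card (Pt n e D) = n * (e + D) := by
  rw [← Fintype.card_congr (ptEquiv n e D)]; simp

lemma card_fib_vtx (v : Fin n) : (fib (Pt.vtx : Pt n e D → Fin n) v).card = e + D := by
  have : fib (Pt.vtx : Pt n e D → Fin n) v =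
      Finset.univ.image (fun x => ptEquiv n e D (v, x)) := by
    ext p
    rcases p with ⟨w, x⟩ | ⟨w, x⟩ <;> simp [mem_fib, Pt.vtx, ptEquiv, eq_comm]
  rw [this, Finset.card_image_of_injective _ (fun i j h => by simpa using h)]
  simp

set_option maxHeartbeats 1000000 in
lemma labS_bounds [Fintype L] {d : ℕ} (hd : e + D = d) (hd1 : 1 ≤ d) (hn : 176 * d ^ 3 ≤ n)
    (hl : ∀ x, ∑ v, labCount l v x = 0 ∨ (n : ℝ) / (2 * d) ≤ (∑ v, labCount l v x : ℕ)) :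
    let η : ℝ := 180 * d ^ 7 / n
    let W := ∑ p, wt (labelCol (e := e) l) p
    labN e l * Real.exp (-((labK e l - W) / 4 + η)) ≤ labS e l ∧
      labS e l ≤ labN e l * Real.exp (-((labK e l - W) / 4 - η)) := by
  intro η W
  have hd1' : (1:ℝ) ≤ d := by exact_mod_cast hd1
  have hn' : 176 * (d:ℝ) ^ 3 ≤ n := by exact_mod_cast hn
  have hd0 : (0:ℝ) < d := by linarith
  have hn0 : (0:ℝ) < n := lt_of_lt_of_le (by positivity) hn'
  set M : ℝ := n / (2 * d) with hM
  have hM0 : 0 < M := by positivity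
  set δ : ℝ := 44 * d ^ 3 / n with hδ
  have hδM : δ * M = 22 * (d:ℝ) ^ 2 := by rw [hδ, hM]; field_simp; norm_num
  have hδ4 : 4 * δ ≤ 1 := by
    rw [hδ, ← mul_div_assoc, div_le_one hn0]; linarith
  have hsw : SwitchData (labelCol (e := e) l) (Pt.vtx : Pt n e D → Fin n) d M δ := by
    refine ⟨fun u => by rw [card_fib_vtx, hd], hM0, fun p => ?_, ?_, by linarith⟩
    · rcases p with ⟨v, i⟩ | ⟨v, i⟩
      · have he : 1 ≤ e := by have := i.2; omega
        have : cls (labelCol (e := e) l) (Pt.spec v i) =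
            Finset.univ.filter fun p => labelCol l p = Col.none := rfl
        rw [this, card_labelCol_none]
        calc M ≤ n := div_le_self hn0.le (by linarith)
          _ ≤ (n * e : ℕ) := by exact_mod_cast Nat.le_mul_of_pos_right n he
      · have : cls (labelCol (e := e) l) (Pt.lab v i) =
            Finset.univ.filter fun p => labelCol l p = Col.some (l v i) := rfl
        rw [this, card_labelCol_some]
        refine (hl _).resolve_left fun h0 => ?_
        rw [Finset.sum_eq_zero_iff] at h0
        have h1 := h0 v (Finset.mem_univ v)
        rw [labCount, Finset.card_eq_zero, Finset.filter_eq_empty_iff] at h1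
        exact h1 (Finset.mem_univ i) rfl
    · rw [hδM]; push_cast; nlinarith
  have key := simple_pairings_bounds hsw hδ4
  have hP : (Fintype.card (Pt n e D) : ℝ) = n * d := by
    rw [← hd, card_Pt]; push_cast; ring
  have hη : 2 * δ * (Fintype.card (Pt n e D) * d ^ 2 / M) +
      Fintype.card (Pt n e D) * d ^ 3 / M ^ 2 ≤ η := by
    rw [hP]
    have e1 : 2 * δ * ((n:ℝ) * d * d ^ 2 / M) = 176 * d ^ 7 / n := by
      rw [hδ, hM]; field_simp; norm_num
    have e2 : (n:ℝ) * d * d ^ 3 / M ^ 2 = 4 * d ^ 6 / n := by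
      rw [hM]; field_simp; norm_num
    rw [e1, e2, ← add_div]
    refine div_le_div_of_nonneg_right ?_ hn0.le
    have : (d:ℝ) ^ 6 ≤ d ^ 7 := pow_le_pow_right₀ hd1' (by norm_num)
    linarith
  have hN0 : 0 ≤ labN e l := by unfold labN; positivity
  refine ⟨le_trans ?_ key.1, key.2.trans ?_⟩
  · refine mul_le_mul_of_nonneg_left (Real.exp_le_exp.mpr ?_) hN0
    have : labK e l = ∑ u, ∑ v, fibWt (labelCol (e := e) l) Pt.vtx u v ^ 2 := rfl
    linarith
  · refine mul_le_mul_of_nonneg_left (Real.exp_le_exp.mpr ?_) hN0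
    have : labK e l = ∑ u, ∑ v, fibWt (labelCol (e := e) l) Pt.vtx u v ^ 2 := rfl
    linarith

end
end
end RegSum

namespace RegSum
section
open scoped Classical

/-- The labelling with a single label. -/
def labOne (n D : ℕ) (_ : Fin n) (_ : Fin D) : Unit := ()

/-- The labelling by membership in a chosen set of positions. -/
noncomputable def labIn {n D : ℕ} (σ : Fin n → Finset (Fin D)) (v : Fin n) (i : Fin D) : Bool :=
  decide (i ∈ σ v)

/-- The labelling by membership in two chosen sets of positions. -/
noncomputable def labTwo {n D : ℕ} (σ σ' : Fin n → Finset (Fin D)) (v : Fin n) (i : Fin D) :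
    Bool × Bool :=
  (labIn σ v i, labIn σ' v i)

variable {n e D : ℕ}

lemma labCount_labOne (v : Fin n) (x : Unit) : labCount (labOne n D) v x = D := by
  unfold labCount labOne; simp

lemma labCount_eq {L : Type*} {l : Fin n → Fin D → L} {v : Fin n} {x : L} {s : Finset (Fin D)}
    (h : ∀ i, l v i = x ↔ i ∈ s) : labCount l v x = s.card := by
  unfold labCount; congr 1; ext i; simp [h]

lemma labCount_labIn_true (σ : Fin n → Finset (Fin D)) (v : Fin n) :
    labCount (labIn σ) v true = (σ v).card :=
  labCount_eq fun i => by simp [labIn]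

lemma labCount_labIn_false (σ : Fin n → Finset (Fin D)) (v : Fin n) :
    labCount (labIn σ) v false = D - (σ v).card := by
  rw [labCount_eq (s := (σ v)ᶜ) fun i => by simp [labIn], Finset.card_compl, Fintype.card_fin]

lemma labCount_labTwo (σ σ' : Fin n → Finset (Fin D)) (v : Fin n) :
    labCount (labTwo σ σ') v (true, true) = (σ v ∩ σ' v).card ∧
    labCount (labTwo σ σ') v (true, false) = (σ v).card - (σ v ∩ σ' v).card ∧
    labCount (labTwo σ σ') v (false, true) = (σ' v).card - (σ v ∩ σ' v).card ∧
    labCount (labTwo σ σ') v (false, false) = D - ((σ v).card + (σ' v).card - (σ v ∩ σ' v).card) := by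
  refine ⟨labCount_eq fun i => by simp [labTwo, labIn], ?_, ?_, ?_⟩
  · rw [labCount_eq (s := σ v \ σ' v) fun i => by simp [labTwo, labIn], Finset.card_sdiff,
      Finset.inter_comm]
  · rw [labCount_eq (s := σ' v \ σ v) fun i => by simp [labTwo, labIn, and_comm], Finset.card_sdiff]
  · rw [labCount_eq (s := (σ v ∪ σ' v)ᶜ) fun i => by simp [labTwo, labIn], Finset.card_compl,
      Fintype.card_fin, Finset.card_union]

lemma split_quotient {m n x y : ℝ} (hm : m ≠ 0) (hn : n ≠ 0) :
    (m / n + x) * (m / n + y) / m = m / n ^ 2 + (x + y) / n + x * y / m := by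
  field_simp; ring

lemma sum_sq_rank_one {c Q : ℝ} {x : Fin n → ℝ} (hx : ∑ v, x v = 0) :
    ∑ u, ∑ v, (c + x u * x v * Q) ^ 2 = (n * c) ^ 2 + (Q * ∑ v, x v ^ 2) ^ 2 := by
  have : ∀ u, ∑ v, (c + x u * x v * Q) ^ 2 = n * c ^ 2 + x u ^ 2 * (Q ^ 2 * ∑ v, x v ^ 2) := by
    intro u
    have : ∀ v, (c + x u * x v * Q) ^ 2 =
        c ^ 2 + (2 * c * x u * Q) * x v + (x u ^ 2 * Q ^ 2) * x v ^ 2 := fun v => by ring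
    simp only [this, Finset.sum_add_distrib, ← Finset.mul_sum, hx]
    simp; ring
  simp only [this, Finset.sum_add_distrib, ← Finset.sum_mul]
  simp; ring

lemma labK_labOne (hn : 0 < n) : labK e (labOne n D) = ((e : ℝ) + D) ^ 2 := by
  have hn' : (n:ℝ) ≠ 0 := by exact_mod_cast hn.ne'
  unfold labK
  have : ∀ u v, fibWt (labelCol (e := e) (labOne n D)) Pt.vtx u v = ((e:ℝ) + D) / n := by
    intro u v
    rw [fibWt_labelCol]
    simp only [labCount_labOne]
    rcases Nat.eq_zero_or_pos D with rfl | hD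
    · simp
    · have : (D:ℝ) ≠ 0 := by exact_mod_cast hD.ne'
      simp; field_simp
  simp only [this]
  simp; field_simp

lemma labK_labIn {a b : ℕ} (hn : 0 < n) (ha : 0 < a) (hb : 0 < b)
    {σ : Fin n → Finset (Fin (a + b))} (hσ : ∀ v, (σ v).card = a) :
    labK e (labIn σ) = ((e : ℝ) + a + b) ^ 2 := by
  have hn' : (n:ℝ) ≠ 0 := by exact_mod_cast hn.ne'
  have ha' : (a:ℝ) ≠ 0 := by exact_mod_cast ha.ne'
  have hb' : (b:ℝ) ≠ 0 := by exact_mod_cast hb.ne'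
  unfold labK
  have : ∀ u v, fibWt (labelCol (e := e) (labIn σ)) Pt.vtx u v = ((e:ℝ) + a + b) / n := by
    intro u v
    rw [fibWt_labelCol, Fintype.sum_bool]
    simp only [labCount_labIn_true, labCount_labIn_false, hσ, Nat.add_sub_cancel_left]
    simp; field_simp; ring
  simp only [this]
  simp; field_simp

lemma labCount_labTwo_eq {a b : ℕ} (hab : a ≤ b) {σ σ' : Fin n → Finset (Fin (a + b))}
    {t : Fin n → Fin (a + 1)} (hσ : ∀ v, (σ v).card = a) (hσ' : ∀ v, (σ' v).card = a)
    (ht : ∀ v, (t v : ℕ) = (σ v ∩ σ' v).card) (v : Fin n) :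
    labCount (labTwo σ σ') v (true, true) = t v ∧
    labCount (labTwo σ σ') v (true, false) = a - t v ∧
    labCount (labTwo σ σ') v (false, true) = a - t v ∧
    labCount (labTwo σ σ') v (false, false) = b - a + t v := by
  obtain ⟨h1, h2, h3, h4⟩ := labCount_labTwo σ σ' v
  have := (t v).2
  rw [h1, h2, h3, h4, hσ, hσ', ← ht]
  refine ⟨rfl, rfl, rfl, by omega⟩

lemma sum_labCount_labTwo {a b : ℕ} (hab : a ≤ b) {σ σ' : Fin n → Finset (Fin (a + b))}
    {t : Fin n → Fin (a + 1)} (hσ : ∀ v, (σ v).card = a) (hσ' : ∀ v, (σ' v).card = a)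
    (ht : ∀ v, (t v : ℕ) = (σ v ∩ σ' v).card) :
    ∑ v, labCount (labTwo σ σ') v (true, true) = coordSum t ∧
    ∑ v, labCount (labTwo σ σ') v (true, false) = a * n - coordSum t ∧
    ∑ v, labCount (labTwo σ σ') v (false, true) = a * n - coordSum t ∧
    ∑ v, labCount (labTwo σ σ') v (false, false) = b * n + coordSum t - a * n := by
  have h := labCount_labTwo_eq hab hσ hσ' ht
  have h2 : ∑ v, (a - (t v : ℕ)) = a * n - coordSum t := by
    have : ∑ v, (a - (t v : ℕ)) + coordSum t = a * n := by
      rw [coordSum, ← Finset.sum_add_distrib]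
      rw [Finset.sum_congr rfl fun v _ => Nat.sub_add_cancel (Nat.lt_succ_iff.mp (t v).2)]
      simp [mul_comm]
    omega
  refine ⟨Finset.sum_congr rfl fun v _ => (h v).1, ?_, ?_, ?_⟩
  · rw [← h2]; exact Finset.sum_congr rfl fun v _ => (h v).2.1
  · rw [← h2]; exact Finset.sum_congr rfl fun v _ => (h v).2.2.1
  · rw [Finset.sum_congr rfl fun v _ => (h v).2.2.2, Finset.sum_add_distrib]
    have : n * (b - a) = b * n - a * n := by rw [Nat.mul_sub, mul_comm, mul_comm n a]
    have h3 : a * n ≤ b * n := Nat.mul_le_mul_right n hab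
    simp only [Finset.sum_const, Finset.card_univ, Fintype.card_fin, smul_eq_mul, this]
    rw [← coordSum]; omega

lemma labK_labTwo {a b : ℕ} (hn : 0 < n) (hab : a ≤ b) {σ σ' : Fin n → Finset (Fin (a + b))}
    {t : Fin n → Fin (a + 1)} (hσ : ∀ v, (σ v).card = a) (hσ' : ∀ v, (σ' v).card = a)
    (ht : ∀ v, (t v : ℕ) = (σ v ∩ σ' v).card) (hT0 : 0 < coordSum t) (hTN : coordSum t < a * n) :
    labK e (labTwo σ σ') = ((e : ℝ) + a + b) ^ 2 +
      (invSum (a * n) (b * n) (coordSum t) * dispersion t) ^ 2 := by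
  have hn' : (n:ℝ) ≠ 0 := by exact_mod_cast hn.ne'
  set T := coordSum t with hT
  have hT' : (0:ℝ) < T := by exact_mod_cast hT0
  have hTN' : (T:ℝ) < a * n := by exact_mod_cast hTN
  have hab' : (a:ℝ) * n ≤ b * n := by exact_mod_cast Nat.mul_le_mul_right n hab
  have hl := labCount_labTwo_eq hab hσ hσ' ht
  obtain ⟨s1, s2, s3, s4⟩ := sum_labCount_labTwo hab hσ hσ' ht
  rw [← hT] at s1 s2 s3 s4
  have c2 : ((a * n - T : ℕ) : ℝ) = a * n - T := by
    rw [Nat.cast_sub hTN.le]; push_cast; ring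
  have c4 : ((b * n + T - a * n : ℕ) : ℝ) = b * n - a * n + T := by
    rw [Nat.cast_sub (by have := Nat.mul_le_mul_right n hab; omega)]; push_cast; ring
  have hx : ∑ v, (((t v : ℕ) : ℝ) - T / n) = 0 := by
    rw [Finset.sum_sub_distrib, hT, coordSum]
    push_cast; simp; field_simp; ring
  have key : ∀ u v, fibWt (labelCol (e := e) (labTwo σ σ')) Pt.vtx u v =
      ((e:ℝ) + a + b) / n + (((t u : ℕ) : ℝ) - T / n) * (((t v : ℕ) : ℝ) - T / n) *
        invSum (a * n) (b * n) T := by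
    intro u v
    rw [fibWt_labelCol, Fintype.sum_prod_type, Fintype.sum_bool, Fintype.sum_bool, Fintype.sum_bool]
    rw [s1, s2, s3, s4, (hl u).1, (hl v).1, (hl u).2.1, (hl v).2.1, (hl u).2.2.1, (hl v).2.2.1,
      (hl u).2.2.2, (hl v).2.2.2, c2, c4]
    have d1 : ∀ w, ((a - (t w : ℕ) : ℕ) : ℝ) = a - (t w : ℕ) := fun w =>
      Nat.cast_sub (Nat.lt_succ_iff.mp (t w).2)
    have d2 : ∀ w, ((b - a + (t w : ℕ) : ℕ) : ℝ) = b - a + (t w : ℕ) := fun w => by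
      rw [Nat.cast_add, Nat.cast_sub hab]
    rw [d1, d1, d2, d2]
    set x : ℝ := ((t u : ℕ) : ℝ) - T / n with hxd
    set y : ℝ := ((t v : ℕ) : ℝ) - T / n with hyd
    have m2 : (a:ℝ) * n - T ≠ 0 := by linarith
    have m4 : (b:ℝ) * n - a * n + T ≠ 0 := by linarith
    have q1 := split_quotient (x := x) (y := y) hT'.ne' hn'
    have q2 := split_quotient (x := -x) (y := -y) m2 hn'
    have q4 := split_quotient (x := x) (y := y) m4 hn'
    have r1 : ∀ z w : ℝ, z = w - T / n → w = T / n + z := fun z w h => by rw [h]; ring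
    have r2 : ∀ z w : ℝ, z = w - T / n → (a:ℝ) - w = (a * n - T) / n + -z := fun z w h => by
      rw [h]; field_simp; ring
    have r4 : ∀ z w : ℝ, z = w - T / n → (b:ℝ) - a + w = (b * n - a * n + T) / n + z := fun z w h => by
      rw [h]; field_simp; ring
    rw [r2 x _ hxd, r2 y _ hyd, r4 x _ hxd, r4 y _ hyd, q2, q4]
    rw [r1 x _ hxd, r1 y _ hyd, q1]
    unfold invSum
    push_cast
    field_simp
    ring
  unfold labK
  simp only [key]
  rw [sum_sq_rank_one hx, dispersion, Fintype.card_fin, ← hT]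
  congr 2
  field_simp

end
end RegSum

namespace RegSum
section
open scoped Classical

variable {n e a b d : ℕ}

lemma labN_labOne {D : ℕ} : labN e (labOne n D) = pf (n * e) * pf (D * n) := by
  unfold labN
  rw [card_pairings_labelCol]
  simp [labCount_labOne, mul_comm]

lemma labN_labIn {σ : Fin n → Finset (Fin (a + b))} (hσ : ∀ v, (σ v).card = a) :
    labN e (labIn σ) = pf (n * e) * (pf (a * n) * pf (b * n)) := by
  unfold labN
  rw [card_pairings_labelCol, Fintype.prod_bool]
  simp only [labCount_labIn_true, labCount_labIn_false, hσ, Nat.add_sub_cancel_left]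
  simp [mul_comm]

lemma labN_labTwo (hab : a ≤ b) {σ σ' : Fin n → Finset (Fin (a + b))}
    {t : Fin n → Fin (a + 1)} (hσ : ∀ v, (σ v).card = a) (hσ' : ∀ v, (σ' v).card = a)
    (ht : ∀ v, (t v : ℕ) = (σ v ∩ σ' v).card) :
    labN e (labTwo σ σ') = pf (n * e) * (pf (coordSum t) * pf (a * n - coordSum t) ^ 2 *
      pf (b * n + coordSum t - a * n)) := by
  obtain ⟨s1, s2, s3, s4⟩ := sum_labCount_labTwo hab hσ hσ' ht
  unfold labN
  rw [card_pairings_labelCol, Fintype.prod_prod_type, Fintype.prod_bool, Fintype.prod_bool,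
    Fintype.prod_bool, s1, s2, s3, s4]
  push_cast; ring

lemma labN_mul_labN (hn : Even n) (hab : a ≤ b) {σ σ' : Fin n → Finset (Fin (a + b))}
    {t : Fin n → Fin (a + 1)} (hσ : ∀ v, (σ v).card = a) (hσ' : ∀ v, (σ' v).card = a)
    (ht : ∀ v, (t v : ℕ) = (σ v ∩ σ' v).card) :
    labN e (labTwo σ σ') * labN e (labOne n (a + b)) =
      ovr (a * n) (b * n) (coordSum t) * labN e (labIn σ) ^ 2 := by
  rw [labN_labTwo hab hσ hσ' ht, labN_labOne, labN_labIn hσ, ovr]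
  have h1 : (pf (a * n) : ℝ) ≠ 0 := by exact_mod_cast (pf_pos_of_even (hn.mul_left a)).ne'
  have h2 : (pf (b * n) : ℝ) ≠ 0 := by exact_mod_cast (pf_pos_of_even (hn.mul_left b)).ne'
  rw [show (a + b) * n = a * n + b * n by ring]
  field_simp

/-- Lower bound for the number of simple pairings that respect a two-part labelling. -/
noncomputable def partLow (n e a b : ℕ) : ℝ :=
  pf (n * e) * (pf (a * n) * pf (b * n)) *
    Real.exp (-((((e + a + b : ℕ) : ℝ) ^ 2 - (((n * e : ℕ) : ℝ) / (n * e : ℕ) + 2)) / 4 +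
      180 * ((e + a + b : ℕ) : ℝ) ^ 7 / n))

lemma partLow_pos (hn : Even n) : 0 < partLow n e a b := by
  have h1 : (0:ℝ) < pf (a * n) := by exact_mod_cast pf_pos_of_even (hn.mul_left a)
  have h2 : (0:ℝ) < pf (b * n) := by exact_mod_cast pf_pos_of_even (hn.mul_left b)
  have h3 : (0:ℝ) < pf (n * e) := by exact_mod_cast pf_pos_of_even (hn.mul_right e)
  unfold partLow; positivity

lemma div_two_mul_le {k : ℕ} (hd : 1 ≤ d) (hk : 1 ≤ k) : (n : ℝ) / (2 * d) ≤ (k * n : ℕ) := by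
  have h1 : (1:ℝ) ≤ d := by exact_mod_cast hd
  calc (n : ℝ) / (2 * d) ≤ n := div_le_self (by positivity) (by linarith)
    _ ≤ (k * n : ℕ) := by exact_mod_cast Nat.le_mul_of_pos_left n hk

lemma partLow_le (hd : e + a + b = d) (ha : 0 < a) (hb : 0 < b) (hn : 176 * d ^ 3 ≤ n)
    {σ : Fin n → Finset (Fin (a + b))} (hσ : ∀ v, (σ v).card = a) :
    partLow n e a b ≤ labS e (labIn σ) := by
  have hd1 : 1 ≤ d := by omega
  have hn0 : 0 < n := lt_of_lt_of_le (by positivity) hn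
  have hsum : ∀ x, ∑ v, labCount (labIn σ) v x = if x then a * n else b * n := by
    intro x
    cases x
    · simp only [labCount_labIn_false, hσ, Nat.add_sub_cancel_left]; simp [mul_comm]
    · simp only [labCount_labIn_true, hσ]; simp [mul_comm]
  have h := (labS_bounds (e := e) (labIn σ) (d := d) (by omega) hd1 hn (fun x => by
    right; rw [hsum]; cases x
    · simpa using div_two_mul_le (n := n) hd1 hb
    · simpa using div_two_mul_le (n := n) hd1 ha)).1
  refine le_trans (le_of_eq ?_) h
  have ha' : (a:ℝ) ≠ 0 := by exact_mod_cast ha.ne'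
  have hb' : (b:ℝ) ≠ 0 := by exact_mod_cast hb.ne'
  have hn' : (n:ℝ) ≠ 0 := by exact_mod_cast hn0.ne'
  rw [labN_labIn hσ, labK_labIn hn0 ha hb hσ, sum_wt_labelCol, Fintype.sum_bool, hsum, hsum,
    partLow, hd]
  have e1 : ((a * n : ℕ) : ℝ) / (a * n : ℕ) = 1 := div_self (by push_cast; positivity)
  have e2 : ((b * n : ℕ) : ℝ) / (b * n : ℕ) = 1 := div_self (by push_cast; positivity)
  have e3 : (e:ℝ) + a + b = d := by exact_mod_cast hd
  simp only [if_true, Bool.false_eq_true, if_false]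
  rw [e1, e2, e3]
  norm_num

lemma labS_labOne_le (hd : e + a + b = d) (ha : 0 < a) (hn : 176 * d ^ 3 ≤ n) :
    labS e (labOne n (a + b)) ≤ labN e (labOne n (a + b)) *
      Real.exp (-(((d : ℝ) ^ 2 - (((n * e : ℕ) : ℝ) / (n * e : ℕ) + 1)) / 4 - 180 * d ^ 7 / n)) := by
  have hd1 : 1 ≤ d := by omega
  have hn0 : 0 < n := lt_of_lt_of_le (by positivity) hn
  have hsum : ∀ x, ∑ v, labCount (labOne n (a + b)) v x = (a + b) * n := by
    intro x; simp only [labCount_labOne]; simp [mul_comm]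
  have h := (labS_bounds (e := e) (labOne n (a + b)) (d := d) (by omega) hd1 hn (fun x => by
    right; rw [hsum]; exact div_two_mul_le (n := n) hd1 (by omega))).2
  refine le_trans h (le_of_eq ?_)
  rw [labK_labOne hn0, sum_wt_labelCol]
  simp only [hsum]
  have e1 : (((a + b) * n : ℕ) : ℝ) / ((a + b) * n : ℕ) = 1 :=
    div_self (by exact_mod_cast (Nat.mul_pos (by omega) hn0).ne')
  have e3 : (e:ℝ) + (a + b : ℕ) = d := by rw [← hd]; push_cast; ring
  rw [e1, e3]
  simp

/-- The bound for the normalised second moment terms. -/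
noncomputable def overlapWt (n a b d : ℕ) (t : Fin n → Fin (a + 1)) : ℝ :=
  if |(coordSum t : ℝ) - ovrCenter (a * n) (b * n)| < ovrCenter (a * n) (b * n) / 2
  then bulkWt (a * n) (b * n) (coordSum t) (dispersion t)
  else Real.exp ((d : ℝ) ^ 2) * ovr (a * n) (b * n) (coordSum t)

lemma labS_mul_le (hn2 : Even n) (hd : e + a + b = d) (ha : 0 < a) (hab : 8 * a ≤ b)
    (hn : 176 * d ^ 3 ≤ n) {σ σ' : Fin n → Finset (Fin (a + b))}
    {t : Fin n → Fin (a + 1)} (hσ : ∀ v, (σ v).card = a) (hσ' : ∀ v, (σ' v).card = a)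
    (ht : ∀ v, (t v : ℕ) = (σ v ∩ σ' v).card) :
    labS e (labTwo σ σ') * labS e (labOne n (a + b)) ≤
      Real.exp (4 * (180 * d ^ 7 / n)) * overlapWt n a b d t * partLow n e a b ^ 2 := by
  have hd1 : 1 ≤ d := by omega
  have hn0 : 0 < n := lt_of_lt_of_le (by positivity) hn
  have hn' : (0:ℝ) < n := by exact_mod_cast hn0
  have hd' : (1:ℝ) ≤ d := by exact_mod_cast hd1
  have hab1 : a ≤ b := by omega
  have h1 := labS_labOne_le hd ha hn
  have hmul := labN_mul_labN (e := e) hn2 hab1 hσ hσ' ht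
  set η : ℝ := 180 * d ^ 7 / n with hη
  have hη0 : 0 ≤ η := by positivity
  set ω : ℝ := ((n * e : ℕ) : ℝ) / (n * e : ℕ) with hω
  have hω0 : 0 ≤ ω := by positivity
  have hω1 : ω ≤ 1 := div_self_le_one _
  have hlow : partLow n e a b = labN e (labIn σ) * Real.exp (-(((d:ℝ) ^ 2 - (ω + 2)) / 4 + η)) := by
    rw [labN_labIn hσ, partLow, hd]
  have hS1 : 0 ≤ labS e (labOne n (a + b)) := by unfold labS; positivity
  have hS5 : 0 ≤ labS e (labTwo σ σ') := by unfold labS; positivity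
  have hN5 : 0 ≤ labN e (labTwo σ σ') := by unfold labN; positivity
  have hO := ovr_nonneg (a * n) (b * n) (coordSum t)
  have hlow2 : partLow n e a b ^ 2 = labN e (labIn σ) ^ 2 *
      Real.exp (-(((d:ℝ) ^ 2 - (ω + 2)) / 2 + 2 * η)) := by
    rw [hlow, mul_pow, ← Real.exp_nat_mul]; congr 2; push_cast; ring
  unfold overlapWt
  set T := coordSum t with hT
  set T₀ := ovrCenter (a * n) (b * n) with hT₀
  split_ifs with hb
  · rw [abs_lt] at hb
    have hT₀1 : (n:ℝ) / d ≤ T₀ := div_le_ovrCenter ha (by omega)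
    have hT₀2 : T₀ ≤ ((a * n : ℕ) : ℝ) / 9 := ovrCenter_le (by
      have := Nat.mul_le_mul_right n hab; rw [← mul_assoc]; exact this)
    have hT1 : (n:ℝ) / (2 * d) ≤ T := by
      rw [mul_comm, ← div_div]; linarith
    have hnd : 0 < (n:ℝ) / (2 * d) := by positivity
    have hT0 : 0 < T := by
      have : (0:ℝ) < T := by linarith
      exact_mod_cast this
    have haN : (n:ℝ) ≤ (a * n : ℕ) := by exact_mod_cast Nat.le_mul_of_pos_left n ha
    have hTN' : (T:ℝ) ≤ (a * n : ℕ) / 6 := by linarith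
    have hTN : T < a * n := by
      have : (T:ℝ) < (a * n : ℕ) := by linarith
      exact_mod_cast this
    obtain ⟨s1, s2, s3, s4⟩ := sum_labCount_labTwo hab1 hσ hσ' ht
    rw [← hT] at s1 s2 s3 s4
    have c2 : (n:ℝ) / (2 * d) ≤ ((a * n - T : ℕ) : ℝ) := by
      rw [Nat.cast_sub hTN.le]
      have : (n:ℝ) / (2 * d) ≤ n / 2 := by
        refine div_le_div_of_nonneg_left hn'.le (by norm_num) (by linarith)
      linarith
    have c4 : (n:ℝ) / (2 * d) ≤ ((b * n + T - a * n : ℕ) : ℝ) := by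
      refine hT1.trans ?_
      have := Nat.mul_le_mul_right n hab1
      exact_mod_cast (by omega : T ≤ b * n + T - a * n)
    have h5 := (labS_bounds (e := e) (labTwo σ σ') (d := d) (by omega) hd1 hn (fun x => by
      right
      rcases x with ⟨x | x, y | y⟩
      · rw [s4]; exact c4
      · rw [s3]; exact c2
      · rw [s2]; exact c2
      · rw [s1]; exact hT1)).2
    have q1 : (T:ℝ) / T = 1 := div_self (lt_of_lt_of_le hnd hT1).ne'
    have q2 : ((a * n - T : ℕ) : ℝ) / (a * n - T : ℕ) = 1 := div_self (lt_of_lt_of_le hnd c2).ne'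
    have q4 : ((b * n + T - a * n : ℕ) : ℝ) / (b * n + T - a * n : ℕ) = 1 :=
      div_self (lt_of_lt_of_le hnd c4).ne'
    rw [labK_labTwo hn0 hab1 hσ hσ' ht (hT ▸ hT0) (hT ▸ hTN), sum_wt_labelCol,
      Fintype.sum_prod_type, Fintype.sum_bool, Fintype.sum_bool, Fintype.sum_bool, s1, s2, s3, s4,
      q1, q2, q4,
      show (e:ℝ) + a + b = d by exact_mod_cast hd, ← hT, ← hω, ← hη] at h5
    set χ := invSum (a * n) (b * n) T * dispersion t with hχ
    calc _ ≤ _ := mul_le_mul h5 h1 hS1 (by positivity)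
      _ = (labN e (labTwo σ σ') * labN e (labOne n (a + b))) *
          Real.exp (-(((d:ℝ) ^ 2 + χ ^ 2 - (ω + (1 + 1 + (1 + 1)))) / 4 - η) +
            -(((d : ℝ) ^ 2 - (ω + 1)) / 4 - η)) := by rw [Real.exp_add]; ring
      _ = _ := by
        rw [hmul, bulkWt, ← hχ, hlow2]
        have : Real.exp (4 * η) * (ovr (a * n) (b * n) T * Real.exp ((1 - χ ^ 2) / 4)) *
            (labN e (labIn σ) ^ 2 * Real.exp (-(((d:ℝ) ^ 2 - (ω + 2)) / 2 + 2 * η))) =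
            ovr (a * n) (b * n) T * labN e (labIn σ) ^ 2 *
            Real.exp (4 * η + (1 - χ ^ 2) / 4 + -(((d:ℝ) ^ 2 - (ω + 2)) / 2 + 2 * η)) := by
          rw [Real.exp_add, Real.exp_add]; ring
        rw [this]; congr 2; ring
  · have h5 : labS e (labTwo σ σ') ≤ labN e (labTwo σ σ') := labS_le_labN _
    calc _ ≤ _ := mul_le_mul h5 h1 hS1 hN5
      _ = (labN e (labTwo σ σ') * labN e (labOne n (a + b))) *
          Real.exp (-(((d : ℝ) ^ 2 - (ω + 1)) / 4 - η)) := by ring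
      _ = ovr (a * n) (b * n) T * labN e (labIn σ) ^ 2 *
          Real.exp (-(((d : ℝ) ^ 2 - (ω + 1)) / 4 - η)) := by rw [hmul]
      _ ≤ ovr (a * n) (b * n) T * labN e (labIn σ) ^ 2 *
          Real.exp (4 * η + (d:ℝ) ^ 2 + -(((d:ℝ) ^ 2 - (ω + 2)) / 2 + 2 * η)) := by
        refine mul_le_mul_of_nonneg_left (Real.exp_le_exp.mpr ?_) (by positivity)
        nlinarith [sq_nonneg (d:ℝ)]
      _ = _ := by
        rw [hlow2, Real.exp_add, Real.exp_add]; ring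

end
end RegSum

namespace RegSum
section
open scoped Classical

lemma card_inter_eq {D a k : ℕ} (hk : k ≤ a) {s : Finset (Fin D)} :
    ((Finset.powersetCard a Finset.univ).filter fun s' => (s ∩ s').card = k).card =
      s.card.choose k * (D - s.card).choose (a - k) := by
  have h1 : s.card.choose k * (D - s.card).choose (a - k) =
      (Finset.powersetCard k s ×ˢ Finset.powersetCard (a - k) sᶜ).card := by
    rw [Finset.card_product, Finset.card_powersetCard, Finset.card_powersetCard,
      Finset.card_compl, Fintype.card_fin]
  rw [h1]
  refine Finset.card_nbij' (fun s' => (s ∩ s', sᶜ ∩ s')) (fun p => p.1 ∪ p.2) ?_ ?_ ?_ ?_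
  · intro s' hs'
    simp only [Finset.coe_filter, Finset.mem_powersetCard, Set.mem_ofPred_eq] at hs'
    simp only [Finset.coe_product, Set.mem_prod, Finset.mem_coe, Finset.mem_powersetCard]
    refine ⟨⟨Finset.inter_subset_left, hs'.2⟩, Finset.inter_subset_left, ?_⟩
    have h2 := Finset.card_union_of_disjoint (s := s ∩ s') (t := sᶜ ∩ s')
      (disjoint_compl_right.mono Finset.inter_subset_left Finset.inter_subset_left)
    have h3 : s ∩ s' ∪ sᶜ ∩ s' = s' := by ext i; simp; tauto
    rw [h3, hs'.1.2, hs'.2] at h2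
    omega
  · rintro ⟨x, y⟩ hp
    simp only [Finset.coe_product, Set.mem_prod, Finset.mem_coe, Finset.mem_powersetCard] at hp
    obtain ⟨⟨hx, hxc⟩, hy, hyc⟩ := hp
    have hd : Disjoint x y := disjoint_compl_right.mono hx hy
    have h3 : s ∩ (x ∪ y) = x := by
      ext i; simp only [Finset.mem_inter, Finset.mem_union]
      have := @hx i; have := @hy i; simp only [Finset.mem_compl] at this; tauto
    simp only [Finset.coe_filter, Finset.mem_powersetCard, Set.mem_ofPred_eq]
    refine ⟨⟨Finset.subset_univ _, ?_⟩, by rw [h3, hxc]⟩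
    rw [Finset.card_union_of_disjoint hd, hxc, hyc]; omega
  · intro s' _
    ext i; simp; tauto
  · rintro ⟨x, y⟩ hp
    simp only [Finset.coe_product, Set.mem_prod, Finset.mem_coe, Finset.mem_powersetCard] at hp
    obtain ⟨⟨hx, hxc⟩, hy, hyc⟩ := hp
    refine Prod.ext ?_ ?_
    · ext i; simp only [Finset.mem_inter, Finset.mem_union]
      have := @hx i; have := @hy i; simp only [Finset.mem_compl] at this; tauto
    · ext i; simp only [Finset.mem_inter, Finset.mem_union, Finset.mem_compl]
      have := @hx i; have := @hy i; simp only [Finset.mem_compl] at this; tauto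

lemma sum_piFinset_comp {ι X S : Type*} [Fintype ι] [DecidableEq ι] [Fintype S] (A : Finset X) (g : ι → X → S)
    (F : (ι → S) → ℝ) :
    ∑ σ ∈ Fintype.piFinset (fun _ => A), F (fun v => g v (σ v)) =
      ∑ τ : ι → S, (∏ v, ((A.filter fun x => g v x = τ v).card : ℝ)) * F τ := by
  rw [← Finset.sum_fiberwise _ (fun σ : ι → X => fun v => g v (σ v))]
  refine Finset.sum_congr rfl fun τ _ => ?_
  have h1 : (Fintype.piFinset (fun _ => A)).filter (fun σ : ι → X => (fun v => g v (σ v)) = τ) =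
      Fintype.piFinset (fun v => A.filter fun x => g v x = τ v) := by
    ext σ; simp only [Finset.mem_filter, Fintype.mem_piFinset, funext_iff, forall_and]
  rw [h1, Finset.sum_congr rfl (g := fun _ => F τ), Finset.sum_const, Fintype.card_piFinset,
    nsmul_eq_mul]
  · push_cast; rfl
  · intro σ hσ
    congr 1; funext v
    exact (Finset.mem_filter.1 (Fintype.mem_piFinset.1 hσ v)).2

/-- The ways to choose `a` of `D` positions at each vertex. -/
noncomputable def sel (n D a : ℕ) : Finset (Fin n → Finset (Fin D)) :=
  Fintype.piFinset fun _ => Finset.powersetCard a Finset.univ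

lemma mem_sel {n D a : ℕ} {σ : Fin n → Finset (Fin D)} : σ ∈ sel n D a ↔ ∀ v, (σ v).card = a := by
  simp [sel, Fintype.mem_piFinset, Finset.mem_powersetCard]

lemma card_sel (n D a : ℕ) : (sel n D a).card = D.choose a ^ n := by
  simp [sel, Fintype.card_piFinset]

/-- The overlap sizes of two selections. -/
noncomputable def overlap {n D : ℕ} (a : ℕ) (σ σ' : Fin n → Finset (Fin D)) (v : Fin n) :
    Fin (a + 1) :=
  ⟨min a (σ v ∩ σ' v).card, by omega⟩

variable {n e a b d : ℕ}

lemma overlap_val {σ σ' : Fin n → Finset (Fin (a + b))} (hσ : σ ∈ sel n (a + b) a) (v : Fin n) :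
    (overlap a σ σ' v : ℕ) = (σ v ∩ σ' v).card := by
  have := Finset.card_le_card (Finset.inter_subset_left (s₁ := σ v) (s₂ := σ' v))
  rw [mem_sel.1 hσ v] at this
  exact min_eq_right this

lemma sum_sel_overlap {σ : Fin n → Finset (Fin (a + b))} (hσ : σ ∈ sel n (a + b) a)
    (F : (Fin n → Fin (a + 1)) → ℝ) :
    ∑ σ' ∈ sel n (a + b) a, F (overlap a σ σ') =
      (sel n (a + b) a).card * pexp (Fin n) (hypW a b) F := by
  have h := sum_piFinset_comp (Finset.powersetCard a (Finset.univ : Finset (Fin (a + b))))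
    (fun (v : Fin n) s => (⟨min a (σ v ∩ s).card, by omega⟩ : Fin (a + 1))) F
  refine Eq.trans h ?_
  rw [pexp, Finset.mul_sum]
  refine Finset.sum_congr rfl fun τ _ => ?_
  rw [← mul_assoc]
  congr 1
  have h2 : ((sel n (a + b) a).card : ℝ) = ∏ _v : Fin n, ((a + b).choose a : ℝ) := by
    rw [card_sel]; simp
  rw [h2, ← Finset.prod_mul_distrib]
  refine Finset.prod_congr rfl fun v _ => ?_
  have h3 : ∀ s ∈ Finset.powersetCard a (Finset.univ : Finset (Fin (a + b))),
      ((⟨min a (σ v ∩ s).card, by omega⟩ : Fin (a + 1)) = τ v ↔ (σ v ∩ s).card = (τ v : ℕ)) := by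
    intro s _
    have := Finset.card_le_card (Finset.inter_subset_left (s₁ := σ v) (s₂ := s))
    rw [mem_sel.1 hσ v] at this
    simp only [Fin.ext_iff, min_eq_right this]
  have h4 : ((a + b).choose a : ℝ) ≠ 0 := by
    exact_mod_cast (Nat.choose_pos (Nat.le_add_right a b)).ne'
  have h5 := card_inter_eq (Nat.lt_succ_iff.1 (τ v).2) (s := σ v)
  rw [mem_sel.1 hσ v, Nat.add_sub_cancel_left] at h5
  have h6 : ∀ m : ℕ, m = a.choose (τ v) * b.choose (a - τ v) →
      (m : ℝ) = (a + b).choose a * hypW a b (τ v) := by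
    rintro m rfl
    rw [hypW, hyp]
    push_cast
    field_simp
  refine h6 _ ?_
  rw [← h5]
  congr 1
  ext s
  simp only [Finset.mem_filter]
  exact and_congr_right (h3 s)

lemma exp_four_mul_le {C ε : ℝ} {n d K : ℕ} (hC : 1 ≤ C) (hε : 0 < ε) (hε1 : ε ≤ 1)
    (hK : 8640 * C / ε ≤ K) (hKd : K ≤ d) (hn : 0 < n) (h : (d : ℝ) ^ 10 ≤ C * n) :
    Real.exp (4 * (180 * d ^ 7 / n)) ≤ 1 + ε / 3 := by
  have hn' : (0:ℝ) < n := by exact_mod_cast hn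
  have hK' : (K:ℝ) ≤ d := by exact_mod_cast hKd
  have h1 : 8640 * C ≤ d * ε := (div_le_iff₀ hε).1 (hK.trans hK')
  have hd1 : (1:ℝ) ≤ d := by nlinarith
  have h2 : (d:ℝ) ^ 7 / n * (8640 * C) ≤ C * ε := by
    rw [div_mul_eq_mul_div, div_le_iff₀ hn']
    calc (d:ℝ) ^ 7 * (8640 * C) ≤ (d:ℝ) ^ 7 * (d * ε) := mul_le_mul_of_nonneg_left h1 (by positivity)
      _ = (d:ℝ) ^ 8 * ε := by ring
      _ ≤ (d:ℝ) ^ 10 * ε :=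
        mul_le_mul_of_nonneg_right (pow_le_pow_right₀ hd1 (by norm_num)) hε.le
      _ ≤ C * n * ε := mul_le_mul_of_nonneg_right h hε.le
      _ = C * ε * n := by ring
  have h3 : (d:ℝ) ^ 7 / n * 8640 ≤ ε := by
    have : (0:ℝ) < C := by linarith
    refine le_of_mul_le_mul_left ?_ this
    linarith
  have h4 : 0 ≤ (d:ℝ) ^ 7 / n := by positivity
  have h5 : 4 * (180 * (d:ℝ) ^ 7 / n) = 720 * ((d:ℝ) ^ 7 / n) := by ring
  rw [h5]
  have := Real.abs_exp_sub_one_le (x := 720 * ((d:ℝ) ^ 7 / n)) (by rw [abs_of_nonneg] <;> linarith)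
  rw [abs_of_nonneg (a := 720 * ((d:ℝ) ^ 7 / n)) (by linarith)] at this
  have := (abs_le.1 this).2
  linarith

lemma second_moment {C ε : ℝ} (hC : 1 ≤ C) (hε : 0 < ε) (hε1 : ε ≤ 1) :
    ∃ K : ℕ, ∀ n e a b d : ℕ, Even n → K ≤ a → 8 * a ≤ b → e + a + b = d → (d : ℝ) ^ 10 ≤ C * n →
      0 < n → 0 < ∑ σ ∈ sel n (a + b) a, labS e (labIn σ) ∧
      (∑ σ ∈ sel n (a + b) a, ∑ σ' ∈ sel n (a + b) a, labS e (labTwo σ σ')) *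
        labS e (labOne n (a + b)) ≤ (1 + ε) * (∑ σ ∈ sel n (a + b) a, labS e (labIn σ)) ^ 2 := by
  obtain ⟨K₀, hK₀⟩ := overlap_bound hC (ε := ε / 3) (by linarith) (by linarith)
  refine ⟨max (max K₀ 1) ⌈8640 * C / ε⌉₊, fun n e a b d hn2 hKa hab hd hdn hn => ?_⟩
  have hK1 : K₀ ≤ a := (le_max_left _ _).trans ((le_max_left _ _).trans hKa)
  have ha : 1 ≤ a := (le_max_right _ _).trans ((le_max_left _ _).trans hKa)
  have hK2 : 8640 * C / ε ≤ (a : ℕ) := Nat.ceil_le.1 ((le_max_right _ _).trans hKa)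
  have had : a ≤ d := by omega
  have had' : (a:ℝ) ≤ d := by exact_mod_cast had
  have hexp := exp_four_mul_le hC hε hε1 hK2 had hn hdn
  have hd1 : (1:ℝ) ≤ d := by exact_mod_cast ha.trans had
  have h176 : 176 * d ^ 3 ≤ n := by
    have h1 : 8640 * C ≤ d := by
      have : 8640 * C ≤ 8640 * C / ε := by
        rw [le_div_iff₀ hε]; nlinarith
      linarith
    have h2 : C * (176 * (d:ℝ) ^ 3) ≤ C * n := by
      calc C * (176 * (d:ℝ) ^ 3) ≤ d * (d:ℝ) ^ 3 := by
            rw [← mul_assoc]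
            exact mul_le_mul_of_nonneg_right (by linarith) (by positivity)
        _ = (d:ℝ) ^ 4 := by ring
        _ ≤ (d:ℝ) ^ 10 := pow_le_pow_right₀ hd1 (by norm_num)
        _ ≤ _ := hdn
    have h3 : 176 * (d:ℝ) ^ 3 ≤ n := le_of_mul_le_mul_left h2 (by linarith)
    exact_mod_cast h3
  have hε3 : (1 + ε / 3) * (1 + ε / 3) ≤ 1 + ε := by nlinarith
  have hO := hK₀ n a b d hn2 hK1 hab (by omega) hdn
  have hlow := partLow_pos (e := e) (a := a) (b := b) hn2
  have hselpos : (0:ℝ) < (sel n (a + b) a).card := by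
    rw [card_sel]; exact_mod_cast Nat.pow_pos (Nat.choose_pos (Nat.le_add_right a b))
  set N : ℝ := ((sel n (a + b) a).card : ℝ) with hN
  have hsum : N * partLow n e a b ≤ ∑ σ ∈ sel n (a + b) a, labS e (labIn σ) := by
    rw [hN, ← nsmul_eq_mul]
    refine Finset.card_nsmul_le_sum _ _ _ fun σ hσ => ?_
    exact partLow_le hd ha (by omega) h176 (mem_sel.1 hσ)
  have hpos : 0 < N * partLow n e a b := by positivity
  refine ⟨hpos.trans_le hsum, ?_⟩
  set E := Real.exp (4 * (180 * d ^ 7 / n)) with hE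
  have hE0 : 0 < E := Real.exp_pos _
  calc _ = ∑ σ ∈ sel n (a + b) a, ∑ σ' ∈ sel n (a + b) a,
        labS e (labTwo σ σ') * labS e (labOne n (a + b)) := by
        simp only [Finset.sum_mul]
    _ ≤ ∑ σ ∈ sel n (a + b) a, ∑ σ' ∈ sel n (a + b) a,
        E * overlapWt n a b d (overlap a σ σ') * partLow n e a b ^ 2 :=
        Finset.sum_le_sum fun σ hσ => Finset.sum_le_sum fun σ' hσ' =>
          labS_mul_le hn2 hd ha hab h176 (mem_sel.1 hσ) (mem_sel.1 hσ') (overlap_val hσ)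
    _ = ∑ σ ∈ sel n (a + b) a, E * partLow n e a b ^ 2 * (N * pexp (Fin n) (hypW a b)
        (overlapWt n a b d)) := by
        refine Finset.sum_congr rfl fun σ hσ => ?_
        rw [← sum_sel_overlap hσ, Finset.mul_sum]
        refine Finset.sum_congr rfl fun σ' _ => by ring
    _ = E * pexp (Fin n) (hypW a b) (overlapWt n a b d) * (N * partLow n e a b) ^ 2 := by
        rw [Finset.sum_const, nsmul_eq_mul, ← hN]; ring
    _ ≤ ((1 + ε / 3) * (1 + ε / 3)) * (∑ σ ∈ sel n (a + b) a, labS e (labIn σ)) ^ 2 := by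
        have h1 : E * pexp (Fin n) (hypW a b) (overlapWt n a b d) ≤ (1 + ε / 3) * (1 + ε / 3) :=
          (mul_le_mul_of_nonneg_left hO hE0.le).trans
            (mul_le_mul_of_nonneg_right hexp (by linarith))
        exact mul_le_mul h1 (pow_le_pow_left₀ hpos.le hsum 2) (by positivity) (by positivity)
    _ ≤ _ := mul_le_mul_of_nonneg_right hε3 (sq_nonneg _)

end
end RegSum

namespace RegSum
section
open scoped Classical

lemma disjoint_iff_adj {V : Type*} {G H : SimpleGraph V} :
    Disjoint G H ↔ ∀ u w, G.Adj u w → ¬ H.Adj u w := by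
  rw [disjoint_iff_inf_le]
  exact ⟨fun h u w hG hH => h (show (G ⊓ H).Adj u w from ⟨hG, hH⟩),
    fun h u w hGH => absurd hGH.2 (h u w hGH.1)⟩

variable {P V ι : Type*} {c : P → ι} {vtx : P → V}

/-- The graph formed by the pairs of points that meet `S`. -/
def pairGraph (vtx : P → V) (π : Equiv.Perm P) (S : Set P) : SimpleGraph V :=
  SimpleGraph.fromRel fun u w => ∃ p ∈ S, vtx p = u ∧ vtx (π p) = w

lemma pairGraph_adj {π : Equiv.Perm P} (h : IsPairing c π) (hs : IsSimplePairing vtx π) {S : Set P}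
    (hS : ∀ p ∈ S, π p ∈ S) {u w : V} :
    (pairGraph vtx π S).Adj u w ↔ ∃ p ∈ S, vtx p = u ∧ vtx (π p) = w := by
  rw [pairGraph, SimpleGraph.fromRel_adj]
  constructor
  · rintro ⟨-, h1 | ⟨p, hp, rfl, rfl⟩⟩
    · exact h1
    · exact ⟨π p, hS p hp, rfl, by rw [h.1]⟩
  · rintro ⟨p, hp, rfl, rfl⟩
    exact ⟨(hs.1 p).symm, Or.inl ⟨p, hp, rfl, rfl⟩⟩

/-- The graph formed by the pairs of a given colour. -/
abbrev colGraph (c : P → ι) (vtx : P → V) (π : Equiv.Perm P) (k : ι) : SimpleGraph V :=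
  pairGraph vtx π {p | c p = k}

lemma colGraph_adj {π : Equiv.Perm P} (h : IsPairing c π) (hs : IsSimplePairing vtx π) {k : ι}
    {u w : V} : (colGraph c vtx π k).Adj u w ↔ ∃ p, c p = k ∧ vtx p = u ∧ vtx (π p) = w :=
  pairGraph_adj h hs fun p (hp : c p = k) => (h.2.2 p).trans hp

lemma colGraph_disjoint {π : Equiv.Perm P} (h : IsPairing c π) (hs : IsSimplePairing vtx π)
    {k l : ι} (hkl : k ≠ l) : Disjoint (colGraph c vtx π k) (colGraph c vtx π l) := by
  rw [disjoint_iff_adj]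
  intro u w h1 h2
  rw [colGraph_adj h hs] at h1 h2
  obtain ⟨p, rfl, rfl, rfl⟩ := h1
  obtain ⟨q, rfl, hq, hq'⟩ := h2
  exact hs.2 p q (fun hpq => hkl (by rw [hpq])) hq.symm hq'.symm

lemma iSup_colGraph {π : Equiv.Perm P} (h : IsPairing c π) (hs : IsSimplePairing vtx π) :
    ⨆ k, colGraph c vtx π k = pairGraph vtx π Set.univ := by
  ext u w
  rw [SimpleGraph.iSup_adj, pairGraph_adj (S := Set.univ) h hs (fun _ _ => Set.mem_univ _)]
  simp only [colGraph_adj h hs]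
  constructor
  · rintro ⟨k, p, -, h1⟩; exact ⟨p, Set.mem_univ _, h1⟩
  · rintro ⟨p, -, h1⟩; exact ⟨c p, p, rfl, h1⟩

lemma bijective_neighbours {π : Equiv.Perm P} (h : IsPairing c π) (hs : IsSimplePairing vtx π)
    {k : ι} {H : SimpleGraph V} (hH : colGraph c vtx π k = H) (v : V) :
    Function.Bijective (fun p : {p // vtx p = v ∧ c p = k} =>
      (⟨vtx (π p.1), by
        rw [← hH, colGraph_adj h hs]; exact ⟨p.1, p.2.2, p.2.1, rfl⟩⟩ : {w // H.Adj v w})) := by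
  constructor
  · rintro ⟨p, hp⟩ ⟨q, hq⟩ hpq
    by_contra hne
    exact hs.2 p q (fun hh => hne (Subtype.ext hh)) (hp.1.trans hq.1.symm) (congrArg Subtype.val hpq)
  · rintro ⟨w, hw⟩
    have hw' := hw
    rw [← hH, colGraph_adj h hs] at hw'
    obtain ⟨p, h1, h2, h3⟩ := hw'
    exact ⟨⟨p, h2, h1⟩, Subtype.ext h3⟩

lemma natCard_adj_colGraph {π : Equiv.Perm P} (h : IsPairing c π) (hs : IsSimplePairing vtx π)
    (k : ι) (v : V) :
    Nat.card {w // (colGraph c vtx π k).Adj v w} = Nat.card {p // vtx p = v ∧ c p = k} :=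
  (Nat.card_eq_of_bijective _ (bijective_neighbours h hs rfl v)).symm

lemma exists_pairing_of_neighbours {H : ι → SimpleGraph V}
    (hdis : ∀ k l, k ≠ l → Disjoint (H k) (H l))
    (F : ∀ v k, {p // vtx p = v ∧ c p = k} ≃ {w // (H k).Adj v w}) :
    ∃ π : Equiv.Perm P, (IsPairing c π ∧ IsSimplePairing vtx π ∧ ∀ k, colGraph c vtx π k = H k) ∧
      ∀ v k p, (F v k p : V) = vtx (π p.1) := by
  let t : P → V := fun p => F (vtx p) (c p) ⟨p, rfl, rfl⟩
  have ht : ∀ v k p (hp : vtx p = v ∧ c p = k), (F v k ⟨p, hp⟩ : V) = t p := by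
    rintro _ _ p ⟨rfl, rfl⟩; rfl
  have hadj : ∀ p, (H (c p)).Adj (vtx p) (t p) := fun p => (F (vtx p) (c p) ⟨p, rfl, rfl⟩).2
  have hinj : ∀ p q, vtx p = vtx q → c p = c q → t p = t q → p = q := by
    intro p q h1 h2 h3
    have h4 := ht (vtx q) (c q) p ⟨h1, h2⟩
    have h5 : F (vtx q) (c q) ⟨p, h1, h2⟩ = F (vtx q) (c q) ⟨q, rfl, rfl⟩ :=
      Subtype.ext (h4.trans h3)
    exact congrArg Subtype.val ((F (vtx q) (c q)).injective h5)
  let g : P → P := fun p => (F (t p) (c p)).symm ⟨vtx p, (hadj p).symm⟩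
  have hg1 : ∀ p, vtx (g p) = t p := fun p =>
    ((F (t p) (c p)).symm ⟨vtx p, (hadj p).symm⟩).2.1
  have hg2 : ∀ p, c (g p) = c p := fun p =>
    ((F (t p) (c p)).symm ⟨vtx p, (hadj p).symm⟩).2.2
  have hg3 : ∀ p, t (g p) = vtx p := by
    intro p
    rw [← ht (t p) (c p) (g p) ⟨hg1 p, hg2 p⟩]
    exact congrArg Subtype.val ((F (t p) (c p)).apply_symm_apply ⟨vtx p, (hadj p).symm⟩)
  have hgg : Function.Involutive g := fun p =>
    hinj _ _ (by rw [hg1, hg3]) (by rw [hg2, hg2]) (by rw [hg3, hg1])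
  have hne : ∀ p, vtx (g p) ≠ vtx p := fun p => by rw [hg1]; exact (hadj p).ne'
  have hP : IsPairing c (Function.Involutive.toPerm g hgg) := ⟨hgg, fun p hp => hne p (congrArg vtx hp), hg2⟩
  have hS : IsSimplePairing vtx (Function.Involutive.toPerm g hgg) := by
    refine ⟨hne, fun p q hpq hv htt => ?_⟩
    have htt' : t p = t q := by rw [← hg1, ← hg1]; exact htt
    by_cases hc : c p = c q
    · exact hpq (hinj p q hv hc htt')
    · refine disjoint_iff_adj.1 (hdis _ _ hc) _ _ (hadj p) ?_
      rw [hv, htt']; exact hadj q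
  refine ⟨Function.Involutive.toPerm g hgg, ⟨hP, hS, fun k => ?_⟩, ?_⟩
  · ext u w
    rw [colGraph_adj hP hS]
    constructor
    · rintro ⟨p, rfl, rfl, rfl⟩
      have hp : vtx ((Function.Involutive.toPerm g hgg) p) = t p := hg1 p
      rw [hp]; exact hadj p
    · intro hw
      refine ⟨(F u k).symm ⟨w, hw⟩, ((F u k).symm ⟨w, hw⟩).2.2, ((F u k).symm ⟨w, hw⟩).2.1, ?_⟩
      refine (hg1 _).trans ?_
      rw [← ht u k _ ((F u k).symm ⟨w, hw⟩).2]
      exact congrArg Subtype.val ((F u k).apply_symm_apply ⟨w, hw⟩)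
  · rintro v k ⟨p, hp⟩
    rw [ht]; exact (hg1 p).symm

lemma natCard_equiv_eq {α β : Type*} [Finite α] [Finite β] {r : ℕ} (ha : Nat.card α = r)
    (hb : Nat.card β = r) : Nat.card (α ≃ β) = r.factorial := by
  have e1 : α ≃ Fin r := ha ▸ Finite.equivFin α
  have e2 : β ≃ Fin r := hb ▸ Finite.equivFin β
  rw [Nat.card_congr (e1.equivCongr e2), Nat.card_perm, Nat.card_eq_fintype_card, Fintype.card_fin]

lemma natCard_pairings_fiber [Finite P] [Fintype V] [Fintype ι] {H : ι → SimpleGraph V}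
    (hdis : ∀ k l, k ≠ l → Disjoint (H k) (H l)) {r : ι → ℕ}
    (h1 : ∀ v k, Nat.card {p // vtx p = v ∧ c p = k} = r k)
    (h2 : ∀ k v, Nat.card {w // (H k).Adj v w} = r k) :
    Nat.card {π : Equiv.Perm P // IsPairing c π ∧ IsSimplePairing vtx π ∧
      ∀ k, colGraph c vtx π k = H k} = ∏ _v : V, ∏ k, (r k).factorial := by
  have h3 : Nat.card (∀ v k, {p // vtx p = v ∧ c p = k} ≃ {w // (H k).Adj v w}) =
      ∏ _v : V, ∏ k, (r k).factorial := by
    rw [Nat.card_pi]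
    refine Finset.prod_congr rfl fun v _ => ?_
    rw [Nat.card_pi]
    exact Finset.prod_congr rfl fun k _ => natCard_equiv_eq (h1 v k) (h2 k v)
  rw [← h3]
  refine Nat.card_eq_of_bijective
    (fun π v k => Equiv.ofBijective _ (bijective_neighbours π.2.1 π.2.2.1 (π.2.2.2 k) v)) ⟨?_, ?_⟩
  · rintro ⟨π, hπ⟩ ⟨ρ, hρ⟩ hF
    refine Subtype.ext (Equiv.ext fun p => ?_)
    have ht : ∀ p, vtx (π p) = vtx (ρ p) := fun p =>
      congrArg (fun F : ∀ v k, {p // vtx p = v ∧ c p = k} ≃ {w // (H k).Adj v w} =>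
        (F (vtx p) (c p) ⟨p, rfl, rfl⟩ : V)) hF
    by_contra hne
    refine hρ.2.1.2 (π p) (ρ p) hne (ht p) ?_
    rw [← ht, hπ.1.1, hρ.1.1]
  · intro F
    obtain ⟨π, hπ, hF⟩ := exists_pairing_of_neighbours hdis F
    refine ⟨⟨π, hπ⟩, ?_⟩
    funext v k
    exact Equiv.ext fun p => Subtype.ext (hF v k p).symm

end
end RegSum

namespace RegSum
section
open scoped Classical

lemma natCard_pairings_graph {P V ι : Type*} {c : P → ι} {vtx : P → V} [Finite P] [Fintype V]
    [Fintype ι] {r : ι → ℕ}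
    (h1 : ∀ v k, Nat.card {p // vtx p = v ∧ c p = k} = r k) (G : SimpleGraph V) :
    Nat.card {π : Equiv.Perm P // IsPairing c π ∧ IsSimplePairing vtx π ∧
      pairGraph vtx π Set.univ = G} = (∏ _v : V, ∏ k, (r k).factorial) *
      Nat.card {H : ι → SimpleGraph V // (∀ k l, k ≠ l → Disjoint (H k) (H l)) ∧
        (∀ k v, Nat.card {w // (H k).Adj v w} = r k) ∧ ⨆ k, H k = G} := by
  let f : {π : Equiv.Perm P // IsPairing c π ∧ IsSimplePairing vtx π ∧
      pairGraph vtx π Set.univ = G} →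
      {H : ι → SimpleGraph V // (∀ k l, k ≠ l → Disjoint (H k) (H l)) ∧
        (∀ k v, Nat.card {w // (H k).Adj v w} = r k) ∧ ⨆ k, H k = G} := fun π =>
    ⟨colGraph c vtx π.1, fun _ _ hkl => colGraph_disjoint π.2.1 π.2.2.1 hkl,
      fun k v => (natCard_adj_colGraph π.2.1 π.2.2.1 k v).trans (h1 v k),
      (iSup_colGraph π.2.1 π.2.2.1).trans π.2.2.2⟩
  rw [← Nat.card_congr (Equiv.sigmaFiberEquiv f), Nat.card_sigma,
    Finset.sum_congr rfl (g := fun _ => ∏ _v : V, ∏ k, (r k).factorial)]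
  · rw [Finset.sum_const, Finset.card_univ, ← Nat.card_eq_fintype_card, smul_eq_mul, mul_comm]
  · rintro ⟨H, hd, hr, hG⟩ -
    rw [← natCard_pairings_fiber hd h1 hr]
    refine Nat.card_congr
      { toFun := fun π => ⟨π.1.1, π.1.2.1, π.1.2.2.1, fun k =>
          congrFun (congrArg Subtype.val π.2) k⟩
        invFun := fun π => ⟨⟨π.1, π.2.1, π.2.2.1, ?_⟩, Subtype.ext (funext π.2.2.2)⟩
        left_inv := fun _ => rfl
        right_inv := fun _ => rfl }
    rw [← iSup_colGraph π.2.1 π.2.2.1, ← hG]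
    exact iSup_congr π.2.2.2

/-- The number of ways to split a graph into an `x`-regular and a `y`-regular graph. -/
noncomputable def splits (n x y : ℕ) (G : SimpleGraph (Fin n)) : ℕ :=
  Nat.card {H : SimpleGraph (Fin n) × SimpleGraph (Fin n) //
    Disjoint H.1 H.2 ∧ IsRegularGraph H.1 x ∧ IsRegularGraph H.2 y ∧ H.1 ⊔ H.2 = G}

/-- The number of ways to split a graph into three regular graphs of given degrees. -/
noncomputable def splits₃ (n x y z : ℕ) (G : SimpleGraph (Fin n)) : ℕ :=
  Nat.card {H : SimpleGraph (Fin n) × SimpleGraph (Fin n) × SimpleGraph (Fin n) //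
    (Disjoint H.1 H.2.1 ∧ Disjoint H.1 H.2.2 ∧ Disjoint H.2.1 H.2.2) ∧
    (IsRegularGraph H.1 x ∧ IsRegularGraph H.2.1 y ∧ IsRegularGraph H.2.2 z) ∧
    H.1 ⊔ (H.2.1 ⊔ H.2.2) = G}

/-- The number of simple pairings with a given graph that respect the labelling. -/
noncomputable def labG (e : ℕ) {n D : ℕ} {L : Type*} (l : Fin n → Fin D → L)
    (G : SimpleGraph (Fin n)) : ℕ :=
  Nat.card {π : Equiv.Perm (Pt n e D) // IsPairing (labelCol (e := e) l) π ∧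
    IsSimplePairing Pt.vtx π ∧ pairGraph Pt.vtx π Set.univ = G}

lemma Col.iSup_eq {L M : Type*} [CompleteLattice M] (f : Col L → M) :
    ⨆ k, f k = f Col.none ⊔ ⨆ x, f (Col.some x) := by
  rw [← (colEquiv L).iSup_comp, iSup_option]; rfl

lemma Col.forall_eq {L : Type*} {p : Col L → Prop} :
    (∀ k, p k) ↔ p Col.none ∧ ∀ x, p (Col.some x) :=
  ⟨fun h => ⟨h _, fun _ => h _⟩, fun h k => by rcases k with _ | x; exacts [h.1, h.2 x]⟩

variable {n e D : ℕ}

lemma labG_eq {L : Type*} [Fintype L] {l : Fin n → Fin D → L} {r : L → ℕ}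
    (h : ∀ v x, labCount l v x = r x) (G : SimpleGraph (Fin n)) :
    labG e l G = (∏ _v : Fin n, (e.factorial * ∏ x, (r x).factorial)) *
      Nat.card {H : Col L → SimpleGraph (Fin n) // (∀ k m, k ≠ m → Disjoint (H k) (H m)) ∧
        (IsRegularGraph (H Col.none) e ∧ ∀ x, IsRegularGraph (H (Col.some x)) (r x)) ∧
        H Col.none ⊔ ⨆ x, H (Col.some x) = G} := by
  have h1 : ∀ (v : Fin n) (k : Col L), Nat.card {p : Pt n e D // p.vtx = v ∧ labelCol l p = k} =
      (fun k : Col L => match k with | Col.none => e | Col.some x => r x) k := by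
    intro v k
    have h2 : Nat.card {p : Pt n e D // p.vtx = v ∧ labelCol l p = k} =
        ((fib (Pt.vtx : Pt n e D → Fin n) v).filter fun p => labelCol l p = k).card := by
      refine Nat.subtype_card _ fun p => ?_
      rw [Finset.mem_filter, mem_fib]
    rw [h2]
    rcases k with _ | x
    · exact card_fib_labelCol_none l v
    · exact (card_fib_labelCol_some l v x).trans (h v x)
  refine (natCard_pairings_graph h1 G).trans ?_
  simp only [Col.prod_eq, Col.iSup_eq]
  congr 1
  refine Nat.card_congr (Equiv.subtypeEquivRight fun H => ?_)
  rw [Col.forall_eq (p := fun k => ∀ v, Nat.card {w // (H k).Adj v w} = _)]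
  rfl

lemma labG_labOne : ∃ K : ℕ, ∀ G : SimpleGraph (Fin n), labG e (labOne n D) G = K * splits n e D G := by
  refine ⟨∏ _v : Fin n, (e.factorial * ∏ _x : Unit, D.factorial), fun G =>
    (labG_eq (r := fun _ => D) labCount_labOne G).trans ?_⟩
  congr 1
  refine Nat.card_congr (Equiv.subtypeEquiv
    { toFun := fun f => (f Col.none, f (Col.some ()))
      invFun := fun H k => match k with | Col.none => H.1 | Col.some () => H.2
      left_inv := fun f => by funext k; rcases k with _ | _ <;> rfl
      right_inv := fun _ => rfl } fun H => ?_)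
  simp only [Col.forall_eq, iSup_unique, Equiv.coe_fn_mk]
  simp [disjoint_comm]
  tauto

lemma labG_labIn {a b : ℕ} : ∃ K : ℕ, ∀ σ ∈ sel n (a + b) a, ∀ G : SimpleGraph (Fin n),
    labG e (labIn σ) G = K * splits₃ n e a b G := by
  refine ⟨∏ _v : Fin n, (e.factorial * ∏ x : Bool, (if x then a else b).factorial), fun σ hσ G =>
    (labG_eq (r := fun x => if x then a else b) ?_ G).trans ?_⟩
  · rintro v (_ | _)
    · rw [labCount_labIn_false, mem_sel.1 hσ]; simp
    · rw [labCount_labIn_true, mem_sel.1 hσ]; simp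
  congr 1
  refine Nat.card_congr (Equiv.subtypeEquiv
    { toFun := fun f => (f Col.none, f (Col.some true), f (Col.some false))
      invFun := fun H k => match k with
        | Col.none => H.1 | Col.some true => H.2.1 | Col.some false => H.2.2
      left_inv := fun f => by funext k; rcases k with _ | (_ | _) <;> rfl
      right_inv := fun _ => rfl } fun H => ?_)
  simp only [Col.forall_eq, iSup_bool_eq, Equiv.coe_fn_mk, Bool.forall_bool]
  simp [disjoint_comm]
  tauto

end
end RegSum

namespace RegSum
section
open scoped Classical

lemma sq_sum_abs_le {α : Type*} {Ω : Finset α} {Y : α → ℝ} {A ε : ℝ} (hA : 0 < A)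
    (hΩ : (0 : ℝ) < Ω.card) (hY : ∑ x ∈ Ω, Y x = A)
    (h : (∑ x ∈ Ω, Y x ^ 2) * Ω.card ≤ (1 + ε) * A ^ 2) :
    (∑ x ∈ Ω, |1 / (Ω.card : ℝ) - Y x / A|) ^ 2 ≤ ε := by
  have h1 : ∑ x ∈ Ω, |1 / (Ω.card : ℝ) - Y x / A| ^ 2 =
      (∑ x ∈ Ω, Y x ^ 2) / A ^ 2 - 1 / Ω.card := by
    have h2 : ∀ x, |1 / (Ω.card : ℝ) - Y x / A| ^ 2 =
        1 / (Ω.card : ℝ) ^ 2 - 2 / (Ω.card * A) * Y x + 1 / A ^ 2 * Y x ^ 2 := fun x => by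
      rw [sq_abs]; field_simp; ring
    simp only [h2, Finset.sum_add_distrib, Finset.sum_sub_distrib, ← Finset.mul_sum, hY]
    rw [Finset.sum_const, nsmul_eq_mul]
    field_simp; ring
  calc _ ≤ (Ω.card : ℝ) * ∑ x ∈ Ω, |1 / (Ω.card : ℝ) - Y x / A| ^ 2 := sq_sum_le_card_mul_sum_sq
    _ = (∑ x ∈ Ω, Y x ^ 2) * Ω.card / A ^ 2 - 1 := by rw [h1]; field_simp
    _ ≤ (1 + ε) - 1 := by
      refine sub_le_sub_right ?_ 1
      rwa [div_le_iff₀ (by positivity)]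
    _ = ε := by ring

variable {n e D a b : ℕ}

/-- The simple pairings that respect the labelling. -/
noncomputable def simplePairings (e : ℕ) {n D : ℕ} {L : Type*} (l : Fin n → Fin D → L) :
    Finset (Equiv.Perm (Pt n e D)) :=
  Finset.univ.filter fun π => IsPairing (labelCol (e := e) l) π ∧ IsSimplePairing Pt.vtx π

lemma mem_simplePairings {L : Type*} {l : Fin n → Fin D → L} {π : Equiv.Perm (Pt n e D)} :
    π ∈ simplePairings e l ↔ IsPairing (labelCol (e := e) l) π ∧ IsSimplePairing Pt.vtx π := by
  rw [simplePairings, Finset.mem_filter]; simp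

lemma labS_eq_card {L : Type*} (l : Fin n → Fin D → L) : labS e l = (simplePairings e l).card := rfl

lemma isPairing_labIn_labOne {σ : Fin n → Finset (Fin D)} {π : Equiv.Perm (Pt n e D)}
    (h : IsPairing (labelCol (labIn σ)) π) : IsPairing (labelCol (labOne n D)) π := by
  refine ⟨h.1, h.2.1, fun p => ?_⟩
  have := h.2.2 p
  rcases p with ⟨v, i⟩ | ⟨v, i⟩
  all_goals
    generalize π _ = q at this ⊢
    rcases q with ⟨w, j⟩ | ⟨w, j⟩ <;> simp_all [labelCol, labOne]

lemma isPairing_labTwo {σ σ' : Fin n → Finset (Fin D)} {π : Equiv.Perm (Pt n e D)} :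
    IsPairing (labelCol (labTwo σ σ')) π ↔
      IsPairing (labelCol (labIn σ)) π ∧ IsPairing (labelCol (labIn σ')) π := by
  have key : ∀ p q : Pt n e D, labelCol (labTwo σ σ') p = labelCol (labTwo σ σ') q ↔
      labelCol (labIn σ) p = labelCol (labIn σ) q ∧
        labelCol (labIn σ') p = labelCol (labIn σ') q := by
    intro p q
    rcases p with ⟨v, i⟩ | ⟨v, i⟩ <;> rcases q with ⟨w, j⟩ | ⟨w, j⟩ <;>
      simp [labelCol, labTwo]
  unfold IsPairing
  simp only [key, forall_and]
  tauto

/-- The number of selections that a pairing respects. -/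
noncomputable def selCount (a : ℕ) (π : Equiv.Perm (Pt n e D)) : ℕ :=
  ((sel n D a).filter fun σ => IsPairing (labelCol (labIn σ)) π).card

lemma sum_selCount_mul (φ : Equiv.Perm (Pt n e D) → ℝ) :
    ∑ π ∈ simplePairings e (labOne n D), (selCount a π : ℝ) * φ π =
      ∑ σ ∈ sel n D a, ∑ π ∈ simplePairings e (labIn σ), φ π := by
  have h1 : ∀ π : Equiv.Perm (Pt n e D), (selCount a π : ℝ) * φ π =
      ∑ σ ∈ sel n D a, if IsPairing (labelCol (labIn σ)) π then φ π else 0 := by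
    intro π
    rw [← Finset.sum_filter, Finset.sum_const, nsmul_eq_mul, selCount]
  simp only [h1]
  rw [Finset.sum_comm]
  refine Finset.sum_congr rfl fun σ _ => ?_
  rw [← Finset.sum_filter]
  refine Finset.sum_congr ?_ fun _ _ => rfl
  ext π
  rw [Finset.mem_filter, mem_simplePairings, mem_simplePairings]
  exact ⟨fun h => ⟨h.2, h.1.2⟩, fun h => ⟨⟨isPairing_labIn_labOne h.1, h.2⟩, h.1⟩⟩

lemma sum_selCount : ∑ π ∈ simplePairings e (labOne n D), (selCount a π : ℝ) =
    ∑ σ ∈ sel n D a, labS e (labIn σ) := by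
  have := sum_selCount_mul (n := n) (e := e) (D := D) (a := a) (fun _ => 1)
  simp only [mul_one] at this
  rw [this]
  refine Finset.sum_congr rfl fun σ _ => ?_
  rw [Finset.sum_const, nsmul_eq_mul, mul_one, labS_eq_card]

lemma sum_selCount_sq : ∑ π ∈ simplePairings e (labOne n D), (selCount a π : ℝ) ^ 2 =
    ∑ σ ∈ sel n D a, ∑ σ' ∈ sel n D a, labS e (labTwo σ σ') := by
  simp only [sq]
  rw [sum_selCount_mul]
  refine Finset.sum_congr rfl fun σ _ => ?_
  have h1 : ∀ π : Equiv.Perm (Pt n e D), (selCount a π : ℝ) =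
      ∑ σ' ∈ sel n D a, if IsPairing (labelCol (labIn σ')) π then 1 else 0 := by
    intro π
    rw [← Finset.sum_filter, Finset.sum_const, nsmul_eq_mul, selCount, mul_one]
  simp only [h1]
  rw [Finset.sum_comm]
  refine Finset.sum_congr rfl fun σ' _ => ?_
  rw [← Finset.sum_filter, Finset.sum_const, nsmul_eq_mul, mul_one, labS_eq_card]
  congr 2
  ext π
  rw [Finset.mem_filter, mem_simplePairings, mem_simplePairings, isPairing_labTwo]
  tauto

lemma labG_eq_card {L : Type*} (l : Fin n → Fin D → L) (G : SimpleGraph (Fin n)) :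
    labG e l G =
      ((simplePairings e l).filter fun π => pairGraph Pt.vtx π Set.univ = G).card := by
  refine Nat.subtype_card _ fun π => ?_
  rw [Finset.mem_filter, mem_simplePairings, and_assoc]

lemma sum_labG {L : Type*} (l : Fin n → Fin D → L) :
    ∑ G, (labG e l G : ℝ) = labS e l := by
  simp only [labG_eq_card]
  rw [labS_eq_card, ← Nat.cast_sum]
  congr 1
  exact (Finset.card_eq_sum_card_fiberwise (fun _ _ => Finset.mem_univ _)).symm

lemma sum_selCount_graph (G : SimpleGraph (Fin n)) :
    ∑ π ∈ (simplePairings e (labOne n D)).filter (fun π => pairGraph Pt.vtx π Set.univ = G),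
      (selCount a π : ℝ) = ∑ σ ∈ sel n D a, (labG e (labIn σ) G : ℝ) := by
  have := sum_selCount_mul (n := n) (e := e) (D := D) (a := a)
    (fun π => if pairGraph Pt.vtx π Set.univ = G then 1 else 0)
  simp only [mul_ite, mul_one, mul_zero] at this
  rw [← Finset.sum_filter] at this
  rw [this]
  refine Finset.sum_congr rfl fun σ _ => ?_
  rw [← Finset.sum_filter, Finset.sum_const, nsmul_eq_mul, mul_one, labG_eq_card]

/-- The law of the union of two disjoint regular graphs. -/
noncomputable def law (n x y : ℕ) (G : SimpleGraph (Fin n)) : ℝ :=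
  splits n x y G / ∑ G', (splits n x y G' : ℝ)

/-- The law of the union of three disjoint regular graphs. -/
noncomputable def law₃ (n x y z : ℕ) (G : SimpleGraph (Fin n)) : ℝ :=
  splits₃ n x y z G / ∑ G', (splits₃ n x y z G' : ℝ)

lemma sum_abs_law_sub_le (hA : 0 < ∑ σ ∈ sel n (a + b) a, labS e (labIn σ)) :
    0 < ∑ G, (splits n e (a + b) G : ℝ) ∧ 0 < ∑ G, (splits₃ n e a b G : ℝ) ∧
    ∑ G, |law n e (a + b) G - law₃ n e a b G| ≤
      ∑ π ∈ simplePairings e (labOne n (a + b)),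
        |1 / ((simplePairings e (labOne n (a + b))).card : ℝ) -
          selCount a π / ∑ σ ∈ sel n (a + b) a, labS e (labIn σ)| := by
  obtain ⟨K, hK⟩ := labG_labOne (n := n) (e := e) (D := a + b)
  obtain ⟨K', hK'⟩ := labG_labIn (n := n) (e := e) (a := a) (b := b)
  set Ω := simplePairings e (labOne n (a + b)) with hΩ
  set A := ∑ σ ∈ sel n (a + b) a, labS e (labIn σ) with hAdef
  have hA' : A = (sel n (a + b) a).card * K' * ∑ G, (splits₃ n e a b G : ℝ) := by
    rw [hAdef, Finset.sum_congr rfl (g := fun _ => K' * ∑ G, (splits₃ n e a b G : ℝ)),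
      Finset.sum_const, nsmul_eq_mul, mul_assoc]
    intro σ hσ
    rw [← sum_labG, Finset.mul_sum]
    refine Finset.sum_congr rfl fun G _ => ?_
    rw [hK' σ hσ]; push_cast; rfl
  have hS : (Ω.card : ℝ) = K * ∑ G, (splits n e (a + b) G : ℝ) := by
    rw [hΩ, ← labS_eq_card, ← sum_labG, Finset.mul_sum]
    refine Finset.sum_congr rfl fun G _ => ?_
    rw [hK]; push_cast; rfl
  have hSpos : (0:ℝ) < Ω.card := by
    rw [Nat.cast_pos, Finset.card_pos, Finset.nonempty_iff_ne_empty]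
    intro h0
    have := sum_selCount (n := n) (e := e) (D := a + b) (a := a)
    rw [← hΩ, h0, Finset.sum_empty] at this
    exact hA.ne this
  have h3 : 0 < ∑ G, (splits₃ n e a b G : ℝ) := by
    rw [hA'] at hA
    exact pos_of_mul_pos_right hA (by positivity)
  have h2 : 0 < ∑ G, (splits n e (a + b) G : ℝ) := by
    rw [hS] at hSpos
    exact pos_of_mul_pos_right hSpos (by positivity)
  refine ⟨h2, h3, ?_⟩
  rw [← Finset.sum_fiberwise Ω (fun π => pairGraph Pt.vtx π Set.univ)]
  refine Finset.sum_le_sum fun G _ => ?_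
  refine le_of_eq_of_le ?_ (Finset.abs_sum_le_sum_abs _ _)
  congr 1
  rw [Finset.sum_sub_distrib, ← Finset.sum_div, ← Finset.sum_div, hΩ, sum_selCount_graph, Finset.sum_const, nsmul_eq_mul,
    ← labG_eq_card, hK, Finset.sum_congr rfl (g := fun _ => (K':ℝ) * splits₃ n e a b G),
    Finset.sum_const, nsmul_eq_mul, ← hΩ, hS, hA', law, law₃]
  · have hK0 : (K:ℝ) ≠ 0 := by
      rintro h0; rw [hS, h0, zero_mul] at hSpos; exact hSpos.ne rfl
    have hK0' : ((sel n (a + b) a).card * K' : ℝ) ≠ 0 := by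
      rintro h0; rw [hA', h0, zero_mul] at hA; exact hA.ne rfl
    congr 1
    · push_cast
      rw [mul_one, mul_div_mul_left _ _ hK0]
    · rw [← mul_assoc, mul_div_mul_left _ _ hK0']
  · intro σ hσ
    rw [hK' σ hσ]; push_cast; rfl

lemma law_sub_law₃_le {C δ : ℝ} (hC : 1 ≤ C) (hδ : 0 < δ) (hδ1 : δ ≤ 1) :
    ∃ K : ℕ, ∀ n e a b d : ℕ, Even n → K ≤ a → 8 * a ≤ b → e + a + b = d → (d : ℝ) ^ 10 ≤ C * n →
      0 < n → 0 < ∑ G, (splits n e (a + b) G : ℝ) ∧ 0 < ∑ G, (splits₃ n e a b G : ℝ) ∧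
      ∑ G, |law n e (a + b) G - law₃ n e a b G| ≤ δ := by
  obtain ⟨K, hK⟩ := second_moment hC (ε := δ ^ 2) (by positivity) (by nlinarith)
  refine ⟨K, fun n e a b d hn2 hKa hab hd hdn hn => ?_⟩
  obtain ⟨hA, hM⟩ := hK n e a b d hn2 hKa hab hd hdn hn
  obtain ⟨h2, h3, h4⟩ := sum_abs_law_sub_le hA
  refine ⟨h2, h3, h4.trans ?_⟩
  have hcard : (0:ℝ) < (simplePairings e (labOne n (a + b))).card := by
    rw [Nat.cast_pos, Finset.card_pos, Finset.nonempty_iff_ne_empty]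
    intro h0
    have := sum_selCount (n := n) (e := e) (D := a + b) (a := a)
    rw [h0, Finset.sum_empty] at this
    exact hA.ne this
  rw [← sum_selCount_sq, labS_eq_card] at hM
  have := sq_sum_abs_le hA hcard sum_selCount hM
  exact abs_le_of_sq_le_sq' this hδ.le |>.2

end
end RegSum

namespace RegSum
section
open scoped Classical

variable {n : ℕ}

lemma splits_comm (n x y : ℕ) : splits n x y = splits n y x := by
  funext G
  refine Nat.card_congr (Equiv.subtypeEquiv (Equiv.prodComm _ _) fun H => ?_)
  simp only [Equiv.prodComm_apply, Prod.fst_swap, Prod.snd_swap]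
  rw [disjoint_comm, sup_comm]
  tauto

lemma splits₃_swap (n x y z : ℕ) : splits₃ n x y z = splits₃ n z y x := by
  funext G
  refine Nat.card_congr (Equiv.subtypeEquiv
    { toFun := fun H => (H.2.2, H.2.1, H.1)
      invFun := fun H => (H.2.2, H.2.1, H.1)
      left_inv := fun _ => rfl
      right_inv := fun _ => rfl } fun H => ?_)
  simp only [Equiv.coe_fn_mk]
  have h : H.2.2 ⊔ (H.2.1 ⊔ H.1) = H.1 ⊔ (H.2.1 ⊔ H.2.2) := by ac_rfl
  rw [h, disjoint_comm (a := H.2.2) (b := H.2.1), disjoint_comm (a := H.2.2) (b := H.1),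
    disjoint_comm (a := H.2.1) (b := H.1)]
  tauto

lemma isRegularGraph_zero {G : SimpleGraph (Fin n)} : IsRegularGraph G 0 ↔ G = ⊥ := by
  constructor
  · intro h
    ext u w
    simp only [SimpleGraph.bot_adj, iff_false]
    intro hadj
    have h1 := h u
    rw [gDeg, Finite.card_eq_zero_iff] at h1
    exact h1.elim ⟨w, hadj⟩
  · rintro rfl v
    rw [gDeg, Finite.card_eq_zero_iff]
    exact ⟨fun w => w.2⟩

lemma splits₃_zero (n x y : ℕ) : splits₃ n 0 x y = splits n x y := by
  funext G
  refine Nat.card_congr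
    { toFun := fun H => ⟨H.1.2, H.2.1.2.2, H.2.2.1.2.1, H.2.2.1.2.2, ?_⟩
      invFun := fun H => ⟨(⊥, H.1), ⟨disjoint_bot_left, disjoint_bot_left, H.2.1⟩,
        ⟨isRegularGraph_zero.2 rfl, H.2.2.1, H.2.2.2.1⟩, ?_⟩
      left_inv := fun H => ?_
      right_inv := fun _ => rfl }
  · have := H.2.2.2
    rwa [isRegularGraph_zero.1 H.2.2.1.1, bot_sup_eq] at this
  · simpa using H.2.2.2.2
  · refine Subtype.ext (Prod.ext (isRegularGraph_zero.1 H.2.2.1.1).symm rfl)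

lemma law_comm (n x y : ℕ) : law n x y = law n y x := by
  unfold law; rw [splits_comm]

lemma law₃_swap (n x y z : ℕ) : law₃ n x y z = law₃ n z y x := by
  unfold law₃; rw [splits₃_swap]

lemma law₃_zero (n x y : ℕ) : law₃ n 0 x y = law n x y := by
  unfold law₃; rw [splits₃_zero]; rfl

lemma sum_abs_sub_le {α : Type*} [Fintype α] (p q r : α → ℝ) :
    ∑ x, |p x - r x| ≤ ∑ x, |p x - q x| + ∑ x, |q x - r x| := by
  rw [← Finset.sum_add_distrib]
  exact Finset.sum_le_sum fun x _ => abs_sub_le _ _ _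

lemma sum_abs_sub_comm {α : Type*} [Fintype α] (p q : α → ℝ) :
    ∑ x, |p x - q x| = ∑ x, |q x - p x| :=
  Finset.sum_congr rfl fun _ _ => abs_sub_comm _ _

lemma law_sub_law_zero_le_of_ratio {C : ℝ} (hC : 1 ≤ C) (j : ℕ) :
    ∀ δ : ℝ, 0 < δ → δ ≤ 1 → ∃ K : ℕ, ∀ n x y d : ℕ, Even n → K ≤ x → x ≤ y →
      8 ^ (j + 1) * x ≤ 9 ^ j * y → x + y = d → (d : ℝ) ^ 10 ≤ C * n → 0 < n →
      0 < ∑ G, (splits n x y G : ℝ) ∧ ∑ G, |law n x y G - law n 0 d G| ≤ δ := by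
  induction j with
  | zero =>
    intro δ hδ hδ1
    obtain ⟨K, hK⟩ := law_sub_law₃_le hC hδ hδ1
    refine ⟨K, fun n x y d hn2 hKx _ h8 hd hdn hn => ?_⟩
    obtain ⟨-, h2, h3⟩ := hK n 0 x y d hn2 hKx (by simpa using h8) (by omega) hdn hn
    rw [splits₃_zero] at h2
    rw [law₃_zero, hd, sum_abs_sub_comm] at h3
    exact ⟨h2, h3⟩
  | succ j ih =>
    intro δ hδ hδ1
    obtain ⟨K₁, hK₁⟩ := law_sub_law₃_le hC (δ := δ / 3) (by linarith) (by linarith)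
    obtain ⟨K₂, hK₂⟩ := ih (δ / 3) (by linarith) (by linarith)
    refine ⟨9 * (K₁ + K₂ + 8), fun n x y d hn2 hKx hxy h8 hd hdn hn => ?_⟩
    obtain ⟨a, ha⟩ : ∃ a, a = x / 9 := ⟨_, rfl⟩
    have ha1 : 9 * a ≤ x := by omega
    have ha2 : x ≤ 9 * a + 8 := by omega
    have ha3 : K₁ + K₂ + 8 ≤ a := by omega
    obtain ⟨x', hx'⟩ : ∃ x', x = a + x' := ⟨x - a, by omega⟩
    have hratio : 8 ^ (j + 1) * x' ≤ 9 ^ j * (a + y) := by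
      have e1 : 9 * x' ≤ 8 * x + 8 := by omega
      have e2 : 8 ^ (j + 1) ≤ 9 ^ (j + 1) := Nat.pow_le_pow_left (by norm_num) _
      have e3 : 9 * (8 ^ (j + 1) * x') ≤ 9 * (9 ^ j * (a + y)) :=
        calc 9 * (8 ^ (j + 1) * x') = 8 ^ (j + 1) * (9 * x') := by ring
          _ ≤ 8 ^ (j + 1) * (8 * x + 8) := Nat.mul_le_mul_left _ e1
          _ = 8 ^ (j + 1 + 1) * x + 8 ^ (j + 1) * 8 := by ring
          _ ≤ 9 ^ (j + 1) * y + 9 ^ (j + 1) * a :=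
            add_le_add h8 (Nat.mul_le_mul e2 (by omega))
          _ = 9 * (9 ^ j * (a + y)) := by ring
      exact Nat.le_of_mul_le_mul_left e3 (by norm_num)
    obtain ⟨h1, -, h2⟩ := hK₁ n y a x' d hn2 (by omega) (by omega) (by omega) hdn hn
    obtain ⟨-, -, h3⟩ := hK₁ n x' a y d hn2 (by omega) (by omega) (by omega) hdn hn
    obtain ⟨-, h4⟩ := hK₂ n x' (a + y) d hn2 (by omega) (by omega) hratio (by omega) hdn hn
    rw [← hx', splits_comm] at h1
    rw [← hx', law_comm, law₃_swap] at h2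
    rw [sum_abs_sub_comm] at h3
    refine ⟨h1, ?_⟩
    have h5 := sum_abs_sub_le (law n x y) (law₃ n x' a y) (law n x' (a + y))
    have h6 := sum_abs_sub_le (law n x y) (law n x' (a + y)) (law n 0 d)
    linarith

lemma law_sub_law_zero_le {C δ : ℝ} (hC : 1 ≤ C) (hδ : 0 < δ) (hδ1 : δ ≤ 1) :
    ∃ K : ℕ, ∀ n x y d : ℕ, Even n → K ≤ x → K ≤ y → x + y = d → (d : ℝ) ^ 10 ≤ C * n → 0 < n →
      0 < ∑ G, (splits n x y G : ℝ) ∧ ∑ G, |law n x y G - law n 0 d G| ≤ δ := by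
  obtain ⟨K, hK⟩ := law_sub_law_zero_le_of_ratio hC 18 δ hδ hδ1
  refine ⟨K, fun n x y d hn2 hx hy hd hdn hn => ?_⟩
  rcases le_total x y with h | h
  · exact hK n x y d hn2 hx h (Nat.mul_le_mul (by norm_num) h) hd hdn hn
  · rw [splits_comm, law_comm]
    exact hK n y x d hn2 hy h (Nat.mul_le_mul (by norm_num) h) (by omega) hdn hn

end
end RegSum

namespace RegSum
section
open scoped Classical

lemma exists_coupling {α : Type*} [Fintype α] (p q : α → ℝ) (hp : IsProbC p) (hq : IsProbC q) :
    ∃ π : α × α → ℝ, IsCoupling π p q ∧ 1 - ∑ x, |p x - q x| ≤ probOf π {z | z.1 = z.2} ∧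
      probOf π {z | z.1 = z.2} ≤ 1 := by
  obtain ⟨hp0, hp1⟩ := hp
  obtain ⟨hq0, hq1⟩ := hq
  rw [tsum_fintype] at hp1 hq1
  let m : α → ℝ := fun x => min (p x) (q x)
  let s : ℝ := ∑ x, (p x - m x)
  have hu : ∀ x, 0 ≤ p x - m x := fun x => sub_nonneg.2 (min_le_left _ _)
  have hv : ∀ x, 0 ≤ q x - m x := fun x => sub_nonneg.2 (min_le_right _ _)
  have hm : ∀ x, 0 ≤ m x := fun x => le_min (hp0 x) (hq0 x)
  have hs0 : 0 ≤ s := Finset.sum_nonneg fun x _ => hu x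
  have hsq : ∑ x, (q x - m x) = s := by
    simp only [s, Finset.sum_sub_distrib, hp1, hq1]
  let π : α × α → ℝ := fun z =>
    (if z.1 = z.2 then m z.1 else 0) + (p z.1 - m z.1) * (q z.2 - m z.2) / s
  have hπ0 : ∀ z, 0 ≤ π z := fun z =>
    add_nonneg (by split_ifs; exacts [hm _, le_rfl])
      (div_nonneg (mul_nonneg (hu _) (hv _)) hs0)
  have hrow : ∀ x, ∑ y, π (x, y) = p x := by
    intro x
    simp only [π, Finset.sum_add_distrib, ← Finset.sum_div, ← Finset.mul_sum, hsq]
    rw [Finset.sum_ite_eq Finset.univ x, if_pos (Finset.mem_univ _)]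
    by_cases h : s = 0
    · have := (Finset.sum_eq_zero_iff_of_nonneg (fun x _ => hu x)).1 h x (Finset.mem_univ _)
      rw [h, div_zero]; linarith
    · rw [mul_div_cancel_right₀ _ h]; ring
  have hcol : ∀ y, ∑ x, π (x, y) = q y := by
    intro y
    simp only [π, Finset.sum_add_distrib, ← Finset.sum_div, ← Finset.sum_mul]
    rw [Finset.sum_ite_eq' Finset.univ y, if_pos (Finset.mem_univ _)]
    change m y + s * (q y - m y) / s = q y
    by_cases h : s = 0
    · have := (Finset.sum_eq_zero_iff_of_nonneg (fun x _ => hv x)).1 (hsq.trans h) y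
        (Finset.mem_univ _)
      rw [h, div_zero]; linarith
    · rw [mul_div_cancel_left₀ _ h]; ring
  have htot : ∑ z, π z = 1 := by
    rw [Fintype.sum_prod_type]; simp only [hrow, hp1]
  have hdiag : probOf π {z | z.1 = z.2} = ∑ z, Set.indicator {z : α × α | z.1 = z.2} π z := by
    rw [probOf, tsum_subtype, tsum_fintype]
  refine ⟨π, ⟨⟨hπ0, by rw [tsum_fintype, htot]⟩, fun x => by rw [tsum_fintype, hrow],
    fun y => by rw [tsum_fintype, hcol]⟩, ?_, ?_⟩
  · rw [hdiag, Fintype.sum_prod_type]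
    have h1 : ∑ x, m x ≤ ∑ x, ∑ y, Set.indicator {z : α × α | z.1 = z.2} π (x, y) := by
      refine Finset.sum_le_sum fun x _ => ?_
      refine le_trans ?_ (Finset.single_le_sum (f := fun y =>
        Set.indicator {z : α × α | z.1 = z.2} π (x, y))
        (fun y _ => Set.indicator_nonneg (fun z _ => hπ0 z) _) (Finset.mem_univ x))
      have h2 : Set.indicator {z : α × α | z.1 = z.2} π (x, x) = π (x, x) :=
        Set.indicator_of_mem (by rfl) _
      simp only [h2, π, if_true]
      exact le_add_of_nonneg_right (div_nonneg (mul_nonneg (hu _) (hv _)) hs0)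
    have h3 : ∑ x, (p x - |p x - q x|) ≤ ∑ x, m x := Finset.sum_le_sum fun x _ =>
      le_min (by linarith [abs_nonneg (p x - q x)]) (by linarith [le_abs_self (p x - q x)])
    rw [Finset.sum_sub_distrib, hp1] at h3
    exact h3.trans h1
  · rw [hdiag, ← htot]
    exact Finset.sum_le_sum fun z _ => Set.indicator_le_self' (fun z _ => hπ0 z) z

variable {n : ℕ}

lemma oplusMass_mu (n x y : ℕ) (G : SimpleGraph (Fin n)) :
    oplusMass (mu n x) (mu n y) G =
      (Nat.card {H : SimpleGraph (Fin n) // IsRegularGraph H x} : ℝ)⁻¹ *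
        (Nat.card {H : SimpleGraph (Fin n) // IsRegularGraph H y} : ℝ)⁻¹ * splits n x y G := by
  have h1 : splits n x y G = (Finset.univ.filter fun H : SimpleGraph (Fin n) × SimpleGraph (Fin n) =>
      Disjoint H.1 H.2 ∧ IsRegularGraph H.1 x ∧ IsRegularGraph H.2 y ∧ H.1 ⊔ H.2 = G).card :=
    Nat.subtype_card _ fun H => by rw [Finset.mem_filter]; simp
  rw [h1, oplusMass, tsum_fintype, mul_comm, ← nsmul_eq_mul, ← Finset.sum_const, Finset.sum_filter]
  refine Finset.sum_congr rfl fun H _ => ?_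
  unfold mu
  split_ifs <;> first | rfl | (exfalso; tauto) | simp only [mul_zero, zero_mul]

lemma natCard_pos_of_splits {x y : ℕ} (h : 0 < ∑ G, (splits n x y G : ℝ)) :
    0 < Nat.card {H : SimpleGraph (Fin n) // IsRegularGraph H x} ∧
      0 < Nat.card {H : SimpleGraph (Fin n) // IsRegularGraph H y} := by
  obtain ⟨G, -, hG⟩ := Finset.exists_ne_zero_of_sum_ne_zero h.ne'
  have hG' : splits n x y G ≠ 0 := by exact_mod_cast hG
  obtain ⟨H⟩ := (Nat.card_ne_zero.1 hG').1
  have : Nonempty {H : SimpleGraph (Fin n) // IsRegularGraph H x} := ⟨⟨H.1.1, H.2.2.1⟩⟩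
  have : Nonempty {H : SimpleGraph (Fin n) // IsRegularGraph H y} := ⟨⟨H.1.2, H.2.2.2.1⟩⟩
  exact ⟨Nat.card_pos, Nat.card_pos⟩

lemma oplus_mu_eq_law {x y : ℕ} (h : 0 < ∑ G, (splits n x y G : ℝ)) :
    oplus (mu n x) (mu n y) = law n x y := by
  obtain ⟨h1, h2⟩ := natCard_pos_of_splits h
  have h1' : (Nat.card {H : SimpleGraph (Fin n) // IsRegularGraph H x} : ℝ) ≠ 0 := by
    exact_mod_cast h1.ne'
  have h2' : (Nat.card {H : SimpleGraph (Fin n) // IsRegularGraph H y} : ℝ) ≠ 0 := by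
    exact_mod_cast h2.ne'
  funext G
  rw [oplus, law, tsum_fintype]
  simp only [oplusMass_mu, ← Finset.mul_sum]
  exact mul_div_mul_left _ _ (mul_ne_zero (inv_ne_zero h1') (inv_ne_zero h2'))

lemma isProbC_law {x y : ℕ} (h : 0 < ∑ G, (splits n x y G : ℝ)) : IsProbC (law n x y) := by
  refine ⟨fun G => div_nonneg (by positivity) h.le, ?_⟩
  rw [tsum_fintype]
  simp only [law, ← Finset.sum_div]
  exact div_self h.ne'

lemma pow_ten_le {C d n : ℝ} (hd : 0 ≤ d) (hn : 0 ≤ n) (h : d ≤ C * n ^ ((1 : ℝ) / 10)) :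
    d ^ 10 ≤ max 1 (C ^ 10) * n := by
  calc d ^ 10 ≤ (C * n ^ ((1 : ℝ) / 10)) ^ 10 := pow_le_pow_left₀ hd h 10
    _ = C ^ 10 * n := by
      rw [mul_pow, ← Real.rpow_natCast (n ^ ((1 : ℝ) / 10)), ← Real.rpow_mul hn]
      norm_num
    _ ≤ _ := mul_le_mul_of_nonneg_right (le_max_right _ _) hn

lemma eventually_oplus_close {d₁ d₂ : ℕ → ℕ}
    (hO : ∃ C : ℝ, 0 < C ∧ ∀ᶠ m in atTop,
      (d₂ (2*m) : ℝ) ≤ C * ((2*m : ℕ) : ℝ) ^ ((1:ℝ)/10))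
    (hle : ∀ᶠ m in atTop, d₁ (2*m) ≤ d₂ (2*m))
    (h₁ : Tendsto (fun m => d₁ (2*m)) atTop atTop)
    (h₂ : Tendsto (fun m => d₂ (2*m) - d₁ (2*m)) atTop atTop)
    {δ : ℝ} (hδ : 0 < δ) (hδ1 : δ ≤ 1) :
    ∀ᶠ m in atTop, IsProbC (oplus (mu (2*m) (d₁ (2*m))) (mu (2*m) (d₂ (2*m) - d₁ (2*m)))) ∧
      ∑ G, |oplus (mu (2*m) (d₁ (2*m))) (mu (2*m) (d₂ (2*m) - d₁ (2*m))) G -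
        law (2*m) 0 (d₂ (2*m)) G| ≤ δ := by
  obtain ⟨C, -, hC⟩ := hO
  obtain ⟨K, hK⟩ := law_sub_law_zero_le (le_max_left 1 (C ^ 10)) hδ hδ1
  filter_upwards [hC, hle, tendsto_atTop.1 h₁ K, tendsto_atTop.1 h₂ K, eventually_gt_atTop 0]
    with m hm1 hm2 hm3 hm4 hm5
  obtain ⟨h3, h4⟩ := hK (2*m) (d₁ (2*m)) (d₂ (2*m) - d₁ (2*m)) (d₂ (2*m)) (even_two_mul m) hm3 hm4
    (Nat.add_sub_of_le hm2) (pow_ten_le (by positivity) (by positivity) hm1) (by omega)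
  rw [oplus_mu_eq_law h3]
  exact ⟨isProbC_law h3, h4⟩

end
end RegSum

/-- For even `n = 2m`, `d₂ → ∞` with `d₂ = O(n^{1/10})`, and
`min{d₁, d₁', d₂ - d₁, d₂ - d₁'} → ∞`, there is, for each even `n`, a coupling of
`G_⊕ ~ μ_{d₁,n} ⊕ μ_{d₂-d₁,n}` and `G'_⊕ ~ μ_{d₁',n} ⊕ μ_{d₂-d₁',n}` with
`P(G_⊕ = G'_⊕) → 1` as `n → ∞`. -/
theorem statement_1 (d₁ d₁' d₂ : ℕ → ℕ)
    (hd₂top : Tendsto (fun m => d₂ (2*m)) atTop atTop)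
    (hO : ∃ C : ℝ, 0 < C ∧ ∀ᶠ m in atTop,
      (d₂ (2*m) : ℝ) ≤ C * ((2*m : ℕ) : ℝ) ^ ((1:ℝ)/10))
    (hle : ∀ᶠ m in atTop, d₁ (2*m) ≤ d₂ (2*m) ∧ d₁' (2*m) ≤ d₂ (2*m))
    (h₁ : Tendsto (fun m => d₁ (2*m)) atTop atTop)
    (h₁' : Tendsto (fun m => d₁' (2*m)) atTop atTop)
    (h₂ : Tendsto (fun m => d₂ (2*m) - d₁ (2*m)) atTop atTop)
    (h₂' : Tendsto (fun m => d₂ (2*m) - d₁' (2*m)) atTop atTop) :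
    ∃ π : (m : ℕ) → (SimpleGraph (Fin (2*m)) × SimpleGraph (Fin (2*m)) → ℝ),
      (∀ᶠ m in atTop, IsCoupling (π m)
        (oplus (mu (2*m) (d₁ (2*m))) (mu (2*m) (d₂ (2*m) - d₁ (2*m))))
        (oplus (mu (2*m) (d₁' (2*m))) (mu (2*m) (d₂ (2*m) - d₁' (2*m))))) ∧
      Tendsto (fun m => probOf (π m) {p | p.1 = p.2}) atTop (𝓝 1) := by
  classical
  have key : ∀ m : ℕ, ∃ π : SimpleGraph (Fin (2*m)) × SimpleGraph (Fin (2*m)) → ℝ,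
      IsProbC (oplus (mu (2*m) (d₁ (2*m))) (mu (2*m) (d₂ (2*m) - d₁ (2*m)))) →
      IsProbC (oplus (mu (2*m) (d₁' (2*m))) (mu (2*m) (d₂ (2*m) - d₁' (2*m)))) →
      IsCoupling π (oplus (mu (2*m) (d₁ (2*m))) (mu (2*m) (d₂ (2*m) - d₁ (2*m))))
        (oplus (mu (2*m) (d₁' (2*m))) (mu (2*m) (d₂ (2*m) - d₁' (2*m)))) ∧
      1 - ∑ G, |oplus (mu (2*m) (d₁ (2*m))) (mu (2*m) (d₂ (2*m) - d₁ (2*m))) G -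
        oplus (mu (2*m) (d₁' (2*m))) (mu (2*m) (d₂ (2*m) - d₁' (2*m))) G| ≤
          probOf π {p | p.1 = p.2} ∧ probOf π {p | p.1 = p.2} ≤ 1 := by
    intro m
    by_cases hp : IsProbC (oplus (mu (2*m) (d₁ (2*m))) (mu (2*m) (d₂ (2*m) - d₁ (2*m))))
    · by_cases hq : IsProbC (oplus (mu (2*m) (d₁' (2*m))) (mu (2*m) (d₂ (2*m) - d₁' (2*m))))
      · obtain ⟨π, hπ⟩ := RegSum.exists_coupling _ _ hp hq
        exact ⟨π, fun _ _ => hπ⟩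
      · exact ⟨0, fun _ h => absurd h hq⟩
    · exact ⟨0, fun h => absurd h hp⟩
  choose π hπ using key
  have hclose := fun {δ : ℝ} (hδ : 0 < δ) (hδ1 : δ ≤ 1) =>
    (RegSum.eventually_oplus_close hO (hle.mono fun _ h => h.1) h₁ h₂ hδ hδ1).and
      (RegSum.eventually_oplus_close hO (hle.mono fun _ h => h.2) h₁' h₂' hδ hδ1)
  refine ⟨π, ?_, ?_⟩
  · filter_upwards [hclose one_pos le_rfl] with m hm
    exact (hπ m hm.1.1 hm.2.1).1
  · rw [Metric.tendsto_nhds]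
    intro ε hε
    have hδ : 0 < min 1 (ε / 3) := lt_min one_pos (by linarith)
    filter_upwards [hclose hδ (min_le_left _ _)] with m hm
    obtain ⟨-, h3, h4⟩ := hπ m hm.1.1 hm.2.1
    have h5 := RegSum.sum_abs_sub_le
      (oplus (mu (2*m) (d₁ (2*m))) (mu (2*m) (d₂ (2*m) - d₁ (2*m))))
      (RegSum.law (2*m) 0 (d₂ (2*m)))
      (oplus (mu (2*m) (d₁' (2*m))) (mu (2*m) (d₂ (2*m) - d₁' (2*m))))
    rw [RegSum.sum_abs_sub_comm (RegSum.law (2*m) 0 (d₂ (2*m)))] at h5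
    have h6 := hm.1.2
    have h7 := hm.2.2
    have h8 := min_le_right 1 (ε / 3)
    rw [Real.dist_eq, abs_lt]
    constructor <;> linarith
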